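/- Let X ⊂ P^{n+c} be a nondegenerate irreducible projective variety of dimension n, codimension c ≥ 4, and degree c+3, which is a variety of maximal sectional regularity, with extremal n-plane F(X). Then depth(X) = n, depth(X ∪ F(X)) = n+1, the homogeneous ideal of X ∪ F(X) is generated by quadrics, and I(X)₂ = I(X ∪ F(X))₂; consequently the base locus of quadrics through X is Q(X) = X ∪ F(X). -/

import Mathlib

/-!
Common framework: a projective variety `X ⊆ ℙ^N` over a field `k` is represented by its
affine cone `C ⊆ (ι → k)` (with `ι` the index type of homogeneous coordinates,
`Fintype.card ι = N + 1`).  All projective notions (vanishing ideal, `a₂`, Hilbert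
function, dimension, degree, depth, base locus of quadrics, irreducible components,
scrolls and divisors on them, sectional genus, maximal sectional regularity) are
defined concretely below.
-/

open MvPolynomial

noncomputable section

namespace PaperQuadrics

variable (k : Type) [Field k] (ι : Type) [Fintype ι] [DecidableEq ι]

/-- The vanishing ideal of a subset `C` of the affine cone `ι → k`. -/
def vanIdeal (C : Set (ι → k)) : Ideal (MvPolynomial ι k) :=
  ⨅ x ∈ C, RingHom.ker (MvPolynomial.eval x)

/-- The degree-`m` graded piece of an ideal of the polynomial ring. -/
def idealPiece (I : Ideal (MvPolynomial ι k)) (m : ℕ) : Submodule k (MvPolynomial ι k) :=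
  Submodule.restrictScalars k I ⊓ homogeneousSubmodule ι k m

/-- The space of quadrics vanishing on `C`, i.e. `H⁰(ℙ^N, I_C(2))`. -/
def quadrics (C : Set (ι → k)) : Submodule k (MvPolynomial ι k) :=
  idealPiece k ι (vanIdeal k ι C) 2

/-- `a₂(C) = h⁰(ℙ^N, I_C(2))`, the number of linearly independent quadrics through `C`. -/
def a2 (C : Set (ι → k)) : ℕ := Module.finrank k (quadrics k ι C)

/-- The Hilbert function of `R/I` in degree `m`. -/
def idealHilb (I : Ideal (MvPolynomial ι k)) (m : ℕ) : ℕ :=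
  Module.finrank k (homogeneousSubmodule ι k m) - Module.finrank k (idealPiece k ι I m)

/-- The Hilbert function of the homogeneous coordinate ring of `C`. -/
def hilb (C : Set (ι → k)) (m : ℕ) : ℕ := idealHilb k ι (vanIdeal k ι C) m

/-- `C ⊆ ι → k` is the affine cone of an irreducible projective variety:
it is a Zariski-closed cone whose vanishing ideal is prime. -/
structure IsProjVariety (C : Set (ι → k)) : Prop where
  zero_mem : (0 : ι → k) ∈ C
  smul_mem : ∀ x ∈ C, ∀ t : k, t • x ∈ C
  closed : C = {x | ∀ f ∈ vanIdeal k ι C, MvPolynomial.eval x f = 0}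
  prime : (vanIdeal k ι C).IsPrime

/-- Nondegenerate: no nonzero linear form vanishes identically on `C`. -/
def Nondeg (C : Set (ι → k)) : Prop :=
  ∀ f ∈ homogeneousSubmodule ι k 1, (∀ x ∈ C, MvPolynomial.eval x f = 0) → f = 0

/-- The projective variety with cone `C` has dimension `n`
(so the affine cone has Krull dimension `n + 1`). -/
def HasDim (C : Set (ι → k)) (n : ℕ) : Prop :=
  ringKrullDim (MvPolynomial ι k ⧸ vanIdeal k ι C) = (n + 1 : ℕ)

/-- `C` (of projective dimension `n`) has degree `d`:
the Hilbert function satisfies `hF(m) · n! / mⁿ → d`. -/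
def HasDegree (C : Set (ι → k)) (n d : ℕ) : Prop :=
  Filter.Tendsto (fun m : ℕ => (hilb k ι C m : ℝ) * (Nat.factorial n : ℝ) / (m : ℝ) ^ n)
    Filter.atTop (nhds (d : ℝ))

/-- `Q(C)`: the common zero set (base locus) of all quadrics through `C`. -/
def quadZero (C : Set (ι → k)) : Set (ι → k) :=
  {x | ∀ f ∈ quadrics k ι C, MvPolynomial.eval x f = 0}

/-- `fs` is a regular sequence on `R/I`. -/
def IsRegSeqOn (I : Ideal (MvPolynomial ι k)) (fs : List (MvPolynomial ι k)) : Prop :=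
  (∀ i : Fin fs.length, ∀ g : MvPolynomial ι k,
      fs.get i * g ∈ I ⊔ Ideal.span {h | ∃ j : Fin fs.length, j < i ∧ fs.get j = h} →
      g ∈ I ⊔ Ideal.span {h | ∃ j : Fin fs.length, j < i ∧ fs.get j = h}) ∧
  I ⊔ Ideal.span {h | ∃ j : Fin fs.length, fs.get j = h} ≠ ⊤

/-- Arithmetic depth of the homogeneous coordinate ring of `C`: the supremum of lengths of
regular sequences of elements of the irrelevant maximal ideal. -/
def arithDepth (C : Set (ι → k)) : ℕ :=
  sSup {l : ℕ | ∃ fs : List (MvPolynomial ι k), fs.length = l ∧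
    (∀ f ∈ fs, MvPolynomial.coeff 0 f = 0) ∧ IsRegSeqOn k ι (vanIdeal k ι C) fs}

/-- `Z` is an irreducible Zariski-closed cone. -/
def IsIrredClosed (Z : Set (ι → k)) : Prop :=
  Z = {x | ∀ f ∈ vanIdeal k ι Z, MvPolynomial.eval x f = 0} ∧ (vanIdeal k ι Z).IsPrime

/-- `Z` is an irreducible component of `Q`: an irreducible closed subset of `Q`, maximal
among the irreducible closed subsets of `Q`. -/
def IsComponentOf (Z Q : Set (ι → k)) : Prop :=
  IsIrredClosed k ι Z ∧ Z ⊆ Q ∧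
    ∀ Z' : Set (ι → k), IsIrredClosed k ι Z' → Z ⊆ Z' → Z' ⊆ Q → Z' = Z

/-- `C` is smooth away from the cone vertex, of codimension `c`: at each nonzero point the
Jacobian of the vanishing ideal has rank `c` (valid criterion in characteristic `0`). -/
def IsSmoothOfCodim (C : Set (ι → k)) (c : ℕ) : Prop :=
  ∀ x ∈ C, x ≠ (0 : ι → k) →
    Module.finrank k (Submodule.span k
      {v : ι → k | ∃ f ∈ vanIdeal k ι C,
        v = fun i => MvPolynomial.eval x (MvPolynomial.pderiv i f)}) = c

/-- The projective variety with affine cone `C` is a cone (in the projective sense):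
there is a vertex point `[v]` such that `C` is stable under the join with `[v]`. -/
def IsConeVariety (C : Set (ι → k)) : Prop :=
  ∃ v ∈ C, v ≠ 0 ∧ ∀ x ∈ C, ∀ s t : k, s • x + t • v ∈ C

/-- `C` (an `n`-dimensional variety of degree `d`) has sectional genus `g`: a general linear
curve section (cut by `n - 1` general hyperplanes) has Hilbert polynomial `d·m + 1 - g`. -/
def SectionalGenus (n : ℕ) (C : Set (ι → k)) (d g : ℕ) : Prop :=
  ∃ P : MvPolynomial (Fin (n - 1) × ι) k, P ≠ 0 ∧
    ∀ w : Fin (n - 1) → ι → k, MvPolynomial.eval (fun q => w q.1 q.2) P ≠ 0 →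
      ∀ᶠ m in Filter.atTop,
        (hilb k ι (C ∩ {x | ∀ j, ∑ i, w j i * x i = 0}) m : ℤ) = d * m + 1 - g

/-- `C` (an `n`-dimensional variety of degree `c + 3`) is a variety of maximal sectional
regularity: there is an `n`-dimensional linear subspace `F(X) = ℙ(L)` such that
`X ∩ F(X)` is (scheme-theoretically) a hypersurface of degree `4` in `F(X) ≅ ℙⁿ`,
detected by the Hilbert function of the ideal sum. -/
def IsVMSR (n : ℕ) (C : Set (ι → k)) : Prop :=
  ∃ L : Submodule k (ι → k), Module.finrank k L = n + 1 ∧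
    ∀ᶠ m in Filter.atTop,
      idealHilb k ι (vanIdeal k ι C ⊔ vanIdeal k ι (L : Set (ι → k))) m =
        Nat.choose (m + n) n - Nat.choose (m - 4 + n) n

end PaperQuadrics

namespace PaperQuadrics

variable {k : Type} [Field k]

/-- The parametrization of the rational normal scroll `S(a₀, …, aₙ)` (so the scroll has
dimension `n + 1`): homogeneous coordinates are indexed by `(i, j)`, `0 ≤ j ≤ aᵢ`,
and the point of parameters `(s : t) ∈ ℙ¹`, `λ` has coordinates `λᵢ sʲ t^{aᵢ - j}`. -/
def scrollParam (n : ℕ) (a : Fin (n + 1) → ℕ) (s t : k) (lam : Fin (n + 1) → k) :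
    ((i : Fin (n + 1)) × Fin (a i + 1)) → k :=
  fun x => lam x.1 * s ^ (x.2 : ℕ) * t ^ (a x.1 - (x.2 : ℕ))

/-- The affine cone of the scroll `S(a₀, …, aₙ) ⊆ ℙ^{n+1+c-1}`, `c = Σ aᵢ`. -/
def scrollCone (n : ℕ) (a : Fin (n + 1) → ℕ) :
    Set (((i : Fin (n + 1)) × Fin (a i + 1)) → k) :=
  {v | ∃ s t lam, v = scrollParam n a s t lam}

/-- Global sections of `O_Y(A·H + b·F)` on the scroll `Y = S(a₀, …, aₙ)`, realized as
bihomogeneous polynomials in `s, t` (the `ℙ¹`-coordinates) and `T₀, …, Tₙ` (the fiber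
coordinates): each monomial has total `T`-degree `A` and `(s,t)`-degree `b + Σ mᵢ aᵢ`. -/
def sectionSpace (k : Type) [Field k] (n : ℕ) (a : Fin (n + 1) → ℕ) (A b : ℤ) :
    Submodule k (MvPolynomial (Fin 2 ⊕ Fin (n + 1)) k) where
  carrier := {F | ∀ m ∈ F.support,
    ((∑ i, m (Sum.inr i) : ℕ) : ℤ) = A ∧
    ((m (Sum.inl 0) + m (Sum.inl 1) : ℕ) : ℤ)
      = b + ∑ i, (m (Sum.inr i) : ℤ) * (a i : ℤ)}
  add_mem' := by
    intro p q hp hq m hm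
    rcases Finset.mem_union.mp (MvPolynomial.support_add hm) with h | h
    · exact hp m h
    · exact hq m h
  zero_mem' := by
    intro m hm
    simp at hm
  smul_mem' := by
    intro c p hp m hm
    exact hp m (MvPolynomial.support_smul hm)

/-- The affine cone of the effective divisor `X ≡ A·H + b·F` on the scroll cut out by a
section `F`: the points of the scroll whose parameters are zeros of `F`. -/
def divisorCone (n : ℕ) (a : Fin (n + 1) → ℕ)
    (F : MvPolynomial (Fin 2 ⊕ Fin (n + 1)) k) :
    Set (((i : Fin (n + 1)) × Fin (a i + 1)) → k) :=
  {v | ∃ s t lam, v = scrollParam n a s t lam ∧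
     MvPolynomial.eval (Sum.elim (fun j : Fin 2 => if j = 0 then s else t) lam) F = 0}

end PaperQuadrics

open PaperQuadrics

set_option linter.unusedSectionVars false

namespace DepthBound

open CategoryTheory CategoryTheory.Abelian

variable {S : Type} [CommRing S]

/-- The sequence `S/I → S/I → S/(I + (f))`. -/
def quotSeq (I : Ideal S) (f : S) : ShortComplex (ModuleCat S) :=
  ModuleCat.shortComplexOfCompEqZero (LinearMap.lsmul S (S ⧸ I) f)
    (Submodule.factor (le_sup_left : I ≤ I ⊔ Ideal.span {f})) (by
      ext
      have : (f • (1 : S)) ∈ I ⊔ Ideal.span {f} := by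
        simpa using (Ideal.mem_sup_right (Ideal.mem_span_singleton_self f))
      change Submodule.factor (le_sup_left : I ≤ I ⊔ Ideal.span {f}) (Submodule.Quotient.mk (f • (1 : S))) = 0
      simpa using (Submodule.Quotient.mk_eq_zero _).2 this)

lemma quotSeq_shortExact (I : Ideal S) (f : S) (hf : ∀ g, f * g ∈ I → g ∈ I) :
    (quotSeq I f).ShortExact where
  exact := by
    refine ModuleCat.shortComplex_exact _ ?_
    intro x
    obtain ⟨x, rfl⟩ := Submodule.Quotient.mk_surjective _ x
    change (Submodule.Quotient.mk x : S ⧸ (I ⊔ Ideal.span {f})) = 0 ↔ _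
    rw [Submodule.Quotient.mk_eq_zero]
    constructor
    · intro h
      obtain ⟨a, ha, b, hb, rfl⟩ := Submodule.mem_sup.1 h
      obtain ⟨c, rfl⟩ := Ideal.mem_span_singleton.1 hb
      refine ⟨Submodule.Quotient.mk c, ?_⟩
      change (Submodule.Quotient.mk (f • c) : S ⧸ I) = _
      rw [Submodule.Quotient.eq]
      simpa using ha
    · rintro ⟨y, hy⟩
      obtain ⟨y, rfl⟩ := Submodule.Quotient.mk_surjective _ y
      change (Submodule.Quotient.mk (f • y) : S ⧸ I) = _ at hy
      rw [Submodule.Quotient.eq] at hy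
      have h2 : f • y ∈ I ⊔ Ideal.span {f} :=
        Ideal.mem_sup_right (Ideal.mul_mem_right _ _ (Ideal.mem_span_singleton_self f))
      have := Submodule.sub_mem _ h2 ((le_sup_left : I ≤ I ⊔ Ideal.span {f}) hy)
      simpa using this
  mono_f := by
    rw [ModuleCat.mono_iff_injective]
    change Function.Injective (LinearMap.lsmul S (S ⧸ I) f)
    rw [injective_iff_map_eq_zero]
    intro x hx
    obtain ⟨x, rfl⟩ := Submodule.Quotient.mk_surjective _ x
    change (Submodule.Quotient.mk (f • x) : S ⧸ I) = 0 at hx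
    rw [Submodule.Quotient.mk_eq_zero] at hx ⊢
    exact hf x hx
  epi_g := by
    rw [ModuleCat.epi_iff_surjective]
    intro x
    obtain ⟨x, rfl⟩ := Submodule.Quotient.mk_surjective _ x
    exact ⟨Submodule.Quotient.mk x, rfl⟩

/-- `Ext^i(S/m, S/I) = 0`. -/
def ExtZero (m I : Ideal S) (i : ℕ) : Prop :=
  ∀ x : Ext (ModuleCat.of S (S ⧸ m)) (ModuleCat.of S (S ⧸ I)) i, x = 0

variable {m I : Ideal S} {f : S}

lemma comp_smul_id_eq_zero (hfm : f ∈ m) {i : ℕ}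
    (x : Ext (ModuleCat.of S (S ⧸ m)) (ModuleCat.of S (S ⧸ I)) i) :
    x.comp (Ext.mk₀ (f • 𝟙 (ModuleCat.of S (S ⧸ I)))) (add_zero i) = 0 := by
  have h2 : f ∈ Module.annihilator S (S ⧸ m) := by
    rw [Ideal.annihilator_quotient]; exact hfm
  have h3 : f • 𝟙 (ModuleCat.of S (S ⧸ m)) = 0 := by
    rw [← ModuleCat.lsmul_eq_smul_id, Module.mem_annihilator_iff_lsmul_eq_zero.mp h2]
    rfl
  have h5 : f • x = (Ext.mk₀ (f • 𝟙 (ModuleCat.of S (S ⧸ m)))).comp x (zero_add i) := by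
    simp [Ext.mk₀_smul]
  rw [h3] at h5
  simpa [Ext.mk₀_smul] using h5

lemma comp_f_eq_zero (hfm : f ∈ m) {i : ℕ}
    (x : Ext (ModuleCat.of S (S ⧸ m)) (quotSeq I f).X₁ i) :
    x.comp (Ext.mk₀ (quotSeq I f).f) (add_zero i) = 0 :=
  comp_smul_id_eq_zero hfm x

lemma extZero_succ (hfm : f ∈ m) (hf : ∀ g, f * g ∈ I → g ∈ I) {i : ℕ}
    (h : ExtZero m (I ⊔ Ideal.span {f}) i) : ExtZero m I (i + 1) := by
  intro x
  obtain ⟨y, rfl⟩ := Ext.covariant_sequence_exact₁ _ (quotSeq_shortExact I f hf) x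
    (comp_f_eq_zero hfm x) rfl
  have : y = 0 := h y
  subst this
  simp only [Ext.zero_comp]; rfl

lemma extZero_quot (hf : ∀ g, f * g ∈ I → g ∈ I) {i : ℕ}
    (h : ExtZero m I i) (h' : ExtZero m I (i + 1)) : ExtZero m (I ⊔ Ideal.span {f}) i := by
  intro x
  have hx := h' (x.comp (quotSeq_shortExact I f hf).extClass rfl)
  obtain ⟨y, rfl⟩ := Ext.covariant_sequence_exact₃ _ (quotSeq_shortExact I f hf)
    (n₁ := i + 1) x rfl hx
  have : y = 0 := h y
  subst this
  simp only [Ext.zero_comp]; rfl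

lemma extZero_zero_iff : ExtZero m I 0 ↔ ∀ t, (∀ a ∈ m, a * t ∈ I) → t ∈ I := by
  constructor
  · intro h t ht
    let φ : (S ⧸ m) →ₗ[S] (S ⧸ I) := Submodule.liftQ m ((LinearMap.toSpanSingleton S (S ⧸ I)
      (Submodule.Quotient.mk t))) (by
        intro a ha
        rw [LinearMap.mem_ker, LinearMap.toSpanSingleton_apply]
        change (Submodule.Quotient.mk (a • t) : S ⧸ I) = 0
        rw [Submodule.Quotient.mk_eq_zero]
        exact ht a ha)
    have h0 : Ext.mk₀ (ModuleCat.ofHom φ) = 0 := h _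
    have h1 : ModuleCat.ofHom φ = 0 := (Ext.mk₀_bijective _ _).1 (by rw [h0, Ext.mk₀_zero])
    have h2 : φ = 0 := by
      have := congrArg ModuleCat.Hom.hom h1
      exact this
    have h3 : φ (Submodule.Quotient.mk 1) = 0 := by rw [h2]; rfl
    have h4 : φ (Submodule.Quotient.mk 1) = Submodule.Quotient.mk ((1 : S) • t) := rfl
    rw [h4, Submodule.Quotient.mk_eq_zero] at h3
    simpa using h3
  · intro h x
    obtain ⟨g, rfl⟩ := (Ext.mk₀_bijective _ _).2 x
    have : g = 0 := by
      obtain ⟨t, ht⟩ := Submodule.Quotient.mk_surjective _ (g.hom (Submodule.Quotient.mk 1))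
      have h1 : ∀ b : S, g.hom (Submodule.Quotient.mk b) = Submodule.Quotient.mk (b * t) := by
        intro b
        have : (Submodule.Quotient.mk b : S ⧸ m) = b • Submodule.Quotient.mk 1 := by
          rw [← Submodule.Quotient.mk_smul]; simp
        rw [this, map_smul, ← ht]; rfl
      have h2 : t ∈ I := by
        apply h
        intro a ha
        have := h1 a
        rw [(Submodule.Quotient.mk_eq_zero _).2 ha, map_zero] at this
        exact (Submodule.Quotient.mk_eq_zero _).1 this.symm
      refine ModuleCat.hom_ext (LinearMap.ext fun y => ?_)
      obtain ⟨y, rfl⟩ := Submodule.Quotient.mk_surjective _ y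
      change g.hom (Submodule.Quotient.mk y) = 0
      rw [h1, Submodule.Quotient.mk_eq_zero]
      exact I.mul_mem_left _ h2
    rw [this, Ext.mk₀_zero]

/-- `fs` is a weakly regular sequence of elements of `m` on `S/I`. -/
def RegIn (m : Ideal S) : Ideal S → List S → Prop
  | _, [] => True
  | I, f :: fs => f ∈ m ∧ (∀ g, f * g ∈ I → g ∈ I) ∧ RegIn m (I ⊔ Ideal.span {f}) fs

lemma extZero_of_regIn : ∀ (fs : List S) (I : Ideal S), RegIn m I fs →
    I ⊔ Ideal.span {h | h ∈ fs} ≤ m → ∀ i < fs.length, ExtZero m I i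
  | [], _, _, _, i, hi => absurd hi (by simp)
  | f :: fs, I, ⟨hfm, hf, h⟩, hne, 0, _ => by
      rw [extZero_zero_iff]
      intro t ht
      exact hf t (ht f hfm)
  | f :: fs, I, ⟨hfm, hf, h⟩, hne, i + 1, hi => by
      refine extZero_succ hfm hf (extZero_of_regIn fs _ h ?_ i (by simpa using hi))
      refine le_trans ?_ hne
      refine sup_le (sup_le le_sup_left ?_) ?_
      · refine le_trans (Ideal.span_mono ?_) le_sup_right
        simp
      · refine le_trans (Ideal.span_mono ?_) le_sup_right
        intro x hx
        exact List.mem_cons_of_mem _ hx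

lemma exists_not_extZero : ∀ (fs : List S) (I : Ideal S), RegIn m I fs →
    (∃ t, (∀ a ∈ m, a * t ∈ I ⊔ Ideal.span {h | h ∈ fs}) ∧ t ∉ I ⊔ Ideal.span {h | h ∈ fs}) →
    ∃ i ≤ fs.length, ¬ ExtZero m I i
  | [], I, _, ⟨t, ht, ht'⟩ => by
      refine ⟨0, le_rfl, fun h => ?_⟩
      simp only [List.not_mem_nil, Set.ofPred_false, Ideal.span_empty, sup_bot_eq] at ht ht'
      exact ht' (extZero_zero_iff.1 h t ht)
  | f :: fs, I, ⟨hfm, hf, h⟩, ⟨t, ht, ht'⟩ => by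
      have he : I ⊔ Ideal.span {h | h ∈ f :: fs} = I ⊔ Ideal.span {f} ⊔ Ideal.span {h | h ∈ fs} := by
        rw [sup_assoc, ← Ideal.span_union]
        congr 2
        ext x; simp
      rw [he] at ht ht'
      obtain ⟨i, hi, hi'⟩ := exists_not_extZero fs _ h ⟨t, ht, ht'⟩
      by_contra! hcon
      exact hi' (extZero_quot hf (hcon i (by simp; omega)) (hcon (i + 1) (by simp; omega)))

/-- If some regular sequence in `m` has a quotient with nonzero socle, then it is longest. -/
theorem length_le_of_socle {fs gs : List S} (hfs : RegIn m I fs) (hgs : RegIn m I gs)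
    (hI : I ⊔ Ideal.span {h | h ∈ gs} ≤ m)
    (h : ∃ t, (∀ a ∈ m, a * t ∈ I ⊔ Ideal.span {h | h ∈ fs}) ∧
      t ∉ I ⊔ Ideal.span {h | h ∈ fs}) : gs.length ≤ fs.length := by
  obtain ⟨i, hi, hi'⟩ := exists_not_extZero fs I hfs h
  by_contra! hcon
  exact hi' (extZero_of_regIn gs I hgs hI i (by omega))


lemma regIn_iff (m : Ideal S) : ∀ (fs : List S) (I : Ideal S), RegIn m I fs ↔
    (∀ f ∈ fs, f ∈ m) ∧ ∀ i : Fin fs.length, ∀ g : S,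
      fs.get i * g ∈ I ⊔ Ideal.span {h | ∃ j : Fin fs.length, j < i ∧ fs.get j = h} →
      g ∈ I ⊔ Ideal.span {h | ∃ j : Fin fs.length, j < i ∧ fs.get j = h}
  | [], I => by
      simp only [RegIn, true_iff]
      exact ⟨by simp, fun i => i.elim0⟩
  | f :: fs, I => by
      have key : ∀ i : Fin fs.length,
          I ⊔ Ideal.span {h | ∃ j : Fin (f :: fs).length, j < i.succ ∧ (f :: fs).get j = h} =
          I ⊔ Ideal.span {f} ⊔ Ideal.span {h | ∃ j : Fin fs.length, j < i ∧ fs.get j = h} := by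
        intro i
        rw [sup_assoc, ← Ideal.span_union]
        congr 2
        ext x
        constructor
        · rintro ⟨j, hj, rfl⟩
          revert hj
          refine Fin.cases (fun _ => Or.inl rfl) (fun j hj => Or.inr ⟨j, ?_, rfl⟩) j
          exact Fin.succ_lt_succ_iff.1 hj
        · rintro (rfl | ⟨j, hj, rfl⟩)
          · exact ⟨0, Fin.succ_pos i, rfl⟩
          · exact ⟨j.succ, Fin.succ_lt_succ_iff.2 hj, rfl⟩
      have key0 : I ⊔ Ideal.span {h | ∃ j : Fin (f :: fs).length,
          j < (⟨0, Nat.succ_pos _⟩ : Fin (f :: fs).length) ∧ (f :: fs).get j = h} = I := by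
        have : {h | ∃ j : Fin (f :: fs).length,
          j < (⟨0, Nat.succ_pos _⟩ : Fin (f :: fs).length) ∧ (f :: fs).get j = h} = ∅ := by
          ext x
          simp only [Set.mem_ofPred_eq, Set.mem_empty_iff_false, iff_false]
          rintro ⟨j, hj, -⟩
          exact absurd hj (Nat.not_lt_zero _)
        rw [this, Ideal.span_empty, sup_bot_eq]
      simp only [RegIn, regIn_iff m fs]
      constructor
      · rintro ⟨hfm, hf, hm, h⟩
        refine ⟨by simpa using ⟨hfm, hm⟩, fun i => ?_⟩
        refine Fin.cases ?_ (fun i => ?_) i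
        · intro g hg
          rw [show (0 : Fin (f :: fs).length) = ⟨0, Nat.succ_pos _⟩ from rfl] at hg ⊢
          rw [key0] at hg ⊢
          exact hf g hg
        · intro g hg
          rw [key] at hg ⊢
          exact h i g hg
      · rintro ⟨hm, h⟩
        refine ⟨hm f (by simp), fun g hg => ?_, fun x hx => hm x (by simp [hx]), fun i g hg => ?_⟩
        · have := h ⟨0, Nat.succ_pos _⟩ g
          rw [key0] at this
          exact this hg
        · have := h i.succ g
          rw [key] at this
          exact this hg

lemma setOf_get (fs : List S) : {h | ∃ j : Fin fs.length, fs.get j = h} = {h | h ∈ fs} := by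
  ext x
  exact List.mem_iff_get.symm

variable {k : Type} [Field k] {ι : Type} [Fintype ι] [DecidableEq ι]

theorem arithDepth_eq (X : Set (ι → k)) (fs : List (MvPolynomial ι k))
    (hX : vanIdeal k ι X ≤ RingHom.ker (constantCoeff (R := k) (σ := ι)))
    (hfs : RegIn (RingHom.ker (constantCoeff (R := k) (σ := ι))) (vanIdeal k ι X) fs)
    (h : ∃ t, (∀ a ∈ RingHom.ker (constantCoeff (R := k) (σ := ι)),
        a * t ∈ vanIdeal k ι X ⊔ Ideal.span {h | h ∈ fs}) ∧
      t ∉ vanIdeal k ι X ⊔ Ideal.span {h | h ∈ fs}) :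
    arithDepth k ι X = fs.length := by
  have hle : ∀ gs : List (MvPolynomial ι k),
      (∀ g ∈ gs, g ∈ RingHom.ker (constantCoeff (R := k) (σ := ι))) →
      vanIdeal k ι X ⊔ Ideal.span {h | h ∈ gs} ≤ RingHom.ker (constantCoeff (R := k) (σ := ι)) :=
    fun gs hgs => sup_le hX (Ideal.span_le.2 hgs)
  have hmem : fs.length ∈ {l : ℕ | ∃ fs : List (MvPolynomial ι k), fs.length = l ∧
      (∀ f ∈ fs, MvPolynomial.coeff 0 f = 0) ∧ IsRegSeqOn k ι (vanIdeal k ι X) fs} := by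
    obtain ⟨h1, h2⟩ := (regIn_iff _ _ _).1 hfs
    refine ⟨fs, rfl, h1, h2, ?_⟩
    rw [setOf_get]
    intro htop
    have := hle fs h1
    rw [htop, top_le_iff] at this
    exact RingHom.ker_ne_top _ this
  have hub : ∀ l ∈ {l : ℕ | ∃ fs : List (MvPolynomial ι k), fs.length = l ∧
      (∀ f ∈ fs, MvPolynomial.coeff 0 f = 0) ∧ IsRegSeqOn k ι (vanIdeal k ι X) fs},
      l ≤ fs.length := by
    rintro l ⟨gs, rfl, hg, hreg, -⟩
    exact length_le_of_socle hfs ((regIn_iff _ _ _).2 ⟨hg, hreg⟩) (hle gs hg) h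
  exact le_antisymm (csSup_le ⟨_, hmem⟩ hub) (le_csSup ⟨_, hub⟩ hmem)

end DepthBound

namespace PointsOnLine

lemma sum_dite_lt {M : Type} [AddCommMonoid M] {r N : ℕ} (h : r ≤ N) (f : Fin r → M) :
    ∑ j : Fin N, (if hj : j.1 < r then f ⟨j, hj⟩ else 0) = ∑ j, f j := by
  obtain ⟨s, rfl⟩ := Nat.exists_eq_add_of_le h
  rw [Fin.sum_univ_add]
  simp

open Polynomial in
/-- A vector orthogonal to the evaluations of low degree polynomials is a weighted
evaluation vector. -/
lemma exists_weight_of_orth {k Γ : Type} [Field k] [Fintype Γ] [DecidableEq Γ] {lam : Γ → k}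
    (hlam : Function.Injective lam) {e f : ℕ} (hef : f + e = Fintype.card Γ) (y : Γ → k)
    (hy : ∀ h ∈ degreeLT k f, ∑ i, y i * h.eval (lam i) = 0) :
    ∃ q ∈ degreeLT k e, ∀ i, y i = (∏ j ∈ Finset.univ.erase i, (lam i - lam j))⁻¹ * q.eval (lam i) := by
  have hinj : Set.InjOn lam (Finset.univ : Finset Γ) := hlam.injOn
  set P : Γ → k := fun i => ∏ j ∈ Finset.univ.erase i, (lam i - lam j) with hP
  have hP0 : ∀ i, P i ≠ 0 := fun i => Finset.prod_ne_zero_iff.2 fun j hj => by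
    have := Finset.ne_of_mem_erase hj
    exact sub_ne_zero.2 fun h => this (hlam h).symm
  set g := Lagrange.interpolate Finset.univ lam (fun i => y i * P i) with hg
  have hgd : g.degree < (Finset.univ : Finset Γ).card := Lagrange.degree_interpolate_lt _ hinj
  have hge : ∀ i, g.eval (lam i) = y i * P i := fun i =>
    Lagrange.eval_interpolate_at_node _ hinj (Finset.mem_univ i)
  refine ⟨g, ?_, fun i => by
    rw [hge, mul_comm, mul_assoc, mul_inv_cancel₀ (hP0 i), mul_one]⟩
  rw [mem_degreeLT]
  by_contra hcon
  have hg0 : g ≠ 0 := by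
    rintro h0
    rw [h0] at hcon
    simp [bot_lt_iff_ne_bot] at hcon
  rw [degree_eq_natDegree hg0] at hcon hgd
  norm_cast at hcon hgd
  rw [Finset.card_univ] at hgd
  have hj : g.natDegree + (Fintype.card Γ - 1 - g.natDegree) = Fintype.card Γ - 1 := by omega
  have hd : (g * Polynomial.X ^ (Fintype.card Γ - 1 - g.natDegree)).degree <
      ((Finset.univ : Finset Γ).card : WithBot ℕ) := by
    rw [degree_mul, degree_X_pow, degree_eq_natDegree hg0, Finset.card_univ]
    norm_cast
    omega
  have h1 := Lagrange.coeff_eq_sum hinj hd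
  have h1' : (g * Polynomial.X ^ (Fintype.card Γ - 1 - g.natDegree)).coeff (Fintype.card Γ - 1) =
      g.leadingCoeff := by
    conv_lhs => rw [← hj, Nat.add_sub_cancel_left]
    rw [Polynomial.coeff_mul_X_pow, coeff_natDegree]
  rw [Finset.card_univ, h1'] at h1
  have h2 := hy (Polynomial.X ^ (Fintype.card Γ - 1 - g.natDegree)) (by
    rw [mem_degreeLT, degree_X_pow]; norm_cast; omega)
  have h3 : g.leadingCoeff = 0 := by
    rw [h1, ← h2]
    refine Finset.sum_congr rfl fun i _ => ?_
    rw [Polynomial.eval_mul, hge]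
    have := hP0 i
    simp only [hP] at this ⊢
    field_simp
  exact hg0 (leadingCoeff_eq_zero.1 h3)

open Polynomial in
/-- If two polynomials of small degree agree at the points, they are equal. -/
lemma eq_zero_of_eval {k Γ : Type} [Field k] [Fintype Γ] {lam : Γ → k}
    (hlam : Function.Injective lam) {g : k[X]} {e : ℕ} (he : e ≤ Fintype.card Γ)
    (hg : g ∈ degreeLT k e) (h : ∀ i, g.eval (lam i) = 0) : g = 0 := by
  refine Polynomial.eq_zero_of_degree_lt_of_eval_index_eq_zero (s := Finset.univ) (v := lam) hlam.injOn ?_ fun i _ => h i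
  refine (mem_degreeLT.1 hg).trans_le ?_
  rw [Finset.card_univ]
  exact_mod_cast he

open Polynomial in
/-- A functional on polynomials of degree `< m` vanishing on those whose `ω`-weighted values
are values of a polynomial of degree `< c` is given by a polynomial of degree `< 3`. -/
lemma exists_quadratic {k Γ : Type} [Field k] [Fintype Γ] [DecidableEq Γ] {lam om : Γ → k}
    (hlam : Function.Injective lam) {c m : ℕ} (hcard : Fintype.card Γ = c + 3)
    (φ : k[X] →ₗ[k] k)
    (hφ : ∀ h ∈ degreeLT k m, (∃ p ∈ degreeLT k c, ∀ i, om i * h.eval (lam i) = p.eval (lam i)) →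
      φ h = 0) :
    ∃ q ∈ degreeLT k 3, ∀ h ∈ degreeLT k m,
      φ h = ∑ i, (∏ j ∈ Finset.univ.erase i, (lam i - lam j))⁻¹ * (om i * q.eval (lam i)) *
        h.eval (lam i) := by
  let ev : k[X] →ₗ[k] (Γ → k) := LinearMap.pi fun i => Polynomial.leval (lam i)
  let evo : k[X] →ₗ[k] (Γ → k) := LinearMap.pi fun i => om i • Polynomial.leval (lam i)
  let Φ : (degreeLT k m) × (degreeLT k c) →ₗ[k] (Γ → k) :=
    (evo ∘ₗ (degreeLT k m).subtype) ∘ₗ LinearMap.fst _ _ _ - (ev ∘ₗ (degreeLT k c).subtype) ∘ₗ LinearMap.snd _ _ _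
  let ψ : Module.Dual k ((degreeLT k m) × (degreeLT k c)) :=
    (φ ∘ₗ (degreeLT k m).subtype) ∘ₗ LinearMap.fst _ _ _
  have hψ : ψ ∈ LinearMap.range Φ.dualMap := by
    rw [LinearMap.range_dualMap_eq_dualAnnihilator_ker, Submodule.mem_dualAnnihilator]
    rintro ⟨h, p⟩ hhp
    refine hφ h h.2 ⟨p, p.2, fun i => ?_⟩
    have := congrFun (LinearMap.mem_ker.1 hhp) i
    simpa [Φ, ev, evo, sub_eq_zero] using this
  obtain ⟨y, hy⟩ := hψ
  have hyv : ∀ v : Γ → k, y v = ∑ i, y (Pi.single i 1) * v i := by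
    intro v
    conv_lhs => rw [← LinearMap.sum_single_apply (fun _ => k) v]
    rw [map_sum]
    refine Finset.sum_congr rfl fun i _ => ?_
    rw [mul_comm, ← smul_eq_mul, ← map_smul]
    congr 1
    ext j
    simp [Pi.single_apply]
  have hy' : ∀ h p, y (Φ (h, p)) = φ h := fun h p => LinearMap.congr_fun hy (h, p)
  obtain ⟨q, hq, hqy⟩ := exists_weight_of_orth (e := 3) (f := c) hlam hcard.symm
    (fun i => y (Pi.single i 1)) (by
      intro h hh
      have := hy' 0 ⟨h, hh⟩
      rw [hyv] at this
      simpa [Φ, ev, evo] using this)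
  refine ⟨q, hq, fun h hh => ?_⟩
  have := hy' ⟨h, hh⟩ 0
  rw [hyv] at this
  rw [← this]
  refine Finset.sum_congr rfl fun i _ => ?_
  rw [hqy]
  simp [Φ, ev, evo]
  ring

open Polynomial in
/-- Vanishing of shift-compatible bilinear forms for points not in degenerate position. -/
theorem bilin_eq_zero {k Γ : Type} [Field k] [Fintype Γ] [DecidableEq Γ] {lam om : Γ → k}
    (hlam : Function.Injective lam) (hom : ∀ i, om i ≠ 0) {c : ℕ} (hc : 4 ≤ c)
    (hcard : Fintype.card Γ = c + 3)
    (hno : ¬ ∃ p ∈ degreeLT k c, ∀ i, om i * p.eval (lam i) = 1)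
    (β : k[X] →ₗ[k] k[X] →ₗ[k] k)
    (hβ : ∀ p ∈ degreeLT k c, ∀ h ∈ degreeLT k (2 * c - 1),
      (∃ p ∈ degreeLT k c, ∀ i, om i * h.eval (lam i) = p.eval (lam i)) → β p h = 0)
    (hshift : ∀ i < c - 1, ∀ j < 2 * c - 2, β (Polynomial.X ^ (i + 1)) (Polynomial.X ^ j) = β (Polynomial.X ^ i) (Polynomial.X ^ (j + 1))) :
    ∀ i < c, ∀ j < 2 * c - 1, β (Polynomial.X ^ i) (Polynomial.X ^ j) = 0 := by
  have hX : ∀ {i N : ℕ}, i < N → (Polynomial.X ^ i : k[X]) ∈ degreeLT k N := fun {i N} h => by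
    rw [mem_degreeLT, degree_X_pow]; exact_mod_cast h
  have hq : ∀ i : ℕ, ∃ q ∈ degreeLT k 3, i < c → ∀ h ∈ degreeLT k (2 * c - 1),
      β (Polynomial.X ^ i) h = ∑ s, (∏ j ∈ Finset.univ.erase s, (lam s - lam j))⁻¹ * (om s * q.eval (lam s)) *
        h.eval (lam s) := fun i => by
    by_cases hi : i < c
    · obtain ⟨q, h1, h2⟩ := exists_quadratic (m := 2 * c - 1) hlam hcard (β (Polynomial.X ^ i))
        (hβ _ (hX hi))
      exact ⟨q, h1, fun _ => h2⟩
    · exact ⟨0, zero_mem _, fun h => absurd h hi⟩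
  choose q hq3 hqβ using hq
  have hP0 : ∀ i, ∏ j ∈ Finset.univ.erase i, (lam i - lam j) ≠ 0 := fun i =>
    Finset.prod_ne_zero_iff.2 fun j hj => by
      have := Finset.ne_of_mem_erase hj
      exact sub_ne_zero.2 fun h => this (hlam h).symm
  have hstep : ∀ i < c - 1, q (i + 1) = Polynomial.X * q i := by
    intro i hi
    have hg4 : q (i + 1) - Polynomial.X * q i ∈ degreeLT k 4 := by
      refine sub_mem (degreeLT_mono (by norm_num) (hq3 _)) ?_
      rw [mem_degreeLT]
      by_cases h0 : q i = 0
      · simp [h0, bot_lt_iff_ne_bot]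
      have := mem_degreeLT.1 (hq3 i)
      rw [degree_mul, degree_X, degree_eq_natDegree h0] at *
      norm_cast at *
      omega
    set g := q (i + 1) - Polynomial.X * q i with hg
    obtain ⟨a, ha, hag⟩ := exists_weight_of_orth (e := 1) (f := c + 2) hlam (by omega)
      (fun s => (∏ j ∈ Finset.univ.erase s, (lam s - lam j))⁻¹ * (om s * g.eval (lam s))) (by
        intro h hh
        have hsh : β (Polynomial.X ^ (i + 1)) h = β (Polynomial.X ^ i) (Polynomial.X * h) := by
          rw [h.as_sum_range_C_mul_X_pow, Finset.mul_sum, map_sum, map_sum]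
          refine Finset.sum_congr rfl fun j hj => ?_
          rw [Polynomial.C_mul', mul_smul_comm, map_smul, map_smul, ← pow_succ']
          by_cases h0 : h.coeff j = 0
          · simp [h0]
          rw [hshift i hi j]
          have : (j : WithBot ℕ) < (c + 2 : ℕ) := (le_degree_of_ne_zero h0).trans_lt (mem_degreeLT.1 hh)
          norm_cast at this
          omega
        have hh2 : Polynomial.X * h ∈ degreeLT k (2 * c - 1) := by
          rw [mem_degreeLT]
          by_cases h0 : h = 0
          · simp [h0, bot_lt_iff_ne_bot]
          have := mem_degreeLT.1 hh
          rw [degree_mul, degree_X, degree_eq_natDegree h0] at *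
          norm_cast at *
          omega
        rw [hqβ _ (by omega) h (degreeLT_mono (by omega) hh), hqβ _ (by omega) _ hh2,
          ← sub_eq_zero, ← Finset.sum_sub_distrib] at hsh
        rw [← hsh]
        refine Finset.sum_congr rfl fun s _ => ?_
        simp only [hg, Polynomial.eval_sub, Polynomial.eval_mul, Polynomial.eval_X]
        ring)
    have ha' : a = Polynomial.C (a.coeff 0) := by
      apply eq_C_of_degree_le_zero
      have := mem_degreeLT.1 ha
      exact Order.le_of_lt_succ this
    have hag' : ∀ s, om s * g.eval (lam s) = a.coeff 0 := fun s => by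
      have := mul_left_cancel₀ (inv_ne_zero (hP0 s)) (hag s)
      rw [this]; rw [ha']; simp
    by_cases h0 : a.coeff 0 = 0
    · have : g = 0 := eq_zero_of_eval hlam (by omega) hg4 fun s => by
        have := hag' s
        rw [h0] at this
        exact (mul_eq_zero.1 this).resolve_left (hom s)
      exact sub_eq_zero.1 this
    · exfalso
      refine hno ⟨Polynomial.C (a.coeff 0)⁻¹ * g, ?_, fun s => ?_⟩
      · rw [Polynomial.C_mul']
        exact Submodule.smul_mem _ _ (degreeLT_mono hc hg4)
      · rw [Polynomial.eval_mul, Polynomial.eval_C, mul_left_comm, hag', inv_mul_cancel₀ h0]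
  have hpow : ∀ i < c, q i = Polynomial.X ^ i * q 0 := by
    intro i
    induction i with
    | zero => simp
    | succ i ih => intro hi; rw [hstep i (by omega), ih (by omega), pow_succ']; ring
  have hq0 : q 0 = 0 := by
    by_contra h0
    have h1 := mem_degreeLT.1 (hq3 3)
    rw [hpow 3 (by omega), degree_mul, degree_X_pow, degree_eq_natDegree h0] at h1
    norm_cast at h1
    omega
  intro i hi j hj
  rw [hqβ i hi _ (hX hj)]
  simp [hpow i hi, hq0]

open Polynomial in
/-- The space of `h` of degree `< m` whose weighted values come from degree `< c` has
codimension at most three. -/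
lemma exists_three {k Γ : Type} [Field k] [Fintype Γ] [DecidableEq Γ] {lam om : Γ → k}
    (hlam : Function.Injective lam) {c m : ℕ} (hcard : Fintype.card Γ = c + 3) :
    ∃ g : Fin 3 → k[X], (∀ i, g i ∈ degreeLT k m) ∧ ∀ h ∈ degreeLT k m, ∃ a : Fin 3 → k,
      ∃ p ∈ degreeLT k c, ∀ i, om i * (h - ∑ j, a j • g j).eval (lam i) = p.eval (lam i) := by
  let ev : k[X] →ₗ[k] (Γ → k) := LinearMap.pi fun i => Polynomial.leval (lam i)
  let evo : k[X] →ₗ[k] (Γ → k) := LinearMap.pi fun i => om i • Polynomial.leval (lam i)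
  let U : Submodule k (Γ → k) := LinearMap.range (ev ∘ₗ (degreeLT k c).subtype)
  let π : degreeLT k m →ₗ[k] (Γ → k) ⧸ U := U.mkQ ∘ₗ evo ∘ₗ (degreeLT k m).subtype
  have hU : Module.finrank k U = c := by
    rw [LinearMap.finrank_range_of_inj, LinearEquiv.finrank_eq (degreeLTEquiv k c)]
    · simp
    · rw [← LinearMap.ker_eq_bot, LinearMap.ker_eq_bot']
      intro p hp
      exact Subtype.ext (eq_zero_of_eval hlam (by omega) p.2 fun i => congrFun hp i)
  have hV : Module.finrank k (LinearMap.range π) ≤ 3 := by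
    refine (Submodule.finrank_le _).trans ?_
    have := U.finrank_quotient_add_finrank
    rw [hU, Module.finrank_pi, hcard] at this
    omega
  let b := Module.finBasis k (LinearMap.range π)
  have hb : ∀ j, ∃ x, π x = b j := fun j => (b j).2
  choose x hx using hb
  refine ⟨fun j => if hj : j.1 < Module.finrank k (LinearMap.range π) then x ⟨j, hj⟩ else 0,
    fun j => ?_, fun h hh => ?_⟩
  · dsimp only
    split_ifs
    · exact (x _).2
    · exact zero_mem _
  · let v : LinearMap.range π := ⟨π ⟨h, hh⟩, _, rfl⟩
    let a : Fin 3 → k := fun j =>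
      if hj : j.1 < Module.finrank k (LinearMap.range π) then b.repr v ⟨j, hj⟩ else 0
    let y : degreeLT k m := ∑ j, b.repr v j • x j
    have hy : π y = π ⟨h, hh⟩ := by
      have := congrArg Subtype.val (b.sum_repr v)
      rw [AddSubmonoidClass.coe_finsetSum] at this
      rw [show π ⟨h, hh⟩ = (v : _ ⧸ U) from rfl, ← this, map_sum]
      exact Finset.sum_congr rfl fun j _ => by rw [map_smul, hx]; rfl
    have hsum : (∑ j : Fin 3, a j • (if hj : j.1 < Module.finrank k (LinearMap.range π)
        then (x ⟨j, hj⟩ : k[X]) else 0)) = (y : k[X]) := by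
      have : (y : k[X]) = ∑ j, b.repr v j • (x j : k[X]) := by simp [y]
      rw [this, ← sum_dite_lt hV]
      refine Finset.sum_congr rfl fun j _ => ?_
      simp only [a]
      split_ifs <;> simp
    refine ⟨a, ?_⟩
    rw [hsum]
    have h0 : U.mkQ (evo (h - y)) = 0 := by
      have : π (⟨h, hh⟩ - y) = 0 := by rw [map_sub, hy, sub_self]
      exact this
    rw [Submodule.mkQ_apply, Submodule.Quotient.mk_eq_zero] at h0
    obtain ⟨p, hp⟩ := h0
    refine ⟨p, p.2, fun i => ?_⟩
    have := congrFun hp i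
    simpa [ev, evo] using this.symm

end PointsOnLine

namespace FieldGrowth

open Submodule

variable {K E : Type} [Field K] [Field E] [Algebra K E]

/-- Multiplication by a nonzero element preserves the dimension. -/
lemma finrank_map_mul (x : E) (hx : x ≠ 0) (T : Submodule K E) :
    Module.finrank K (T.map (LinearMap.mulLeft K x)) = Module.finrank K T :=
  ((T.equivMapOfInjective (LinearMap.mulLeft K x) (mul_right_injective₀ hx)).finrank_eq).symm

/-- A nonzero finite-dimensional subspace is not stable under a transcendental element. -/
lemma not_stable {u : E} (hu : Transcendental K u) (T : Submodule K E) [FiniteDimensional K T]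
    (hT : T ≠ ⊥) : ¬ ∀ x ∈ T, u * x ∈ T := by
  intro h
  let f : Module.End K T := (LinearMap.mulLeft K u).restrict h
  obtain ⟨x, hx, hx0⟩ := T.ne_bot_iff.1 hT
  have hf : IsIntegral K f := Algebra.IsIntegral.isIntegral f
  obtain ⟨p, hp, hpf⟩ := hf
  apply hu
  refine ⟨p, hp.ne_zero, ?_⟩
  have key : ∀ q : Polynomial K, ((Polynomial.aeval f q) ⟨x, hx⟩ : E) = Polynomial.aeval u q * x := by
    intro q
    induction q using Polynomial.induction_on' with
    | add p q hp hq => simp [hp, hq, add_mul]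
    | monomial n a =>
      have : ∀ n, ((f ^ n) ⟨x, hx⟩ : E) = u ^ n * x := by
        intro n
        induction n with
        | zero => simp
        | succ n ih =>
          rw [pow_succ', Module.End.mul_apply, pow_succ', mul_assoc, ← ih]
          rfl
      rw [Polynomial.aeval_monomial, Polynomial.aeval_monomial]
      simp [Algebra.algebraMap_eq_smul_one, this]
  have h1 := key p
  rw [show Polynomial.aeval f p = 0 from hpf] at h1
  simpa [hx0] using h1.symm

/-- The geometric progression `t, tu, …`. -/
def chain (K : Type) [Field K] [Algebra K E] (t u : E) (r : ℕ) : Submodule K E :=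
  span K ((fun j => t * u ^ j) '' Set.Iio r)

lemma mem_chain {t u : E} {r j : ℕ} (h : j < r) : t * u ^ j ∈ chain K t u r :=
  subset_span ⟨j, h, rfl⟩

instance (t u : E) (r : ℕ) : FiniteDimensional K (chain K t u r) :=
  FiniteDimensional.span_of_finite K ((Set.finite_Iio r).image _)

lemma chain_succ (t u : E) (r : ℕ) : chain K t u (r + 1) = chain K t u r ⊔ span K {t * u ^ r} := by
  have : Set.Iio (r + 1) = insert r (Set.Iio r) := by
    ext x; simp only [Set.mem_Iio, Set.mem_insert_iff]; omega
  rw [chain, this, Set.image_insert_eq, span_insert, sup_comm]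
  rfl

lemma le_finrank_chain {t u : E} (ht : t ≠ 0) (hu : Transcendental K u) (r : ℕ) :
    r ≤ Module.finrank K (chain K t u r) := by
  induction r with
  | zero => simp
  | succ r ih =>
    by_cases hr : r = 0
    · subst hr
      have : chain K t u (0 + 1) ≠ ⊥ := fun h => by
        have := mem_chain (K := K) (t := t) (u := u) (show 0 < 0 + 1 by simp)
        rw [h] at this
        simp [ht] at this
      exact Nat.one_le_iff_ne_zero.2 fun h => this (finrank_eq_zero.1 h)
    have hlt : chain K t u r < chain K t u (r + 1) := by
      rw [chain_succ]
      refine lt_of_le_of_ne le_sup_left fun h => ?_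
      refine not_stable hu (chain K t u r) (fun h0 => ?_) ?_
      · have := mem_chain (K := K) (t := t) (u := u) (show 0 < r by omega)
        rw [h0] at this
        simp [ht] at this
      · intro x hx
        have : chain K t u r ≤ (chain K t u r).comap (LinearMap.mulLeft K u) := by
          refine span_le.2 ?_
          rintro _ ⟨j, hj, rfl⟩
          change u * (t * u ^ j) ∈ chain K t u r
          rw [h, ← chain_succ, show u * (t * u ^ j) = t * u ^ (j + 1) by ring]
          exact mem_chain (by simpa using hj)
        exact this hx
    have := finrank_lt_finrank_of_lt hlt
    omega

/-- A subspace that grows by at most one under multiplication by `u` is a geometric progression. -/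
lemma eq_chain {u : E} (hu : Transcendental K u) (r : ℕ) (T : Submodule K E) [FiniteDimensional K T]
    (hT : Module.finrank K T = r + 1)
    (h : Module.finrank K (T ⊔ T.map (LinearMap.mulLeft K u) : Submodule K E) ≤ r + 2) :
    ∃ t, t ≠ 0 ∧ T = chain K t u (r + 1) := by
  induction r generalizing T with
  | zero =>
    obtain ⟨t, ht, hs⟩ := finrank_eq_one_iff'.1 (by simpa using hT)
    refine ⟨t, by simpa using ht, ?_⟩
    have : Set.Iio (0 + 1) = {0} := by ext; simp
    rw [chain, this]
    apply le_antisymm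
    · intro x hx
      obtain ⟨c, hc⟩ := hs ⟨x, hx⟩
      simp only [Set.image_singleton, pow_zero, mul_one]
      exact mem_span_singleton.2 ⟨c, congrArg Subtype.val hc⟩
    · rw [span_le]; simp
  | succ r ih =>
    let N : Submodule K E := T ⊔ T.map (LinearMap.mulLeft K u)
    have : FiniteDimensional K N := inferInstance
    let T' : Submodule K E := T ⊓ T.comap (LinearMap.mulLeft K u)
    have : FiniteDimensional K T' := Submodule.finiteDimensional_of_le (inf_le_left : T' ≤ T)
    have hb : T ≠ ⊥ := fun h0 => by rw [h0] at hT; simp at hT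
    have hlt : T' < T := by
      refine lt_of_le_of_ne inf_le_left fun h0 => not_stable hu T hb fun x hx => ?_
      rw [← h0] at hx
      exact hx.2
    have h1 := finrank_lt_finrank_of_lt hlt
    -- T + uT, T ∩ uT
    have h2 : T'.map (LinearMap.mulLeft K u) = T ⊓ T.map (LinearMap.mulLeft K u) ∧ u ≠ 0 := by
      have hu0 : u ≠ 0 := fun h0 => hu (h0 ▸ isAlgebraic_zero)
      refine ⟨?_, hu0⟩
      ext x
      constructor
      · rintro ⟨y, hy, rfl⟩
        exact ⟨hy.2, y, hy.1, rfl⟩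
      · rintro ⟨hx, y, hy, rfl⟩
        exact ⟨y, ⟨hy, hx⟩, rfl⟩
    have h3 := Submodule.finrank_sup_add_finrank_inf_eq T (T.map (LinearMap.mulLeft K u))
    rw [← h2.1, finrank_map_mul u h2.2, finrank_map_mul u h2.2] at h3
    have hT' : Module.finrank K T' = r + 1 := by omega
    have hle : T' ⊔ T'.map (LinearMap.mulLeft K u) ≤ T := by
      refine sup_le inf_le_left ?_
      rw [h2.1]; exact inf_le_left
    obtain ⟨t, ht, hc⟩ := ih T' hT' ((finrank_mono hle).trans (by omega))
    refine ⟨t, ht, (eq_of_le_of_finrank_le ?_ ?_).symm⟩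
    · rw [chain_succ, ← hc]
      refine sup_le inf_le_left ?_
      rw [span_singleton_le_iff_mem]
      have : t * u ^ r ∈ T' := hc ▸ mem_chain (by omega)
      have := this.2
      change u * (t * u ^ r) ∈ T at this
      rwa [pow_succ', mul_left_comm]
    · rw [hT]; exact le_finrank_chain ht hu _

instance finite_mul (P Q : Submodule K E) [FiniteDimensional K P] [FiniteDimensional K Q] :
    FiniteDimensional K (P * Q : Submodule K E) :=
  Module.Finite.of_fg ((Module.Finite.iff_fg.1 ‹_›).mul (Module.Finite.iff_fg.1 ‹_›))

instance finite_pow (P : Submodule K E) [FiniteDimensional K P] (m : ℕ) :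
    FiniteDimensional K (P ^ m : Submodule K E) :=
  Module.Finite.of_fg ((Module.Finite.iff_fg.1 ‹_›).pow m)

/-- Products with a geometric progression have at least the expected dimension. -/
lemma finrank_mul_chain {t u : E} (ht : t ≠ 0) (hu : Transcendental K u) (r : ℕ) (Q : Submodule K E)
    [FiniteDimensional K Q] (hQ : Q ≠ ⊥) :
    Module.finrank K Q + r ≤ Module.finrank K (Q * chain K t u (r + 1) : Submodule K E) := by
  induction r with
  | zero =>
    have : Q.map (LinearMap.mulLeft K t) ≤ Q * chain K t u (0 + 1) := by
      rintro _ ⟨x, hx, rfl⟩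
      rw [mul_comm Q]
      simpa using mul_mem_mul (mem_chain (K := K) (t := t) (u := u) (show 0 < 0 + 1 by simp)) hx
    have h2 := finrank_mono this
    rwa [finrank_map_mul t ht] at h2
  | succ r ih =>
    have hlt : Q * chain K t u (r + 1) < Q * chain K t u (r + 1 + 1) := by
      have hle : Q * chain K t u (r + 1) ≤ Q * chain K t u (r + 1 + 1) := by
        refine mul_le_mul' le_rfl ?_
        rw [chain_succ (r := r + 1)]
        exact le_sup_left
      refine lt_of_le_of_ne hle fun h => ?_
      refine not_stable hu (Q * chain K t u (r + 1)) (fun h0 => ?_) fun x hx => ?_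
      · rw [h0, finrank_bot] at ih
        have : Module.finrank K Q ≠ 0 := fun h => hQ (finrank_eq_zero.1 h)
        omega
      · have : Q * chain K t u (r + 1) ≤ (Q * chain K t u (r + 1)).comap (LinearMap.mulLeft K u) := by
          rw [mul_le]
          intro q hq y hy
          have : chain K t u (r + 1) ≤ (chain K t u (r + 1 + 1)).comap (LinearMap.mulLeft K u) := by
            refine span_le.2 ?_
            rintro _ ⟨j, hj, rfl⟩
            change u * (t * u ^ j) ∈ chain K t u (r + 1 + 1)
            rw [show u * (t * u ^ j) = t * u ^ (j + 1) by ring]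
            exact mem_chain (by simpa using hj)
          change u * (q * y) ∈ Q * chain K t u (r + 1)
          rw [h, mul_left_comm]
          exact mul_mem_mul hq (this hy)
        exact this hx
    have := finrank_lt_finrank_of_lt hlt
    omega

/-- A function of linear growth has, arbitrarily far out, two consecutive small increments. -/
lemma exists_slow {al : ℕ → ℕ} {d a : ℕ} (ha : ∀ m, al m ≤ d * m + a) (M : ℕ) :
    ∃ m ≥ M, al (m + 1) ≤ al m + d ∧ al (m + 2) ≤ al m + 2 * d := by
  by_contra! h
  have key : ∀ j, ∃ i, j ≤ i ∧ (2 * d + 1) * i ≤ 2 * al (M + i) := by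
    intro j
    induction j with
    | zero => exact ⟨0, le_rfl, by simp⟩
    | succ j ih =>
      obtain ⟨i, hi, hi2⟩ := ih
      by_cases h1 : al (M + i + 1) ≤ al (M + i) + d
      · have := h (M + i) (by omega) h1
        refine ⟨i + 2, by omega, ?_⟩
        rw [← add_assoc]
        nlinarith
      · refine ⟨i + 1, by omega, ?_⟩
        rw [← add_assoc]
        nlinarith
  obtain ⟨i, hi, hi2⟩ := key (2 * d * M + 2 * a + 1)
  have := ha (M + i)
  nlinarith

end FieldGrowth

namespace FieldGrowth

open Submodule

/-- Dehomogenised data of a variety of almost minimal growth together with the evaluations at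
`c + 3` points. -/
structure Growth {k K E : Type} [Field k] [Field K] [Field E] [Algebra k K] [Algebra K E]
    [Algebra k E] (c : ℕ) (W V : Submodule k E) (Λ : Submodule k K) (ε : E)
    (ev : Fin c ⊕ Fin 3 → E →ₗ[K] K) : Prop where
  one_mem : (1 : E) ∈ W
  V_le : V ≤ W
  finW : FiniteDimensional k W
  finrank_V : Module.finrank k V = c
  lower : ∀ m, m + 1 ≤ Module.finrank K (span K (W : Set E) ^ m : Submodule K E)
  upper : ∃ a, ∀ m, Module.finrank K (span K (W : Set E) ^ m : Submodule K E) ≤ (c + 3) * m + a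
  ev_one : ∀ σ, ev σ 1 = 1
  ev_mul : ∀ σ m m', ∀ x ∈ span K (W : Set E) ^ m, ∀ y ∈ span K (W : Set E) ^ m',
    ev σ (x * y) = ev σ x * ev σ y
  surj : ∃ M, ∀ m ≥ M, ∀ f : Fin c ⊕ Fin 3 → K, ∃ x ∈ span K (W : Set E) ^ m, ∀ σ, ev σ x = f σ
  gap : ∃ M, ∀ m ≥ M, Module.finrank K (span K (V : Set E) * span K (W : Set E) ^ m : Submodule K E) + 4
    ≤ Module.finrank K (span K (W : Set E) ^ (m + 1) : Submodule K E)
  ev_V : ∀ σ, ∃ v ∈ V, ev σ v ≠ 0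
  ev_W : ∀ σ, ∀ w ∈ W, ∃ a : k, ev σ w = algebraMap k K a
  eps_mem : ε ∈ span K (W : Set E)
  ev_eps : ∀ σ, ev σ ε = 0
  eps_ne : ε ≠ 0
  eps_mul : ∀ j, ∀ y ∈ span K (W : Set E) ^ j, ε * y ∈ W ^ (j + 1) → ∀ σ, ev σ y ∈ Λ
  eps_indep : ∀ v ∈ V, ∀ a ∈ Λ, v - 1 ≠ ε * algebraMap K E a

namespace Growth

variable {k K E : Type} [Field k] [Field K] [Field E] [Algebra k K] [Algebra K E]
    [Algebra k E] [IsScalarTower k K E] {c : ℕ} {W V : Submodule k E} {Λ : Submodule k K} {ε : E}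
    {ev : Fin c ⊕ Fin 3 → E →ₗ[K] K}

/-- A subspace vanishing at independent points has small dimension. -/
lemma finrank_add_card_le {Γ : Type} (ev : Γ → E →ₗ[K] K) (P Q : Submodule K E)
    [FiniteDimensional K P] (hQ : Q ≤ P) (s : Finset Γ)
    (hP : ∀ f : Γ → K, ∃ x ∈ P, ∀ σ, ev σ x = f σ) (hs : ∀ x ∈ Q, ∀ σ ∈ s, ev σ x = 0) :
    Module.finrank K Q + s.card ≤ Module.finrank K P := by
  classical
  let φ : P →ₗ[K] (s → K) := LinearMap.pi fun σ => (ev σ) ∘ₗ P.subtype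
  have hφ : Function.Surjective φ := by
    intro f
    obtain ⟨x, hx, hxf⟩ := hP fun σ => if h : σ ∈ s then f ⟨σ, h⟩ else 0
    refine ⟨⟨x, hx⟩, funext fun σ => ?_⟩
    have := hxf σ
    simpa [φ] using this
  have h1 := φ.finrank_range_add_finrank_ker
  rw [LinearMap.range_eq_top.2 hφ, finrank_top, Module.finrank_pi, Fintype.card_coe] at h1
  have h2 : Module.finrank K Q ≤ Module.finrank K (LinearMap.ker φ) := by
    let ψ : Q →ₗ[K] LinearMap.ker φ := (Submodule.inclusion hQ).codRestrict _ (by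
      intro x
      rw [LinearMap.mem_ker]
      exact funext fun σ => hs x x.2 σ σ.2)
    refine LinearMap.finrank_le_finrank_of_injective (f := ψ) fun x y h => ?_
    have : (((ψ x : LinearMap.ker φ) : P) : E) = ((ψ y : LinearMap.ker φ) : P) := by rw [h]
    exact Subtype.ext this
  omega

lemma finite_span (h : Growth c W V Λ ε ev) : FiniteDimensional K (span K (W : Set E)) := by
  have := h.finW
  let b := Module.finBasis k W
  have : span K (W : Set E) ≤ span K (Set.range fun i => (b i : E)) := by
    refine span_le.2 fun w hw => ?_
    have := congrArg Subtype.val (b.sum_repr ⟨w, hw⟩)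
    rw [AddSubmonoidClass.coe_finsetSum] at this
    change _ = w at this
    rw [← this]
    refine sum_mem fun i _ => ?_
    change b.repr _ i • (b i : E) ∈ _
    rw [← algebraMap_smul K]
    exact smul_mem _ _ (subset_span ⟨i, rfl⟩)
  have h2 := FiniteDimensional.span_of_finite K (Set.finite_range fun i => (b i : E))
  exact Submodule.finiteDimensional_of_le this

lemma span_V_le (h : Growth c W V Λ ε ev) : span K (V : Set E) ≤ span K (W : Set E) :=
  span_mono h.V_le

lemma finite_span_V (h : Growth c W V Λ ε ev) : FiniteDimensional K (span K (V : Set E)) :=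
  have := h.finite_span
  Submodule.finiteDimensional_of_le h.span_V_le

lemma one_mem_span (h : Growth c W V Λ ε ev) : (1 : E) ∈ span K (W : Set E) :=
  subset_span h.one_mem

lemma pow_le_succ (h : Growth c W V Λ ε ev) (m : ℕ) :
    span K (W : Set E) ^ m ≤ span K (W : Set E) ^ (m + 1) := fun x hx => by
  rw [pow_succ, ← mul_one x]
  exact mul_mem_mul hx h.one_mem_span

lemma surj_V (h : Growth c W V Λ ε ev) {m : ℕ}
    (hm : ∀ f : Fin c ⊕ Fin 3 → K, ∃ x ∈ span K (W : Set E) ^ m, ∀ σ, ev σ x = f σ)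
    (f : Fin c ⊕ Fin 3 → K) :
    ∃ x ∈ span K (V : Set E) * span K (W : Set E) ^ m, ∀ σ, ev σ x = f σ := by
  classical
  choose v hv hv0 using h.ev_V
  choose x hx hxe using fun σ : Fin c ⊕ Fin 3 => hm (Pi.single σ 1)
  refine ⟨∑ σ, (f σ / ev σ (v σ)) • (v σ * x σ), sum_mem fun σ _ => smul_mem _ _
    (mul_mem_mul (subset_span (hv σ)) (hx σ)), fun τ => ?_⟩
  rw [map_sum, Finset.sum_eq_single τ]
  · rw [map_smul, h.ev_mul τ 1 m _ (by rw [pow_one]; exact h.span_V_le (subset_span (hv τ))) _ (hx τ),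
      hxe, Pi.single_eq_same, mul_one, smul_eq_mul, div_mul_cancel₀ _ (hv0 τ)]
  · intro σ _ hσ
    rw [map_smul, h.ev_mul τ 1 m _ (by rw [pow_one]; exact h.span_V_le (subset_span (hv σ))) _ (hx σ),
      hxe, Pi.single_eq_of_ne hσ.symm, mul_zero, smul_zero]
  · simp

/-- A good degree. -/
structure Slow (c : ℕ) (W V : Submodule k E) (ev : Fin c ⊕ Fin 3 → E →ₗ[K] K) (m r : ℕ) : Prop where
  rank : Module.finrank K (span K (W : Set E) ^ m : Submodule K E) = r + 2
  one : Module.finrank K (span K (W : Set E) ^ (m + 1) : Submodule K E) ≤ r + c + 5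
  V_one : Module.finrank K (span K (V : Set E) * span K (W : Set E) ^ m : Submodule K E) ≤ r + c + 1
  V_two : Module.finrank K (span K (V : Set E) * span K (W : Set E) ^ (m + 1) : Submodule K E)
    ≤ r + 2 * c + 4
  surj : ∀ f : Fin c ⊕ Fin 3 → K, ∃ x ∈ span K (W : Set E) ^ m, ∀ σ, ev σ x = f σ

lemma exists_slow (h : Growth c W V Λ ε ev) : ∃ m r, Slow c W V ev m r := by
  obtain ⟨a, ha⟩ := h.upper
  obtain ⟨M, hM⟩ := h.surj
  obtain ⟨M', hM'⟩ := h.gap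
  obtain ⟨m, hm, h1, h2⟩ := FieldGrowth.exists_slow ha (M + M' + 1)
  have h3 := h.lower m
  have h4 := hM' m (by omega)
  have h5 := hM' (m + 1) (by omega)
  rw [add_assoc m 1 1, one_add_one_eq_two] at h5
  exact ⟨m, Module.finrank K (span K (W : Set E) ^ m : Submodule K E) - 2, by omega, by omega,
    by omega, by omega, hM m (by omega)⟩

variable {m r : ℕ}

lemma Slow.surj_succ (h : Growth c W V Λ ε ev) (hs : Slow c W V ev m r)
    (f : Fin c ⊕ Fin 3 → K) : ∃ x ∈ span K (W : Set E) ^ (m + 1), ∀ σ, ev σ x = f σ := by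
  obtain ⟨x, hx, hf⟩ := hs.surj f
  exact ⟨x, h.pow_le_succ m hx, hf⟩

/-- Subspaces of `V·T` vanishing on many points are small. -/
lemma Slow.le (h : Growth c W V Λ ε ev) (hs : Slow c W V ev m r) (Q : Submodule K E)
    (hQ : Q ≤ span K (V : Set E) * span K (W : Set E) ^ m) (s : Finset (Fin c ⊕ Fin 3))
    (h0 : ∀ x ∈ Q, ∀ σ ∈ s, ev σ x = 0) : Module.finrank K Q + s.card ≤ r + c + 1 := by
  have := h.finite_span
  have := h.finite_span_V
  exact (finrank_add_card_le ev _ Q hQ s (h.surj_V hs.surj) h0).trans hs.V_one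

lemma mul_vanish (h : Growth c W V Λ ε ev) {a m : ℕ} {Q : Submodule K E}
    (hQ : Q ≤ span K (W : Set E) ^ a) {σ : Fin c ⊕ Fin 3} (h0 : ∀ x ∈ Q, ev σ x = 0) :
    ∀ x ∈ Q * span K (W : Set E) ^ m, ev σ x = 0 := by
  intro x hx
  refine Submodule.mul_induction_on hx (fun q hq t ht => ?_) fun x y hx hy => by rw [map_add, hx, hy, add_zero]
  rw [h.ev_mul σ a m q (hQ hq) t ht, h0 q hq, zero_mul]

/-- Nonzero elements of the span of `V` vanish at fewer than `c` points. -/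
lemma general_position (h : Growth c W V Λ ε ev) {z : E} (hz : z ∈ span K (V : Set E))
    (s : Finset (Fin c ⊕ Fin 3)) (h0 : ∀ σ ∈ s, ev σ z = 0) (hcard : c ≤ s.card) : z = 0 := by
  by_contra hz0
  obtain ⟨m, r, hs⟩ := h.exists_slow
  have hzs : span K {z} ≤ span K (V : Set E) := by rwa [span_singleton_le_iff_mem]
  have h1 := Slow.le h hs (span K {z} * span K (W : Set E) ^ m) (mul_le_mul' hzs le_rfl) s (by
    intro x hx σ hσ
    refine h.mul_vanish (a := 1) ?_ ?_ x hx
    · rw [pow_one]; exact hzs.trans h.span_V_le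
    · intro y hy
      obtain ⟨a, rfl⟩ := mem_span_singleton.1 hy
      rw [map_smul, h0 σ hσ, smul_zero])
  have := h.finite_span
  have h2 : Module.finrank K (span K (W : Set E) ^ m : Submodule K E) ≤
      Module.finrank K (span K {z} * span K (W : Set E) ^ m : Submodule K E) := by
    rw [← finrank_map_mul z hz0]
    refine finrank_mono ?_
    rintro _ ⟨x, hx, rfl⟩
    exact mul_mem_mul (mem_span_singleton_self z) hx
  rw [hs.rank] at h2
  omega

lemma eq_zero_of_inl (h : Growth c W V Λ ε ev) {z : E} (hz : z ∈ span K (V : Set E))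
    (h0 : ∀ i, ev (Sum.inl i) z = 0) : z = 0 :=
  h.general_position hz (Finset.univ.map Function.Embedding.inl) (by simpa using h0) (by simp)

/-- The dual basis at the first `c` points. -/
lemma exists_dual (h : Growth c W V Λ ε ev) :
    ∃ e : Fin c → E, (∀ i, e i ∈ V) ∧ ∀ i j, ev (Sum.inl j) (e i) = if j = i then 1 else 0 := by
  have := h.finW
  have : FiniteDimensional k V := Submodule.finiteDimensional_of_le h.V_le
  let φ : V →ₗ[k] (Fin c → K) :=
    LinearMap.pi fun i => ((ev (Sum.inl i)).restrictScalars k) ∘ₗ V.subtype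
  let ι : (Fin c → k) →ₗ[k] (Fin c → K) := LinearMap.pi fun i => Algebra.linearMap k K ∘ₗ LinearMap.proj i
  have hφ : Function.Injective φ := by
    rw [← LinearMap.ker_eq_bot, LinearMap.ker_eq_bot']
    intro x hx
    exact Subtype.ext (h.eq_zero_of_inl (subset_span x.2) fun i => congrFun hx i)
  have hι : Function.Injective ι := by
    intro x y hxy
    exact funext fun i => (algebraMap k K).injective (congrFun hxy i)
  have hle : LinearMap.range φ ≤ LinearMap.range ι := by
    rintro _ ⟨x, rfl⟩
    choose a ha using fun i : Fin c => h.ev_W (Sum.inl i) x (h.V_le x.2)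
    exact ⟨a, funext fun i => (ha i).symm⟩
  have heq : LinearMap.range φ = LinearMap.range ι := by
    apply eq_of_le_of_finrank_eq hle
    rw [LinearMap.finrank_range_of_inj hφ, LinearMap.finrank_range_of_inj hι, h.finrank_V]
    simp
  have hex : ∀ i : Fin c, ∃ v : V, φ v = ι (Pi.single i 1) := fun i =>
    (heq.symm ▸ LinearMap.mem_range_self ι _ : ι (Pi.single i 1) ∈ LinearMap.range φ)
  choose v hv using hex
  refine ⟨fun i => v i, fun i => (v i).2, fun i j => ?_⟩
  have := congrFun (hv i) j
  change ev (Sum.inl j) (v i) = algebraMap k K ((Pi.single i 1 : Fin c → k) j) at this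
  rw [this, Pi.single_apply]
  split_ifs <;> simp

end Growth
end FieldGrowth

namespace FieldGrowth

open Submodule

section
variable {K E : Type} [Field K] [Field E] [Algebra K E]

lemma exists_coeff_of_mem_chain {t u z : E} {r : ℕ} (hz : z ∈ chain K t u r) :
    ∃ p : ℕ → K, z = ∑ s ∈ Finset.range r, p s • (t * u ^ s) := by
  refine span_induction (p := fun z _ => ∃ p : ℕ → K, z = ∑ s ∈ Finset.range r, p s • (t * u ^ s))
    ?_ ⟨0, by simp⟩ ?_ ?_ hz
  · rintro _ ⟨j, hj, rfl⟩
    refine ⟨Pi.single j 1, ?_⟩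
    rw [Finset.sum_eq_single j]
    · simp
    · intro b _ hb
      simp [hb]
    · intro h
      simp at h hj
      omega
  · rintro _ _ _ _ ⟨p, rfl⟩ ⟨q, rfl⟩
    exact ⟨p + q, by simp [add_smul, Finset.sum_add_distrib]⟩
  · rintro a _ _ ⟨p, rfl⟩
    exact ⟨a • p, by simp [Finset.smul_sum, mul_smul]⟩

lemma exists_combination {P Q : Submodule K E} [FiniteDimensional K Q] (hPQ : P ≤ Q)
    (h : Module.finrank K Q ≤ Module.finrank K P + 1) {x y : E} (hx : x ∈ Q) (hy : y ∈ Q) :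
    ∃ a b : K, (a ≠ 0 ∨ b ≠ 0) ∧ a • x + b • y ∈ P := by
  by_cases hxP : x ∈ P
  · exact ⟨1, 0, by simp, by simpa using hxP⟩
  have hle : P ⊔ span K {x} ≤ Q := sup_le hPQ (by rwa [span_singleton_le_iff_mem])
  have : FiniteDimensional K (P ⊔ span K {x} : Submodule K E) := Submodule.finiteDimensional_of_le hle
  have hlt : P < P ⊔ span K {x} := lt_of_le_of_ne le_sup_left fun h0 => hxP (by
    rw [h0]; exact mem_sup_right (mem_span_singleton_self x))
  have h1 := finrank_lt_finrank_of_lt hlt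
  have h2 : P ⊔ span K {x} = Q := eq_of_le_of_finrank_le hle (by omega)
  rw [← h2] at hy
  obtain ⟨p, hp, q, hq, rfl⟩ := mem_sup.1 hy
  obtain ⟨a, rfl⟩ := mem_span_singleton.1 hq
  exact ⟨-a, 1, by simp, by simpa using hp⟩
end

namespace Growth

variable {k K E : Type} [Field k] [Field K] [Field E] [Algebra k K] [Algebra K E]
    [Algebra k E] [IsScalarTower k K E] {c : ℕ} {W V : Submodule k E} {Λ : Submodule k K} {ε : E}
    {ev : Fin c ⊕ Fin 3 → E →ₗ[K] K}

lemma mem_pow_one {x : E} (hx : x ∈ span K (W : Set E)) : x ∈ span K (W : Set E) ^ 1 := by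
  rwa [pow_one]

lemma ev_pow (h : Growth c W V Λ ε ev) (σ) {x : E} (hx : x ∈ span K (W : Set E)) (s : ℕ) :
    ev σ (x ^ s) = ev σ x ^ s := by
  induction s with
  | zero => simp [h.ev_one]
  | succ s ih =>
    rw [pow_succ, h.ev_mul σ s 1 _ (pow_mem_pow _ hx s) _ (mem_pow_one hx), ih, pow_succ]

lemma ev_mul_pow (h : Growth c W V Λ ε ev) (σ) {x y : E} {m : ℕ} (hx : x ∈ span K (W : Set E) ^ m)
    (hy : y ∈ span K (W : Set E)) (s : ℕ) :
    ev σ (x * y ^ s) = ev σ x * ev σ y ^ s := by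
  rw [h.ev_mul σ m s _ hx _ (pow_mem_pow _ hy s), h.ev_pow σ hy]

/-- Top coefficient of a binary form relation. -/
lemma top_coeff (h : Growth c W V Λ ε ev) {x y : E} (hx : x ∈ span K (W : Set E))
    (hy : y ∈ span K (W : Set E)) {σ : Fin c ⊕ Fin 3} (h1 : ev σ x = 1) (h0 : ev σ y = 0) (N : ℕ)
    (p : ℕ → K) : ev σ (∑ s ∈ Finset.range (N + 1), p s • (x ^ s * y ^ (N - s))) = p N := by
  rw [map_sum, Finset.sum_range_succ, Finset.sum_eq_zero]
  · rw [map_smul, h.ev_mul_pow σ (pow_mem_pow _ hx N) hy, h.ev_pow σ hx]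
    simp [h1]
  · intro s hs
    rw [map_smul, h.ev_mul_pow σ (pow_mem_pow _ hx s) hy, h0, zero_pow]
    · simp
    · simp at hs; omega

lemma sum_factor {x y : E} (N : ℕ) (p : ℕ → K) (h : p (N + 1) = 0) :
    ∑ s ∈ Finset.range (N + 1 + 1), p s • (x ^ s * y ^ (N + 1 - s)) =
      y * ∑ s ∈ Finset.range (N + 1), p s • (x ^ s * y ^ (N - s)) := by
  rw [Finset.sum_range_succ, h, zero_smul, add_zero, Finset.mul_sum]
  refine Finset.sum_congr rfl fun s hs => ?_
  have : N + 1 - s = N - s + 1 := by simp at hs; omega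
  rw [this, pow_succ, mul_smul_comm]
  congr 1
  ring

lemma coeff_eq_zero (h : Growth c W V Λ ε ev) {x y : E} (hx : x ∈ span K (W : Set E))
    (hy : y ∈ span K (W : Set E)) {σ : Fin c ⊕ Fin 3} (h1 : ev σ x = 1) (h0 : ev σ y = 0)
    (hy0 : y ≠ 0) (N : ℕ) (p : ℕ → K)
    (hp : ∑ s ∈ Finset.range (N + 1), p s • (x ^ s * y ^ (N - s)) = 0) : ∀ s ≤ N, p s = 0 := by
  induction N with
  | zero =>
    intro s hs
    have := h.top_coeff hx hy h1 h0 0 p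
    rw [hp, map_zero] at this
    rw [Nat.le_zero.1 hs, ← this]
  | succ N ih =>
    have := h.top_coeff hx hy h1 h0 (N + 1) p
    rw [hp, map_zero] at this
    rw [sum_factor N p this.symm] at hp
    intro s hs
    rcases Nat.lt_or_ge N s with h2 | h2
    · rw [show s = N + 1 by omega, ← this]
    · exact ih ((mul_eq_zero.1 hp).resolve_left hy0) s h2

lemma transcendental_div (h : Growth c W V Λ ε ev) {x y : E} (hx : x ∈ span K (W : Set E))
    (hy : y ∈ span K (W : Set E)) {σ : Fin c ⊕ Fin 3} (h1 : ev σ x = 1) (h0 : ev σ y = 0)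
    (hy0 : y ≠ 0) : Transcendental K (x / y) := by
  rintro ⟨p, hp, hp0⟩
  apply hp
  ext s
  rcases Nat.lt_or_ge p.natDegree s with h2 | h2
  · simpa using Polynomial.coeff_eq_zero_of_natDegree_lt h2
  refine h.coeff_eq_zero hx hy h1 h0 hy0 p.natDegree p.coeff ?_ s h2
  rw [Polynomial.aeval_eq_sum_range] at hp0
  have := congrArg (fun z => z * y ^ p.natDegree) hp0
  simp only [Finset.sum_mul, zero_mul] at this
  rw [← this]
  refine Finset.sum_congr rfl fun s hs => ?_
  rw [smul_mul_assoc, div_pow, div_mul_eq_mul_div, mul_div_assoc, div_eq_mul_inv,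
    ← pow_sub₀ _ hy0 (by simp at hs; omega)]

lemma relation (h : Growth c W V Λ ε ev) {x y Z : E} (hx : x ∈ span K (W : Set E))
    (hy : y ∈ span K (W : Set E)) (hZ : Z ∈ span K (W : Set E) ^ 2) {σ τ : Fin c ⊕ Fin 3}
    (h1 : ev σ x = 1) (h0 : ev σ y = 0) (hy0 : y ≠ 0) (g1 : ev τ y = 1) (g0 : ev τ x = 0)
    (hZ1 : ev σ Z = 0) (hZ2 : ev τ Z = 0) (N : ℕ) (p : ℕ → K)
    (hp : Z * y ^ N = ∑ s ∈ Finset.range (N + 2 + 1), p s • (x ^ s * y ^ (N + 2 - s))) :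
    Z = p 1 • (x * y) := by
  induction N with
  | zero =>
    have h2 := h.top_coeff hx hy h1 h0 2 p
    rw [← hp, pow_zero, mul_one, hZ1] at h2
    have h3 : p 0 = 0 := by
      have := congrArg (ev τ) hp
      simp only [pow_zero, mul_one, hZ2, Finset.sum_range_succ, Finset.range_zero, Finset.sum_empty,
        map_add, map_smul] at this
      rw [← h2, ← pow_zero x, h.ev_mul_pow τ (pow_mem_pow _ hx 0) hy,
        h.ev_mul_pow τ (pow_mem_pow _ hx 1) hy, h.ev_pow τ hx, h.ev_pow τ hx] at this
      simpa [g0, g1] using this.symm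
    simpa [Finset.sum_range_succ, h3, ← h2] using hp
  | succ N ih =>
    have h2 := h.top_coeff hx hy h1 h0 (N + 1 + 2) p
    rw [← hp, h.ev_mul_pow σ hZ hy, hZ1, zero_mul] at h2
    rw [show N + 1 + 2 = N + 2 + 1 by ring] at h2 hp
    rw [sum_factor (N + 2) p h2.symm, pow_succ', mul_left_comm] at hp
    exact ih (mul_left_cancel₀ hy0 hp)

end Growth
end FieldGrowth

namespace FieldGrowth

open Submodule

namespace Growth

variable {k K E : Type} [Field k] [Field K] [Field E] [Algebra k K] [Algebra K E]
    [Algebra k E] [IsScalarTower k K E] {c : ℕ} {W V : Submodule k E} {Λ : Submodule k K} {ε : E}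
    {ev : Fin c ⊕ Fin 3 → E →ₗ[K] K} {e : Fin c → E}

/-- Products of part of the dual basis with `T` are small. -/
lemma Slow.le_of_dual (h : Growth c W V Λ ε ev) (he : ∀ i, e i ∈ V)
    (hd : ∀ i j, ev (Sum.inl j) (e i) = if j = i then 1 else 0) {m r : ℕ} (hs : Slow c W V ev m r)
    (I : Finset (Fin c)) :
    Module.finrank K (span K (e '' I) * span K (W : Set E) ^ m : Submodule K E) ≤ r + I.card + 1 := by
  have hle : span K (e '' I) ≤ span K (V : Set E) := span_mono (by rintro _ ⟨i, _, rfl⟩; exact he i)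
  have := Slow.le h hs (span K (e '' I) * span K (W : Set E) ^ m) (mul_le_mul' hle le_rfl)
    ((Finset.univ \ I).map Function.Embedding.inl) (by
      intro x hx σ hσ
      simp only [Finset.mem_map, Finset.mem_sdiff, Finset.mem_univ, true_and] at hσ
      obtain ⟨j, hj, rfl⟩ := hσ
      refine h.mul_vanish (a := 1) ?_ ?_ x hx
      · rw [pow_one]; exact hle.trans h.span_V_le
      · intro y hy
        have : span K (e '' I) ≤ LinearMap.ker (ev (Sum.inl j)) := by
          rw [span_le]
          rintro _ ⟨i, hi, rfl⟩
          change ev (Sum.inl j) (e i) = 0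
          rw [hd, if_neg]
          rintro rfl
          exact hj hi
        exact this hy)
  rw [Finset.card_map, Finset.card_sdiff_of_subset (Finset.subset_univ _), Finset.card_univ, Fintype.card_fin] at this
  have h2 := Finset.card_le_univ I
  rw [Fintype.card_fin] at h2
  omega

variable (h : Growth c W V Λ ε ev) (he : ∀ i, e i ∈ V)
    (hd : ∀ i j, ev (Sum.inl j) (e i) = if j = i then 1 else 0)
include h he hd

lemma dual_ne_zero (i : Fin c) : e i ≠ 0 := fun h0 => by
  have := hd i i
  simp [h0] at this

lemma dual_mem (i : Fin c) : e i ∈ span K (W : Set E) := subset_span (h.V_le (he i))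

lemma chain_of_slow {m r : ℕ} (hs : Slow c W V ev m r) {i j : Fin c} (hij : i ≠ j) :
    ∃ t, t ≠ 0 ∧ span K (W : Set E) ^ m = chain K t (e i / e j) (r + 2) := by
  have := h.finite_span
  have hj := dual_ne_zero h he hd j
  refine eq_chain (h.transcendental_div (dual_mem h he hd i) (dual_mem h he hd j)
    (σ := Sum.inl i) (by simp [hd]) (by simp [hd, hij]) hj) (r + 1) _ hs.rank ?_
  rw [← finrank_map_mul _ hj]
  have : FiniteDimensional K (span K (e '' ({i, j} : Finset (Fin c)))) :=
    FiniteDimensional.span_of_finite K ((Finset.finite_toSet _).image _)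
  have h2 := Slow.le_of_dual h he hd hs {i, j}
  rw [Finset.card_pair hij] at h2
  refine (finrank_mono ?_).trans h2
  rw [Submodule.map_sup, sup_le_iff]
  constructor
  · rintro _ ⟨x, hx, rfl⟩
    exact mul_mem_mul (subset_span ⟨j, by simp, rfl⟩) hx
  · rintro _ ⟨_, ⟨x, hx, rfl⟩, rfl⟩
    change e j * (e i / e j * x) ∈ _
    rw [← mul_assoc, mul_div_cancel₀ _ hj]
    exact mul_mem_mul (subset_span ⟨i, by simp, rfl⟩) hx

lemma exists_relation {i₁ i₂ i : Fin c} (h12 : i₁ ≠ i₂) (h1 : i ≠ i₁) (h2 : i ≠ i₂) :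
    ∃ a b : K, e i * (a • e i₂ + b • e i₁) = e i₁ * e i₂ := by
  have := h.finite_span
  obtain ⟨m, r, hs⟩ := h.exists_slow
  obtain ⟨t, ht, hT⟩ := chain_of_slow h he hd hs h12
  have he1 := dual_ne_zero h he hd i₁
  have he2 := dual_ne_zero h he hd i₂
  have hei := dual_ne_zero h he hd i
  have htr := h.transcendental_div (dual_mem h he hd i₁) (dual_mem h he hd i₂)
    (σ := Sum.inl i₁) (by simp [hd]) (by simp [hd, h12]) he2
  set u := e i₁ / e i₂ with hu
  have hu2 : u * e i₂ = e i₁ := div_mul_cancel₀ _ he2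
  have h3 := Slow.le_of_dual h he hd hs {i, i₁, i₂}
  have hc3 : ({i, i₁, i₂} : Finset (Fin c)).card = 3 := by
    rw [Finset.card_insert_of_notMem (by simp [h1, h2]), Finset.card_pair h12]
  rw [hc3] at h3
  set Q := span K (e '' ({i, i₁, i₂} : Finset (Fin c))) * span K (W : Set E) ^ m with hQ
  have : FiniteDimensional K (span K (e '' ({i, i₁, i₂} : Finset (Fin c)))) :=
    FiniteDimensional.span_of_finite K ((Finset.finite_toSet _).image _)
  have hmul : ∀ j ∈ ({i, i₁, i₂} : Finset (Fin c)), ∀ s < r + 2, e j * (t * u ^ s) ∈ Q := by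
    intro j hj s hs
    exact mul_mem_mul (subset_span ⟨j, by simpa using hj, rfl⟩) (hT ▸ mem_chain hs)
  have hle : chain K (e i₂ * t) u (r + 3) ≤ Q := by
    refine span_le.2 ?_
    rintro _ ⟨s, hs, rfl⟩
    change e i₂ * t * u ^ s ∈ Q
    rcases Nat.lt_or_ge s (r + 2) with h4 | h4
    · rw [mul_assoc]
      exact hmul _ (by simp) s h4
    · have : s = r + 1 + 1 := by simp at hs; omega
      rw [this, show e i₂ * t * u ^ (r + 1 + 1) = (u * e i₂) * (t * u ^ (r + 1)) by ring, hu2]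
      exact hmul _ (by simp) _ (by omega)
  obtain ⟨a, b, hab, hmem⟩ := exists_combination hle
    (h3.trans (Nat.succ_le_succ (le_finrank_chain (mul_ne_zero he2 ht) htr (r + 3))))
    (hmul i (by simp) 0 (by omega)) (hmul i (by simp) 1 (by omega))
  obtain ⟨p, hp⟩ := exists_coeff_of_mem_chain hmem
  have hZ : e i * (a • e i₂ + b • e i₁) = p 1 • (e i₁ * e i₂) := by
    refine h.relation (dual_mem h he hd i₁) (dual_mem h he hd i₂) ?_ (σ := Sum.inl i₁)
      (τ := Sum.inl i₂) (by simp [hd]) (by simp [hd, h12]) he2 (by simp [hd]) (by simp [hd, h12.symm])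
      ?_ ?_ r p ?_
    · rw [pow_two]
      exact mul_mem_mul (dual_mem h he hd i) (add_mem (smul_mem _ _ (dual_mem h he hd _))
        (smul_mem _ _ (dual_mem h he hd _)))
    · rw [h.ev_mul _ 1 1 _ (mem_pow_one (dual_mem h he hd i)) _ (mem_pow_one
        (add_mem (smul_mem _ _ (dual_mem h he hd _)) (smul_mem _ _ (dual_mem h he hd _))))]
      simp [hd, h1.symm]
    · rw [h.ev_mul _ 1 1 _ (mem_pow_one (dual_mem h he hd i)) _ (mem_pow_one
        (add_mem (smul_mem _ _ (dual_mem h he hd _)) (smul_mem _ _ (dual_mem h he hd _))))]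
      simp [hd, h2.symm]
    · have h5 : e i * (a • 1 + b • u) = ∑ s ∈ Finset.range (r + 3), p s • (e i₂ * u ^ s) := by
        apply mul_left_cancel₀ ht
        rw [Finset.mul_sum]
        calc t * (e i * (a • 1 + b • u)) = a • (e i * (t * u ^ 0)) + b • (e i * (t * u ^ 1)) := by
              simp only [Algebra.smul_def]; ring
          _ = _ := hp
          _ = _ := Finset.sum_congr rfl fun s _ => by simp only [Algebra.smul_def]; ring
      have h6 := congrArg (fun z => z * e i₂ ^ (r + 1)) h5
      simp only [Finset.sum_mul] at h6
      calc e i * (a • e i₂ + b • e i₁) * e i₂ ^ r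
          = e i * (a • 1 + b • u) * e i₂ ^ (r + 1) := by
            rw [← hu2]; simp only [Algebra.smul_def]; ring
        _ = _ := h6
        _ = _ := Finset.sum_congr rfl fun s hs => by
          have hs' : s < r + 3 := by simpa using hs
          rw [← hu2, mul_pow, mul_assoc (u ^ s), ← pow_add, show s + (r + 2 - s) = r + 2 by omega]
          simp only [Algebra.smul_def]; ring
  have hne : a • e i₂ + b • e i₁ ≠ 0 := by
    intro h0
    rcases hab with ha | hb
    · have := congrArg (ev (Sum.inl i₂)) h0
      simp [hd, h12.symm, ha] at this
    · have := congrArg (ev (Sum.inl i₁)) h0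
      simp [hd, h12, hb] at this
  have hp1 : p 1 ≠ 0 := by
    intro h0
    rw [h0, zero_smul] at hZ
    exact mul_ne_zero hei hne hZ
  refine ⟨(p 1)⁻¹ * a, (p 1)⁻¹ * b, ?_⟩
  rw [mul_smul, mul_smul, ← smul_add, mul_smul_comm, hZ, smul_smul, inv_mul_cancel₀ hp1, one_smul]

lemma dual_inr_ne_zero (τ : Fin 3) (i : Fin c) : ev (Sum.inr τ) (e i) ≠ 0 := by
  intro h0
  refine dual_ne_zero h he hd i (h.general_position (subset_span (he i))
    (insert (Sum.inr τ) ((Finset.univ.erase i).map Function.Embedding.inl)) ?_ ?_)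
  · intro σ hσ
    simp only [Finset.mem_insert, Finset.mem_map, Finset.mem_erase, Finset.mem_univ, and_true] at hσ
    rcases hσ with rfl | ⟨j, hj, rfl⟩
    · exact h0
    · change ev (Sum.inl j) (e i) = 0
      rw [hd, if_neg hj]
  · rw [Finset.card_insert_of_notMem (by simp), Finset.card_map, Finset.card_erase_of_mem (by simp)]
    simp
    omega

lemma det_ne_zero {i₁ i₂ : Fin c} (h12 : i₁ ≠ i₂) {τ τ' : Fin 3} (hτ : τ ≠ τ') :
    ev (Sum.inr τ) (e i₂) * ev (Sum.inr τ') (e i₁) - ev (Sum.inr τ') (e i₂) * ev (Sum.inr τ) (e i₁) ≠ 0 := by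
  intro h0
  set z := ev (Sum.inr τ) (e i₂) • e i₁ - ev (Sum.inr τ) (e i₁) • e i₂ with hz
  have hz0 : z = 0 := by
    refine h.general_position (sub_mem (smul_mem _ _ (subset_span (he i₁))) (smul_mem _ _ (subset_span (he i₂))))
      (insert (Sum.inr τ) (insert (Sum.inr τ') (((Finset.univ.erase i₁).erase i₂).map Function.Embedding.inl))) ?_ ?_
    · intro σ hσ
      simp only [Finset.mem_insert, Finset.mem_map, Finset.mem_erase, Finset.mem_univ, and_true] at hσ
      rcases hσ with rfl | rfl | ⟨j, hj, rfl⟩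
      · simp only [hz, map_sub, map_smul, smul_eq_mul]; ring
      · simp only [hz, map_sub, map_smul, smul_eq_mul]; linear_combination h0
      · simp [hz, hd, hj]
    · rw [Finset.card_insert_of_notMem (by simp [hτ]), Finset.card_insert_of_notMem (by simp),
        Finset.card_map, Finset.card_erase_of_mem (by simp [h12.symm]), Finset.card_erase_of_mem (by simp)]
      simp
      omega
  have := congrArg (ev (Sum.inl i₁)) hz0
  simp [hz, hd, h12] at this
  exact dual_inr_ne_zero h he hd τ i₂ this

/-- The inverses of the dual basis span a pencil over `k`. -/
lemma exists_relation_base {i₁ i₂ : Fin c} (h12 : i₁ ≠ i₂) (i : Fin c) :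
    ∃ a b : k, e i * (algebraMap k E a * e i₂ + algebraMap k E b * e i₁) = e i₁ * e i₂ := by
  by_cases h1 : i = i₁
  · exact ⟨1, 0, by simp [h1]⟩
  by_cases h2 : i = i₂
  · exact ⟨0, 1, by simp [h2, mul_comm]⟩
  obtain ⟨a, b, hab⟩ := exists_relation h he hd h12 h1 h2
  choose A hA using fun (i : Fin c) (τ : Fin 3) => h.ev_W (Sum.inr τ) (e i) (h.V_le (he i))
  have hmap := FaithfulSMul.algebraMap_injective k K
  have hA0 : ∀ i τ, A i τ ≠ 0 := fun i τ h0 => by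
    have := dual_inr_ne_zero h he hd τ i
    rw [hA, h0] at this
    simp at this
  have hD := det_ne_zero h he hd h12 (τ := 0) (τ' := 1) (by decide)
  rw [hA, hA, hA, hA] at hD
  have hτ : ∀ τ, algebraMap k K (A i τ) * (a * algebraMap k K (A i₂ τ) + b * algebraMap k K (A i₁ τ)) =
      algebraMap k K (A i₁ τ) * algebraMap k K (A i₂ τ) := by
    intro τ
    have := congrArg (ev (Sum.inr τ)) hab
    rw [h.ev_mul _ 1 1 _ (mem_pow_one (dual_mem h he hd i)) _ (mem_pow_one
        (add_mem (smul_mem _ _ (dual_mem h he hd _)) (smul_mem _ _ (dual_mem h he hd _)))),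
        h.ev_mul _ 1 1 _ (mem_pow_one (dual_mem h he hd _)) _ (mem_pow_one (dual_mem h he hd _))] at this
    simpa [hA] using this
  set w : Fin 3 → k := fun τ => A i₁ τ * A i₂ τ / A i τ with hw
  have hw' : ∀ τ, a * algebraMap k K (A i₂ τ) + b * algebraMap k K (A i₁ τ) = algebraMap k K (w τ) := by
    intro τ
    have : algebraMap k K (A i τ) ≠ 0 := fun h => hA0 i τ (hmap (by simpa using h))
    rw [hw]
    simp only [map_div₀, map_mul]
    rw [eq_div_iff this, mul_comm, hτ]
  set D : k := A i₂ 0 * A i₁ 1 - A i₂ 1 * A i₁ 0 with hDdef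
  have hD' : algebraMap k K D ≠ 0 := by simpa [hDdef] using hD
  have ha : a = algebraMap k K ((w 0 * A i₁ 1 - w 1 * A i₁ 0) / D) := by
    rw [map_div₀, eq_div_iff hD']
    simp only [hDdef, map_sub, map_mul, ← hw']
    ring
  have hb : b = algebraMap k K ((A i₂ 0 * w 1 - A i₂ 1 * w 0) / D) := by
    rw [map_div₀, eq_div_iff hD']
    simp only [hDdef, map_sub, map_mul, ← hw']
    ring
  refine ⟨(w 0 * A i₁ 1 - w 1 * A i₁ 0) / D, (A i₂ 0 * w 1 - A i₂ 1 * w 0) / D, ?_⟩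
  rw [← hab, ha, hb, Algebra.smul_def, Algebra.smul_def, ← IsScalarTower.algebraMap_apply,
    ← IsScalarTower.algebraMap_apply]

end Growth
end FieldGrowth

namespace FieldGrowth

open Submodule

namespace Growth

variable {k K E : Type} [Field k] [Field K] [Field E] [Algebra k K] [Algebra K E]
    [Algebra k E] [IsScalarTower k K E] {c : ℕ} {W V : Submodule k E} {Λ : Submodule k K} {ε : E}
    {ev : Fin c ⊕ Fin 3 → E →ₗ[K] K} {e : Fin c → E}

section
variable (h : Growth c W V Λ ε ev) (he : ∀ i, e i ∈ V)
    (hd : ∀ i j, ev (Sum.inl j) (e i) = if j = i then 1 else 0)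
include h he hd

lemma exists_pencil [Infinite k] {i₁ i₂ : Fin c} (h12 : i₁ ≠ i₂) :
    ∃ (y u : E) (mu nu : Fin c → k), (∀ i, mu i ≠ 0) ∧
      (∀ i, e i * (algebraMap k E (mu i) * y * (u - algebraMap k E (nu i))) = 1) ∧
      ∀ τ, algebraMap k K (mu i₁) * ev (Sum.inr τ) (e i₁) ≠
        algebraMap k K (mu i₂) * ev (Sum.inr τ) (e i₂) := by
  classical
  choose a b hab using exists_relation_base h he hd h12
  have hne := dual_ne_zero h he hd
  choose A hA using fun (i : Fin c) (τ : Fin 3) => h.ev_W (Sum.inr τ) (e i) (h.V_le (he i))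
  have hmap := FaithfulSMul.algebraMap_injective k K
  have hA0 : ∀ i τ, A i τ ≠ 0 := fun i τ h0 => by
    have := dual_inr_ne_zero h he hd τ i
    rw [hA, h0] at this
    simp at this
  have hsm : ∀ (x : k) (z : E) σ, ev σ (algebraMap k E x * z) = algebraMap k K x * ev σ z := by
    intro x z σ
    rw [IsScalarTower.algebraMap_apply k K E, ← Algebra.smul_def, map_smul, smul_eq_mul]
  have ha1 : a i₁ = 1 ∧ b i₁ = 0 := by
    have h1 := mul_left_cancel₀ (hne i₁) (hab i₁)
    constructor
    · have := congrArg (ev (Sum.inl i₂)) h1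
      simp only [map_add, hsm, hd, if_true, if_neg h12.symm] at this
      exact hmap (by simpa using this)
    · have := congrArg (ev (Sum.inl i₁)) h1
      simp only [map_add, hsm, hd, if_true, if_neg h12] at this
      exact hmap (by simpa using this)
  have ha2 : a i₂ = 0 ∧ b i₂ = 1 := by
    have h1 := mul_left_cancel₀ (hne i₂) ((hab i₂).trans (mul_comm _ _))
    constructor
    · have := congrArg (ev (Sum.inl i₂)) h1
      simp only [map_add, hsm, hd, if_true, if_neg h12.symm] at this
      exact hmap (by simpa using this)
    · have := congrArg (ev (Sum.inl i₁)) h1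
      simp only [map_add, hsm, hd, if_true, if_neg h12] at this
      exact hmap (by simpa using this)
  obtain ⟨α, hα⟩ := Infinite.exists_notMem_finset ((Finset.univ.image fun i => - b i / a i) ∪
    (Finset.univ.image fun τ => A i₂ τ / A i₁ τ))
  simp only [Finset.mem_union, Finset.mem_image, Finset.mem_univ, true_and, not_or, not_exists] at hα
  have hf : ∀ i, a i * α + b i ≠ 0 := by
    intro i h0
    by_cases hai : a i = 0
    · have hbi : b i = 0 := by simpa [hai] using h0
      have := hab i
      rw [hai, hbi] at this
      simp only [map_zero, zero_mul, add_zero, mul_zero] at this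
      exact mul_ne_zero (hne i₁) (hne i₂) this.symm
    · refine hα.1 i ?_
      rw [div_eq_iff hai]
      linear_combination -h0
  have hy : (e i₁)⁻¹ - algebraMap k E α * (e i₂)⁻¹ ≠ 0 := by
    intro h0
    have h1 : e i₂ = algebraMap k E α * e i₁ := by
      have := hne i₁
      have := hne i₂
      field_simp at h0
      linear_combination h0
    have := congrArg (ev (Sum.inl i₂)) h1
    rw [hsm] at this
    simp [hd, h12.symm] at this
  set y := (e i₁)⁻¹ - algebraMap k E α * (e i₂)⁻¹ with hydef
  refine ⟨y, (e i₂)⁻¹ / y, fun i => a i * α + b i, fun i => - a i / (a i * α + b i), hf, ?_, ?_⟩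
  · intro i
    have h1 : algebraMap k E (a i * α + b i) ≠ 0 := fun h => hf i ((algebraMap k E).injective (by simpa using h))
    have h2 : algebraMap k E (a i * α + b i) * y * ((e i₂)⁻¹ / y - algebraMap k E (-a i / (a i * α + b i)))
        = algebraMap k E (a i * α + b i) * (e i₂)⁻¹ + algebraMap k E (a i) * y := by
      rw [map_div₀, map_neg]
      field_simp
      ring
    rw [h2, hydef, map_add, map_mul]
    have := hab i
    have := hne i₁
    have := hne i₂
    field_simp
    linear_combination hab i
  · intro τ h0
    simp only [hA, ha1.1, ha1.2, ha2.1, ha2.2] at h0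
    rw [← map_mul, ← map_mul] at h0
    have := hmap h0
    refine hα.2 τ ?_
    rw [div_eq_iff (hA0 _ _)]
    linear_combination -this

end

lemma exists_scroll [Infinite k] (h : Growth c W V Λ ε ev) (hc : 4 ≤ c) :
    ∃ (z : ℕ → E) (lam om : Fin c ⊕ Fin 3 → k), V = span k (z '' Set.Iio c) ∧
      (∀ i j, z i * z (j + 1) = z (i + 1) * z j) ∧
      (∀ σ, ∀ j < c, ev σ (z j) = algebraMap k K (om σ * lam σ ^ j)) ∧
      Function.Injective lam ∧ ∀ σ, om σ ≠ 0 := by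
  classical
  obtain ⟨e, he, hd⟩ := h.exists_dual
  set i₁ : Fin c := ⟨0, by omega⟩
  set i₂ : Fin c := ⟨1, by omega⟩
  have h12 : i₁ ≠ i₂ := by simp [i₁, i₂]
  obtain ⟨y, u, mu, nu, hmu, hpen, htau⟩ := exists_pencil h he hd h12
  have hmap := FaithfulSMul.algebraMap_injective k K
  have hsm : ∀ (x : k) (z : E) σ, ev σ (x • z) = algebraMap k K x * ev σ z := by
    intro x z σ
    rw [← algebraMap_smul K, map_smul, smul_eq_mul]
  have hfac : ∀ i, u - algebraMap k E (nu i) ≠ 0 := fun i h0 => by simpa [h0] using hpen i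
  have hy : y ≠ 0 := fun h0 => by simpa [h0] using hpen i₁
  have hmu' : ∀ i, algebraMap k E (mu i) ≠ 0 := fun i h0 => by simpa [h0] using hpen i
  have := h.finW
  have : FiniteDimensional k V := Submodule.finiteDimensional_of_le h.V_le
  set om : E := (y * ∏ l, (u - algebraMap k E (nu l)))⁻¹ with hom
  have hprod : (∏ l, (u - algebraMap k E (nu l))) ≠ 0 := Finset.prod_ne_zero_iff.2 fun i _ => hfac i
  set z : ℕ → E := fun j => om * u ^ j with hz
  set q : Fin c → Polynomial k := fun i => ∏ l ∈ Finset.univ.erase i, (Polynomial.X - Polynomial.C (nu l)) with hq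
  have hqm : ∀ i, (q i).Monic := fun i => Polynomial.monic_prod_of_monic _ _ fun l _ => Polynomial.monic_X_sub_C _
  have hqd : ∀ i, (q i).natDegree = c - 1 := fun i => by
    rw [hq]
    simp only
    rw [Polynomial.natDegree_prod_of_monic _ _ fun l _ => Polynomial.monic_X_sub_C _]
    simp
  have hpoly : ∀ p : Polynomial k, p.natDegree < c →
      om * Polynomial.aeval u p = ∑ j ∈ Finset.range c, p.coeff j • z j := by
    intro p hp
    rw [Polynomial.aeval_eq_sum_range' hp, Finset.mul_sum]
    exact Finset.sum_congr rfl fun j _ => by rw [mul_smul_comm]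
  have he' : ∀ i, e i = (mu i)⁻¹ • ∑ j ∈ Finset.range c, (q i).coeff j • z j := by
    intro i
    rw [← hpoly _ (by rw [hqd]; omega), Algebra.smul_def, map_inv₀, hom]
    have h1 : Polynomial.aeval u (q i) * (u - algebraMap k E (nu i)) = ∏ l, (u - algebraMap k E (nu l)) := by
      rw [hq]
      simp only [map_prod, map_sub, Polynomial.aeval_X, Polynomial.aeval_C]
      exact Finset.prod_erase_mul _ _ (Finset.mem_univ i)
    have h2 := hpen i
    have h3 : e i = (algebraMap k E (mu i) * y * (u - algebraMap k E (nu i)))⁻¹ :=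
      eq_inv_of_mul_eq_one_left h2
    rw [h3, ← h1]
    have := hmu' i
    have := hfac i
    have h4 : Polynomial.aeval u (q i) ≠ 0 := fun h0 => hprod (by rw [← h1, h0, zero_mul])
    field_simp
  have hVle : V ≤ span k (z '' Set.Iio c) := by
    intro v hv
    choose a ha using fun i : Fin c => h.ev_W (Sum.inl i) v (h.V_le hv)
    have : v = ∑ i, a i • e i := by
      rw [← sub_eq_zero]
      refine h.eq_zero_of_inl (subset_span (sub_mem hv (sum_mem fun i _ => smul_mem _ _ (he i)))) fun i => ?_
      simp [ha, hsm, hd]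
    rw [this]
    refine sum_mem fun i _ => smul_mem _ _ ?_
    rw [he']
    exact smul_mem _ _ (sum_mem fun j hj => smul_mem _ _ (subset_span ⟨j, by simpa using hj, rfl⟩))
  have hrange : span k (z '' Set.Iio c) = span k (Set.range fun j : Fin c => z j) := by
    congr 1
    ext x
    constructor
    · rintro ⟨j, hj, rfl⟩; exact ⟨⟨j, hj⟩, rfl⟩
    · rintro ⟨j, rfl⟩; exact ⟨j, j.2, rfl⟩
  have hfin : FiniteDimensional k (span k (z '' Set.Iio c)) := by
    rw [hrange]; exact FiniteDimensional.span_of_finite k (Set.finite_range _)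
  have hcard := finrank_range_le_card (R := k) (fun j : Fin c => z j)
  have hVeq : V = span k (z '' Set.Iio c) := by
    refine eq_of_le_of_finrank_le hVle ?_
    rw [h.finrank_V, hrange]
    simpa [Set.finrank] using hcard
  have hli : LinearIndependent k (fun j : Fin c => z j) := by
    rw [linearIndependent_iff_card_eq_finrank_span]
    rw [Set.finrank, ← hrange, ← hVeq, h.finrank_V, Fintype.card_fin]
  have hzV : ∀ j < c, z j ∈ V := fun j hj => hVeq ▸ subset_span ⟨j, hj, rfl⟩
  have hrel : ∀ i j, z i * z (j + 1) = z (i + 1) * z j := fun i j => by rw [hz]; ring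
  choose A hA using fun (σ : Fin c ⊕ Fin 3) (j : Fin c) => h.ev_W σ (z j) (h.V_le (hzV j j.2))
  set B : Fin c ⊕ Fin 3 → ℕ → k := fun σ j => if hj : j < c then A σ ⟨j, hj⟩ else 0 with hBdef
  have hB : ∀ σ, ∀ j < c, ev σ (z j) = algebraMap k K (B σ j) := fun σ j hj => by
    rw [hBdef]; simp only [hj, dif_pos]; exact hA σ ⟨j, hj⟩
  have hmem : ∀ j < c, z j ∈ span K (W : Set E) ^ 1 := fun j hj =>
    mem_pow_one (subset_span (h.V_le (hzV j hj)))
  have hBrel : ∀ σ i j, i + 1 < c → j + 1 < c → B σ i * B σ (j + 1) = B σ (i + 1) * B σ j := by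
    intro σ i j hi hj
    have := congrArg (ev σ) (hrel i j)
    rw [h.ev_mul σ 1 1 _ (hmem i (by omega)) _ (hmem _ hj), h.ev_mul σ 1 1 _ (hmem _ hi) _ (hmem j (by omega)),
      hB _ _ (by omega), hB _ _ (by omega), hB _ _ (by omega), hB _ _ (by omega), ← map_mul, ← map_mul] at this
    exact hmap this
  have hB0 : ∀ σ, B σ 0 ≠ 0 := by
    intro σ h0
    have h1 : ∀ j, j + 1 < c → B σ j = 0 := by
      intro j
      induction j with
      | zero => exact fun _ => h0
      | succ j ih =>
        intro hj
        have := hBrel σ j (j + 1) (by omega) (by omega)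
        rw [ih (by omega), zero_mul] at this
        exact mul_self_eq_zero.1 this.symm
    have h2 : ∀ i, algebraMap k K (mu i) * ev σ (e i) = algebraMap k K (B σ (c - 1)) := by
      intro i
      rw [he', hsm, ← mul_assoc, ← map_mul, mul_inv_cancel₀ (hmu i), map_one, one_mul, map_sum,
        Finset.sum_eq_single (c - 1)]
      · rw [hsm, hB _ _ (by omega)]
        have : (q i).coeff (c - 1) = 1 := by
          rw [← hqd i]; exact (hqm i).coeff_natDegree
        rw [this, map_one, one_mul]
      · intro j hj hj'
        rw [Finset.mem_range] at hj
        rw [hsm, hB _ _ hj, h1 j (by omega), map_zero, mul_zero]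
      · intro hcc; exact absurd (Finset.mem_range.2 (by omega)) hcc
    have h3 := (h2 i₁).trans (h2 i₂).symm
    rcases σ with i | τ
    · by_cases hi : i = i₁
      · rw [hi, hd, hd, if_pos rfl, if_neg h12, mul_one, mul_zero] at h3
        exact hmu i₁ (hmap (by simpa using h3))
      · have h4 := (h2 i).trans (h2 i₁).symm
        rw [hd, hd, if_pos rfl, if_neg hi, mul_one, mul_zero] at h4
        exact hmu i (hmap (by simpa using h4))
    · exact htau τ h3
  have hBpow : ∀ σ, ∀ j < c, B σ j = B σ 0 * (B σ 1 / B σ 0) ^ j := by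
    intro σ j
    induction j with
    | zero => simp
    | succ j ih =>
      intro hj
      have h1 := hBrel σ j 0 hj (by omega)
      rw [pow_succ, ← mul_assoc, ← ih (by omega), mul_div_assoc', eq_div_iff (hB0 σ)]
      simpa using h1.symm
  refine ⟨z, fun σ => B σ 1 / B σ 0, fun σ => B σ 0, hVeq, hrel, fun σ j hj => ?_, ?_, hB0⟩
  · rw [hB σ j hj, hBpow σ j hj]
  · intro σ τ hst
    by_contra hne
    obtain ⟨s, hs1, hs2⟩ := Finset.exists_subsuperset_card_eq (Finset.subset_univ ({σ, τ} : Finset (Fin c ⊕ Fin 3)))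
      (n := c) (by rw [Finset.card_pair hne]; omega) (by simp)
    have hs3 := hs2.2
    have hs2 := hs2.1
    have hτs : τ ∈ s := hs1 (by simp)
    have hσs : σ ∈ s := hs1 (by simp)
    set p : Polynomial k := ∏ ρ ∈ s.erase τ, (Polynomial.X - Polynomial.C (B ρ 1 / B ρ 0)) with hp
    have hpm : p.Monic := Polynomial.monic_prod_of_monic _ _ fun l _ => Polynomial.monic_X_sub_C _
    have hpd : p.natDegree = c - 1 := by
      rw [hp, Polynomial.natDegree_prod_of_monic _ _ fun l _ => Polynomial.monic_X_sub_C _]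
      simp [Finset.card_erase_of_mem hτs, hs3]
    have h0 : ∑ j ∈ Finset.range c, p.coeff j • z j = 0 := by
      refine h.general_position (s := s) ?_ ?_ hs3.ge
      · exact sum_mem fun j hj => by
          rw [← algebraMap_smul K]
          exact smul_mem _ _ (subset_span (hzV j (by simpa using hj)))
      · intro ρ hρ
        have : ev ρ (∑ j ∈ Finset.range c, p.coeff j • z j) = algebraMap k K (B ρ 0 * p.eval (B ρ 1 / B ρ 0)) := by
          rw [map_sum, Polynomial.eval_eq_sum_range' (n := c) (by omega), Finset.mul_sum, map_sum]
          refine Finset.sum_congr rfl fun j hj => ?_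
          have hj := Finset.mem_range.1 hj
          rw [hsm, hB ρ j hj, hBpow ρ j hj, ← map_mul]
          congr 1; ring
        rw [this]
        have : p.eval (B ρ 1 / B ρ 0) = 0 := by
          rw [hp, Polynomial.eval_prod]
          by_cases hρτ : ρ = τ
          · refine Finset.prod_eq_zero (Finset.mem_erase.2 ⟨hne, hσs⟩) ?_
            simp [hρτ, hst]
          · exact Finset.prod_eq_zero (Finset.mem_erase.2 ⟨hρτ, hρ⟩) (by simp)
        rw [this, mul_zero, map_zero]
    rw [← Fin.sum_univ_eq_sum_range (fun j => p.coeff j • z j)] at h0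
    have h1 := Fintype.linearIndependent_iff.1 hli (fun j => p.coeff j) h0 ⟨c - 1, by omega⟩
    simp only [] at h1
    rw [← hpd, hpm.coeff_natDegree] at h1
    exact one_ne_zero h1

end Growth
end FieldGrowth

namespace FieldGrowth

open Submodule

namespace Growth

variable {k K E : Type} [Field k] [Field K] [Field E] [Algebra k K] [Algebra K E]
    [Algebra k E] [IsScalarTower k K E] {c : ℕ} {W V : Submodule k E} {Λ : Submodule k K} {ε : E}
    {ev : Fin c ⊕ Fin 3 → E →ₗ[K] K}

/-- A good degree in which the powers of `W` form a chain. -/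
lemma exists_chain (h : Growth c W V Λ ε ev) (hc : 2 ≤ c) :
    ∃ m r t u, Slow c W V ev m r ∧ t ≠ 0 ∧ Transcendental K u ∧
      span K (W : Set E) ^ m = chain K t u (r + 2) := by
  obtain ⟨e, he, hd⟩ := h.exists_dual
  obtain ⟨m, r, hs⟩ := h.exists_slow
  have h12 : (⟨0, by omega⟩ : Fin c) ≠ ⟨1, by omega⟩ := by simp
  obtain ⟨t, ht, hT⟩ := chain_of_slow h he hd hs h12
  have hv := (hd ⟨1, by omega⟩ ⟨0, by omega⟩).trans (if_neg h12)
  exact ⟨m, r, t, _, hs, ht, h.transcendental_div (dual_mem h he hd _) (dual_mem h he hd _)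
    (σ := Sum.inl ⟨0, by omega⟩) (by simp [hd]) hv (dual_ne_zero h he hd ⟨1, by omega⟩), hT⟩

/-- Elements of `span W` vanishing at all the points are multiples of `ε`. -/
lemma exists_smul_eps (h : Growth c W V Λ ε ev) (hc : 2 ≤ c) {x : E}
    (hx : x ∈ span K (W : Set E)) (h0 : ∀ σ, ev σ x = 0) : ∃ a : K, x = a • ε := by
  obtain ⟨m, r, t, u, hs, ht, hu, hT⟩ := h.exists_chain hc
  have := h.finite_span
  set Q : Submodule K E := span K {ε, x} with hQ
  have hQW : Q ≤ span K (W : Set E) := by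
    rw [hQ, span_le]
    rintro y (rfl | rfl)
    · exact h.eps_mem
    · exact hx
  have : FiniteDimensional K Q := Submodule.finiteDimensional_of_le hQW
  have hQ0 : ∀ σ, ∀ y ∈ Q, ev σ y = 0 := by
    intro σ y hy
    have : Q ≤ LinearMap.ker (ev σ) := by
      rw [hQ, span_le]
      rintro y (rfl | rfl)
      · exact h.ev_eps σ
      · exact h0 σ
    exact this hy
  have hεQ : ε ∈ Q := subset_span (by simp)
  have hle : Q * span K (W : Set E) ^ m ≤ span K (W : Set E) ^ (m + 1) := by
    rw [pow_succ']; exact mul_le_mul' hQW le_rfl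
  have h1 := finrank_add_card_le ev (span K (W : Set E) ^ (m + 1)) (Q * span K (W : Set E) ^ m) hle
    Finset.univ (Slow.surj_succ h hs) (fun y hy σ _ => h.mul_vanish (a := 1) (by rwa [pow_one]) (hQ0 σ) y hy)
  have h2 := finrank_mul_chain ht hu (r + 1) Q (fun hb => h.eps_ne (by rw [hb] at hεQ; exact hεQ))
  rw [← hT] at h2
  have h3 := hs.one
  simp only [Finset.card_univ, Fintype.card_sum, Fintype.card_fin] at h1
  have h4 : Module.finrank K Q ≤ 1 := by omega
  have h5 : span K {ε} = Q := by
    refine eq_of_le_of_finrank_le (span_mono (by simp)) ?_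
    rwa [finrank_span_singleton h.eps_ne]
  have h6 : x ∈ span K {ε} := h5 ▸ subset_span (by simp)
  obtain ⟨a, ha⟩ := mem_span_singleton.1 h6
  exact ⟨a, ha.symm⟩

/-- No element of `V` takes the value one at all the points. -/
lemma not_ev_eq_one (h : Growth c W V Λ ε ev) (hc : 2 ≤ c) {v : E} (hv : v ∈ V) :
    ¬ ∀ σ, ev σ v = 1 := by
  intro h1
  have hvW : v - 1 ∈ W := sub_mem (h.V_le hv) h.one_mem
  obtain ⟨a, ha⟩ := h.exists_smul_eps hc (subset_span hvW) (fun σ => by rw [map_sub, h1, h.ev_one, sub_self])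
  have hmem := h.eps_mul 0 (algebraMap K E a) (by
    rw [pow_zero]; exact algebraMap_mem a) (by
    rw [zero_add, pow_one]
    rwa [mul_comm, ← Algebra.smul_def, ← ha])
  have h2 : ∀ σ, ev σ (algebraMap K E a) = a := fun σ => by
    rw [Algebra.algebraMap_eq_smul_one, map_smul, h.ev_one, smul_eq_mul, mul_one]
  have h3 := hmem (Sum.inr 0)
  rw [h2] at h3
  exact h.eps_indep v hv a h3 (by rw [ha, Algebra.smul_def, mul_comm])

/-- Elements of `span V * span W` vanishing at all the points are multiples of `ε`. -/
lemma exists_eps_mul (h : Growth c W V Λ ε ev) (hc : 2 ≤ c) {x : E}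
    (hx : x ∈ span K (V : Set E) * span K (W : Set E)) (h0 : ∀ σ, ev σ x = 0) :
    ∃ y ∈ span K (V : Set E), x = ε * y := by
  obtain ⟨m, r, t, u, hs, ht, hu, hT⟩ := h.exists_chain hc
  have := h.finite_span
  have := h.finite_span_V
  set P : Submodule K E := (span K (V : Set E)).map (LinearMap.mulLeft K ε) with hP
  set Q : Submodule K E := P ⊔ span K {x} with hQ
  have hPVW : P ≤ span K (V : Set E) * span K (W : Set E) := by
    rintro _ ⟨y, hy, rfl⟩
    rw [mul_comm (span K (V : Set E))]
    exact mul_mem_mul h.eps_mem hy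
  have hQVW : Q ≤ span K (V : Set E) * span K (W : Set E) := by
    rw [hQ, sup_le_iff]
    exact ⟨hPVW, by rwa [span_singleton_le_iff_mem]⟩
  have hVWW : span K (V : Set E) * span K (W : Set E) ≤ span K (W : Set E) ^ 2 := by
    rw [pow_two]; exact mul_le_mul' h.span_V_le le_rfl
  have : FiniteDimensional K Q := Submodule.finiteDimensional_of_le hQVW
  have hQ0 : ∀ σ, ∀ y ∈ Q, ev σ y = 0 := by
    intro σ y hy
    have : Q ≤ LinearMap.ker (ev σ) := by
      rw [hQ, sup_le_iff, span_singleton_le_iff_mem]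
      refine ⟨?_, h0 σ⟩
      rintro _ ⟨y, hy, rfl⟩
      change ev σ (ε * y) = 0
      rw [h.ev_mul σ 1 1 _ (mem_pow_one h.eps_mem) _ (mem_pow_one (h.span_V_le hy)), h.ev_eps, zero_mul]
    exact this hy
  have hle : Q * span K (W : Set E) ^ m ≤ span K (V : Set E) * span K (W : Set E) ^ (m + 1) := by
    rw [pow_succ', ← mul_assoc]; exact mul_le_mul' hQVW le_rfl
  have h1 := finrank_add_card_le ev (span K (V : Set E) * span K (W : Set E) ^ (m + 1))
    (Q * span K (W : Set E) ^ m) hle Finset.univ (h.surj_V (Slow.surj_succ h hs))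
    (fun y hy σ _ => h.mul_vanish (a := 2) (hQVW.trans hVWW) (hQ0 σ) y hy)
  have hV : Module.finrank K (span K (V : Set E)) = Module.finrank K P := (finrank_map_mul ε h.eps_ne _).symm
  have hcV : c ≤ Module.finrank K (span K (V : Set E)) := by
    obtain ⟨e, he, hd⟩ := h.exists_dual
    have hli : LinearIndependent K (fun i : Fin c => (⟨e i, subset_span (he i)⟩ : span K (V : Set E))) := by
      rw [Fintype.linearIndependent_iff]
      intro g hg i
      have := congrArg (fun w : span K (V : Set E) => ev (Sum.inl i) w) hg
      simpa [hd, AddSubmonoidClass.coe_finsetSum] using this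
    simpa using hli.fintype_card_le_finrank
  have hQb : Q ≠ ⊥ := by
    intro hb
    have h2 : P = ⊥ := by
      rw [eq_bot_iff, ← hb]; exact le_sup_left
    rw [h2, finrank_bot] at hV
    omega
  have h2 := finrank_mul_chain ht hu (r + 1) Q hQb
  rw [← hT] at h2
  have h3 := hs.V_two
  simp only [Finset.card_univ, Fintype.card_sum, Fintype.card_fin] at h1
  have h5 : P = Q := eq_of_le_of_finrank_le le_sup_left (by omega)
  have h6 : x ∈ P := h5 ▸ (le_sup_right (a := P) (b := span K {x})) (mem_span_singleton_self x)
  obtain ⟨y, hy, hxy⟩ := h6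
  exact ⟨y, hy, hxy.symm⟩

lemma mem_eps_smul (h : Growth c W V Λ ε ev) (hc : 2 ≤ c) {x : E}
    (hx : x ∈ V * W) (h0 : ∀ σ, ev σ x = 0) :
    x ∈ span k {y | ∃ a ∈ Λ, ∃ v ∈ V, y = ε * (algebraMap K E a * v)} := by
  obtain ⟨e, he, hd⟩ := h.exists_dual
  have hx' : x ∈ span K (V : Set E) * span K (W : Set E) := by
    refine Submodule.mul_induction_on hx (fun v hv w hw => ?_) fun y z hy hz => add_mem hy hz
    exact mul_mem_mul (subset_span hv) (subset_span hw)
  obtain ⟨y, hy, rfl⟩ := h.exists_eps_mul hc hx' h0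
  have hΛ : ∀ σ, ev σ y ∈ Λ := by
    refine h.eps_mul 1 y ?_ ?_
    · rw [pow_one]; exact h.span_V_le hy
    · rw [pow_two]; exact mul_le_mul' h.V_le le_rfl hx
  have hsum : y = ∑ i, ev (Sum.inl i) y • e i := by
    rw [← sub_eq_zero]
    refine h.eq_zero_of_inl (sub_mem hy (sum_mem fun i _ => smul_mem _ _ (subset_span (he i)))) fun i => ?_
    simp [hd]
  rw [hsum, Finset.mul_sum]
  refine sum_mem fun i _ => subset_span ⟨_, hΛ (Sum.inl i), e i, he i, ?_⟩
  rw [Algebra.smul_def]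

end Growth
end FieldGrowth

/-- Coordinates adapted to a variety with prime ideal `P` of degree `c + 3` and a linear space with
ideal `J`. -/
structure Frame {k ι : Type} [Field k] [Fintype ι] [DecidableEq ι] (n c N : ℕ)
    (P J : Ideal (MvPolynomial ι k)) (ell : Fin (n + 1) → MvPolynomial ι k)
    (kap : MvPolynomial ι k →ₐ[k] MvPolynomial (Fin (n + 1)) k)
    (theta : MvPolynomial ι k) (r : MvPolynomial (Fin (n + 1)) k)
    (zeta : Fin c ⊕ Fin 3 → ι → k) : Prop where
  ell_hom : ∀ i, (ell i).IsHomogeneous 1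
  prime : P.IsPrime
  hom : ∀ f ∈ P, ∀ m, homogeneousComponent m f ∈ P
  P_one : ∀ f ∈ P, f.IsHomogeneous 1 → f = 0
  card_eq : Fintype.card ι = n + c + 1
  kap_ell : ∀ i, kap (ell i) = X i
  kap_hom : ∀ i, (kap (X i)).IsHomogeneous 1
  mem_J : ∀ f, f ∈ J ↔ kap f = 0
  zeta_P : ∀ σ, ∀ f ∈ P, eval (zeta σ) f = 0
  zeta_ell : ∀ σ i, eval (zeta σ) (ell i) = if i = 0 then 1 else 0
  zeta_theta : Function.Injective fun σ => eval (zeta σ) theta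
  theta_hom : theta.IsHomogeneous 1
  r_hom : r.IsHomogeneous N
  r_ne : eval (Pi.single 0 1) r ≠ 0
  le_N : c + 3 ≤ N
  red : ∀ m G, G.IsHomogeneous m → ∃ lam : ℕ → MvPolynomial (Fin (n + 1)) k,
    (∀ i < c + 3, (lam i).IsHomogeneous (N + m - i)) ∧
      aeval ell r * G - ∑ i ∈ Finset.range (c + 3), aeval ell (lam i) * theta ^ i ∈ P
  free : ∀ lam : ℕ → MvPolynomial (Fin (n + 1)) k,
    ∑ i ∈ Finset.range (c + 3), aeval ell (lam i) * theta ^ i ∈ P → ∀ i < c + 3, lam i = 0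
  psi : ∃ s, ∃ f : MvPolynomial (Fin (n + 1)) k, f.IsHomogeneous s ∧ eval (Pi.single 0 1) f ≠ 0 ∧ aeval ell f ∈ P ⊔ J
  quartic : ∀ᶠ m in Filter.atTop,
    Module.finrank k (idealPiece k (Fin (n + 1)) ((P ⊔ J).comap (aeval ell)) m) =
      Nat.choose (m - 4 + n) n

namespace Forms

section
variable {k ι κ : Type} [Field k] {n : ℕ}

lemma isHomogeneous_aeval {f : MvPolynomial κ k} {m : ℕ} (hf : f.IsHomogeneous m)
    {ell : κ → MvPolynomial ι k} (h : ∀ i, (ell i).IsHomogeneous 1) :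
    (aeval ell f).IsHomogeneous m := by
  have := hf.aeval ell h
  simpa using this

lemma isHomogeneous_algHom {f : MvPolynomial κ k} {m : ℕ} (hf : f.IsHomogeneous m)
    (φ : MvPolynomial κ k →ₐ[k] MvPolynomial ι k) (h : ∀ i, (φ (X i)).IsHomogeneous 1) :
    (φ f).IsHomogeneous m := by
  rw [aeval_unique φ]
  exact isHomogeneous_aeval hf h

lemma sum_reduction {A α : Type} [CommRing A] (s : Finset α) (I : Finset ℕ) (r θ : A) (g G : α → A)
    (l : α → ℕ → A) : ∑ i ∈ I, (∑ a ∈ s, g a * l a i) * θ ^ i =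
      r * (∑ a ∈ s, g a * G a) - ∑ a ∈ s, g a * (r * G a - ∑ i ∈ I, l a i * θ ^ i) := by
  simp only [mul_sub, Finset.sum_sub_distrib, Finset.mul_sum, Finset.sum_mul]
  rw [Finset.sum_comm, eq_sub_iff_add_eq, add_comm, ← eq_sub_iff_add_eq, sub_eq_sub_iff_add_eq_add]
  congr 1
  · exact Finset.sum_congr rfl fun a _ => by ring
  · exact Finset.sum_congr rfl fun a _ => Finset.sum_congr rfl fun a _ => by ring

lemma finSuccEquiv_rename_succ (g : MvPolynomial (Fin n) k) :
    finSuccEquiv k n (rename Fin.succ g) = Polynomial.C g := by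
  induction g using MvPolynomial.induction_on with
  | C a =>
    rw [rename_C]
    exact ((finSuccEquiv k n).symm_apply_eq.1 (RingHom.congr_fun (finSuccEquiv_comp_C_eq_C n) a)).symm
  | add p q hp hq => rw [map_add, map_add, map_add, hp, hq]
  | mul_X p i hp => rw [map_mul, map_mul, map_mul, hp, rename_X, finSuccEquiv_X_succ]

lemma finSuccEquiv_coeff_top {f : MvPolynomial (Fin (n + 1)) k} {m : ℕ} (hf : f.IsHomogeneous m) :
    (finSuccEquiv k n f).coeff m = C (eval (Pi.single 0 1) f) := by
  have h1 : ((finSuccEquiv k n f).coeff m).IsHomogeneous 0 := hf.finSuccEquiv_coeff_isHomogeneous m 0 (by simp)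
  have h2 : (finSuccEquiv k n f).coeff m = C (coeff 0 ((finSuccEquiv k n f).coeff m)) :=
    (totalDegree_eq_zero_iff_eq_C).1 (Nat.le_zero.1 (IsHomogeneous.totalDegree_le h1))
  rw [h2]
  congr 1
  rw [finSuccEquiv_coeff_coeff, eval_eq]
  rw [Finset.sum_eq_single (Finsupp.cons m 0)]
  · rw [Finset.prod_eq_one, mul_one]
    intro i _
    refine Fin.cases ?_ (fun i => ?_) i <;> simp
  · intro d hd hne
    have hdeg := hf (mem_support_iff.1 hd)
    have : ∃ i : Fin n, d i.succ ≠ 0 := by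
      by_contra! hall
      apply hne
      have hd' : d = Finsupp.cons (d 0) 0 := by
        ext i
        refine Fin.cases ?_ (fun i => ?_) i <;> simp [hall]
      rw [hd'] at hdeg ⊢
      congr 1
      rw [Finsupp.weight_apply, Finsupp.sum_fintype _ _ (by simp), Fin.sum_univ_succ] at hdeg
      simpa using hdeg
    obtain ⟨i, hi⟩ := this
    rw [Finset.prod_eq_zero (Finsupp.mem_support_iff.2 hi), mul_zero]
    rw [Pi.single_eq_of_ne (Fin.succ_ne_zero i), zero_pow hi]
  · intro h
    rw [notMem_support_iff.1 h, zero_mul]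

end
end Forms

namespace Frame

variable {k ι : Type} [Field k] [Fintype ι] [DecidableEq ι] {n c N : ℕ}
    {P J : Ideal (MvPolynomial ι k)} {ell : Fin (n + 1) → MvPolynomial ι k}
    {kap : MvPolynomial ι k →ₐ[k] MvPolynomial (Fin (n + 1)) k}
    {theta : MvPolynomial ι k} {r : MvPolynomial (Fin (n + 1)) k}
    {zeta : Fin c ⊕ Fin 3 → ι → k}

lemma kap_aeval (F : Frame n c N P J ell kap theta r zeta) (f : MvPolynomial (Fin (n + 1)) k) :
    kap (aeval ell f) = f := by
  have : kap.comp (aeval ell) = AlgHom.id k _ := by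
    ext i; simp [F.kap_ell]
  exact DFunLike.congr_fun this f

lemma sub_mem_J (F : Frame n c N P J ell kap theta r zeta) (f : MvPolynomial ι k) :
    f - aeval ell (kap f) ∈ J := by
  rw [F.mem_J, map_sub, F.kap_aeval, sub_self]

lemma kap_homogeneous (F : Frame n c N P J ell kap theta r zeta) {f : MvPolynomial ι k} {m : ℕ}
    (hf : f.IsHomogeneous m) : (kap f).IsHomogeneous m := Forms.isHomogeneous_algHom hf kap F.kap_hom

lemma aeval_homogeneous (F : Frame n c N P J ell kap theta r zeta) {f : MvPolynomial (Fin (n + 1)) k}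
    {m : ℕ} (hf : f.IsHomogeneous m) : (aeval ell f).IsHomogeneous m := Forms.isHomogeneous_aeval hf F.ell_hom

lemma eval_zeta_aeval (F : Frame n c N P J ell kap theta r zeta) (σ) (f : MvPolynomial (Fin (n + 1)) k) :
    eval (zeta σ) (aeval ell f) = eval (Pi.single 0 1) f := by
  have : (aeval (R := k) (zeta σ)).comp (aeval ell) = aeval (R := k) (Pi.single 0 1 : Fin (n + 1) → k) := by
    ext i
    have := F.zeta_ell σ i
    rw [← coe_aeval_eq_eval] at this
    simp only [AlgHom.comp_apply, aeval_X]
    exact this.trans (by rw [Pi.single_apply])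
  have := DFunLike.congr_fun this f
  simpa [coe_aeval_eq_eval] using this

lemma coeff_relation (F : Frame n c N P J ell kap theta r zeta) {α : Type} (s : Finset α)
    (g : α → MvPolynomial (Fin n) k) (lam : α → ℕ → MvPolynomial (Fin (n + 1)) k)
    (G : α → MvPolynomial ι k)
    (hlam : ∀ a ∈ s, aeval ell r * G a - ∑ i ∈ Finset.range (c + 3), aeval ell (lam a i) * theta ^ i ∈ P)
    (hG : ∑ a ∈ s, aeval (fun i => ell i.succ) (g a) * G a ∈ P) :
    ∀ i < c + 3, ∀ t, ∑ a ∈ s, g a * (finSuccEquiv k n (lam a i)).coeff t = 0 := by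
  have hren : ∀ f : MvPolynomial (Fin n) k, aeval (fun i => ell i.succ) f = aeval ell (rename Fin.succ f) := by
    intro f; rw [aeval_rename]; rfl
  have h1 : ∑ i ∈ Finset.range (c + 3), aeval ell (∑ a ∈ s, rename Fin.succ (g a) * lam a i) * theta ^ i ∈ P := by
    simp only [map_sum, map_mul]
    rw [Forms.sum_reduction s _ (aeval ell r) theta _ G fun a i => aeval ell (lam a i)]
    simp only [hren] at hG
    exact sub_mem (Ideal.mul_mem_left _ _ hG) (sum_mem fun a ha => Ideal.mul_mem_left _ _ (hlam a ha))
  intro i hi t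
  have h3 := F.free _ h1 i hi
  have h4 := congrArg (fun f => (finSuccEquiv k n f).coeff t) h3
  simpa [map_sum, map_mul, Forms.finSuccEquiv_rename_succ, Polynomial.finsetSum_coeff, Polynomial.coeff_C_mul] using h4

end Frame

namespace Forms

section
variable (k : Type) [Field k]

instance finite_homogeneousSubmodule (ι : Type) [Finite ι] (m : ℕ) :
    Module.Finite k (homogeneousSubmodule ι k m) := by
  cases nonempty_fintype ι
  classical
  rw [homogeneousSubmodule_eq_finsupp_supported]
  have : Finite {d : ι →₀ ℕ | d.degree = m} := by
    refine Set.Finite.to_subtype (Set.Finite.subset (Finset.finite_toSet ((Finset.univ : Finset ι).finsuppAntidiag m)) ?_)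
    intro d hd
    rw [Finset.mem_coe, Finset.mem_finsuppAntidiag]
    exact ⟨by rw [← hd, Finsupp.degree_eq_sum], Finset.subset_univ _⟩
  exact Module.Finite.equiv (AddMonoidAlgebra.supportedEquivFinsupp _).symm

lemma finrank_homogeneousSubmodule (n m : ℕ) :
    Module.finrank k (homogeneousSubmodule (Fin (n + 1)) k m) = (m + n).choose n := by
  rw [homogeneousSubmodule_eq_finsupp_supported,
    (AddMonoidAlgebra.supportedEquivFinsupp (R := k) (S := k) {d : Fin (n + 1) →₀ ℕ | d.degree = m}).finrank_eq]
  have h : {d : Fin (n + 1) →₀ ℕ | d.degree = m} = ↑((Finset.univ : Finset (Fin (n + 1))).finsuppAntidiag m) := by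
    ext d
    simp [Finset.mem_finsuppAntidiag, Finsupp.degree_eq_sum]
  rw [h, Module.finrank_finsupp_self]
  erw [Fintype.card_coe]
  rw [Finset.card_finsuppAntidiag_nat_eq_choose]
  simp only [Finset.card_univ, Fintype.card_fin]
  rw [show n + 1 + m - 1 = m + n by omega, Nat.choose_symm_add]

end

lemma tendsto_choose (p a : ℕ) :
    Filter.Tendsto (fun m : ℕ => ((m + a).choose p : ℝ) / (m : ℝ) ^ p) Filter.atTop
      (nhds (1 / (p.factorial : ℝ))) := by
  have h1 : Filter.Tendsto (fun n : ℕ => (n.choose p : ℝ) / (n : ℝ) ^ p) Filter.atTop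
      (nhds (1 / (p.factorial : ℝ))) := by
    have h := isEquivalent_choose p
    rw [Asymptotics.isEquivalent_iff_tendsto_one] at h
    · have := h.mul_const (1 / (p.factorial : ℝ))
      rw [one_mul] at this
      refine this.congr fun n => ?_
      have : (p.factorial : ℝ) ≠ 0 := Nat.cast_ne_zero.2 p.factorial_ne_zero
      simp only [Pi.div_apply]
      field_simp
    · filter_upwards [Filter.eventually_gt_atTop 0] with n hn
      have : (p.factorial : ℝ) ≠ 0 := Nat.cast_ne_zero.2 p.factorial_ne_zero
      positivity
  have h2 : Filter.Tendsto (fun m : ℕ => (((m + a : ℕ) : ℝ) / (m : ℝ)) ^ p) Filter.atTop (nhds 1) := by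
    have : Filter.Tendsto (fun m : ℕ => (((m + a : ℕ) : ℝ) / (m : ℝ))) Filter.atTop (nhds 1) := by
      have h3 : Filter.Tendsto (fun m : ℕ => 1 + (a : ℝ) / (m : ℝ)) Filter.atTop (nhds (1 + 0)) :=
        tendsto_const_nhds.add (tendsto_const_div_atTop_nhds_zero_nat (a : ℝ))
      rw [add_zero] at h3
      refine h3.congr' ?_
      filter_upwards [Filter.eventually_gt_atTop 0] with n hn
      have : (n : ℝ) ≠ 0 := by positivity
      push_cast
      field_simp
    simpa using this.pow p
  have h4 := ((h1.comp (Filter.tendsto_add_atTop_nat a)).mul h2)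
  rw [mul_one] at h4
  refine h4.congr' ?_
  filter_upwards [Filter.eventually_gt_atTop 0] with n hn
  have : (n : ℝ) ≠ 0 := by positivity
  have : ((n + a : ℕ) : ℝ) ≠ 0 := by positivity
  simp only [Function.comp]
  rw [div_pow]
  field_simp

lemma eventually_choose_lt (p t q : ℕ) :
    ∀ᶠ m : ℕ in Filter.atTop, t * (m + q + p).choose p < (t + 1) * (m + p).choose p := by
  have h1 := (tendsto_choose p (q + p)).const_mul (t : ℝ)
  have h2 := (tendsto_choose p p).const_mul ((t : ℝ) + 1)
  have hp : (0 : ℝ) < 1 / (p.factorial : ℝ) := by positivity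
  have hlt : (t : ℝ) * (1 / (p.factorial : ℝ)) < ((t : ℝ) + 1) * (1 / (p.factorial : ℝ)) := by linarith
  filter_upwards [h1.eventually_lt h2 hlt, Filter.eventually_gt_atTop 0] with m hm h0
  have hm0 : (0 : ℝ) < (m : ℝ) ^ p := by positivity
  rw [mul_div_assoc', mul_div_assoc', div_lt_div_iff_of_pos_right hm0] at hm
  rw [add_assoc]
  exact_mod_cast hm

lemma choose_telescope (p M t : ℕ) : (M + t + (p + 1)).choose (p + 1) =
    (M + (p + 1)).choose (p + 1) + ∑ j ∈ Finset.range t, (M + j + 1 + p).choose p := by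
  induction t with
  | zero => simp
  | succ t ih =>
    have h := Nat.choose_succ_succ' (M + t + (p + 1)) p
    rw [Finset.sum_range_succ, show M + (t + 1) + (p + 1) = M + t + (p + 1) + 1 by ring, h, ih,
      show M + t + 1 + p = M + t + (p + 1) by ring]
    ring

section
variable {k : Type} [Field k] {n : ℕ}

instance finite_idealPiece {ι : Type} [Fintype ι] [DecidableEq ι] (I : Ideal (MvPolynomial ι k)) (m : ℕ) :
    Module.Finite k (idealPiece k ι I m) := by
  have : Module.Finite k (homogeneousSubmodule ι k m) := inferInstance
  exact Submodule.finiteDimensional_of_le (S₂ := homogeneousSubmodule ι k m) inf_le_right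

/-- An ideal whose Hilbert function is that of a quartic hypersurface contains no nonzero form of degree at most three. -/
lemma eq_zero_of_degree_le (hn : 1 ≤ n) (B : Ideal (MvPolynomial (Fin (n + 1)) k))
    (hB : ∀ᶠ m in Filter.atTop, Module.finrank k (idealPiece k (Fin (n + 1)) B m) = Nat.choose (m - 4 + n) n)
    {i : ℕ} (hi : i ≤ 3) {f : MvPolynomial (Fin (n + 1)) k} (hf : f.IsHomogeneous i) (hfB : f ∈ B) : f = 0 := by
  by_contra h0
  obtain ⟨m, hm, hm4⟩ := (hB.and (Filter.eventually_ge_atTop 4)).exists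
  let φ : homogeneousSubmodule (Fin (n + 1)) k (m - i) →ₗ[k] idealPiece k (Fin (n + 1)) B m :=
    LinearMap.codRestrict _ ((LinearMap.mulLeft k f).comp (Submodule.subtype _)) (by
      rintro ⟨g, hg⟩
      refine ⟨Ideal.mul_mem_right _ _ hfB, ?_⟩
      have : (f * g).IsHomogeneous (i + (m - i)) := hf.mul hg
      rw [Nat.add_sub_cancel' (by omega)] at this
      exact this)
  have hφ : Function.Injective φ := by
    intro a b hab
    have : f * a.1 = f * b.1 := congrArg Subtype.val hab
    exact Subtype.ext (mul_left_cancel₀ h0 this)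
  have := LinearMap.finrank_le_finrank_of_injective hφ
  rw [hm, finrank_homogeneousSubmodule] at this
  have h2 : (m - 4 + n).choose n < (m - i + n).choose n := by
    calc (m - 4 + n).choose n < (m - 4 + n + 1).choose n := by
          obtain ⟨p, rfl⟩ : ∃ p, n = p + 1 := ⟨n - 1, by omega⟩
          rw [Nat.choose_succ_succ']
          have : 0 < (m - 4 + (p + 1)).choose p := Nat.choose_pos (by omega)
          omega
      _ ≤ _ := Nat.choose_le_choose n (by omega)
  omega

end
end Forms

namespace Forms
section
variable {k : Type} [Field k] {p : ℕ}

private def comb (f g : MvPolynomial (Fin (p + 1 + 1)) k) (s a m t : ℕ) :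
    (homogeneousSubmodule (Fin (p + 1 + 1)) k (m - s) ×
      ((j : Fin t) → homogeneousSubmodule (Fin (p + 1)) k (m - a - j))) →ₗ[k] MvPolynomial (Fin (p + 1 + 1)) k :=
  ((LinearMap.mulRight k f).comp (Submodule.subtype _)).coprod
    (∑ j : Fin t, ((LinearMap.mulRight k (X 0 ^ (j : ℕ) * g)).comp (rename Fin.succ).toLinearMap).comp
      ((Submodule.subtype _).comp (LinearMap.proj j)))

private lemma comb_apply (f g : MvPolynomial (Fin (p + 1 + 1)) k) (s a m t : ℕ) (u v) :
    comb f g s a m t (u, v) = u.1 * f + ∑ j, rename Fin.succ (v j).1 * (X 0 ^ (j : ℕ) * g) := by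
  simp [comb, mul_assoc]

private lemma comb_injective {f g : MvPolynomial (Fin (p + 1 + 1)) k} {s a m t : ℕ}
    (hf : (finSuccEquiv k (p + 1) f).coeff s ≠ 0) (hg : g ≠ 0)
    (ht : t + (finSuccEquiv k (p + 1) g).natDegree ≤ s) : Function.Injective (comb f g s a m t) := by
  rw [← LinearMap.ker_eq_bot, LinearMap.ker_eq_bot']
  rintro ⟨u, v⟩ h
  rw [comb_apply] at h
  set T := finSuccEquiv k (p + 1) with hT
  have hg' : T g ≠ 0 := by simpa using hg
  have h1 : T u.1 * T f + (∑ j : Fin t, Polynomial.C (v j).1 * Polynomial.X ^ (j : ℕ)) * T g = 0 := by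
    have := congrArg T h
    simp only [map_add, map_mul, map_sum, map_pow, hT, finSuccEquiv_rename_succ, finSuccEquiv_X_zero, map_zero] at this
    rw [← this, Finset.sum_mul]
    simp only [mul_assoc, hT]
  set q := ∑ j : Fin t, Polynomial.C (v j).1 * Polynomial.X ^ (j : ℕ) with hq
  have hcoef : ∀ j : Fin t, q.coeff j = (v j).1 := by
    intro j
    simp only [hq, Polynomial.finsetSum_coeff, Polynomial.coeff_C_mul, Polynomial.coeff_X_pow]
    rw [Finset.sum_eq_single j]
    · simp
    · intro b _ hb
      rw [if_neg (fun h => hb (Fin.ext h.symm)), mul_zero]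
    · simp
  have hqdeg : q.degree < t := by
    refine (Polynomial.degree_sum_le _ _).trans_lt ((Finset.sup_lt_iff (WithBot.bot_lt_coe t)).2 fun j _ => ?_)
    exact (Polynomial.degree_C_mul_X_pow_le _ _).trans_lt (WithBot.coe_lt_coe.2 j.2)
  have hu : T u.1 = 0 := by
    by_contra hu
    have hf0 : T f ≠ 0 := fun h0 => hf (by rw [h0, Polynomial.coeff_zero])
    have h2 : T u.1 * T f = - (q * T g) := by rw [eq_neg_iff_add_eq_zero]; exact h1
    have h3 := congrArg Polynomial.degree h2
    rw [Polynomial.degree_neg, Polynomial.degree_mul, Polynomial.degree_mul] at h3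
    have h4 : (s : WithBot ℕ) ≤ (T f).degree := Polynomial.le_degree_of_ne_zero hf
    have h5 : q.degree + (T g).degree < (s : WithBot ℕ) := by
      rw [Polynomial.degree_eq_natDegree hg']
      by_cases hq0 : q = 0
      · rw [hq0]; simp
      · rw [Polynomial.degree_eq_natDegree hq0] at hqdeg ⊢
        have : q.natDegree < t := by exact_mod_cast hqdeg
        have h6 : q.natDegree + (T g).natDegree < s := by omega
        exact_mod_cast h6
    rw [← h3, Polynomial.degree_eq_natDegree hu] at h5
    rw [Polynomial.degree_eq_natDegree hf0] at h4 h5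
    have h4' : s ≤ (T f).natDegree := by exact_mod_cast h4
    have h5' : (T u.1).natDegree + (T f).natDegree < s := by exact_mod_cast h5
    omega
  have hu' : u = 0 := Subtype.ext (by simpa [hT] using hu)
  rw [hu, zero_mul, zero_add] at h1
  have hq0 : q = 0 := (mul_eq_zero.1 h1).resolve_right hg'
  have hv : v = 0 := by
    ext1 j
    exact Subtype.ext (by rw [← hcoef j, hq0]; simp)
  rw [hu', hv]; rfl

/-- An ideal whose Hilbert function is that of a quartic hypersurface and which contains a form that is monic in the
first variable contains no nonzero form of degree at most three in that variable. -/
lemma eq_zero_of_natDegree_le (B : Ideal (MvPolynomial (Fin (p + 1 + 1)) k))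
    (hB : ∀ᶠ m in Filter.atTop,
      Module.finrank k (idealPiece k (Fin (p + 1 + 1)) B m) = Nat.choose (m - 4 + (p + 1)) (p + 1))
    {s : ℕ} {f : MvPolynomial (Fin (p + 1 + 1)) k} (hf : f.IsHomogeneous s) (hf0 : eval (Pi.single 0 1) f ≠ 0)
    (hfB : f ∈ B) {a : ℕ} {g : MvPolynomial (Fin (p + 1 + 1)) k} (hg : g.IsHomogeneous a) (hgB : g ∈ B)
    (hg3 : (finSuccEquiv k (p + 1) g).natDegree ≤ 3) : g = 0 := by
  by_contra hg0
  obtain ⟨M, hM, hM2⟩ := ((eventually_choose_lt p s (a + (s + 4))).and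
    ((Filter.tendsto_add_atTop_nat (a + (s + 4))).eventually hB)).exists
  set m := M + (a + (s + 4)) with hm
  set f' := f * X 0 ^ 4 with hf'
  have hf'h : f'.IsHomogeneous (s + 4) := by
    have := hf.mul ((isHomogeneous_X k (0 : Fin (p + 1 + 1))).pow 4)
    simpa using this
  have hf'c : (finSuccEquiv k (p + 1) f').coeff (s + 4) ≠ 0 := by
    rw [finSuccEquiv_coeff_top hf'h]
    simp [hf', hf0]
  have hinj := comb_injective (a := a) (m := m) (t := s + 1) hf'c hg0 (by omega)
  let φ := LinearMap.codRestrict (idealPiece k (Fin (p + 1 + 1)) B m) (comb f' g (s + 4) a m (s + 1)) (by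
    rintro ⟨⟨u, hu⟩, v⟩
    rw [comb_apply]
    refine add_mem ?_ (sum_mem fun j _ => ?_)
    · refine ⟨Ideal.mul_mem_left _ _ (Ideal.mul_mem_right _ _ hfB), ?_⟩
      have : (u * f').IsHomogeneous (m - (s + 4) + (s + 4)) := IsHomogeneous.mul hu hf'h
      rwa [Nat.sub_add_cancel (by omega)] at this
    · refine ⟨Ideal.mul_mem_left _ _ (Ideal.mul_mem_left _ _ hgB), ?_⟩
      have hv : (v j).1.IsHomogeneous (m - a - j) := (v j).2
      have : (rename Fin.succ (v j).1 * (X 0 ^ (j : ℕ) * g)).IsHomogeneous (m - a - j + (1 * j + a)) :=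
        hv.rename_isHomogeneous.mul (((isHomogeneous_X k (0 : Fin (p + 1 + 1))).pow j).mul hg)
      have hj := j.2
      rwa [show m - a - j + (1 * j + a) = m by omega] at this)
  have hφ : Function.Injective φ := fun x y h => hinj (congrArg Subtype.val h)
  have h1 := LinearMap.finrank_le_finrank_of_injective hφ
  rw [hM2, Module.finrank_prod, Module.finrank_pi_fintype, finrank_homogeneousSubmodule] at h1
  simp only [finrank_homogeneousSubmodule] at h1
  have h2 := choose_telescope p (m - (s + 4)) s
  rw [show m - (s + 4) + s = m - 4 by omega] at h2
  rw [h2] at h1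
  have h3 : ∑ j ∈ Finset.range s, (m - (s + 4) + j + 1 + p).choose p ≤ s * (m + p).choose p := by
    refine (Finset.sum_le_card_nsmul _ _ _ fun j hj => ?_).trans (by rw [Finset.card_range, smul_eq_mul])
    have := Finset.mem_range.1 hj
    exact Nat.choose_le_choose _ (by omega)
  have h4 : (s + 1) * (M + p).choose p ≤ ∑ j : Fin (s + 1), (m - a - j + p).choose p := by
    refine le_trans (by rw [Finset.card_univ, Fintype.card_fin, smul_eq_mul])
      (Finset.card_nsmul_le_sum Finset.univ _ ((M + p).choose p) fun j _ => ?_)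
    have hj := j.2
    exact Nat.choose_le_choose _ (by omega)
  omega

end
end Forms

namespace Forms
section
variable {k ι : Type} [Field k] [Fintype ι]

lemma aeval_mul_left {E : Type} [CommRing E] [Algebra k E] {f : MvPolynomial ι k} {m : ℕ} (hf : f.IsHomogeneous m)
    (a : E) (x : ι → E) : aeval (fun i => a * x i) f = a ^ m * aeval x f := by
  rw [aeval_def, aeval_def, eval₂_eq', eval₂_eq', Finset.mul_sum]
  refine Finset.sum_congr rfl fun d hd => ?_
  have hdeg := hf (mem_support_iff.1 hd)
  rw [Finsupp.weight_apply, Finsupp.sum_fintype _ _ (by simp)] at hdeg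
  have h2 : ∑ i, d i = m := by simpa using hdeg
  simp only [mul_pow, Finset.prod_mul_distrib, Finset.prod_pow_eq_pow_sum, h2]
  ring

variable (ι) in
lemma finrank_homogeneousSubmodule_one [DecidableEq ι] : Module.finrank k (homogeneousSubmodule ι k 1) = Fintype.card ι := by
  have h := homogeneousSubmodule_one_eq_span_X (σ := ι) (R := k)
  rw [h]
  refine finrank_span_eq_card ?_
  rw [Fintype.linearIndependent_iff]
  intro g hg i
  have := congrArg (coeff (Finsupp.single i 1)) hg
  simpa [coeff_sum, coeff_X, Finsupp.single_left_inj] using this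

end
end Forms

/-- A field of functions `E` of the variety with ideal `P`, over the field `K` of functions in the last coordinates. -/
structure Functions {k ι : Type} [Field k] {n : ℕ} (P : Ideal (MvPolynomial ι k)) (ell : Fin (n + 1) → MvPolynomial ι k)
    (K E : Type) [Field K] [Field E] [Algebra (MvPolynomial (Fin n) k) K] [Algebra k K] [Algebra K E] [Algebra k E]
    (π : MvPolynomial ι k →ₐ[k] E) : Prop where
  ker : ∀ f, π f = 0 ↔ f ∈ P
  base : ∀ g : MvPolynomial (Fin n) k, algebraMap K E (algebraMap _ K g) = π (aeval (fun i => ell i.succ) g)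

namespace Functions

variable {k ι : Type} [Field k] [Fintype ι] [DecidableEq ι] {n c N : ℕ}
    {P J : Ideal (MvPolynomial ι k)} {ell : Fin (n + 1) → MvPolynomial ι k}
    {kap : MvPolynomial ι k →ₐ[k] MvPolynomial (Fin (n + 1)) k}
    {theta : MvPolynomial ι k} {r : MvPolynomial (Fin (n + 1)) k}
    {zeta : Fin c ⊕ Fin 3 → ι → k}
    {K E : Type} [Field K] [Field E] [Algebra (MvPolynomial (Fin n) k) K]
    [IsFractionRing (MvPolynomial (Fin n) k) K] [Algebra k K] [IsScalarTower k (MvPolynomial (Fin n) k) K]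
    [Algebra K E] [Algebra k E] [IsScalarTower k K E] {π : MvPolynomial ι k →ₐ[k] E}

/-- Dehomogenisation with respect to a linear form. -/
def dehom (π : MvPolynomial ι k →ₐ[k] E) (l : MvPolynomial ι k) : MvPolynomial ι k →ₐ[k] E :=
  aeval fun i => (π l)⁻¹ * π (X i)

lemma dehom_apply (π : MvPolynomial ι k →ₐ[k] E) (l : MvPolynomial ι k) {f : MvPolynomial ι k} {m : ℕ}
    (hf : f.IsHomogeneous m) : dehom π l f = (π l)⁻¹ ^ m * π f := by
  rw [dehom, Forms.aeval_mul_left hf]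
  congr 1
  exact (DFunLike.congr_fun (aeval_unique π) f).symm

/-- The dehomogenised forms of degree one. -/
def lin (π : MvPolynomial ι k →ₐ[k] E) (l : MvPolynomial ι k) : Submodule k E :=
  (homogeneousSubmodule ι k 1).map (dehom π l).toLinearMap

lemma lin_pow (π : MvPolynomial ι k →ₐ[k] E) (l : MvPolynomial ι k) (m : ℕ) :
    lin π l ^ m = (homogeneousSubmodule ι k m).map (dehom π l).toLinearMap := by
  rw [lin, ← Submodule.map_pow, homogeneousSubmodule_one_pow]

lemma span_lin_pow (π : MvPolynomial ι k →ₐ[k] E) (l : MvPolynomial ι k) (m : ℕ) :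
    Submodule.span K (lin π l : Set E) ^ m =
      Submodule.span K (dehom π l '' {f | f.IsHomogeneous m}) := by
  have h1 : Submodule.span K (lin π l : Set E) ^ m = Submodule.span K ((lin π l ^ m : Submodule k E) : Set E) := by
    induction m with
    | zero =>
      rw [pow_zero, pow_zero, Submodule.one_eq_span, Submodule.one_eq_span, Submodule.span_span_of_tower]
    | succ m ih =>
      rw [pow_succ, pow_succ, ih, Submodule.span_mul_span]
      apply le_antisymm
      · rw [Submodule.span_le]
        rintro _ ⟨x, hx, y, hy, rfl⟩
        exact Submodule.subset_span (Submodule.mul_mem_mul hx hy)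
      · rw [Submodule.span_le]
        intro x hx
        induction hx using Submodule.mul_induction_on' with
        | mem_mul_mem a ha b hb => exact Submodule.subset_span ⟨a, ha, b, hb, rfl⟩
        | add a _ b _ ha hb => exact add_mem ha hb
  rw [h1, lin_pow]
  rfl

section
variable (F : Frame n c N P J ell kap theta r zeta) (H : Functions P ell K E π)
include F H

lemma map_ell_ne : π (ell 0) ≠ 0 := by
  rw [Ne, H.ker]
  intro h
  have := F.P_one _ h (F.ell_hom 0)
  have h2 := F.kap_ell 0
  rw [this, map_zero] at h2
  exact X_ne_zero (R := k) (0 : Fin (n + 1)) h2.symm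

omit F in
lemma exists_clear {α : Type} (s : Finset α) (κ : α → K) : ∃ b : MvPolynomial (Fin n) k, b ≠ 0 ∧
    ∃ g : α → MvPolynomial (Fin n) k, ∀ a ∈ s, algebraMap _ K (g a) = algebraMap _ K b * κ a := by
  obtain ⟨b, hb⟩ := IsLocalization.exist_integer_multiples (nonZeroDivisors (MvPolynomial (Fin n) k)) s κ
  choose! g hg using hb
  exact ⟨b, nonZeroDivisors.ne_zero b.2, g, fun a ha => by rw [hg a ha, Algebra.smul_def]⟩

omit F in
lemma base_ne {b : MvPolynomial (Fin n) k} (hb : b ≠ 0) : algebraMap (MvPolynomial (Fin n) k) K b ≠ 0 := by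
  rw [Ne, FaithfulSMul.algebraMap_eq_zero_iff]; exact hb

/-- Clearing denominators in a linear combination over the function field of the base. -/
lemma exists_of_mem_span {m : ℕ} {T : Set (MvPolynomial ι k)} (hT : ∀ f ∈ T, f.IsHomogeneous m) {x : E}
    (hx : x ∈ Submodule.span K (dehom π (ell 0) '' T)) :
    ∃ (s : Finset (MvPolynomial ι k)) (κ : MvPolynomial ι k → K) (b : MvPolynomial (Fin n) k)
      (g : MvPolynomial ι k → MvPolynomial (Fin n) k), ↑s ⊆ T ∧ b ≠ 0 ∧
      (∀ Z ∈ s, algebraMap _ K (g Z) = algebraMap _ K b * κ Z) ∧ x = ∑ Z ∈ s, κ Z • dehom π (ell 0) Z ∧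
      π (aeval (fun i => ell i.succ) b) * π (ell 0) ^ m * x = π (∑ Z ∈ s, aeval (fun i => ell i.succ) (g Z) * Z) := by
  rw [Finsupp.mem_span_image_iff_linearCombination] at hx
  obtain ⟨κ, hκ, rfl⟩ := hx
  rw [Finsupp.mem_supported] at hκ
  obtain ⟨b, hb, g, hg⟩ := H.exists_clear κ.support κ
  refine ⟨κ.support, κ, b, g, hκ, hb, hg, by rw [Finsupp.linearCombination_apply, Finsupp.sum], ?_⟩
  rw [Finsupp.linearCombination_apply, Finsupp.sum, Finset.mul_sum, map_sum]
  refine Finset.sum_congr rfl fun Z hZ => ?_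
  rw [map_mul, ← H.base, ← H.base, hg Z hZ, dehom_apply π _ (hT Z (hκ hZ)), Algebra.smul_def, map_mul]
  have := H.map_ell_ne F
  rw [inv_pow]
  field_simp

end
end Functions

namespace Functions

variable {k ι : Type} [Field k] [Fintype ι] [DecidableEq ι] {n c N : ℕ}
    {P J : Ideal (MvPolynomial ι k)} {ell : Fin (n + 1) → MvPolynomial ι k}
    {kap : MvPolynomial ι k →ₐ[k] MvPolynomial (Fin (n + 1)) k}
    {theta : MvPolynomial ι k} {r : MvPolynomial (Fin (n + 1)) k}
    {zeta : Fin c ⊕ Fin 3 → ι → k}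
    {K E : Type} [Field K] [Field E] [Algebra (MvPolynomial (Fin n) k) K]
    [IsFractionRing (MvPolynomial (Fin n) k) K] [Algebra k K] [IsScalarTower k (MvPolynomial (Fin n) k) K]
    [Algebra K E] [Algebra k E] [IsScalarTower k K E] {π : MvPolynomial ι k →ₐ[k] E}

/-- The dehomogenisation map with coefficients extended to the function field of the base. -/
def dehomK (K : Type) [Field K] [Algebra K E] (π : MvPolynomial ι k →ₐ[k] E) (l : MvPolynomial ι k) :
    MvPolynomial ι K →ₐ[K] E := aeval fun i => (π l)⁻¹ * π (X i)

lemma dehomK_map (l : MvPolynomial ι k) (f : MvPolynomial ι k) :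
    dehomK K π l (map (algebraMap k K) f) = dehom π l f := aeval_map_algebraMap _ _ _

variable (F : Frame n c N P J ell kap theta r zeta) (H : Functions P ell K E π)
include F H

omit H in
/-- A form is determined at the chosen points by its reduction. -/
lemma eval_zeta_red {G : MvPolynomial ι k} {lam : ℕ → MvPolynomial (Fin (n + 1)) k}
    (h : aeval ell r * G - ∑ i ∈ Finset.range (c + 3), aeval ell (lam i) * theta ^ i ∈ P) (σ : Fin c ⊕ Fin 3) :
    eval (Pi.single 0 1) r * eval (zeta σ) G =
      ∑ i ∈ Finset.range (c + 3), eval (Pi.single 0 1) (lam i) * eval (zeta σ) theta ^ i := by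
  have := F.zeta_P σ _ h
  simpa only [map_sub, map_mul, map_sum, map_pow, F.eval_zeta_aeval, sub_eq_zero] using this

omit F H in
lemma algebraMap_C (a : k) : algebraMap (MvPolynomial (Fin n) k) K (C a) = algebraMap k K a := by
  rw [← algebraMap_eq, ← IsScalarTower.algebraMap_apply]

lemma eval_eq_zero_of_dehomK (σ : Fin c ⊕ Fin 3) {p : MvPolynomial ι K} (hp : dehomK K π (ell 0) p = 0) :
    eval (fun i => algebraMap k K (zeta σ i)) p = 0 := by
  obtain ⟨b, hb, g, hg⟩ := H.exists_clear p.support (fun α => coeff α p)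
  set M := p.totalDegree with hM
  have hdeg : ∀ α ∈ p.support, α.degree ≤ M := fun α hα => by
    have := le_totalDegree hα
    rwa [Finsupp.degree_apply]
  let G : (ι →₀ ℕ) → MvPolynomial ι k := fun α => ell 0 ^ (M - α.degree) * monomial α 1
  have hGh : ∀ α ∈ p.support, (G α).IsHomogeneous M := fun α hα => by
    have := ((F.ell_hom 0).pow (M - α.degree)).mul (isHomogeneous_monomial (1 : k) (d := α) rfl)
    rwa [one_mul, Nat.sub_add_cancel (hdeg α hα)] at this
  have hl := H.map_ell_ne F
  have hGP : ∑ α ∈ p.support, aeval (fun i => ell i.succ) (g α) * G α ∈ P := by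
    rw [← H.ker, map_sum]
    have : ∀ α ∈ p.support, π (aeval (fun i => ell i.succ) (g α) * G α) =
        algebraMap K E (algebraMap _ K b) * π (ell 0) ^ M * dehomK K π (ell 0) (monomial α (coeff α p)) := by
      intro α hα
      have h1 : dehomK K π (ell 0) (monomial α (coeff α p)) =
          algebraMap K E (coeff α p) * ((π (ell 0))⁻¹ ^ α.degree * π (monomial α 1)) := by
        rw [← dehom_apply π _ (isHomogeneous_monomial (1 : k) (d := α) rfl), dehomK, dehom, aeval_monomial,
          aeval_monomial, map_one, one_mul]
      rw [h1, map_mul, map_mul, map_pow, ← H.base, hg α hα, map_mul, inv_pow]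
      rw [show M = (M - α.degree) + α.degree from (Nat.sub_add_cancel (hdeg α hα)).symm, pow_add]
      simp only [Nat.add_sub_cancel]
      field_simp
    rw [Finset.sum_congr rfl this, ← Finset.mul_sum, ← map_sum, ← as_sum, hp, mul_zero]
  choose! lam hlamh hlam using fun α (hα : α ∈ p.support) => F.red M (G α) (hGh α hα)
  have h2 := F.coeff_relation p.support g lam G hlam hGP
  have h3 : ∀ i < c + 3, ∑ α ∈ p.support, g α * C (eval (Pi.single 0 1) (lam α i)) = 0 := by
    intro i hi
    rw [← h2 i hi (N + M - i)]
    exact Finset.sum_congr rfl fun α hα => by rw [Forms.finSuccEquiv_coeff_top (hlamh α hα i hi)]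
  have h4 : ∑ α ∈ p.support, g α * C (eval (Pi.single 0 1) r * eval (zeta σ) (G α)) = 0 := by
    have : ∀ α ∈ p.support, g α * C (eval (Pi.single 0 1) r * eval (zeta σ) (G α)) =
        ∑ i ∈ Finset.range (c + 3), g α * C (eval (Pi.single 0 1) (lam α i)) * C (eval (zeta σ) theta ^ i) := by
      intro α hα
      rw [eval_zeta_red F (hlam α hα) σ, map_sum, Finset.mul_sum]
      exact Finset.sum_congr rfl fun i _ => by rw [map_mul, mul_assoc]
    rw [Finset.sum_congr rfl this, Finset.sum_comm]
    refine Finset.sum_eq_zero fun i hi => ?_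
    rw [← Finset.sum_mul, h3 i (Finset.mem_range.1 hi), zero_mul]
  have h5 : algebraMap _ K b * algebraMap k K (eval (Pi.single 0 1) r) *
      eval (fun i => algebraMap k K (zeta σ i)) p = 0 := by
    rw [← map_zero (algebraMap (MvPolynomial (Fin n) k) K), ← h4, map_sum, eval_eq (f := p), Finset.mul_sum]
    refine Finset.sum_congr rfl fun α hα => ?_
    have h6 : eval (zeta σ) (G α) = ∏ i, zeta σ i ^ α i := by
      simp only [G, map_mul, map_pow, F.zeta_ell, if_pos, one_pow, one_mul]
      rw [eval_monomial, one_mul, Finsupp.prod_fintype _ _ (by simp)]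
    rw [map_mul, algebraMap_C, h6, hg α hα, map_mul, map_prod]
    simp only [map_pow]
    rw [Finset.prod_subset (Finset.subset_univ α.support) (by
      intro i _ hi
      rw [Finsupp.notMem_support_iff.1 hi, pow_zero])]
    ring
  have h7 : algebraMap k K (eval (Pi.single 0 1) r) ≠ 0 := by
    rw [Ne, FaithfulSMul.algebraMap_eq_zero_iff]; exact F.r_ne
  exact (mul_eq_zero.1 h5).resolve_left (mul_ne_zero (base_ne H hb) h7)

lemma exists_ev (σ : Fin c ⊕ Fin 3) : ∃ e : E →ₗ[K] K, ∀ p, e (dehomK K π (ell 0) p) =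
    eval (fun i => algebraMap k K (zeta σ i)) p := by
  let Φ : MvPolynomial ι K →ₗ[K] E := (dehomK K π (ell 0)).toLinearMap
  let φ : MvPolynomial ι K →ₗ[K] K := (aeval (R := K) fun i => algebraMap k K (zeta σ i)).toLinearMap
  have hker : LinearMap.ker Φ ≤ LinearMap.ker φ := by
    intro p hp
    have := eval_eq_zero_of_dehomK F H σ (p := p) hp
    rw [LinearMap.mem_ker]
    simpa [φ, coe_aeval_eq_eval] using this
  obtain ⟨e, he⟩ := LinearMap.exists_extend (((LinearMap.ker Φ).liftQ φ hker).comp Φ.quotKerEquivRange.symm.toLinearMap)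
  refine ⟨e, fun p => ?_⟩
  have h1 := LinearMap.congr_fun he ⟨Φ p, ⟨p, rfl⟩⟩
  simp only [LinearMap.comp_apply, Submodule.subtype_apply, LinearEquiv.coe_coe] at h1
  have h2 : Φ.quotKerEquivRange.symm ⟨Φ p, ⟨p, rfl⟩⟩ = (LinearMap.ker Φ).mkQ p := by
    rw [LinearEquiv.symm_apply_eq]; rfl
  rw [h2, Submodule.mkQ_apply, Submodule.liftQ_apply] at h1
  change e (Φ p) = _
  rw [h1]
  simp [φ]

end Functions

namespace Forms

lemma homogeneousComponent_algHom {k ι κ : Type} [Field k] (φ : MvPolynomial κ k →ₐ[k] MvPolynomial ι k)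
    (h : ∀ i, (φ (X i)).IsHomogeneous 1) (m : ℕ) (f : MvPolynomial κ k) :
    homogeneousComponent m (φ f) = φ (homogeneousComponent m f) := by
  conv_lhs => rw [← sum_homogeneousComponent f]
  rw [map_sum, map_sum]
  have h1 : ∀ i, homogeneousComponent m (φ (homogeneousComponent i f)) =
      if m = i then φ (homogeneousComponent i f) else 0 := fun i =>
    homogeneousComponent_of_mem (isHomogeneous_algHom (homogeneousComponent_isHomogeneous i f) φ h)
  simp only [h1, Finset.sum_ite_eq, Finset.mem_range]
  split_ifs with h2
  · rfl
  · rw [homogeneousComponent_eq_zero _ _ (by omega), map_zero]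

lemma linearIndependent_pow_of_transcendental {K E : Type} [Field K] [Field E] [Algebra K E] {x : E}
    (hx : Transcendental K x) : LinearIndependent K fun j : ℕ => x ^ j := by
  have h := (Polynomial.basisMonomials K).linearIndependent.map' (Polynomial.aeval x).toLinearMap
    (LinearMap.ker_eq_bot.2 (transcendental_iff_injective.1 hx))
  have e : (⇑(Polynomial.aeval (R := K) x).toLinearMap ∘ ⇑(Polynomial.basisMonomials K)) = fun j : ℕ => x ^ j := by
    ext j
    simp [Polynomial.aeval_monomial]
  rwa [e] at h

end Forms

namespace Functions

variable {k ι : Type} [Field k] [Fintype ι] [DecidableEq ι] {n c N : ℕ}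
    {P J : Ideal (MvPolynomial ι k)} {ell : Fin (n + 1) → MvPolynomial ι k}
    {kap : MvPolynomial ι k →ₐ[k] MvPolynomial (Fin (n + 1)) k}
    {theta : MvPolynomial ι k} {r : MvPolynomial (Fin (n + 1)) k}
    {zeta : Fin c ⊕ Fin 3 → ι → k}
    {K E : Type} [Field K] [Field E] [Algebra (MvPolynomial (Fin n) k) K]
    [IsFractionRing (MvPolynomial (Fin n) k) K] [Algebra k K] [IsScalarTower k (MvPolynomial (Fin n) k) K]
    [Algebra K E] [Algebra k E] [IsScalarTower k K E] {π : MvPolynomial ι k →ₐ[k] E}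

open Submodule

lemma span_image_le_range (l : MvPolynomial ι k) (T : Set (MvPolynomial ι k)) {x : E}
    (hx : x ∈ span K (dehom π l '' T)) : ∃ p, dehomK K π l p = x := by
  have : span K (dehom π l '' T) ≤ LinearMap.range (dehomK K π l).toLinearMap := by
    rw [span_le]
    rintro _ ⟨f, _, rfl⟩
    exact ⟨map (algebraMap k K) f, dehomK_map l f⟩
  exact this hx

lemma ev_dehom {l : MvPolynomial ι k} {ev : E →ₗ[K] K} {z : ι → k}
    (hev : ∀ p, ev (dehomK K π l p) = eval (fun i => algebraMap k K (z i)) p) (f : MvPolynomial ι k) :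
    ev (dehom π l f) = algebraMap k K (eval z f) := by
  rw [← dehomK_map (K := K), hev, eval_map, eval₂_eq', eval_eq', map_sum]
  simp only [map_mul, map_prod, map_pow]

instance finite_span_lin_pow (l : MvPolynomial ι k) (m : ℕ) :
    FiniteDimensional K (span K (lin π l : Set E) ^ m : Submodule K E) := by
  have : (span K (lin π l : Set E)).FG := by
    have h1 : (lin π l).FG := (Submodule.fg_top _).1 (Forms.finite_homogeneousSubmodule k ι 1).fg_top |>.map _
    obtain ⟨s, hs⟩ := h1
    refine ⟨s, ?_⟩
    rw [← hs, span_span_of_tower]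
  exact Module.Finite.iff_fg.2 (this.pow m)

variable (F : Frame n c N P J ell kap theta r zeta) (H : Functions P ell K E π)
include F H

omit F in
lemma map_aeval (f : MvPolynomial (Fin (n + 1)) k) : π (aeval ell f) =
    ((finSuccEquiv k n f).map (algebraMap (MvPolynomial (Fin n) k) K)).eval₂ (algebraMap K E) (π (ell 0)) := by
  have : (π.toRingHom.comp (aeval ell).toRingHom) =
      (Polynomial.eval₂RingHom (algebraMap K E) (π (ell 0))).comp ((Polynomial.mapRingHom
        (algebraMap (MvPolynomial (Fin n) k) K)).comp (finSuccEquiv k n).toAlgHom.toRingHom) := by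
    apply MvPolynomial.ringHom_ext
    · intro a
      have h1 : finSuccEquiv k n (C a) = Polynomial.C (C a) :=
        ((finSuccEquiv k n).symm_apply_eq.1 (RingHom.congr_fun (finSuccEquiv_comp_C_eq_C n) a)).symm
      change π (aeval ell (C a)) = Polynomial.eval₂ (algebraMap K E) (π (ell 0))
        (Polynomial.map (algebraMap (MvPolynomial (Fin n) k) K) (finSuccEquiv k n (C a)))
      rw [h1, Polynomial.map_C, Polynomial.eval₂_C, H.base, algHom_C, algHom_C, algebraMap_eq]
    · intro i
      refine Fin.cases ?_ (fun i => ?_) i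
      · simp [finSuccEquiv_X_zero]
      · simp [finSuccEquiv_X_succ, H.base]
  exact RingHom.congr_fun this f

lemma transcendental_ell : Transcendental K (π (ell 0)) := by
  let _ : Algebra (MvPolynomial (Fin n) k) E := ((algebraMap K E).comp (algebraMap _ K)).toAlgebra
  have : IsScalarTower (MvPolynomial (Fin n) k) K E := IsScalarTower.of_algebraMap_eq' rfl
  intro h
  rw [← IsFractionRing.isAlgebraic_iff (MvPolynomial (Fin n) k) K E] at h
  obtain ⟨q, hq, hq0⟩ := h
  have h1 : aeval ell ((finSuccEquiv k n).symm q) ∈ P := by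
    rw [← H.ker, H.map_aeval, AlgEquiv.apply_symm_apply, Polynomial.eval₂_map, ← hq0, Polynomial.aeval_def]
    rfl
  have h2 := F.free (fun i => if i = 0 then (finSuccEquiv k n).symm q else 0) (by
    rw [Finset.sum_eq_single 0]
    · simpa using h1
    · intro b _ hb; simp [hb]
    · intro h; simp at h) 0 (by omega)
  rw [if_pos rfl] at h2
  exact hq (by simpa using h2)

lemma linearIndependent_eps : LinearIndependent K fun j : ℕ => (π (ell 0))⁻¹ ^ j :=
  Forms.linearIndependent_pow_of_transcendental fun h => transcendental_ell F H (IsAlgebraic.inv_iff.1 h)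

omit H in
lemma aeval_notMem {f : MvPolynomial (Fin (n + 1)) k} (hf : eval (Pi.single 0 1) f ≠ 0) : aeval ell f ∉ P := by
  intro h
  have := F.zeta_P (Sum.inr 0) _ h
  rw [F.eval_zeta_aeval] at this
  exact hf this

lemma upper (m : ℕ) : Module.finrank K (span K (lin π (ell 0) : Set E) ^ m : Submodule K E) ≤
    (c + 3) * m + (c + 3) * (N + 1) := by
  set l := π (ell 0) with hl
  let b : Fin (c + 3) × Fin (N + m + 1) → E := fun q =>
    (π (aeval ell r))⁻¹ * (l⁻¹ ^ m * (l ^ (q.2 : ℕ) * π theta ^ (q.1 : ℕ)))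
  have h1 : span K (lin π (ell 0) : Set E) ^ m ≤ span K (Set.range b) := by
    rw [span_lin_pow, span_le]
    rintro _ ⟨G, hG, rfl⟩
    obtain ⟨lam, hlam, hred⟩ := F.red m G hG
    have hr : π (aeval ell r) ≠ 0 := by rw [Ne, H.ker]; exact aeval_notMem F F.r_ne
    rw [← H.ker, map_sub, map_mul, map_sum, sub_eq_zero] at hred
    have h2 : dehom π (ell 0) G = ∑ i ∈ Finset.range (c + 3),
        (π (aeval ell r))⁻¹ * (l⁻¹ ^ m * (π (aeval ell (lam i)) * π theta ^ i)) := by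
      rw [dehom_apply π _ hG, ← Finset.mul_sum, ← Finset.mul_sum, ← hl]
      have h3 : ∑ i ∈ Finset.range (c + 3), π (aeval ell (lam i)) * π theta ^ i = π (aeval ell r) * π G := by
        rw [hred]; simp only [map_mul, map_pow]
      rw [h3]
      field_simp
    rw [SetLike.mem_coe, h2]
    refine sum_mem fun i hi => ?_
    have hi' := Finset.mem_range.1 hi
    have hdeg : (finSuccEquiv k n (lam i)).natDegree < N + m + 1 := by
      rw [natDegree_finSuccEquiv]
      have := degreeOf_le_totalDegree (lam i) 0
      have := IsHomogeneous.totalDegree_le (hlam i hi')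
      omega
    rw [H.map_aeval (lam i), Polynomial.eval₂_eq_sum_range' _ (lt_of_le_of_lt Polynomial.natDegree_map_le hdeg), Finset.sum_mul,
      Finset.mul_sum, Finset.mul_sum]
    refine sum_mem fun j hj => ?_
    have : (π (aeval ell r))⁻¹ * (l⁻¹ ^ m * (algebraMap K E (((finSuccEquiv k n (lam i)).map
        (algebraMap (MvPolynomial (Fin n) k) K)).coeff j) * π (ell 0) ^ j * π theta ^ i)) =
        (((finSuccEquiv k n (lam i)).map (algebraMap (MvPolynomial (Fin n) k) K)).coeff j) •
          b (⟨i, hi'⟩, ⟨j, Finset.mem_range.1 hj⟩) := by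
      rw [Algebra.smul_def]
      ring
    rw [this]
    exact smul_mem _ _ (subset_span ⟨_, rfl⟩)
  have : FiniteDimensional K (span K (Set.range b)) := FiniteDimensional.span_of_finite K (Set.finite_range b)
  refine (Submodule.finrank_mono h1).trans ((finrank_range_le_card b).trans ?_)
  rw [Fintype.card_prod, Fintype.card_fin, Fintype.card_fin]
  exact le_of_eq (by ring)

end Functions

namespace Frame

variable {k ι : Type} [Field k] [Fintype ι] [DecidableEq ι] {n c N : ℕ}
    {P J : Ideal (MvPolynomial ι k)} {ell : Fin (n + 1) → MvPolynomial ι k}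
    {kap : MvPolynomial ι k →ₐ[k] MvPolynomial (Fin (n + 1)) k}
    {theta : MvPolynomial ι k} {r : MvPolynomial (Fin (n + 1)) k}
    {zeta : Fin c ⊕ Fin 3 → ι → k}

lemma finrank_J_one (F : Frame n c N P J ell kap theta r zeta) : Module.finrank k (idealPiece k ι J 1) = c := by
  let φ := kap.toLinearMap.domRestrict (homogeneousSubmodule ι k 1)
  have h1 := φ.finrank_range_add_finrank_ker
  have h2 : LinearMap.range φ = homogeneousSubmodule (Fin (n + 1)) k 1 := by
    apply le_antisymm
    · rintro _ ⟨⟨f, hf⟩, rfl⟩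
      exact F.kap_homogeneous hf
    · intro f hf
      exact ⟨⟨aeval ell f, F.aeval_homogeneous hf⟩, F.kap_aeval f⟩
  have h3 : (LinearMap.ker φ).map (homogeneousSubmodule ι k 1).subtype = idealPiece k ι J 1 := by
    apply le_antisymm
    · rintro _ ⟨⟨f, hf⟩, h, rfl⟩
      exact ⟨(F.mem_J f).2 h, hf⟩
    · rintro f ⟨h, hf⟩
      exact ⟨⟨f, hf⟩, (F.mem_J f).1 h, rfl⟩
  have h4 := LinearEquiv.finrank_eq
    (Submodule.equivMapOfInjective _ (Submodule.injective_subtype (homogeneousSubmodule ι k 1)) (LinearMap.ker φ))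
  rw [h3] at h4
  rw [h2, Forms.finrank_homogeneousSubmodule_one, Forms.finrank_homogeneousSubmodule_one, h4, F.card_eq,
    Fintype.card_fin] at h1
  omega

lemma J_hom (F : Frame n c N P J ell kap theta r zeta) (f : MvPolynomial ι k) (hf : f ∈ J) (m : ℕ) :
    homogeneousComponent m f ∈ J := by
  rw [F.mem_J] at hf ⊢
  rw [← Forms.homogeneousComponent_algHom kap F.kap_hom, hf, map_zero]

lemma sup_hom (F : Frame n c N P J ell kap theta r zeta) (f : MvPolynomial ι k) (hf : f ∈ P ⊔ J) (m : ℕ) :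
    homogeneousComponent m f ∈ P ⊔ J := by
  obtain ⟨a, ha, b, hb, rfl⟩ := Submodule.mem_sup.1 hf
  rw [map_add]
  exact add_mem (Submodule.mem_sup_left (F.hom a ha m)) (Submodule.mem_sup_right (F.J_hom b hb m))

lemma exists_J_one_ne (F : Frame n c N P J ell kap theta r zeta) (σ : Fin c ⊕ Fin 3) :
    ∃ f ∈ J, f.IsHomogeneous 1 ∧ eval (zeta σ) f ≠ 0 := by
  by_contra! hcon
  have h1 : ∀ f, eval (zeta σ) f = eval (zeta σ) (aeval ell (kap f)) := by
    have : aeval (R := k) (zeta σ) = ((aeval (R := k) (zeta σ)).comp (aeval ell)).comp kap := by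
      ext i
      have := hcon _ (F.sub_mem_J (X i))
        ((isHomogeneous_X k i).sub (F.aeval_homogeneous (F.kap_homogeneous (isHomogeneous_X k i))))
      rw [map_sub, sub_eq_zero] at this
      simpa [coe_aeval_eq_eval] using this
    intro f
    simpa [coe_aeval_eq_eval] using DFunLike.congr_fun this f
  obtain ⟨s, f, -, hf0, hf⟩ := F.psi
  obtain ⟨a, ha, b, hb, hab⟩ := Submodule.mem_sup.1 hf
  apply hf0
  rw [← F.eval_zeta_aeval σ, ← hab, map_add, F.zeta_P σ a ha, h1 b, (F.mem_J b).1 hb, map_zero, map_zero, add_zero]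

end Frame

namespace Functions

variable {k ι : Type} [Field k] [Fintype ι] [DecidableEq ι] {n c N : ℕ}
    {P J : Ideal (MvPolynomial ι k)} {ell : Fin (n + 1) → MvPolynomial ι k}
    {kap : MvPolynomial ι k →ₐ[k] MvPolynomial (Fin (n + 1)) k}
    {theta : MvPolynomial ι k} {r : MvPolynomial (Fin (n + 1)) k}
    {zeta : Fin c ⊕ Fin 3 → ι → k}
    {K E : Type} [Field K] [Field E] [Algebra (MvPolynomial (Fin n) k) K]
    [IsFractionRing (MvPolynomial (Fin n) k) K] [Algebra k K] [IsScalarTower k (MvPolynomial (Fin n) k) K]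
    [Algebra K E] [Algebra k E] [IsScalarTower k K E] {π : MvPolynomial ι k →ₐ[k] E}

open Submodule

/-- The dehomogenised linear forms in an ideal. -/
def linOf (π : MvPolynomial ι k →ₐ[k] E) (l : MvPolynomial ι k) (J : Ideal (MvPolynomial ι k)) : Submodule k E :=
  (idealPiece k ι J 1).map (dehom π l).toLinearMap

variable (k n K) in
/-- The linear forms of the base, in its function field. -/
def baseLin : Submodule k K :=
  (homogeneousSubmodule (Fin n) k 1).map (IsScalarTower.toAlgHom k (MvPolynomial (Fin n) k) K).toLinearMap

variable (F : Frame n c N P J ell kap theta r zeta) (H : Functions P ell K E π)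
include F H

lemma dehom_injOn {f g : MvPolynomial ι k} (hf : f.IsHomogeneous 1) (hg : g.IsHomogeneous 1)
    (h : dehom π (ell 0) f = dehom π (ell 0) g) : f = g := by
  rw [← sub_eq_zero]
  apply F.P_one _ _ (hf.sub hg)
  rw [← H.ker]
  have h1 : dehom π (ell 0) (f - g) = 0 := by rw [map_sub, h, sub_self]
  rw [dehom_apply π _ (hf.sub hg), mul_eq_zero] at h1
  exact h1.resolve_left (pow_ne_zero _ (inv_ne_zero (H.map_ell_ne F)))

lemma dehom_ell_zero : dehom π (ell 0) (ell 0) = 1 := by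
  rw [dehom_apply π _ (F.ell_hom 0), pow_one, inv_mul_cancel₀ (H.map_ell_ne F)]

lemma finrank_linOf : Module.finrank k (linOf π (ell 0) J) = c := by
  rw [← F.finrank_J_one]
  let φ := (dehom π (ell 0)).toLinearMap.domRestrict (idealPiece k ι J 1)
  have h1 : Function.Injective φ := fun f g h => Subtype.ext (dehom_injOn F H f.2.2 g.2.2 h)
  rw [← LinearMap.finrank_range_of_inj h1]
  have : LinearMap.range φ = linOf π (ell 0) J := by
    rw [linOf]
    exact LinearMap.range_domRestrict _ _
  rw [this]

lemma one_mem_lin : (1 : E) ∈ lin π (ell 0) := ⟨ell 0, F.ell_hom 0, dehom_ell_zero F H⟩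

lemma dehom_ell_succ (i : Fin n) : dehom π (ell 0) (ell i.succ) =
    (algebraMap (MvPolynomial (Fin n) k) K (X i)) • (π (ell 0))⁻¹ := by
  rw [dehom_apply π _ (F.ell_hom _), pow_one, Algebra.smul_def, H.base, aeval_X, mul_comm]

lemma eps_mem (i : Fin n) : (π (ell 0))⁻¹ ∈ span K (lin π (ell 0) : Set E) := by
  have h := dehom_ell_succ F H i
  have hne : algebraMap (MvPolynomial (Fin n) k) K (X i) ≠ 0 := H.base_ne (X_ne_zero i)
  rw [← inv_smul_smul₀ hne (π (ell 0))⁻¹, ← h]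
  exact smul_mem _ _ (subset_span ⟨_, F.ell_hom _, rfl⟩)

lemma span_pow_mono {a b : ℕ} (hab : a ≤ b) :
    span K (lin π (ell 0) : Set E) ^ a ≤ span K (lin π (ell 0) : Set E) ^ b := by
  refine pow_le_pow_right₀ ?_ hab
  rw [Submodule.one_le]
  exact subset_span (one_mem_lin F H)

lemma lower (i : Fin n) (m : ℕ) :
    m + 1 ≤ Module.finrank K (span K (lin π (ell 0) : Set E) ^ m : Submodule K E) := by
  have h1 : LinearIndependent K fun j : Fin (m + 1) => (π (ell 0))⁻¹ ^ (j : ℕ) :=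
    (linearIndependent_eps F H).comp _ Fin.val_injective
  have h2 : span K (Set.range fun j : Fin (m + 1) => (π (ell 0))⁻¹ ^ (j : ℕ)) ≤
      (span K (lin π (ell 0) : Set E) ^ m : Submodule K E) := by
    rw [span_le]
    rintro _ ⟨j, rfl⟩
    exact span_pow_mono F H (Nat.lt_succ_iff.1 j.2) (pow_mem_pow _ (eps_mem F H i) _)
  have h3 := Submodule.finrank_mono h2
  rwa [finrank_span_eq_card h1, Fintype.card_fin] at h3

variable {ev : Fin c ⊕ Fin 3 → E →ₗ[K] K}
    (hev : ∀ σ p, ev σ (dehomK K π (ell 0) p) = eval (fun i => algebraMap k K (zeta σ i)) p)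
include hev

omit F H in
lemma ev_mul (σ) (m m' : ℕ) : ∀ x ∈ span K (lin π (ell 0) : Set E) ^ m, ∀ y ∈ span K (lin π (ell 0) : Set E) ^ m',
    ev σ (x * y) = ev σ x * ev σ y := by
  intro x hx y hy
  rw [span_lin_pow] at hx hy
  obtain ⟨p, rfl⟩ := span_image_le_range _ _ hx
  obtain ⟨q, rfl⟩ := span_image_le_range _ _ hy
  rw [← map_mul, hev, hev, hev, map_mul]

omit F H in
lemma ev_one (σ) : ev σ 1 = 1 := by
  have := hev σ 1
  rw [map_one (dehomK K π (ell 0))] at this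
  exact this.trans (map_one _)

omit F H in
lemma ev_lin (σ) : ∀ w ∈ lin π (ell 0), ∃ a : k, ev σ w = algebraMap k K a := by
  rintro _ ⟨f, _, rfl⟩
  exact ⟨_, ev_dehom (hev σ) f⟩

lemma ev_eps (i : Fin n) (σ) : ev σ (π (ell 0))⁻¹ = 0 := by
  have h := ev_dehom (hev σ) (ell i.succ)
  rw [dehom_ell_succ F H, map_smul, F.zeta_ell, if_neg (Fin.succ_ne_zero i), map_zero, smul_eq_mul, mul_eq_zero] at h
  exact h.resolve_left (H.base_ne (X_ne_zero i))

lemma ev_surj (m : ℕ) (hm : c + 3 ≤ m) (f : Fin c ⊕ Fin 3 → K) :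
    ∃ x ∈ span K (lin π (ell 0) : Set E) ^ m, ∀ σ, ev σ x = f σ := by
  let ρ : Fin c ⊕ Fin 3 → K := fun σ => algebraMap k K (eval (zeta σ) theta)
  have hρ : Function.Injective ρ := (algebraMap k K).injective.comp F.zeta_theta
  let q := Lagrange.interpolate Finset.univ ρ f
  have hq : q.natDegree < c + 3 := by
    have h := Lagrange.degree_interpolate_lt (s := Finset.univ) f (hρ.injOn)
    rw [Finset.card_univ, Fintype.card_sum, Fintype.card_fin, Fintype.card_fin] at h
    rcases eq_or_ne q 0 with h0 | h0
    · rw [h0]; simp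
    · exact (Polynomial.natDegree_lt_iff_degree_lt h0).2 (by exact_mod_cast h)
  have hθ : dehom π (ell 0) theta ∈ (span K (lin π (ell 0) : Set E)) :=
    subset_span ⟨theta, F.theta_hom, rfl⟩
  refine ⟨Polynomial.aeval (dehom π (ell 0) theta) q, ?_, fun σ => ?_⟩
  · rw [Polynomial.aeval_eq_sum_range]
    refine sum_mem fun i hi => smul_mem _ _ ?_
    refine span_pow_mono F H ?_ (pow_mem_pow _ hθ i)
    have := Finset.mem_range.1 hi
    omega
  · have h1 : Polynomial.aeval (dehom π (ell 0) theta) q =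
        dehomK K π (ell 0) (Polynomial.aeval (map (algebraMap k K) theta) q) := by
      rw [← Polynomial.aeval_algHom_apply, dehomK_map]
    have h2 : eval (fun i => algebraMap k K (zeta σ i)) (map (algebraMap k K) theta) = ρ σ := by
      rw [← hev, dehomK_map, ev_dehom (hev σ)]
    rw [h1, hev, ← coe_aeval_eq_eval, RingHom.coe_coe, ← Polynomial.aeval_algHom_apply]
    rw [← coe_aeval_eq_eval] at h2
    erw [h2]
    rw [Polynomial.coe_aeval_eq_eval]
    exact Lagrange.eval_interpolate_at_node f hρ.injOn (Finset.mem_univ σ)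

lemma ev_linOf (σ) : ∃ v ∈ linOf π (ell 0) J, ev σ v ≠ 0 := by
  obtain ⟨f, hfJ, hf1, hf0⟩ := F.exists_J_one_ne σ
  refine ⟨_, ⟨f, ⟨hfJ, hf1⟩, rfl⟩, ?_⟩
  have := ev_dehom (hev σ) f
  change ev σ (dehom π (ell 0) f) ≠ 0
  rw [this, Ne, FaithfulSMul.algebraMap_eq_zero_iff]
  exact hf0

omit hev in
lemma eps_indep : ∀ v ∈ linOf π (ell 0) J, ∀ a ∈ baseLin k n K, v - 1 ≠ (π (ell 0))⁻¹ * algebraMap K E a := by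
  rintro _ ⟨f, ⟨hfJ, hf1⟩, rfl⟩ _ ⟨a, ha, rfl⟩ h
  have ha' : (aeval (fun i => ell i.succ) a).IsHomogeneous 1 := Forms.isHomogeneous_aeval ha fun i => F.ell_hom _
  have h1 : f - ell 0 = aeval (fun i => ell i.succ) a := by
    apply dehom_injOn F H (IsHomogeneous.sub hf1 (F.ell_hom 0)) ha'
    rw [map_sub, dehom_ell_zero F H, dehom_apply π _ ha', pow_one, ← H.base]
    exact h
  have h2 := congrArg kap h1
  have h3 : aeval (fun i => ell i.succ) a = aeval ell (rename Fin.succ a) := by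
    rw [aeval_rename]; rfl
  rw [h3, map_sub, (F.mem_J f).1 hfJ, F.kap_ell, F.kap_aeval] at h2
  have h4 := congrArg (eval (Pi.single 0 1 : Fin (n + 1) → k)) h2
  rw [eval_rename] at h4
  have h5 : (Pi.single 0 1 : Fin (n + 1) → k) ∘ Fin.succ = 0 := by
    ext i; simp
  have h6 : eval (0 : Fin n → k) a = 0 := by
    have h7 : constantCoeff a = 0 := by
      rw [constantCoeff_eq]
      exact IsHomogeneous.coeff_eq_zero ha (by simp)
    rw [← h7]
    exact RingHom.congr_fun eval_zero a
  rw [h5, h6] at h4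
  simp at h4

end Functions

namespace Forms

lemma natDegree_homogeneousComponent_le {k : Type} [Field k] {n : ℕ} (f : MvPolynomial (Fin (n + 1)) k) (m : ℕ) :
    (finSuccEquiv k n (homogeneousComponent m f)).natDegree ≤ (finSuccEquiv k n f).natDegree := by
  rw [natDegree_finSuccEquiv, natDegree_finSuccEquiv, degreeOf_le_iff]
  intro d hd
  have : d ∈ f.support := by
    rw [mem_support_iff, coeff_homogeneousComponent] at hd
    rw [mem_support_iff]
    intro h
    simp [h] at hd
  exact monomial_le_degreeOf 0 this

end Forms

namespace Functions

variable {k ι : Type} [Field k] [Fintype ι] [DecidableEq ι] {n c N : ℕ}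
    {P J : Ideal (MvPolynomial ι k)} {ell : Fin (n + 1) → MvPolynomial ι k}
    {kap : MvPolynomial ι k →ₐ[k] MvPolynomial (Fin (n + 1)) k}
    {theta : MvPolynomial ι k} {r : MvPolynomial (Fin (n + 1)) k}
    {zeta : Fin c ⊕ Fin 3 → ι → k}
    {K E : Type} [Field K] [Field E] [Algebra (MvPolynomial (Fin n) k) K]
    [IsFractionRing (MvPolynomial (Fin n) k) K] [Algebra k K] [IsScalarTower k (MvPolynomial (Fin n) k) K]
    [Algebra K E] [Algebra k E] [IsScalarTower k K E] {π : MvPolynomial ι k →ₐ[k] E}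

open Submodule

section
variable (F : Frame n c N P J ell kap theta r zeta) (H : Functions P ell K E π)
  {ev : Fin c ⊕ Fin 3 → E →ₗ[K] K}
    (hev : ∀ σ p, ev σ (dehomK K π (ell 0) p) = eval (fun i => algebraMap k K (zeta σ i)) p)
include F H hev

lemma ev_mem_of_eps_mul (j : ℕ) (y : E) (hy : y ∈ span K (lin π (ell 0) : Set E) ^ j)
    (hy' : (π (ell 0))⁻¹ * y ∈ lin π (ell 0) ^ (j + 1)) (σ) : ev σ y ∈ baseLin k n K := by
  rw [span_lin_pow] at hy
  rw [lin_pow] at hy'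
  obtain ⟨G, hG, hGy⟩ := hy'
  obtain ⟨s, κ, b, g, hs, hb, hg, rfl, hrel⟩ := exists_of_mem_span F H (m := j) (T := {f | f.IsHomogeneous j}) (fun f hf => hf) hy
  have hl := H.map_ell_ne F
  have hGy' : (π (ell 0))⁻¹ ^ (j + 1) * π G = (π (ell 0))⁻¹ * ∑ Z ∈ s, κ Z • dehom π (ell 0) Z := by
    rw [← hGy, ← dehom_apply π _ hG]; rfl
  have hP : aeval (fun i => ell i.succ) b * G - ∑ Z ∈ s, aeval (fun i => ell i.succ) (g Z) * Z ∈ P := by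
    rw [← H.ker, map_sub, ← hrel, map_mul, sub_eq_zero]
    have : π G = π (ell 0) ^ j * ∑ Z ∈ s, κ Z • dehom π (ell 0) Z := by
      rw [inv_pow, inv_mul_eq_iff_eq_mul₀ (pow_ne_zero _ hl), pow_succ, mul_assoc, mul_inv_cancel_left₀ hl] at hGy'
      exact hGy'
    rw [this, mul_assoc]
  choose! lam hlam hred using F.red
  let m' : Option (MvPolynomial ι k) → ℕ := fun o => o.elim (j + 1) fun _ => j
  let G' : Option (MvPolynomial ι k) → MvPolynomial ι k := fun o => o.elim G id
  let g' : Option (MvPolynomial ι k) → MvPolynomial (Fin n) k := fun o => o.elim b fun Z => - g Z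
  have hrel2 := F.coeff_relation s.insertNone g' (fun o => lam (m' o) (G' o)) G' (by
    intro o ho
    cases o with
    | none => exact hred _ _ hG
    | some Z => exact hred _ _ (hs (Finset.some_mem_insertNone.1 ho))) (by
    rw [Finset.sum_insertNone]
    simpa [g', G', sub_eq_add_neg] using hP)
  have key : ∀ i < c + 3, algebraMap _ K ((finSuccEquiv k n (lam (j + 1) G i)).coeff (N + j - i)) =
      ∑ Z ∈ s, κ Z * algebraMap k K (eval (Pi.single 0 1) (lam j Z i)) := by
    intro i hi
    have h1 := hrel2 i hi (N + j - i)
    rw [Finset.sum_insertNone] at h1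
    simp only [g', G', m', Option.elim_none, Option.elim_some, neg_mul, Finset.sum_neg_distrib, id] at h1
    rw [← sub_eq_add_neg, sub_eq_zero] at h1
    have h2 := congrArg (algebraMap (MvPolynomial (Fin n) k) K) h1
    rw [map_mul, map_sum] at h2
    refine mul_left_cancel₀ (H.base_ne hb) ?_
    rw [h2, Finset.mul_sum]
    refine Finset.sum_congr rfl fun Z hZ => ?_
    rw [map_mul, hg Z hZ, Forms.finSuccEquiv_coeff_top (hlam j Z (hs hZ) i hi), algebraMap_C, mul_assoc]
  have hη : ∀ i < c + 3, ((finSuccEquiv k n (lam (j + 1) G i)).coeff (N + j - i)).IsHomogeneous 1 := by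
    intro i hi
    have := F.le_N
    exact IsHomogeneous.finSuccEquiv_coeff_isHomogeneous (hlam _ G hG i hi) _ _ (by omega)
  set r0 := eval (Pi.single 0 1 : Fin (n + 1) → k) r with hr0
  have hr0' : algebraMap k K r0 ≠ 0 := by
    rw [Ne, FaithfulSMul.algebraMap_eq_zero_iff]; exact F.r_ne
  have hev1 : algebraMap k K r0 * ev σ (∑ Z ∈ s, κ Z • dehom π (ell 0) Z) = ∑ i ∈ Finset.range (c + 3),
      algebraMap k K (eval (zeta σ) theta ^ i) *
        algebraMap _ K ((finSuccEquiv k n (lam (j + 1) G i)).coeff (N + j - i)) := by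
    rw [map_sum, Finset.mul_sum]
    have h1 : ∀ Z ∈ s, algebraMap k K r0 * ev σ (κ Z • dehom π (ell 0) Z) = ∑ i ∈ Finset.range (c + 3),
        algebraMap k K (eval (zeta σ) theta ^ i) * (κ Z * algebraMap k K (eval (Pi.single 0 1) (lam j Z i))) := by
      intro Z hZ
      rw [map_smul, ev_dehom (hev σ), smul_eq_mul, mul_left_comm, ← map_mul, eval_zeta_red F (hred j Z (hs hZ)) σ,
        map_sum, Finset.mul_sum]
      refine Finset.sum_congr rfl fun i _ => ?_
      rw [map_mul]; ring
    rw [Finset.sum_congr rfl h1, Finset.sum_comm]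
    refine Finset.sum_congr rfl fun i hi => ?_
    rw [key i (Finset.mem_range.1 hi), Finset.mul_sum]
  refine ⟨∑ i ∈ Finset.range (c + 3), (r0⁻¹ * eval (zeta σ) theta ^ i) •
    ((finSuccEquiv k n (lam (j + 1) G i)).coeff (N + j - i)), ?_, ?_⟩
  · exact sum_mem fun i hi => Submodule.smul_mem _ _ (hη i (Finset.mem_range.1 hi))
  · refine mul_left_cancel₀ hr0' ?_
    rw [hev1, map_sum, Finset.mul_sum]
    refine Finset.sum_congr rfl fun i hi => ?_
    rw [map_smul, Algebra.smul_def, map_mul, map_inv₀, ← mul_assoc, mul_inv_cancel_left₀ hr0']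
    rfl

end

section
variable {p : ℕ} {ell : Fin (p + 1 + 1) → MvPolynomial ι k}
    {kap : MvPolynomial ι k →ₐ[k] MvPolynomial (Fin (p + 1 + 1)) k}
    {theta : MvPolynomial ι k} {r : MvPolynomial (Fin (p + 1 + 1)) k}
    {zeta : Fin c ⊕ Fin 3 → ι → k}
    {K E : Type} [Field K] [Field E] [Algebra (MvPolynomial (Fin (p + 1)) k) K]
    [IsFractionRing (MvPolynomial (Fin (p + 1)) k) K] [Algebra k K] [IsScalarTower k (MvPolynomial (Fin (p + 1)) k) K]
    [Algebra K E] [Algebra k E] [IsScalarTower k K E] {π : MvPolynomial ι k →ₐ[k] E}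
    (F : Frame (p + 1) c N P J ell kap theta r zeta) (H : Functions P ell K E π)
include F H

lemma span_linOf_mul_le (m : ℕ) : span K (linOf π (ell 0) J : Set E) * span K (lin π (ell 0) : Set E) ^ m ≤
    span K (dehom π (ell 0) '' {f | f ∈ J ∧ f.IsHomogeneous (m + 1)}) := by
  rw [span_lin_pow, span_mul_span, span_le]
  rintro _ ⟨_, ⟨f, ⟨hfJ, hf1⟩, rfl⟩, _, ⟨g, hg, rfl⟩, rfl⟩
  refine subset_span ⟨f * g, ⟨Ideal.mul_mem_right _ _ hfJ, ?_⟩, map_mul _ _ _⟩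
  have := IsHomogeneous.mul hf1 hg
  rwa [add_comm] at this

lemma eq_zero_of_sum_eps_mem {m : ℕ} (hm : 3 ≤ m) (κ : Fin 4 → K)
    (h : ∑ j, κ j • (π (ell 0))⁻¹ ^ (m + 1 - (j : ℕ)) ∈
      span K (dehom π (ell 0) '' {f | f ∈ J ∧ f.IsHomogeneous (m + 1)})) : κ = 0 := by
  obtain ⟨s, -, b, g, hs, hb, -, -, hrel⟩ := exists_of_mem_span F H (fun f hf => hf.2) h
  obtain ⟨b', hb', q, hq⟩ := H.exists_clear Finset.univ κ
  have hl := H.map_ell_ne F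
  let φ : MvPolynomial (Fin (p + 1 + 1)) k := ∑ j : Fin 4, rename Fin.succ (b * q j) * X 0 ^ (j : ℕ)
  have hren : ∀ f : MvPolynomial (Fin (p + 1)) k, aeval ell (rename Fin.succ f) = aeval (fun i => ell i.succ) f := by
    intro f; rw [aeval_rename]; rfl
  have hφP : aeval ell φ - aeval (fun i => ell i.succ) b' * ∑ Z ∈ s, aeval (fun i => ell i.succ) (g Z) * Z ∈ P := by
    rw [← H.ker, map_sub, map_mul π, ← hrel, sub_eq_zero, map_sum, map_sum, Finset.mul_sum, Finset.mul_sum]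
    refine Finset.sum_congr rfl fun j _ => ?_
    rw [map_mul, hren, map_mul, map_mul, map_mul, map_pow, map_pow, aeval_X, ← H.base (q j), hq j (Finset.mem_univ j), map_mul,
      H.base, Algebra.smul_def]
    have : π (ell 0) ^ (m + 1) = π (ell 0) ^ (j : ℕ) * π (ell 0) ^ (m + 1 - (j : ℕ)) := by
      rw [← pow_add]; congr 1; omega
    rw [this, inv_pow]
    field_simp
  have hφ : φ ∈ (P ⊔ J).comap (aeval ell) := by
    rw [Ideal.mem_comap]
    have h2 : aeval (fun i => ell i.succ) b' * ∑ Z ∈ s, aeval (fun i => ell i.succ) (g Z) * Z ∈ J :=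
      Ideal.mul_mem_left _ _ (sum_mem fun Z hZ => Ideal.mul_mem_left _ _ (hs hZ).1)
    have := add_mem (Submodule.mem_sup_left (T := J) hφP) (Submodule.mem_sup_right (S := P) h2)
    rwa [sub_add_cancel] at this
  have hφS : finSuccEquiv k (p + 1) φ = ∑ j : Fin 4, Polynomial.C (b * q j) * Polynomial.X ^ (j : ℕ) := by
    simp only [φ, map_sum, map_mul, map_pow, Forms.finSuccEquiv_rename_succ, finSuccEquiv_X_zero]
  have hdeg : (finSuccEquiv k (p + 1) φ).natDegree ≤ 3 := by
    rw [hφS]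
    refine Polynomial.natDegree_sum_le_of_forall_le _ _ fun j _ => ?_
    exact (Polynomial.natDegree_C_mul_X_pow_le _ _).trans (by omega)
  have hφ0 : φ = 0 := by
    rw [← sum_homogeneousComponent φ]
    refine Finset.sum_eq_zero fun i _ => ?_
    obtain ⟨t, f, hf, hf0, hfB⟩ := F.psi
    refine Forms.eq_zero_of_natDegree_le _ F.quartic hf hf0 hfB (homogeneousComponent_isHomogeneous i φ) ?_
      ((Forms.natDegree_homogeneousComponent_le φ i).trans hdeg)
    rw [Ideal.mem_comap, ← Forms.homogeneousComponent_algHom (aeval ell) (fun i => by rw [aeval_X]; exact F.ell_hom i)]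
    exact F.sup_hom _ hφ i
  funext j
  have h3 := congrArg (fun f => Polynomial.coeff f (j : ℕ)) hφS
  rw [hφ0] at h3
  simp only [map_zero, Polynomial.coeff_zero, Polynomial.finsetSum_coeff, Polynomial.coeff_C_mul_X_pow] at h3
  have h4 : ∀ x : Fin 4, ((j : ℕ) = (x : ℕ)) ↔ (j = x) := fun x => Fin.ext_iff.symm
  simp only [h4, Finset.sum_ite_eq, Finset.mem_univ, if_true] at h3
  have h5 : q j = 0 := (mul_eq_zero.1 h3.symm).resolve_left hb
  have h6 := hq j (Finset.mem_univ j)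
  rw [h5, map_zero] at h6
  exact (mul_eq_zero.1 h6.symm).resolve_left (H.base_ne hb')

lemma gap {m : ℕ} (hm : 3 ≤ m) :
    Module.finrank K (span K (linOf π (ell 0) J : Set E) * span K (lin π (ell 0) : Set E) ^ m : Submodule K E) + 4
    ≤ Module.finrank K (span K (lin π (ell 0) : Set E) ^ (m + 1) : Submodule K E) := by
  set U := span K (linOf π (ell 0) J : Set E) * span K (lin π (ell 0) : Set E) ^ m with hU
  let ψ : (Fin 4 → K) →ₗ[K] E := Fintype.linearCombination K fun j : Fin 4 => (π (ell 0))⁻¹ ^ (m + 1 - (j : ℕ))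
  have hUle : U ≤ span K (lin π (ell 0) : Set E) ^ (m + 1) := by
    rw [hU, pow_succ']
    exact mul_le_mul' (span_mono (Submodule.map_mono (f := (dehom π (ell 0)).toLinearMap) inf_le_right)) le_rfl
  have hψ : ∀ κ, ψ κ ∈ U → κ = 0 := by
    intro κ hκ
    refine eq_zero_of_sum_eps_mem F H hm κ ?_
    have := span_linOf_mul_le F H m hκ
    rwa [Fintype.linearCombination_apply] at this
  have hinj : Function.Injective ψ := by
    rw [← LinearMap.ker_eq_bot, LinearMap.ker_eq_bot']
    intro κ hκ
    exact hψ κ (by rw [hκ]; exact zero_mem _)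
  have hdisj : LinearMap.range ψ ⊓ U = ⊥ := by
    rw [eq_bot_iff]
    rintro _ ⟨⟨κ, rfl⟩, h2⟩
    rw [hψ κ h2, map_zero]
    exact zero_mem _
  have hle : LinearMap.range ψ ⊔ U ≤ span K (lin π (ell 0) : Set E) ^ (m + 1) := by
    refine sup_le ?_ hUle
    rintro _ ⟨κ, rfl⟩
    rw [Fintype.linearCombination_apply]
    exact sum_mem fun j _ => smul_mem _ _ (span_pow_mono F H (Nat.sub_le _ _) (pow_mem_pow _ (eps_mem F H 0) _))
  have : FiniteDimensional K U := Submodule.finiteDimensional_of_le hUle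
  have h1 := Submodule.finrank_sup_add_finrank_inf_eq (LinearMap.range ψ) U
  rw [hdisj, finrank_bot, LinearMap.finrank_range_of_inj hinj, Module.finrank_pi, Fintype.card_fin] at h1
  have h2 := Submodule.finrank_mono hle
  omega

theorem growth : ∃ ev : Fin c ⊕ Fin 3 → E →ₗ[K] K,
    (∀ σ p, ev σ (dehomK K π (ell 0) p) = eval (fun i => algebraMap k K (zeta σ i)) p) ∧
    FieldGrowth.Growth c (lin π (ell 0)) (linOf π (ell 0) J) (baseLin k (p + 1) K) (π (ell 0))⁻¹ ev := by
  choose ev hev using exists_ev F H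
  have hfin := Forms.finite_homogeneousSubmodule k ι 1
  exact ⟨ev, hev,
    { one_mem := one_mem_lin F H
      V_le := Submodule.map_mono inf_le_right
      finW := Module.Finite.map _ _
      finrank_V := finrank_linOf F H
      lower := lower F H 0
      upper := ⟨_, upper F H⟩
      ev_one := ev_one hev
      ev_mul := ev_mul hev
      surj := ⟨_, fun m hm f => ev_surj F H hev m hm f⟩
      gap := ⟨3, fun m hm => gap F H hm⟩
      ev_V := ev_linOf F H hev
      ev_W := ev_lin hev
      eps_mem := eps_mem F H 0
      ev_eps := ev_eps F H hev 0
      eps_ne := inv_ne_zero (H.map_ell_ne F)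
      eps_mul := ev_mem_of_eps_mul F H hev
      eps_indep := eps_indep F H }⟩

end
end Functions

/-- The linear forms through a linear space organised along a rational normal scroll. -/
structure ScrollData {k ι : Type} [Field k] [Fintype ι] [DecidableEq ι] {n c : ℕ}
    (P J : Ideal (MvPolynomial ι k)) (ell : Fin (n + 1) → MvPolynomial ι k) (zeta : Fin c ⊕ Fin 3 → ι → k)
    (Z : ℕ → MvPolynomial ι k) (lam om : Fin c ⊕ Fin 3 → k) : Prop where
  span_Z : idealPiece k ι J 1 = Submodule.span k (Z '' Set.Iio c)
  scroll : ∀ i j, i + 1 < c → j + 1 < c → Z i * Z (j + 1) - Z (i + 1) * Z j ∈ P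
  eval_Z : ∀ σ, ∀ j < c, eval (zeta σ) (Z j) = om σ * lam σ ^ j
  lam_inj : Function.Injective lam
  om_ne : ∀ σ, om σ ≠ 0
  eval_ne_one : ∀ f ∈ idealPiece k ι J 1, ¬ ∀ σ, eval (zeta σ) f = 1
  vanish : ∀ g ∈ idealPiece k ι J 1 * homogeneousSubmodule ι k 1, (∀ σ, eval (zeta σ) g = 0) →
    ∃ v : Fin n → MvPolynomial ι k, (∀ i, v i ∈ idealPiece k ι J 1) ∧ g - ∑ i, ell i.succ * v i ∈ P

namespace Functions

variable {k ι : Type} [Field k] [Fintype ι] [DecidableEq ι] {c N : ℕ} {P J : Ideal (MvPolynomial ι k)}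
  {p : ℕ} {ell : Fin (p + 1 + 1) → MvPolynomial ι k}
    {kap : MvPolynomial ι k →ₐ[k] MvPolynomial (Fin (p + 1 + 1)) k}
    {theta : MvPolynomial ι k} {r : MvPolynomial (Fin (p + 1 + 1)) k}
    {zeta : Fin c ⊕ Fin 3 → ι → k}
    {K E : Type} [Field K] [Field E] [Algebra (MvPolynomial (Fin (p + 1)) k) K]
    [IsFractionRing (MvPolynomial (Fin (p + 1)) k) K] [Algebra k K] [IsScalarTower k (MvPolynomial (Fin (p + 1)) k) K]
    [Algebra K E] [Algebra k E] [IsScalarTower k K E] {π : MvPolynomial ι k →ₐ[k] E}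
    (F : Frame (p + 1) c N P J ell kap theta r zeta) (H : Functions P ell K E π)
include F H

lemma mem_of_dehom_eq_zero {m : ℕ} {f : MvPolynomial ι k} (hf : f.IsHomogeneous m)
    (h : dehom π (ell 0) f = 0) : f ∈ P := by
  rw [dehom_apply π _ hf, mul_eq_zero] at h
  rw [← H.ker]
  exact h.resolve_left (pow_ne_zero _ (inv_ne_zero (H.map_ell_ne F)))

lemma exists_of_mem_span_eps {x : E} (hx : x ∈ Submodule.span k {y | ∃ a ∈ baseLin k (p + 1) K,
      ∃ v ∈ linOf π (ell 0) J, y = (π (ell 0))⁻¹ * (algebraMap K E a * v)}) :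
    ∃ v : Fin (p + 1) → MvPolynomial ι k, (∀ i, v i ∈ idealPiece k ι J 1) ∧
      x = dehom π (ell 0) (∑ i, ell i.succ * v i) := by
  induction hx using Submodule.span_induction with
  | mem x hx =>
    obtain ⟨_, ⟨a, ha, rfl⟩, _, ⟨f, hf, rfl⟩, rfl⟩ := hx
    refine ⟨fun i => coeff (Finsupp.single i 1) a • f, fun i => Submodule.smul_mem _ _ hf, ?_⟩
    have ha' : a = ∑ i, coeff (Finsupp.single i 1) a • X i := by
      have ha2 : a.IsHomogeneous 1 := ha
      ext d
      rw [coeff_sum]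
      simp only [coeff_smul, coeff_X, smul_eq_mul, mul_ite, mul_one, mul_zero]
      by_cases hd : d.degree = 1
      · obtain ⟨i, rfl⟩ := (Finsupp.range_single_one ▸ hd : d ∈ Set.range fun i => Finsupp.single i 1)
        simp [Finsupp.single_left_inj]
      · rw [IsHomogeneous.coeff_eq_zero ha2 hd]
        refine (Finset.sum_eq_zero fun i _ => ?_).symm
        rw [if_neg]
        rintro rfl
        simp at hd
    have h1 : ∑ i, ell i.succ * (coeff (Finsupp.single i 1) a • f) = aeval (fun i => ell i.succ) a * f := by
      conv_rhs => rw [ha', map_sum, Finset.sum_mul]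
      refine Finset.sum_congr rfl fun i _ => ?_
      rw [map_smul, aeval_X, mul_smul_comm, smul_mul_assoc]
    have h2 : (aeval (fun i => ell i.succ) a).IsHomogeneous 1 := Forms.isHomogeneous_aeval ha fun i => F.ell_hom _
    rw [h1, map_mul, dehom_apply π _ h2, pow_one, ← H.base, mul_assoc]
    rfl
  | zero => exact ⟨0, fun i => zero_mem _, by simp⟩
  | add x y _ _ hx hy =>
    obtain ⟨v, hv, rfl⟩ := hx
    obtain ⟨w, hw, rfl⟩ := hy
    refine ⟨v + w, fun i => add_mem (hv i) (hw i), ?_⟩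
    rw [← map_add, ← Finset.sum_add_distrib]
    simp only [Pi.add_apply, mul_add]
  | smul a x _ hx =>
    obtain ⟨v, hv, rfl⟩ := hx
    refine ⟨a • v, fun i => Submodule.smul_mem _ _ (hv i), ?_⟩
    rw [← map_smul, Finset.smul_sum]
    simp only [Pi.smul_apply, mul_smul_comm]

theorem exists_scrollData [Infinite k] (hc : 4 ≤ c) : ∃ Z lam om, ScrollData P J ell zeta Z lam om := by
  obtain ⟨ev, hev, hG⟩ := growth F H
  obtain ⟨z, lam, om, hV, hz, hevz, hlam, hom⟩ := hG.exists_scroll hc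
  have hz' : ∀ j, ∃ f, j < c → f ∈ idealPiece k ι J 1 ∧ dehom π (ell 0) f = z j := by
    intro j
    by_cases hj : j < c
    · have : z j ∈ linOf π (ell 0) J := by rw [hV]; exact Submodule.subset_span ⟨j, hj, rfl⟩
      obtain ⟨f, hf, hfz⟩ := this
      exact ⟨f, fun _ => ⟨hf, hfz⟩⟩
    · exact ⟨0, fun h => absurd h hj⟩
  choose Z hZ using hz'
  have hmul : ∀ {f g : MvPolynomial ι k}, f ∈ idealPiece k ι J 1 → g ∈ idealPiece k ι J 1 → (f * g).IsHomogeneous 2 :=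
    fun hf hg => IsHomogeneous.mul hf.2 hg.2
  have hinj : ∀ σ f (a : k), ev σ (dehom π (ell 0) f) = algebraMap k K a → eval (zeta σ) f = a := by
    intro σ f a h
    rw [ev_dehom (hev σ)] at h
    exact (algebraMap k K).injective h
  refine ⟨Z, lam, om, ?_, ?_, ?_, hlam, hom, ?_, ?_⟩
  · apply le_antisymm
    · intro f hf
      have h1 : dehom π (ell 0) f ∈ Submodule.span k (z '' Set.Iio c) := by
        rw [← hV]; exact ⟨f, hf, rfl⟩
      have h2 : z '' Set.Iio c = (dehom π (ell 0)).toLinearMap '' (Z '' Set.Iio c) := by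
        rw [Set.image_image]
        exact Set.image_congr fun j hj => ((hZ j hj).2).symm
      rw [h2, ← Submodule.map_span] at h1
      obtain ⟨g, hg, hgf⟩ := h1
      have hgJ : Submodule.span k (Z '' Set.Iio c) ≤ idealPiece k ι J 1 := by
        rw [Submodule.span_le]
        rintro _ ⟨j, hj, rfl⟩
        exact (hZ j hj).1
      have := dehom_injOn F H (hgJ hg).2 hf.2 hgf
      rwa [← this]
    · rw [Submodule.span_le]
      rintro _ ⟨j, hj, rfl⟩
      exact (hZ j hj).1
  · intro i j hi hj
    have hi' := hZ i (by omega)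
    have hj' := hZ j (by omega)
    refine mem_of_dehom_eq_zero F H (m := 2)
      (IsHomogeneous.sub (hmul hi'.1 (hZ _ hj).1) (hmul (hZ _ hi).1 hj'.1)) ?_
    rw [map_sub, map_mul, map_mul, hi'.2, hj'.2, (hZ _ hi).2, (hZ _ hj).2, hz, sub_self]
  · intro σ j hj
    apply hinj
    rw [(hZ j hj).2, hevz σ j hj]
  · intro f hf h
    refine hG.not_ev_eq_one (by omega) (v := dehom π (ell 0) f) ⟨f, hf, rfl⟩ fun σ => ?_
    rw [ev_dehom (hev σ), h, map_one]
  · intro g hg h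
    have hg2 : g.IsHomogeneous 2 := by
      have : g ∈ homogeneousSubmodule ι k 1 * homogeneousSubmodule ι k 1 := (mul_le_mul' (inf_le_right : idealPiece k ι J 1 ≤ homogeneousSubmodule ι k 1) le_rfl) hg
      rw [← pow_two, homogeneousSubmodule_one_pow] at this
      exact this
    have h1 : dehom π (ell 0) g ∈ linOf π (ell 0) J * lin π (ell 0) := by
      rw [linOf, lin, ← Submodule.map_mul]
      exact ⟨g, hg, rfl⟩
    obtain ⟨v, hv, hgv⟩ := exists_of_mem_span_eps F H (hG.mem_eps_smul (by omega) h1 fun σ => by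
      rw [ev_dehom (hev σ), h, map_zero])
    refine ⟨v, hv, mem_of_dehom_eq_zero F H (m := 2) (hg2.sub ?_) (by rw [map_sub, hgv, sub_self])⟩
    exact IsHomogeneous.sum _ _ _ fun i _ => IsHomogeneous.mul (F.ell_hom _) (hv i).2

end Functions

theorem Frame.exists_scrollData {k ι : Type} [Field k] [Infinite k] [Fintype ι] [DecidableEq ι] {c N : ℕ}
    {P J : Ideal (MvPolynomial ι k)} {p : ℕ} {ell : Fin (p + 1 + 1) → MvPolynomial ι k}
    {kap : MvPolynomial ι k →ₐ[k] MvPolynomial (Fin (p + 1 + 1)) k}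
    {theta : MvPolynomial ι k} {r : MvPolynomial (Fin (p + 1 + 1)) k}
    {zeta : Fin c ⊕ Fin 3 → ι → k} (F : Frame (p + 1) c N P J ell kap theta r zeta) (hc : 4 ≤ c) :
    ∃ Z lam om, ScrollData P J ell zeta Z lam om := by
  have := F.prime
  let E := FractionRing (MvPolynomial ι k ⧸ P)
  let R := MvPolynomial (Fin (p + 1)) k
  let π : MvPolynomial ι k →ₐ[k] E := (IsScalarTower.toAlgHom k (MvPolynomial ι k ⧸ P) E).comp (Ideal.Quotient.mkₐ k P)
  have hker : ∀ f, π f = 0 ↔ f ∈ P := by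
    intro f
    rw [← Ideal.Quotient.eq_zero_iff_mem]
    exact FaithfulSMul.algebraMap_eq_zero_iff (MvPolynomial ι k ⧸ P) E
  let φ : R →ₐ[k] E := π.comp (aeval fun i => ell i.succ)
  have hφ : Function.Injective φ := by
    rw [injective_iff_map_eq_zero]
    intro f hf
    have hf' : aeval (fun i => ell i.succ) f ∈ P := (hker _).1 hf
    have hren : aeval (fun i => ell i.succ) f = aeval ell (rename Fin.succ f) := by rw [aeval_rename]; rfl
    rw [hren] at hf'
    have h2 := F.free (fun i => if i = 0 then rename Fin.succ f else 0) (by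
      rw [Finset.sum_eq_single 0]
      · simpa using hf'
      · intro b _ hb; simp [hb]
      · intro h; simp at h) 0 (by omega)
    rw [if_pos rfl] at h2
    exact (map_eq_zero_iff _ (rename_injective _ (Fin.succ_injective _))).1 h2
  let ψ : FractionRing R →+* E := IsFractionRing.lift (g := φ.toRingHom) hφ
  let _ : Algebra (FractionRing R) E := ψ.toAlgebra
  have hψ : ∀ g, algebraMap (FractionRing R) E (algebraMap R _ g) = φ g :=
    fun g => IsFractionRing.lift_algebraMap (g := φ.toRingHom) hφ g
  have : IsScalarTower k (FractionRing R) E := IsScalarTower.of_algebraMap_eq fun a => by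
    rw [IsScalarTower.algebraMap_apply k R (FractionRing R), hψ, AlgHom.commutes]
  exact Functions.exists_scrollData F (K := FractionRing R) (E := E) (π := π) ⟨hker, hψ⟩ hc

namespace ScrollData

lemma degreeLT_le {k : Type} [Field k] {m : ℕ} {Q : Submodule k (Polynomial k)}
    (h : ∀ j < m, (Polynomial.X : Polynomial k) ^ j ∈ Q) : Polynomial.degreeLT k m ≤ Q := by
  classical
  rw [Polynomial.degreeLT_eq_span_X_pow, Submodule.span_le]
  intro x hx
  simp only [Finset.coe_image, Set.mem_image, Finset.coe_range, Set.mem_Iio] at hx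
  obtain ⟨j, hj, rfl⟩ := hx
  exact h j hj

variable {k ι : Type} [Field k] [Fintype ι] [DecidableEq ι] {n c N : ℕ}
    {P J : Ideal (MvPolynomial ι k)} {ell : Fin (n + 1) → MvPolynomial ι k}
    {kap : MvPolynomial ι k →ₐ[k] MvPolynomial (Fin (n + 1)) k}
    {theta : MvPolynomial ι k} {r : MvPolynomial (Fin (n + 1)) k}
    {zeta : Fin c ⊕ Fin 3 → ι → k} {Z : ℕ → MvPolynomial ι k} {lam om : Fin c ⊕ Fin 3 → k}

/-- The linear form attached to a polynomial of degree less than `c`. -/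
def form (Z : ℕ → MvPolynomial ι k) : Polynomial k →ₗ[k] MvPolynomial ι k :=
  (Polynomial.basisMonomials k).constr k Z

/-- The quadratic form attached to a polynomial of degree less than `2 * c - 1`. -/
def form₂ (c : ℕ) (Z : ℕ → MvPolynomial ι k) : Polynomial k →ₗ[k] MvPolynomial ι k :=
  (Polynomial.basisMonomials k).constr k fun j => Z (min j (c - 1)) * Z (j - min j (c - 1))

lemma form_X_pow (j : ℕ) : form Z (Polynomial.X ^ j) = Z j := by
  rw [← Polynomial.monomial_one_right_eq_X_pow, ← congrFun (Polynomial.coe_basisMonomials (R := k)) j, form,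
    Module.Basis.constr_basis]

lemma form₂_X_pow (j : ℕ) : form₂ c Z (Polynomial.X ^ j) = Z (min j (c - 1)) * Z (j - min j (c - 1)) := by
  rw [← Polynomial.monomial_one_right_eq_X_pow, ← congrFun (Polynomial.coe_basisMonomials (R := k)) j, form₂,
    Module.Basis.constr_basis]

variable (D : ScrollData P J ell zeta Z lam om)
include D

lemma Z_mem {j : ℕ} (hj : j < c) : Z j ∈ idealPiece k ι J 1 := by
  rw [D.span_Z]; exact Submodule.subset_span ⟨j, hj, rfl⟩

lemma form_mem {p : Polynomial k} (hp : p ∈ Polynomial.degreeLT k c) : form Z p ∈ idealPiece k ι J 1 := by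
  have : Polynomial.degreeLT k c ≤ (idealPiece k ι J 1).comap (form Z) := degreeLT_le fun j hj => by
    rw [Submodule.mem_comap, form_X_pow]
    exact D.Z_mem hj
  exact this hp

lemma form₂_mem (hc : 1 ≤ c) {p : Polynomial k} (hp : p ∈ Polynomial.degreeLT k (2 * c - 1)) :
    form₂ c Z p ∈ idealPiece k ι J 1 * idealPiece k ι J 1 := by
  have : Polynomial.degreeLT k (2 * c - 1) ≤ (idealPiece k ι J 1 * idealPiece k ι J 1).comap (form₂ c Z) :=
    degreeLT_le fun j hj => by
      rw [Submodule.mem_comap, form₂_X_pow]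
      exact Submodule.mul_mem_mul (D.Z_mem (by omega)) (D.Z_mem (by omega))
  exact this hp

lemma eval_form {p : Polynomial k} (hp : p ∈ Polynomial.degreeLT k c) (σ) :
    eval (zeta σ) (form Z p) = om σ * p.eval (lam σ) := by
  have : Polynomial.degreeLT k c ≤ LinearMap.eqLocus ((aeval (R := k) (zeta σ)).toLinearMap ∘ₗ form Z)
      (om σ • (Polynomial.aeval (R := k) (lam σ)).toLinearMap) := degreeLT_le fun j hj => by
    simp [form_X_pow, D.eval_Z σ j hj]
  have := this hp
  simpa [coe_aeval_eq_eval, Polynomial.coe_aeval_eq_eval] using this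

lemma eval_form₂ (hc : 1 ≤ c) {p : Polynomial k} (hp : p ∈ Polynomial.degreeLT k (2 * c - 1)) (σ) :
    eval (zeta σ) (form₂ c Z p) = om σ * (om σ * p.eval (lam σ)) := by
  have : Polynomial.degreeLT k (2 * c - 1) ≤ LinearMap.eqLocus ((aeval (R := k) (zeta σ)).toLinearMap ∘ₗ form₂ c Z)
      (om σ • om σ • (Polynomial.aeval (R := k) (lam σ)).toLinearMap) := degreeLT_le fun j hj => by
    have h1 : lam σ ^ j = lam σ ^ (min j (c - 1)) * lam σ ^ (j - min j (c - 1)) := by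
      rw [← pow_add]; congr 1; omega
    simp only [LinearMap.mem_eqLocus, LinearMap.comp_apply, form₂_X_pow, LinearMap.smul_apply, AlgHom.toLinearMap_apply,
      map_pow, Polynomial.aeval_X, map_mul]
    change eval (zeta σ) _ * eval (zeta σ) _ = _
    rw [D.eval_Z σ _ (by omega), D.eval_Z σ _ (by omega), h1, smul_eq_mul, smul_eq_mul]
    ring
  have := this hp
  simpa [coe_aeval_eq_eval, Polynomial.coe_aeval_eq_eval] using this

lemma quad_mem {f : MvPolynomial ι k} (hf : f.IsHomogeneous 2) (hP : f ∈ P) :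
    f ∈ Ideal.span (idealPiece k ι P 2 : Set (MvPolynomial ι k)) := Ideal.subset_span ⟨hP, hf⟩

lemma scroll_mem {i j : ℕ} (hi : i + 1 < c) (hj : j + 1 < c) : Z i * Z (j + 1) - Z (i + 1) * Z j ∈
    Ideal.span (idealPiece k ι P 2 : Set (MvPolynomial ι k)) :=
  D.quad_mem (IsHomogeneous.sub (IsHomogeneous.mul (D.Z_mem (by omega)).2 (D.Z_mem hj).2)
    (IsHomogeneous.mul (D.Z_mem hi).2 (D.Z_mem (by omega)).2)) (D.scroll i j hi hj)

lemma mul_sub_mem {i j i' j' : ℕ} (hi : i < c) (hj : j < c) (hi' : i' < c) (hj' : j' < c) (h : i + j = i' + j') :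
    Z i * Z j - Z i' * Z j' ∈ Ideal.span (idealPiece k ι P 2 : Set (MvPolynomial ι k)) := by
  wlog hle : i ≤ i' generalizing i j i' j'
  · have := this hi' hj' hi hj h.symm (by omega)
    rw [← neg_mem_iff, neg_sub]
    exact this
  obtain ⟨d, rfl⟩ := Nat.exists_eq_add_of_le hle
  induction d generalizing j j' with
  | zero =>
    obtain rfl : j = j' := by omega
    simp
  | succ d ih =>
    have h1 := ih (j := j) (j' := j' + 1) hj (by omega) (by omega) (by omega) (by omega)
    have h2 := D.scroll_mem (i := i + d) (j := j') (by omega) (by omega)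
    have := add_mem h1 h2
    rwa [sub_add_sub_cancel] at this

lemma mul_sub_form₂_mem {i j : ℕ} (hi : i < c) (hj : j < c) : Z i * Z j - form₂ c Z (Polynomial.X ^ (i + j)) ∈
    Ideal.span (idealPiece k ι P 2 : Set (MvPolynomial ι k)) := by
  rw [form₂_X_pow]
  exact D.mul_sub_mem hi hj (by omega) (by omega) (by omega)

lemma shift_mem {i j : ℕ} (hi : i < c - 1) (hj : j < 2 * c - 2) :
    Z (i + 1) * form₂ c Z (Polynomial.X ^ j) - Z i * form₂ c Z (Polynomial.X ^ (j + 1)) ∈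
      Ideal.span (idealPiece k ι P 2 : Set (MvPolynomial ι k)) := by
  rw [form₂_X_pow]
  set a := min j (c - 1) with ha
  have h1 := D.mul_sub_form₂_mem (i := a) (j := j - a + 1) (by omega) (by omega)
  have h2 := D.scroll_mem (i := i) (j := j - a) (by omega) (by omega)
  have e : a + (j - a + 1) = j + 1 := by omega
  rw [e] at h1
  have := sub_mem (Ideal.mul_mem_left _ (Z i) h1) (Ideal.mul_mem_left _ (Z a) h2)
  convert this using 1
  ring

end ScrollData

/-- The module over the ring of the coordinates `ell` generated by a family, modulo an ideal. -/
def genSubmodule {k ι α : Type} [Field k] [Fintype α] {n : ℕ} (I : Ideal (MvPolynomial ι k))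
    (ell : Fin (n + 1) → MvPolynomial ι k) (gen : α → MvPolynomial ι k) : Submodule k (MvPolynomial ι k) where
  carrier := {f | ∃ a : α → MvPolynomial (Fin (n + 1)) k, f - ∑ b, aeval ell (a b) * gen b ∈ I}
  zero_mem' := ⟨0, by simp⟩
  add_mem' := by
    rintro f g ⟨a, ha⟩ ⟨b, hb⟩
    refine ⟨a + b, ?_⟩
    have := add_mem ha hb
    convert this using 1
    simp only [Pi.add_apply, map_add, add_mul, Finset.sum_add_distrib]
    ring
  smul_mem' := by
    rintro t f ⟨a, ha⟩
    refine ⟨t • a, ?_⟩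
    have := Submodule.smul_of_tower_mem I t ha
    simpa only [Pi.smul_apply, map_smul, smul_mul_assoc, ← Finset.smul_sum, ← smul_sub] using this

namespace genSubmodule

variable {k ι α : Type} [Field k] [Fintype α] {n : ℕ} {I : Ideal (MvPolynomial ι k)}
    {ell : Fin (n + 1) → MvPolynomial ι k} {gen : α → MvPolynomial ι k}

lemma ideal_le {f : MvPolynomial ι k} (hf : f ∈ I) : f ∈ genSubmodule I ell gen := ⟨0, by simpa using hf⟩

lemma mem_of_sub {f g : MvPolynomial ι k} (h : f - g ∈ I) (hg : g ∈ genSubmodule I ell gen) :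
    f ∈ genSubmodule I ell gen := by
  have := add_mem (ideal_le h) hg
  rwa [sub_add_cancel] at this

lemma gen_mem [DecidableEq α] (b : α) : gen b ∈ genSubmodule I ell gen :=
  ⟨Pi.single b 1, by simp [Pi.single_apply, ite_mul]⟩

lemma aeval_mul_mem (g : MvPolynomial (Fin (n + 1)) k) {f : MvPolynomial ι k} (hf : f ∈ genSubmodule I ell gen) :
    aeval ell g * f ∈ genSubmodule I ell gen := by
  obtain ⟨a, ha⟩ := hf
  refine ⟨fun b => g * a b, ?_⟩
  have := Ideal.mul_mem_left _ (aeval ell g) ha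
  simpa only [map_mul, mul_assoc, ← Finset.mul_sum, ← mul_sub] using this

lemma ell_mul_mem (i : Fin (n + 1)) {f : MvPolynomial ι k} (hf : f ∈ genSubmodule I ell gen) :
    ell i * f ∈ genSubmodule I ell gen := by
  have := aeval_mul_mem (X i) hf
  rwa [aeval_X] at this

lemma mul_mem_of_gen {x : MvPolynomial ι k} (h : ∀ b, x * gen b ∈ genSubmodule I ell gen) {f : MvPolynomial ι k}
    (hf : f ∈ genSubmodule I ell gen) : x * f ∈ genSubmodule I ell gen := by
  obtain ⟨a, ha⟩ := hf
  refine mem_of_sub (g := ∑ b, aeval ell (a b) * (x * gen b)) ?_ (sum_mem fun b _ => aeval_mul_mem _ (h b))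
  have := Ideal.mul_mem_left _ x ha
  convert this using 1
  rw [mul_sub, Finset.mul_sum]
  congr 1
  exact Finset.sum_congr rfl fun b _ => by ring

end genSubmodule

namespace ScrollData

variable {k ι : Type} [Field k] [Fintype ι] [DecidableEq ι] {n c N : ℕ}
    {P J : Ideal (MvPolynomial ι k)} {ell : Fin (n + 1) → MvPolynomial ι k}
    {kap : MvPolynomial ι k →ₐ[k] MvPolynomial (Fin (n + 1)) k}
    {theta : MvPolynomial ι k} {r : MvPolynomial (Fin (n + 1)) k}
    {zeta : Fin c ⊕ Fin 3 → ι → k} {Z : ℕ → MvPolynomial ι k} {lam om : Fin c ⊕ Fin 3 → k}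

/-- The constant `1`, a basis of linear forms and three quadratic forms. -/
def gens (c : ℕ) (Z : ℕ → MvPolynomial ι k) (g : Fin 3 → Polynomial k) :
    Option (Fin c ⊕ Fin 3) → MvPolynomial ι k
  | none => 1
  | some (Sum.inl j) => Z j
  | some (Sum.inr i) => form₂ c Z (g i)

variable (F : Frame n c N P J ell kap theta r zeta) (D : ScrollData P J ell zeta Z lam om)

section

variable {g : Fin 3 → Polynomial k}

local notation "QI" => Ideal.span (idealPiece k ι P 2 : Set (MvPolynomial ι k))
local notation "M" => genSubmodule QI ell (gens c Z g)

include D in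
lemma linear_mem {f : MvPolynomial ι k} (hf : f ∈ idealPiece k ι J 1) : f ∈ M := by
  have h : idealPiece k ι J 1 ≤ M := by
    rw [D.span_Z, Submodule.span_le]
    rintro _ ⟨j, hj, rfl⟩
    exact genSubmodule.gen_mem (some (Sum.inl ⟨j, hj⟩)) (gen := gens c Z g)
  exact h hf

include F D in
/-- A quadratic form whose values at the frame points are those of a linear form. -/
lemma form₂_sub_mem (hc : 1 ≤ c) {h p : Polynomial k} (hh : h ∈ Polynomial.degreeLT k (2 * c - 1))
    (hp : p ∈ Polynomial.degreeLT k c) (e : ∀ σ, om σ * h.eval (lam σ) = p.eval (lam σ)) :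
    ∃ v : Fin (n + 1) → MvPolynomial ι k, (∀ i, v i ∈ idealPiece k ι J 1) ∧
      form₂ c Z h - ∑ i, ell i * v i ∈ QI := by
  have h1 := D.form₂_mem hc hh
  have h2 := D.form_mem hp
  have h3 : form₂ c Z h - form Z p * ell 0 ∈ idealPiece k ι J 1 * homogeneousSubmodule ι k 1 :=
    sub_mem ((mul_le_mul' le_rfl inf_le_right :
      idealPiece k ι J 1 * idealPiece k ι J 1 ≤ idealPiece k ι J 1 * homogeneousSubmodule ι k 1) h1) (Submodule.mul_mem_mul h2 (F.ell_hom 0))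
  have h4 : ∀ σ, eval (zeta σ) (form₂ c Z h - form Z p * ell 0) = 0 := fun σ => by
    rw [map_sub, map_mul, D.eval_form₂ hc hh, D.eval_form hp, F.zeta_ell, e]
    simp
  obtain ⟨v, hv, hv'⟩ := D.vanish _ h3 h4
  refine ⟨Fin.cons (form Z p) v, fun i => ?_, ?_⟩
  · induction i using Fin.cases with
    | zero => exact h2
    | succ i => exact hv i
  · have e1 : form₂ c Z h - ∑ i, ell i * (Fin.cons (form Z p) v : Fin (n + 1) → MvPolynomial ι k) i =
        form₂ c Z h - form Z p * ell 0 - ∑ i, ell (Fin.succ i) * v i := by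
      rw [Fin.sum_univ_succ]
      simp only [Fin.cons_zero, Fin.cons_succ]
      ring
    have h5 : idealPiece k ι J 1 * homogeneousSubmodule ι k 1 ≤ homogeneousSubmodule ι k 2 :=
      Submodule.mul_le.2 fun a ha b hb => IsHomogeneous.mul ha.2 hb
    rw [e1]
    exact D.quad_mem (IsHomogeneous.sub (h5 h3)
      (IsHomogeneous.sum _ _ _ fun i _ => IsHomogeneous.mul (F.ell_hom _) (hv i).2)) hv'

include F D in
lemma form₂_mem_of_values (hc : 1 ≤ c) {h p : Polynomial k} (hh : h ∈ Polynomial.degreeLT k (2 * c - 1))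
    (hp : p ∈ Polynomial.degreeLT k c) (e : ∀ σ, om σ * h.eval (lam σ) = p.eval (lam σ)) : form₂ c Z h ∈ M := by
  obtain ⟨v, hv, hv'⟩ := form₂_sub_mem F D hc hh hp e
  exact genSubmodule.mem_of_sub hv' (sum_mem fun i _ => genSubmodule.ell_mul_mem _ (D.linear_mem (hv i)))

variable (hg : ∀ i, g i ∈ Polynomial.degreeLT k (2 * c - 1))
  (hg' : ∀ h ∈ Polynomial.degreeLT k (2 * c - 1), ∃ a : Fin 3 → k, ∃ p ∈ Polynomial.degreeLT k c,
    ∀ i, om i * (h - ∑ j, a j • g j).eval (lam i) = p.eval (lam i))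
include F D hg hg'

lemma form₂_mem_genSubmodule (hc : 1 ≤ c) {h : Polynomial k} (hh : h ∈ Polynomial.degreeLT k (2 * c - 1)) :
    form₂ c Z h ∈ M := by
  obtain ⟨a, p, hp, e⟩ := hg' h hh
  have h1 : ∑ j, a j • g j ∈ Polynomial.degreeLT k (2 * c - 1) :=
    sum_mem fun j _ => Submodule.smul_mem _ _ (hg j)
  have h2 := form₂_mem_of_values F D (g := g) hc (sub_mem hh h1) hp e
  have h3 : form₂ c Z (∑ j, a j • g j) ∈ M := by
    rw [map_sum]
    refine sum_mem fun j _ => ?_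
    rw [map_smul]
    exact Submodule.smul_mem _ _ (genSubmodule.gen_mem (some (Sum.inr j)) (gen := gens c Z g))
  have := add_mem h2 h3
  rwa [← map_add, sub_add_cancel] at this

lemma linear_mul_linear_mem (hc : 1 ≤ c) {v w : MvPolynomial ι k} (hv : v ∈ idealPiece k ι J 1)
    (hw : w ∈ idealPiece k ι J 1) : v * w ∈ M := by
  have h : idealPiece k ι J 1 * idealPiece k ι J 1 ≤ M := by
    rw [D.span_Z, Submodule.span_mul_span, Submodule.span_le]
    rintro _ ⟨_, ⟨i, hi, rfl⟩, _, ⟨j, hj, rfl⟩, rfl⟩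
    refine genSubmodule.mem_of_sub (D.mul_sub_form₂_mem hi hj) (form₂_mem_genSubmodule F D hg hg' hc ?_)
    rw [Polynomial.mem_degreeLT, Polynomial.degree_X_pow]
    simp only [Set.mem_Iio] at hi hj
    exact_mod_cast (by omega : i + j < 2 * c - 1)
  exact h (Submodule.mul_mem_mul hv hw)

lemma Z_mul_form₂_mem (hc : 4 ≤ c) {i j : ℕ} (hi : i < c) (hj : j < 2 * c - 1) :
    Z i * form₂ c Z (Polynomial.X ^ j) ∈ M := by
  by_contra hcon
  obtain ⟨χ, h1, h2⟩ := Submodule.exists_le_ker_of_notMem hcon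
  have hM : ∀ x ∈ M, χ x = 0 := fun x hx => h2 hx
  let β : Polynomial k →ₗ[k] Polynomial k →ₗ[k] k :=
    (((LinearMap.mul k (MvPolynomial ι k)).compl₁₂ (form Z) (form₂ c Z)).compr₂ χ)
  have hβ : ∀ p q, β p q = χ (form Z p * form₂ c Z q) := fun p q => rfl
  have := PointsOnLine.bilin_eq_zero D.lam_inj D.om_ne hc (by simp) ?_ β ?_ ?_ i hi j hj
  · rw [hβ, form_X_pow] at this
    exact h1 this
  · rintro ⟨p, hp, e⟩
    exact D.eval_ne_one _ (D.form_mem hp) fun σ => by rw [D.eval_form hp, e]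
  · rintro p hp h hh ⟨q, hq, e⟩
    rw [hβ]
    obtain ⟨v, hv, hv'⟩ := form₂_sub_mem F D (by omega) hh hq e
    refine hM _ (genSubmodule.mem_of_sub (g := ∑ i, ell i * (form Z p * v i)) ?_ (sum_mem fun i _ =>
      genSubmodule.ell_mul_mem _ (linear_mul_linear_mem F D hg hg' (by omega) (D.form_mem hp) (hv i))))
    have := Ideal.mul_mem_left _ (form Z p) hv'
    convert this using 1
    rw [mul_sub, Finset.mul_sum]
    congr 1
    exact Finset.sum_congr rfl fun b _ => by ring
  · intro i hi j hj
    rw [hβ, hβ, form_X_pow, form_X_pow, ← sub_eq_zero, ← map_sub]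
    exact hM _ (genSubmodule.ideal_le (D.shift_mem hi hj))

lemma genSubmodule_eq_top (hc : 4 ≤ c) : M = ⊤ := by
  have hV : ∀ v ∈ idealPiece k ι J 1, ∀ f ∈ M, v * f ∈ M := by
    intro v hv f hf
    refine genSubmodule.mul_mem_of_gen (fun b => ?_) hf
    have hlin : ∀ w ∈ idealPiece k ι J 1, v * w ∈ M :=
      fun w hw => linear_mul_linear_mem F D hg hg' (by omega) hv hw
    match b with
    | none => simpa only [gens, mul_one] using D.linear_mem hv
    | some (Sum.inl j) => exact hlin _ (D.Z_mem j.2)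
    | some (Sum.inr i) =>
      have h : idealPiece k ι J 1 ≤ (M).comap (LinearMap.mulRight k (form₂ c Z (g i))) := by
        rw [D.span_Z, Submodule.span_le]
        rintro _ ⟨a, ha, rfl⟩
        have : Polynomial.degreeLT k (2 * c - 1) ≤ (M).comap (LinearMap.mulLeft k (Z a) ∘ₗ form₂ c Z) :=
          degreeLT_le fun j hj => Z_mul_form₂_mem F D hg hg' hc ha hj
        exact this (hg i)
      exact h hv
  have hX : ∀ i, ∀ f ∈ M, X i * f ∈ M := by
    intro i f hf
    have e : (X i : MvPolynomial ι k) * f = aeval ell (kap (X i)) * f + (X i - aeval ell (kap (X i))) * f := by ring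
    rw [e]
    refine add_mem (genSubmodule.aeval_mul_mem _ hf) (hV _ ⟨F.sub_mem_J _, ?_⟩ f hf)
    exact IsHomogeneous.sub (isHomogeneous_X _ _)
      (F.aeval_homogeneous (F.kap_homogeneous (isHomogeneous_X _ _)))
  have h1 : (1 : MvPolynomial ι k) ∈ M := genSubmodule.gen_mem none (gen := gens c Z g)
  refine eq_top_iff.2 fun f _ => ?_
  induction f using MvPolynomial.induction_on with
  | C a => rw [← mul_one (C a), ← smul_eq_C_mul]; exact Submodule.smul_mem _ _ h1
  | add p q hp hq => exact add_mem (hp trivial) (hq trivial)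
  | mul_X p i hp => rw [mul_comm]; exact hX i p (hp trivial)

end

include F D in
theorem exists_generators (hc : 4 ≤ c) : ∃ g : Fin 3 → Polynomial k,
    (∀ i, g i ∈ Polynomial.degreeLT k (2 * c - 1)) ∧
    genSubmodule (Ideal.span (idealPiece k ι P 2 : Set (MvPolynomial ι k))) ell (gens c Z g) = ⊤ := by
  obtain ⟨g, hg, hg'⟩ := PointsOnLine.exists_three (om := om) D.lam_inj (c := c) (m := 2 * c - 1) (by simp)
  exact ⟨g, hg, genSubmodule_eq_top F D hg hg' hc⟩

end ScrollData

namespace RankBound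

variable {R α β : Type} [CommRing R] [IsDomain R] [Fintype α] [Fintype β] {K : Submodule R (α → R)}
  {A : β → α → R}

lemma rank_add_card_le (h : ∀ x : β → R, ∑ j, x j • A j ∈ K → x = 0) :
    Module.rank R K + Fintype.card β ≤ Fintype.card α := by
  have h1 : LinearIndependent R fun j => K.mkQ (A j) := by
    rw [Fintype.linearIndependent_iff]
    intro x hx
    have : K.mkQ (∑ j, x j • A j) = 0 := by simpa only [map_sum, map_smul] using hx
    rw [Submodule.mkQ_apply, Submodule.Quotient.mk_eq_zero] at this
    exact fun i => congrFun (h x this) i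
  have h2 := h1.cardinal_le_rank
  have h3 := rank_quotient_add_rank_of_isDomain K
  rw [rank_fun'] at h3
  rw [Cardinal.mk_fintype] at h2
  rw [← h3, add_comm]
  gcongr

lemma eq_zero_of_card_eq (hcard : Fintype.card β = Fintype.card α)
    (h : ∀ x : β → R, ∑ j, x j • A j ∈ K → x = 0) {v : α → R} (hv : v ∈ K) : v = 0 := by
  by_contra h0
  have h1 : LinearIndependent R ((↑) : ({⟨v, hv⟩} : Set K) → K) :=
    LinearIndepOn.singleton (i := (⟨v, hv⟩ : K)) (v := id) (by simpa [Subtype.ext_iff] using h0)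
  have h2 := h1.cardinal_le_rank
  have h3 := rank_add_card_le h
  have h4 : Module.rank R K ≠ 0 := by
    intro h4
    rw [h4] at h2
    simp at h2
  have h5 := Cardinal.one_le_iff_ne_zero.2 h4
  have h6 : (1 : Cardinal) + Fintype.card β ≤ Fintype.card α := le_trans (by gcongr) h3
  rw [hcard] at h6
  have h7 : 1 + Fintype.card α ≤ Fintype.card α := by exact_mod_cast h6
  omega

lemma mul_comm_of_card_eq (hcard : Fintype.card β + 1 = Fintype.card α)
    (h : ∀ x : β → R, ∑ j, x j • A j ∈ K → x = 0) {v w : α → R} (hv : v ∈ K) (hw : w ∈ K) (a b : α) :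
    v a * w b = v b * w a := by
  by_contra h0
  have h1 : LinearIndependent R ![(⟨v, hv⟩ : K), ⟨w, hw⟩] := by
    rw [LinearIndependent.pair_iff]
    intro s t hst
    have e : ∀ a, s * v a + t * w a = 0 := fun a => congrFun (congrArg Subtype.val hst) a
    have h2 : v a * w b - v b * w a ≠ 0 := sub_ne_zero.2 h0
    refine ⟨(mul_eq_zero_iff_right h2).1 ?_, (mul_eq_zero_iff_right h2).1 ?_⟩
    · linear_combination w b * e a - w a * e b
    · linear_combination v a * e b - v b * e a
  have h2 := h1.cardinal_le_rank
  have h3 := rank_add_card_le h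
  have h6 : (2 : Cardinal) + Fintype.card β ≤ Fintype.card α := le_trans (by gcongr; simpa using h2) h3
  have h7 : 2 + Fintype.card β ≤ Fintype.card α := by exact_mod_cast h6
  omega

end RankBound

/-- The submodule of relations modulo an ideal among a family. -/
def relSubmodule {k ι α : Type} [Field k] [Fintype α] {n : ℕ} (I : Ideal (MvPolynomial ι k))
    (ell : Fin (n + 1) → MvPolynomial ι k) (gen : α → MvPolynomial ι k) :
    Submodule (MvPolynomial (Fin (n + 1)) k) (α → MvPolynomial (Fin (n + 1)) k) where
  carrier := {a | ∑ b, aeval ell (a b) * gen b ∈ I}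
  zero_mem' := by simp
  add_mem' := by
    intro a b ha hb
    simp only [Set.mem_ofPred_eq, Pi.add_apply, map_add, add_mul, Finset.sum_add_distrib] at *
    exact add_mem ha hb
  smul_mem' := by
    intro x a ha
    simp only [Set.mem_ofPred_eq, Pi.smul_apply, smul_eq_mul, map_mul, mul_assoc, ← Finset.mul_sum] at *
    exact Ideal.mul_mem_left _ _ ha

namespace relSubmodule

variable {k ι α β : Type} [Field k] [Fintype α] [Fintype β] {n : ℕ} {I : Ideal (MvPolynomial ι k)}
    {ell : Fin (n + 1) → MvPolynomial ι k} {gen : α → MvPolynomial ι k}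

lemma sum_smul_mem_iff {e : β → MvPolynomial ι k} {A : β → α → MvPolynomial (Fin (n + 1)) k}
    (hA : ∀ j, e j - ∑ b, aeval ell (A j b) * gen b ∈ I) (x : β → MvPolynomial (Fin (n + 1)) k) :
    ∑ j, x j • A j ∈ relSubmodule I ell gen ↔ ∑ j, aeval ell (x j) * e j ∈ I := by
  have h : ∑ j, aeval ell (x j) * (e j - ∑ b, aeval ell (A j b) * gen b) ∈ I :=
    sum_mem fun j _ => Ideal.mul_mem_left _ _ (hA j)
  have e1 : ∑ b, aeval ell ((∑ j, x j • A j) b) * gen b =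
      ∑ j, aeval ell (x j) * ∑ b, aeval ell (A j b) * gen b := by
    simp only [Finset.sum_apply, Pi.smul_apply, smul_eq_mul, map_sum, map_mul, Finset.sum_mul, Finset.mul_sum]
    rw [Finset.sum_comm]
    simp only [mul_assoc]
  change ∑ b, aeval ell ((∑ j, x j • A j) b) * gen b ∈ I ↔ _
  rw [e1]
  simp only [mul_sub, Finset.sum_sub_distrib] at h
  exact ⟨fun h' => by simpa using add_mem h h', fun h' => by simpa using sub_mem h' h⟩

end relSubmodule

section

variable {k ι : Type} [Field k] [Fintype ι] [DecidableEq ι] {n c N : ℕ}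
    {P J : Ideal (MvPolynomial ι k)} {ell : Fin (n + 1) → MvPolynomial ι k}
    {kap : MvPolynomial ι k →ₐ[k] MvPolynomial (Fin (n + 1)) k}
    {theta : MvPolynomial ι k} {r : MvPolynomial (Fin (n + 1)) k}
    {zeta : Fin c ⊕ Fin 3 → ι → k} {Z : ℕ → MvPolynomial ι k} {lam om : Fin c ⊕ Fin 3 → k}

namespace Frame

variable (F : Frame n c N P J ell kap theta r zeta)
include F

lemma mem_J_of_degree_le (hn : 1 ≤ n) {i : ℕ} (hi : i ≤ 3) {f : MvPolynomial ι k} (hf : f.IsHomogeneous i)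
    (hP : f ∈ P) : f ∈ J := by
  rw [F.mem_J]
  refine Forms.eq_zero_of_degree_le hn _ F.quartic hi (F.kap_homogeneous hf) ?_
  rw [Ideal.mem_comap]
  have := sub_mem (Submodule.mem_sup_left (T := J) hP) (Submodule.mem_sup_right (S := P) (F.sub_mem_J f))
  rwa [sub_sub_cancel] at this

lemma exists_mem_notMem : ∃ w ∈ P, w ∉ J := by
  obtain ⟨s, f, -, hf, hf'⟩ := F.psi
  obtain ⟨p, hp, j, hj, e⟩ := Submodule.mem_sup.1 hf'
  refine ⟨p, hp, fun hpJ => hf ?_⟩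
  have h := add_mem hpJ hj
  rw [e, F.mem_J, F.kap_aeval] at h
  rw [h, map_zero]

lemma span_le_inf (hn : 1 ≤ n) : Ideal.span (idealPiece k ι P 2 : Set (MvPolynomial ι k)) ≤ P ⊓ J :=
  Ideal.span_le.2 fun _ hf => ⟨hf.1, F.mem_J_of_degree_le hn (by norm_num) hf.2 hf.1⟩

variable (D : ScrollData P J ell zeta Z lam om)
include D

lemma relSubmodule_inf_eq (hc : 4 ≤ c) {gen : Option (Fin c ⊕ Fin 3) → MvPolynomial ι k}
    {I : Ideal (MvPolynomial ι k)} (hI : I ≤ P ⊓ J) (htop : genSubmodule I ell gen = ⊤)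
    {a : Option (Fin c ⊕ Fin 3) → MvPolynomial (Fin (n + 1)) k} (ha : ∑ b, aeval ell (a b) * gen b ∈ P ⊓ J) :
    a = 0 := by
  obtain ⟨w, hw, hw'⟩ := F.exists_mem_notMem
  have hv := D.Z_mem (j := 0) (by omega)
  have hvP : Z 0 ∉ P := fun h => by
    have h1 := D.eval_Z (Sum.inr 0) 0 (by omega)
    rw [F.P_one _ h hv.2, map_zero, pow_zero, mul_one] at h1
    exact D.om_ne _ h1.symm
  let e : Option (Fin (c + 3)) → MvPolynomial ι k := fun j => j.elim w fun i => theta ^ (i : ℕ) * Z 0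
  have hA : ∀ j, ∃ A : Option (Fin c ⊕ Fin 3) → MvPolynomial (Fin (n + 1)) k,
      e j - ∑ b, aeval ell (A b) * gen b ∈ I := fun j => by
    have : e j ∈ genSubmodule I ell gen := by rw [htop]; trivial
    exact this
  choose A hA using hA
  refine RankBound.eq_zero_of_card_eq (K := relSubmodule (P ⊓ J) ell gen) (A := A) (by simp) (fun x hx => ?_) ha
  rw [relSubmodule.sum_smul_mem_iff fun j => hI (hA j)] at hx
  rw [Fintype.sum_option] at hx
  simp only [e, Option.elim_none, Option.elim_some] at hx
  have hz : ∀ i : Fin (c + 3), x (some i) = 0 := by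
    have h1 : (∑ i : Fin (c + 3), aeval ell (x (some i)) * theta ^ (i : ℕ)) * Z 0 ∈ P := by
      rw [Finset.sum_mul]
      have := sub_mem hx.1 (Ideal.mul_mem_left _ (aeval ell (x none)) hw)
      simpa only [add_sub_cancel_left, mul_assoc] using this
    have h2 := (F.prime.mem_or_mem h1).resolve_right hvP
    rw [Fin.sum_univ_eq_sum_range (fun i => aeval ell (if h : i < c + 3 then x (some ⟨i, h⟩) else 0) * theta ^ i)
      (c + 3) |>.symm.trans (Finset.sum_congr rfl fun i _ => by simp) |> Eq.symm] at h2
    intro i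
    simpa using F.free _ h2 i i.2
  have hn : x none = 0 := by
    have h1 : aeval ell (x none) * w + _ ∈ J := hx.2
    simp only [hz, map_zero, zero_mul, Finset.sum_const_zero, add_zero] at h1
    rw [F.mem_J, map_mul, F.kap_aeval] at h1
    exact (mul_eq_zero.1 h1).resolve_right fun h => hw' ((F.mem_J w).2 h)
  funext j
  cases j with
  | none => exact hn
  | some i => exact hz i

/-- The quadrics through the variety generate the ideal of its union with the linear space. -/
theorem span_eq_inf (hn : 1 ≤ n) (hc : 4 ≤ c) :
    Ideal.span (idealPiece k ι P 2 : Set (MvPolynomial ι k)) = P ⊓ J := by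
  obtain ⟨g, hg, htop⟩ := ScrollData.exists_generators F D hc
  refine le_antisymm (F.span_le_inf hn) fun f hf => ?_
  have h : f ∈ genSubmodule (Ideal.span (idealPiece k ι P 2 : Set (MvPolynomial ι k))) ell
    (ScrollData.gens c Z g) := by rw [htop]; trivial
  obtain ⟨a, ha⟩ := h
  have h1 := sub_mem hf (F.span_le_inf hn ha)
  rw [sub_sub_cancel] at h1
  have h2 := F.relSubmodule_inf_eq D hc (F.span_le_inf hn) htop h1
  simpa [h2] using ha

end Frame

end

namespace Forms

lemma homogeneousComponent_mul_of_isHomogeneous {k ι : Type} [Field k] {b : MvPolynomial ι k} {d : ℕ}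
    (hb : b.IsHomogeneous d) (f : MvPolynomial ι k) (m : ℕ) :
    homogeneousComponent m (f * b) = if d ≤ m then homogeneousComponent (m - d) f * b else 0 := by
  conv_lhs => rw [← sum_homogeneousComponent f]
  rw [Finset.sum_mul, map_sum]
  have h1 : ∀ i, homogeneousComponent m (homogeneousComponent i f * b) =
      if m = i + d then homogeneousComponent i f * b else 0 := fun i =>
    homogeneousComponent_of_mem (IsHomogeneous.mul (homogeneousComponent_isHomogeneous i f) hb)
  simp only [h1]
  split_ifs with h
  · rw [Finset.sum_eq_single (m - d)]
    · rw [if_pos (by omega)]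
    · intro i _ hi
      rw [if_neg (by omega)]
    · intro hi
      rw [Finset.mem_range, not_lt] at hi
      rw [homogeneousComponent_eq_zero _ _ (by omega), zero_mul, ite_self]
  · exact Finset.sum_eq_zero fun i _ => by rw [if_neg (by omega)]

/-- Setting some of the coordinates equal to zero. -/
def kill {k κ : Type} [Field k] (T : Set κ) : MvPolynomial κ k →ₐ[k] MvPolynomial κ k :=
  open Classical in aeval fun i => if i ∈ T then 0 else X i

section

variable {k κ : Type} [Field k] {T : Set κ}

lemma sub_kill_mem (f : MvPolynomial κ k) : f - kill T f ∈ Ideal.span (X '' T : Set (MvPolynomial κ k)) := by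
  have h : (Ideal.Quotient.mkₐ k (Ideal.span (X '' T : Set (MvPolynomial κ k)))).comp (kill T) =
      Ideal.Quotient.mkₐ k _ := by
    ext i
    simp only [AlgHom.comp_apply, kill, aeval_X]
    split_ifs with hi
    · rw [map_zero, eq_comm]
      exact Ideal.Quotient.eq_zero_iff_mem.2 (Ideal.subset_span ⟨i, hi, rfl⟩)
    · rfl
  exact Ideal.Quotient.eq.1 (DFunLike.congr_fun h f).symm

lemma mem_span_X_iff {f : MvPolynomial κ k} : f ∈ Ideal.span (X '' T : Set (MvPolynomial κ k)) ↔ kill T f = 0 := by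
  refine ⟨fun h => ?_, fun h => by simpa [h] using sub_kill_mem (T := T) f⟩
  have : Ideal.span (X '' T : Set (MvPolynomial κ k)) ≤ RingHom.ker (kill T) := by
    rw [Ideal.span_le]
    rintro _ ⟨i, hi, rfl⟩
    simp [kill, hi]
  exact this h

lemma kill_X {i : κ} (hi : i ∉ T) : kill T (X i : MvPolynomial κ k) = X i := by simp [kill, hi]

lemma mem_span_X_univ [Finite κ] {f : MvPolynomial κ k} {m : ℕ} (hm : m ≠ 0) (hf : f.IsHomogeneous m) :
    f ∈ Ideal.span (X '' (Set.univ : Set κ) : Set (MvPolynomial κ k)) := by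
  rw [mem_span_X_iff]
  have h : kill (Set.univ : Set κ) f = C (eval 0 f) := by
    have : kill (k := k) (Set.univ : Set κ) = (Algebra.ofId k _).comp (aeval (R := k) (0 : κ → k)) := by
      ext i
      simp [kill]
    rw [this]
    rfl
  rw [h, eval_zero, constantCoeff_eq, hf.coeff_eq_zero (by simpa using hm.symm), C_0]

lemma eval_eq_zero_of_mem_span_X {f : MvPolynomial κ k} (hf : f ∈ Ideal.span (X '' T : Set (MvPolynomial κ k)))
    {x : κ → k} (hx : ∀ i ∈ T, x i = 0) : eval x f = 0 := by
  have : Ideal.span (X '' T : Set (MvPolynomial κ k)) ≤ RingHom.ker (eval x) := by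
    rw [Ideal.span_le]
    rintro _ ⟨i, hi, rfl⟩
    simp [hx i hi]
  exact this hf

lemma kill_kill (f : MvPolynomial κ k) : kill T (kill T f) = kill T f := by
  have := mem_span_X_iff.1 (sub_kill_mem (T := T) f)
  rw [map_sub, sub_eq_zero] at this
  exact this.symm

lemma aeval_mem_span_image {ι : Type} (ell : κ → MvPolynomial ι k) {g : MvPolynomial κ k}
    (hg : g ∈ Ideal.span (X '' T : Set (MvPolynomial κ k))) : aeval ell g ∈ Ideal.span (ell '' T) := by
  have : Ideal.span (X '' T : Set (MvPolynomial κ k)) ≤ (Ideal.span (ell '' T)).comap (aeval (R := k) ell) := by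
    rw [Ideal.span_le]
    rintro _ ⟨i, hi, rfl⟩
    change aeval ell (X i) ∈ Ideal.span (ell '' T)
    rw [aeval_X]
    exact Ideal.subset_span ⟨i, hi, rfl⟩
  exact this hg

lemma ker_constantCoeff_le {I : Ideal (MvPolynomial κ k)} (h : ∀ i, X i ∈ I) :
    RingHom.ker (constantCoeff (R := k) (σ := κ)) ≤ I := by
  intro f hf
  have h1 : f - C (constantCoeff f) ∈ I := by
    clear hf
    induction f using MvPolynomial.induction_on with
    | C a => simp
    | add p q hp hq =>
      have := add_mem hp hq
      rwa [map_add, map_add, add_sub_add_comm]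
    | mul_X p i _ => simpa using Ideal.mul_mem_left _ p (h i)
  rwa [show constantCoeff f = 0 from hf, C_0, sub_zero] at h1

lemma mul_mem_of_mem_ker_constantCoeff {Q : Ideal (MvPolynomial κ k)} {t : MvPolynomial κ k}
    (h : ∀ i, X i * t ∈ Q) {a : MvPolynomial κ k} (ha : a ∈ RingHom.ker (constantCoeff (R := k) (σ := κ))) :
    a * t ∈ Q :=
  ker_constantCoeff_le (I := Submodule.comap (LinearMap.mulRight (MvPolynomial κ k) t) Q) h ha

end

end Forms

namespace genSubmodule

variable {k ι α : Type} [Field k] [Fintype α] {n : ℕ} {I : Ideal (MvPolynomial ι k)}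
    {ell : Fin (n + 1) → MvPolynomial ι k} {gen : α → MvPolynomial ι k}

lemma exists_homogeneous (hI : ∀ f ∈ I, ∀ m, homogeneousComponent m f ∈ I) (hell : ∀ i, (ell i).IsHomogeneous 1)
    {deg : α → ℕ} (hgen : ∀ b, (gen b).IsHomogeneous (deg b)) {m : ℕ} {f : MvPolynomial ι k}
    (hf : f.IsHomogeneous m) (hf' : f ∈ genSubmodule I ell gen) (hdeg : ∀ b, deg b ≤ m) :
    ∃ a : α → MvPolynomial (Fin (n + 1)) k, (∀ b, (a b).IsHomogeneous (m - deg b)) ∧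
      f - ∑ b, aeval ell (a b) * gen b ∈ I := by
  obtain ⟨a, ha⟩ := hf'
  refine ⟨fun b => homogeneousComponent (m - deg b) (a b), fun b => homogeneousComponent_isHomogeneous _ _, ?_⟩
  have h := hI _ ha m
  rw [map_sub, map_sum, homogeneousComponent_of_mem hf, if_pos rfl] at h
  convert h using 3 with b
  rw [Forms.homogeneousComponent_mul_of_isHomogeneous (hgen b), if_pos (hdeg b),
    Forms.homogeneousComponent_algHom (aeval ell) (fun i => by rw [aeval_X]; exact hell i)]

variable (htop : genSubmodule I ell gen = ⊤)
include htop

/-- Membership in the ideal generated by some coordinates, in terms of coefficients. -/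
lemma mem_sup_span_iff {T : Set (Fin (n + 1))} {f : MvPolynomial ι k} {a : α → MvPolynomial (Fin (n + 1)) k}
    (ha : f - ∑ b, aeval ell (a b) * gen b ∈ I) : f ∈ I ⊔ Ideal.span (ell '' T) ↔
      ∃ x ∈ relSubmodule I ell gen, ∀ b, a b - x b ∈ Ideal.span (X '' T : Set (MvPolynomial (Fin (n + 1)) k)) := by
  constructor
  · intro hf
    obtain ⟨i, hi, g, hg, rfl⟩ := Submodule.mem_sup.1 hf
    have h : ∃ a' : α → MvPolynomial (Fin (n + 1)) k,
        (∀ b, a' b ∈ Ideal.span (X '' T : Set (MvPolynomial (Fin (n + 1)) k))) ∧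
        g - ∑ b, aeval ell (a' b) * gen b ∈ I := by
      clear ha hf
      induction hg using Submodule.span_induction with
      | mem x hx =>
        obtain ⟨j, hj, rfl⟩ := hx
        obtain ⟨c, hc⟩ : (1 : MvPolynomial ι k) ∈ genSubmodule I ell gen := by rw [htop]; trivial
        refine ⟨fun b => X j * c b, fun b => Ideal.mul_mem_right _ _ (Ideal.subset_span ⟨j, hj, rfl⟩), ?_⟩
        have := Ideal.mul_mem_left _ (ell j) hc
        simpa only [map_mul, aeval_X, mul_sub, mul_one, Finset.mul_sum, mul_assoc] using this
      | zero => exact ⟨0, fun b => zero_mem _, by simp⟩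
      | add x y _ _ hx hy =>
        obtain ⟨a, h1, h2⟩ := hx
        obtain ⟨b, h3, h4⟩ := hy
        refine ⟨a + b, fun i => add_mem (h1 i) (h3 i), ?_⟩
        have := add_mem h2 h4
        convert this using 1
        simp only [Pi.add_apply, map_add, add_mul, Finset.sum_add_distrib]
        ring
      | smul s x _ hx =>
        obtain ⟨a, h1, h2⟩ := hx
        have hs : ∀ b, ∃ c : α → MvPolynomial (Fin (n + 1)) k,
            s * gen b - ∑ b', aeval ell (c b') * gen b' ∈ I := fun b => by
          have : s * gen b ∈ genSubmodule I ell gen := by rw [htop]; trivial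
          exact this
        choose c hc using hs
        refine ⟨fun b' => ∑ b, a b * c b b', fun b' => sum_mem fun b _ => Ideal.mul_mem_right _ _ (h1 b), ?_⟩
        have h3 := Ideal.mul_mem_left _ s h2
        have h4 : ∑ b, aeval ell (a b) * (s * gen b - ∑ b', aeval ell (c b b') * gen b') ∈ I :=
          sum_mem fun b _ => Ideal.mul_mem_left _ _ (hc b)
        have h5 := add_mem h3 h4
        convert h5 using 1
        have e : ∑ b', aeval ell (∑ b, a b * c b b') * gen b' =
            ∑ b, aeval ell (a b) * ∑ b', aeval ell (c b b') * gen b' := by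
          simp only [map_sum, map_mul, Finset.sum_mul, Finset.mul_sum]
          rw [Finset.sum_comm]
          simp only [mul_assoc]
        have e2 : s * ∑ b, aeval ell (a b) * gen b = ∑ b, aeval ell (a b) * (s * gen b) := by
          rw [Finset.mul_sum]
          exact Finset.sum_congr rfl fun b _ => by ring
        rw [e, smul_eq_mul, mul_sub, e2]
        simp only [mul_sub, Finset.sum_sub_distrib]
        ring
    obtain ⟨a', h1, h2⟩ := h
    refine ⟨a - a', ?_, fun b => by simpa using h1 b⟩
    change ∑ b, aeval ell ((a - a') b) * gen b ∈ I
    have := sub_mem (add_mem hi h2) ha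
    convert this using 1
    simp only [Pi.sub_apply, map_sub, sub_mul, Finset.sum_sub_distrib]
    ring
  · rintro ⟨x, hx, h⟩
    have h2 : ∑ b, aeval ell (a b - x b) * gen b ∈ Ideal.span (ell '' T) :=
      sum_mem fun b _ => Ideal.mul_mem_right _ _ (Forms.aeval_mem_span_image ell (h b))
    have h3 := add_mem (Submodule.mem_sup_left (T := Ideal.span (ell '' T)) (add_mem ha hx))
      (Submodule.mem_sup_right (S := I) h2)
    convert h3 using 1
    simp only [map_sub, sub_mul, Finset.sum_sub_distrib]
    ring

/-- A criterion for some coordinates to form a regular sequence. -/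
lemma regIn_of_relSubmodule (hell : ∀ i, (ell i).IsHomogeneous 1) (s : Set (Fin (n + 1)))
    (hK : ∀ T ⊆ s, ∀ i ∈ s, i ∉ T → ∀ a : α → MvPolynomial (Fin (n + 1)) k,
      (∃ x ∈ relSubmodule I ell gen, ∀ b, X i * a b - x b ∈ Ideal.span (X '' T : Set (MvPolynomial (Fin (n + 1)) k))) →
      ∃ x ∈ relSubmodule I ell gen, ∀ b, a b - x b ∈ Ideal.span (X '' T : Set (MvPolynomial (Fin (n + 1)) k)))
    (l : List (Fin (n + 1))) (T : Set (Fin (n + 1))) (hT : T ⊆ s) (hl : ∀ i ∈ l, i ∈ s ∧ i ∉ T) (hd : l.Nodup) :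
    DepthBound.RegIn (RingHom.ker (constantCoeff (R := k) (σ := ι))) (I ⊔ Ideal.span (ell '' T)) (l.map ell) := by
  induction l generalizing T with
  | nil => trivial
  | cons i l ih =>
    rw [List.nodup_cons] at hd
    obtain ⟨h1, h2⟩ := hl i (by simp)
    refine ⟨?_, fun g hg => ?_, ?_⟩
    · rw [RingHom.mem_ker, constantCoeff_eq]
      exact (hell i).coeff_eq_zero (by simp)
    · obtain ⟨a, ha⟩ : g ∈ genSubmodule I ell gen := by rw [htop]; trivial
      have h3 : ell i * g - ∑ b, aeval ell (X i * a b) * gen b ∈ I := by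
        have := Ideal.mul_mem_left _ (ell i) ha
        simpa only [map_mul, aeval_X, mul_sub, Finset.mul_sum, mul_assoc] using this
      rw [mem_sup_span_iff htop h3] at hg
      exact (mem_sup_span_iff htop ha).2 (hK T hT i h1 h2 a hg)
    · have := ih (insert i T) (Set.insert_subset h1 hT) (fun j hj => ⟨(hl j (by simp [hj])).1, fun h => ?_⟩) hd.2
      · rwa [Set.image_insert_eq, Ideal.span_insert, sup_comm (Ideal.span {ell i}), ← sup_assoc] at this
      · rcases h with rfl | h
        · exact hd.1 hj
        · exact (hl j (by simp [hj])).2 h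

end genSubmodule

section

/-- Homogeneous module generators of degrees at most two for the coordinate ring of the union. -/
structure ModuleGens {k ι : Type} [Field k] {n : ℕ} (c : ℕ) (P J : Ideal (MvPolynomial ι k))
    (ell : Fin (n + 1) → MvPolynomial ι k) (gen : Option (Fin c ⊕ Fin 3) → MvPolynomial ι k)
    (deg : Option (Fin c ⊕ Fin 3) → ℕ) : Prop where
  isHomogeneous : ∀ b, (gen b).IsHomogeneous (deg b)
  deg_le : ∀ b, deg b ≤ 2
  exists_deg : ∃ b, deg b = 2
  eq_top : genSubmodule (P ⊓ J) ell gen = ⊤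
  free : ∀ a : Option (Fin c ⊕ Fin 3) → MvPolynomial (Fin (n + 1)) k,
    ∑ b, aeval ell (a b) * gen b ∈ P ⊓ J → a = 0

variable {k ι : Type} [Field k] [Fintype ι] [DecidableEq ι] {n c N : ℕ}
    {P J : Ideal (MvPolynomial ι k)} {ell : Fin (n + 1) → MvPolynomial ι k}
    {kap : MvPolynomial ι k →ₐ[k] MvPolynomial (Fin (n + 1)) k}
    {theta : MvPolynomial ι k} {r : MvPolynomial (Fin (n + 1)) k}
    {zeta : Fin c ⊕ Fin 3 → ι → k} {Z : ℕ → MvPolynomial ι k} {lam om : Fin c ⊕ Fin 3 → k}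
    {gen : Option (Fin c ⊕ Fin 3) → MvPolynomial ι k} {deg : Option (Fin c ⊕ Fin 3) → ℕ}

theorem Frame.exists_moduleGens (F : Frame n c N P J ell kap theta r zeta) (D : ScrollData P J ell zeta Z lam om)
    (hn : 1 ≤ n) (hc : 4 ≤ c) : ∃ gen deg, ModuleGens c P J ell gen deg := by
  obtain ⟨g, hg, htop⟩ := ScrollData.exists_generators F D hc
  rw [F.span_eq_inf D hn hc] at htop
  refine ⟨ScrollData.gens c Z g, fun b => b.elim 0 (Sum.elim (fun _ => 1) fun _ => 2), ⟨?_, ?_, ⟨some (Sum.inr 0), rfl⟩, htop, fun a ha =>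
    F.relSubmodule_inf_eq D hc le_rfl htop ha⟩⟩
  · rintro (_ | j | i)
    · exact isHomogeneous_one _ _
    · exact (D.Z_mem j.2).2
    · have h5 : idealPiece k ι J 1 * idealPiece k ι J 1 ≤ homogeneousSubmodule ι k 2 :=
        Submodule.mul_le.2 fun a ha b hb => IsHomogeneous.mul ha.2 hb.2
      exact h5 (D.form₂_mem (by omega) (hg i))
  · rintro (_ | j | i) <;> simp

namespace ModuleGens

variable (F : Frame n c N P J ell kap theta r zeta) (G : ModuleGens c P J ell gen deg)
include F G

lemma inf_hom (f : MvPolynomial ι k) (hf : f ∈ P ⊓ J) (m : ℕ) : homogeneousComponent m f ∈ P ⊓ J :=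
  ⟨F.hom f hf.1 m, F.J_hom f hf.2 m⟩

/-- Forms of degree three lie in the ideal generated by the coordinates. -/
lemma mem_sup_span_univ {f : MvPolynomial ι k} (hf : f.IsHomogeneous 3) :
    f ∈ P ⊓ J ⊔ Ideal.span (ell '' Set.univ) := by
  have h : f ∈ genSubmodule (P ⊓ J) ell gen := by rw [G.eq_top]; trivial
  obtain ⟨a, ha, ha'⟩ := genSubmodule.exists_homogeneous (inf_hom F G) F.ell_hom G.isHomogeneous hf h
    fun b => (G.deg_le b).trans (by norm_num)
  refine (genSubmodule.mem_sup_span_iff G.eq_top ha').2 ⟨0, zero_mem _, fun b => ?_⟩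
  rw [Pi.zero_apply, sub_zero]
  have := G.deg_le b
  exact Forms.mem_span_X_univ (by omega) (ha b)

lemma regIn_inf : DepthBound.RegIn (RingHom.ker (constantCoeff (R := k) (σ := ι))) (P ⊓ J)
    ((List.finRange (n + 1)).map ell) := by
  have := genSubmodule.regIn_of_relSubmodule G.eq_top F.ell_hom Set.univ (fun T _ i _ hi a ⟨x, hx, h⟩ => ?_)
    (List.finRange (n + 1)) ∅ (Set.subset_univ _) (by simp) (List.nodup_finRange _)
  · simpa using this
  · refine ⟨0, zero_mem _, fun b => ?_⟩
    have h1 := h b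
    rw [G.free x hx, Pi.zero_apply, sub_zero, Forms.mem_span_X_iff, map_mul, Forms.kill_X hi] at h1
    rw [Pi.zero_apply, sub_zero, Forms.mem_span_X_iff]
    exact (mul_eq_zero.1 h1).resolve_left (X_ne_zero i)

lemma exists_socle_inf :
    ∃ t, (∀ a ∈ RingHom.ker (constantCoeff (R := k) (σ := ι)),
      a * t ∈ P ⊓ J ⊔ Ideal.span {h | h ∈ (List.finRange (n + 1)).map ell}) ∧
      t ∉ P ⊓ J ⊔ Ideal.span {h | h ∈ (List.finRange (n + 1)).map ell} := by
  have e : {h | h ∈ (List.finRange (n + 1)).map ell} = ell '' Set.univ := by ext; simp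
  obtain ⟨b, hb⟩ := G.exists_deg
  rw [e]
  refine ⟨gen b, fun a ha => ?_, fun h => ?_⟩
  · refine Forms.mul_mem_of_mem_ker_constantCoeff (fun i => mem_sup_span_univ F G ?_) ha
    have := IsHomogeneous.mul (isHomogeneous_X k i) (G.isHomogeneous b)
    rwa [hb] at this
  · rw [genSubmodule.mem_sup_span_iff G.eq_top (a := Pi.single b 1) (by simp [Pi.single_apply, ite_mul])] at h
    obtain ⟨x, hx, h⟩ := h
    have h1 := h b
    rw [G.free x hx, Forms.mem_span_X_iff] at h1
    simp at h1

end ModuleGens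

end

section

variable {k ι : Type} [Field k] [Fintype ι] [DecidableEq ι] {n c N : ℕ}
    {P J : Ideal (MvPolynomial ι k)} {ell : Fin (n + 1) → MvPolynomial ι k}
    {kap : MvPolynomial ι k →ₐ[k] MvPolynomial (Fin (n + 1)) k}
    {theta : MvPolynomial ι k} {r : MvPolynomial (Fin (n + 1)) k}
    {zeta : Fin c ⊕ Fin 3 → ι → k}
    {gen : Option (Fin c ⊕ Fin 3) → MvPolynomial ι k} {deg : Option (Fin c ⊕ Fin 3) → ℕ}

namespace Frame

variable (F : Frame n c N P J ell kap theta r zeta)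
include F

lemma eq_zero_of_aeval_mem {d : MvPolynomial (Fin (n + 1)) k} (h : aeval ell d ∈ P) : d = 0 := by
  have := F.free (fun i => if i = 0 then d else 0) (by
    rw [Finset.sum_eq_single 0 (fun i _ hi => by simp [hi]) (by simp)]
    simpa using h) 0 (by omega)
  simpa using this

lemma mem_of_aeval_mul_mem {d : MvPolynomial (Fin (n + 1)) k} (hd : d ≠ 0) {f : MvPolynomial ι k}
    (h : aeval ell d * f ∈ P) : f ∈ P :=
  (F.prime.mem_or_mem h).resolve_left fun h => hd (F.eq_zero_of_aeval_mem h)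

end Frame

namespace ModuleGens

variable (F : Frame n c N P J ell kap theta r zeta) (G : ModuleGens c P J ell gen deg)
include F G

lemma exists_coeffs (f : MvPolynomial ι k) : ∃ a : Option (Fin c ⊕ Fin 3) → MvPolynomial (Fin (n + 1)) k,
    f - ∑ b, aeval ell (a b) * gen b ∈ P ⊓ J := by
  have : f ∈ genSubmodule (P ⊓ J) ell gen := by rw [G.eq_top]; trivial
  exact this

lemma exists_relation : ∃ a ∈ relSubmodule P ell gen, a ≠ 0 := by
  obtain ⟨w, hw, hw'⟩ := F.exists_mem_notMem
  obtain ⟨a, ha⟩ := exists_coeffs F G w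
  refine ⟨a, ?_, ?_⟩
  · have := sub_mem hw ha.1
    rwa [sub_sub_cancel] at this
  · rintro rfl
    simp only [Pi.zero_apply, map_zero, zero_mul, Finset.sum_const_zero, sub_zero] at ha
    exact hw' ha.2

lemma relation_mul_comm {v w : Option (Fin c ⊕ Fin 3) → MvPolynomial (Fin (n + 1)) k}
    (hv : v ∈ relSubmodule P ell gen) (hw : w ∈ relSubmodule P ell gen) (a b) : v a * w b = v b * w a := by
  have hA : ∀ j : Fin (c + 3), _ := fun j => exists_coeffs F G (theta ^ (j : ℕ))
  choose A hA using hA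
  refine RankBound.mul_comm_of_card_eq (A := A) (by simp) (fun x hx => ?_) hv hw a b
  rw [relSubmodule.sum_smul_mem_iff fun j => (hA j).1] at hx
  rw [Fin.sum_univ_eq_sum_range (fun i => aeval ell (if h : i < c + 3 then x ⟨i, h⟩ else 0) * theta ^ i)
    (c + 3) |>.symm.trans (Finset.sum_congr rfl fun i _ => by simp) |> Eq.symm] at hx
  funext i
  simpa using F.free _ hx i i.2

/-- The relations in the coordinate ring of the variety form a free module of rank one. -/
lemma exists_primitive : ∃ v ∈ relSubmodule P ell gen, v ≠ 0 ∧
    ∀ w ∈ relSubmodule P ell gen, ∃ u : MvPolynomial (Fin (n + 1)) k, ∀ b, w b = u * v b := by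
  classical
  let := UniqueFactorizationMonoid.strongNormalizationMonoid (α := MvPolynomial (Fin (n + 1)) k)
  let := UniqueFactorizationMonoid.toStrongNormalizedGCDMonoid (MvPolynomial (Fin (n + 1)) k)
  obtain ⟨a, ha, ha0⟩ := exists_relation F G
  obtain ⟨v, hv, hv1⟩ := Finset.extract_gcd (s := Finset.univ) a ⟨none, Finset.mem_univ _⟩
  have hg : Finset.univ.gcd a ≠ 0 := fun h => ha0 (funext fun b => by rw [hv b (Finset.mem_univ _), h, zero_mul]; rfl)
  have hvK : v ∈ relSubmodule P ell gen := by
    refine F.mem_of_aeval_mul_mem hg ?_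
    rw [Finset.mul_sum]
    simp only [← mul_assoc, ← map_mul, ← hv _ (Finset.mem_univ _)]
    exact ha
  have hv0 : v ≠ 0 := by
    rintro rfl
    exact ha0 (funext fun b => by rw [hv b (Finset.mem_univ _)]; simp)
  refine ⟨v, hvK, hv0, fun w hw => ?_⟩
  obtain ⟨b, hb⟩ := Function.ne_iff.1 hv0
  have h1 : v b ∣ w b := by
    have h2 : v b ∣ Finset.univ.gcd fun x => v x * w b :=
      Finset.dvd_gcd fun x _ => ⟨w x, relation_mul_comm F G hvK hw x b⟩
    rw [Finset.gcd_mul_right, hv1, one_mul] at h2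
    exact dvd_normalize_iff.1 h2
  obtain ⟨u, hu⟩ := h1
  refine ⟨u, fun x => mul_left_cancel₀ hb ?_⟩
  rw [relation_mul_comm F G hvK hw b x, hu]
  ring

lemma constantCoeff_relation (hn : 1 ≤ n) {w : Option (Fin c ⊕ Fin 3) → MvPolynomial (Fin (n + 1)) k}
    (hw : w ∈ relSubmodule P ell gen) (b) : constantCoeff (w b) = 0 := by
  have h1 := F.hom _ hw (deg b)
  have e : homogeneousComponent (deg b) (∑ b, aeval ell (w b) * gen b) = ∑ b', aeval ell
      (if deg b' ≤ deg b then homogeneousComponent (deg b - deg b') (w b') else 0) * gen b' := by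
    rw [map_sum]
    refine Finset.sum_congr rfl fun b' _ => ?_
    rw [Forms.homogeneousComponent_mul_of_isHomogeneous (G.isHomogeneous b')]
    split_ifs
    · rw [Forms.homogeneousComponent_algHom (aeval ell) (fun i => by rw [aeval_X]; exact F.ell_hom i)]
    · simp
  have h2 := F.mem_J_of_degree_le hn ((G.deg_le b).trans (by norm_num)) (homogeneousComponent_isHomogeneous _ _) h1
  rw [e] at h1 h2
  have h3 := congrFun (G.free _ ⟨h1, h2⟩) b
  simp only [le_refl, if_true, Nat.sub_self, homogeneousComponent_zero, Pi.zero_apply, C_eq_zero] at h3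
  exact h3

lemma exists_eval_ne_zero {v : Option (Fin c ⊕ Fin 3) → MvPolynomial (Fin (n + 1)) k}
    (hv : ∀ w ∈ relSubmodule P ell gen, ∃ u : MvPolynomial (Fin (n + 1)) k, ∀ b, w b = u * v b) :
    ∃ b, eval (Pi.single 0 1) (v b) ≠ 0 := by
  classical
  by_contra! hcon
  have h1 : ∀ b, ∃ l : ℕ → MvPolynomial (Fin (n + 1)) k,
      aeval ell r * gen b - ∑ i ∈ Finset.range (c + 3), aeval ell (l i) * theta ^ i ∈ P := fun b => by
    obtain ⟨l, -, hl⟩ := F.red (deg b) (gen b) (G.isHomogeneous b)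
    exact ⟨l, hl⟩
  choose l hl using h1
  have h2 : ∀ j : ℕ, _ := fun j => exists_coeffs F G (theta ^ j)
  choose m hm using h2
  let A : Matrix (Option (Fin c ⊕ Fin 3)) (Fin (c + 3)) k := fun b i => eval (Pi.single 0 1) (l b i)
  let B : Matrix (Fin (c + 3)) (Option (Fin c ⊕ Fin 3)) k := fun i b => eval (Pi.single 0 1) (m i b)
  have h3 : A * B = (eval (Pi.single 0 1) r) • (1 : Matrix _ _ k) := by
    ext b b'
    have hK : (fun x => (if x = b then r else 0) - ∑ i ∈ Finset.range (c + 3), l b i * m i x) ∈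
        relSubmodule P ell gen := by
      change ∑ x, _ ∈ P
      have h4 : ∑ i ∈ Finset.range (c + 3), aeval ell (l b i) * (theta ^ i - ∑ x, aeval ell (m i x) * gen x) ∈ P :=
        sum_mem fun i _ => Ideal.mul_mem_left _ _ (hm i).1
      have := add_mem (hl b) h4
      convert this using 1
      simp only [map_sub, map_sum, map_mul, sub_mul, mul_sub, Finset.sum_sub_distrib, Finset.sum_mul, Finset.mul_sum,
        apply_ite (aeval (R := k) ell), map_zero, ite_mul, zero_mul, Finset.sum_ite_eq', Finset.mem_univ, if_true]
      rw [Finset.sum_comm]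
      simp only [mul_assoc]
      ring
    obtain ⟨u, hu⟩ := hv _ hK
    have h5 := congrArg (eval (Pi.single 0 1)) (hu b')
    rw [map_mul, hcon, mul_zero, map_sub, map_sum, sub_eq_zero] at h5
    rw [Matrix.mul_apply, Matrix.smul_apply, Matrix.one_apply]
    simp only [A, B]
    rw [Fin.sum_univ_eq_sum_range (fun i => eval (Pi.single 0 1) (l b i) * eval (Pi.single 0 1) (m i b'))]
    simp only [map_mul] at h5
    rw [← h5]
    by_cases hb : b = b'
    · simp [hb]
    · simp [hb, Ne.symm hb]
  have h6 : (A * B).rank = c + 4 := by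
    rw [h3, Matrix.rank_smul_of_mem_nonZeroDivisors, Matrix.rank_one]
    · simp
    · exact mem_nonZeroDivisors_of_ne_zero F.r_ne
  have h7 := (Matrix.rank_mul_le_left A B).trans (Matrix.rank_le_card_width A)
  rw [h6, Fintype.card_fin] at h7
  omega

end ModuleGens

end

section

variable {k ι : Type} [Field k] [Fintype ι] [DecidableEq ι] {n c N : ℕ}
    {P J : Ideal (MvPolynomial ι k)} {ell : Fin (n + 1) → MvPolynomial ι k}
    {kap : MvPolynomial ι k →ₐ[k] MvPolynomial (Fin (n + 1)) k}
    {theta : MvPolynomial ι k} {r : MvPolynomial (Fin (n + 1)) k}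
    {zeta : Fin c ⊕ Fin 3 → ι → k}
    {gen : Option (Fin c ⊕ Fin 3) → MvPolynomial ι k} {deg : Option (Fin c ⊕ Fin 3) → ℕ}

namespace ModuleGens

variable (F : Frame n c N P J ell kap theta r zeta) (G : ModuleGens c P J ell gen deg)
include F G

lemma genSubmodule_prime_eq_top : genSubmodule P ell gen = ⊤ :=
  eq_top_iff.2 fun f _ => by
    obtain ⟨a, ha⟩ := exists_coeffs F G f
    exact ⟨a, ha.1⟩

lemma eval_kill {T : Set (Fin (n + 1))} (hT : T ⊆ {0}ᶜ) (f : MvPolynomial (Fin (n + 1)) k) :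
    eval (Pi.single 0 1) (Forms.kill T f) = eval (Pi.single 0 1) f := by
  have := Forms.eval_eq_zero_of_mem_span_X (Forms.sub_kill_mem (T := T) f) (x := Pi.single 0 1)
    fun i hi => Pi.single_eq_of_ne (hT hi) _
  rw [map_sub, sub_eq_zero] at this
  exact this.symm

variable {v : Option (Fin c ⊕ Fin 3) → MvPolynomial (Fin (n + 1)) k} (hvK : v ∈ relSubmodule P ell gen)
  (hv : ∀ w ∈ relSubmodule P ell gen, ∃ u : MvPolynomial (Fin (n + 1)) k, ∀ b, w b = u * v b)
include hvK hv

lemma regIn_of_primitive : DepthBound.RegIn (RingHom.ker (constantCoeff (R := k) (σ := ι))) P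
    ((List.finRange n).map fun i => ell i.succ) := by
  have := genSubmodule.regIn_of_relSubmodule (genSubmodule_prime_eq_top F G) F.ell_hom {0}ᶜ
    (fun T hT i hi hiT a ⟨x, hx, h⟩ => ?_) ((List.finRange n).map Fin.succ) ∅ (Set.empty_subset _)
    (by simp) ((List.nodup_finRange _).map (Fin.succ_injective _))
  · simpa [Function.comp_def] using this
  · obtain ⟨u, hu⟩ := hv x hx
    obtain ⟨b0, hb0⟩ := exists_eval_ne_zero F G hv
    have h1 : ∀ b, X i * Forms.kill T (a b) = Forms.kill T u * Forms.kill T (v b) := fun b => by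
      have := Forms.mem_span_X_iff.1 (h b)
      rw [map_sub, map_mul, Forms.kill_X hiT, hu, map_mul, sub_eq_zero] at this
      exact this
    have h2 : ¬ (X i : MvPolynomial (Fin (n + 1)) k) ∣ Forms.kill T (v b0) := by
      rintro ⟨g, hg⟩
      rw [← eval_kill F G hT, hg, map_mul, eval_X, Pi.single_eq_of_ne hi, zero_mul] at hb0
      exact hb0 rfl
    have hpr : Prime (X i : MvPolynomial (Fin (n + 1)) k) := MvPolynomial.X_prime
    obtain ⟨u', hu'⟩ := (hpr.dvd_or_dvd ⟨_, (h1 b0).symm⟩).resolve_right h2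
    refine ⟨u' • v, Submodule.smul_mem _ _ hvK, fun b => ?_⟩
    have h3 : Forms.kill T (a b) = u' * Forms.kill T (v b) :=
      mul_left_cancel₀ (X_ne_zero i) (by rw [h1, hu']; ring)
    have h4 := congrArg (Forms.kill T) h3
    rw [Forms.kill_kill, map_mul, Forms.kill_kill] at h4
    rw [Forms.mem_span_X_iff, map_sub, Pi.smul_apply, smul_eq_mul, map_mul, h4, sub_self]

lemma exists_socle_of_primitive (hn : 1 ≤ n) :
    ∃ t, (∀ a ∈ RingHom.ker (constantCoeff (R := k) (σ := ι)), a * t ∈ P ⊔ Ideal.span (ell '' {0}ᶜ)) ∧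
      t ∉ P ⊔ Ideal.span (ell '' {0}ᶜ) := by
  have htop := genSubmodule_prime_eq_top F G
  have hX0 : ∀ f : MvPolynomial (Fin (n + 1)) k, constantCoeff f = 0 → X 0 ∣ Forms.kill {0}ᶜ f := by
    have : RingHom.ker (constantCoeff (R := k) (σ := Fin (n + 1))) ≤
        (Ideal.span {(X 0 : MvPolynomial (Fin (n + 1)) k)}).comap (Forms.kill {0}ᶜ) :=
      Forms.ker_constantCoeff_le fun i => by
        change Forms.kill {0}ᶜ (X i) ∈ Ideal.span {(X 0 : MvPolynomial (Fin (n + 1)) k)}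
        by_cases hi : i = 0
        · rw [Forms.kill_X (by simp [hi]), hi]
          exact Ideal.mem_span_singleton_self _
        · rw [Forms.mem_span_X_iff.1 (Ideal.subset_span ⟨i, hi, rfl⟩)]
          exact zero_mem _
    exact fun f hf => Ideal.mem_span_singleton.1 (this hf)
  have h1 : ∀ b, ∃ t, Forms.kill {0}ᶜ (v b) = X 0 * t := fun b => hX0 _ (constantCoeff_relation F G hn hvK b)
  choose τ hτ using h1
  have hk0 : Forms.kill {0}ᶜ (X 0 : MvPolynomial (Fin (n + 1)) k) = X 0 := Forms.kill_X (by simp)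
  have hkτ : ∀ b, Forms.kill {0}ᶜ (τ b) = τ b := fun b => by
    have := congrArg (Forms.kill {0}ᶜ) (hτ b)
    rw [Forms.kill_kill, map_mul, hk0, hτ] at this
    exact (mul_left_cancel₀ (X_ne_zero 0) this).symm
  set t := ∑ b, aeval ell (τ b) * gen b with ht
  set Q := P ⊔ Ideal.span (ell '' {0}ᶜ) with hQ
  have hmem : ∀ {f : MvPolynomial ι k} {a : Option (Fin c ⊕ Fin 3) → MvPolynomial (Fin (n + 1)) k},
      f - ∑ b, aeval ell (a b) * gen b ∈ P → (f ∈ Q ↔ ∃ u : MvPolynomial (Fin (n + 1)) k,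
        ∀ b, Forms.kill {0}ᶜ (a b) = Forms.kill {0}ᶜ u * (X 0 * τ b)) := by
    intro f a ha
    rw [hQ, genSubmodule.mem_sup_span_iff htop ha]
    constructor
    · rintro ⟨x, hx, h⟩
      obtain ⟨u, hu⟩ := hv x hx
      refine ⟨u, fun b => ?_⟩
      have := Forms.mem_span_X_iff.1 (h b)
      rwa [map_sub, hu, map_mul, sub_eq_zero, hτ] at this
    · rintro ⟨u, hu⟩
      refine ⟨u • v, Submodule.smul_mem _ _ hvK, fun b => ?_⟩
      rw [Forms.mem_span_X_iff, map_sub, hu, Pi.smul_apply, smul_eq_mul, map_mul, hτ, sub_self]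
  have hell0 : ell 0 * t ∈ Q := by
    refine (hmem (a := fun b => X 0 * τ b) ?_).2 ⟨1, fun b => by rw [map_mul, hk0, hkτ, map_one, one_mul]⟩
    simp only [map_mul, aeval_X, mul_assoc, ← Finset.mul_sum, ht, sub_self, zero_mem]
  have hell : ∀ f ∈ P ⊔ Ideal.span (ell '' Set.univ), f * t ∈ Q := by
    have : P ⊔ Ideal.span (ell '' Set.univ) ≤ Submodule.comap (LinearMap.mulRight (MvPolynomial ι k) t) Q := by
      refine sup_le (fun f hf => Ideal.mul_mem_right _ _ (Submodule.mem_sup_left hf)) (Ideal.span_le.2 ?_)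
      rintro _ ⟨i, -, rfl⟩
      by_cases hi : i = 0
      · rw [hi]; exact hell0
      · exact Ideal.mul_mem_right _ _ (Submodule.mem_sup_right (Ideal.subset_span (Set.mem_image_of_mem ell hi)))
    exact this
  have htQ : t ∉ Q := by
    rw [hmem (a := τ) (by rw [ht, sub_self]; exact zero_mem _)]
    rintro ⟨u, hu⟩
    obtain ⟨b0, hb0⟩ := exists_eval_ne_zero F G hv
    rw [← eval_kill F G le_rfl, hτ] at hb0
    have h2 : τ b0 ≠ 0 := by
      intro h
      rw [h, mul_zero, map_zero] at hb0
      exact hb0 rfl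
    have h3 := hu b0
    rw [hkτ, ← mul_assoc] at h3
    have h4 := mul_right_cancel₀ h2 ((one_mul _).trans h3)
    have := congrArg constantCoeff h4
    simp at this
  have htor : ∀ f, ell 0 * f ∈ Q → ∃ s : k, f - C s * t ∈ Q := by
    intro f hf
    obtain ⟨a, ha⟩ : f ∈ genSubmodule P ell gen := by rw [htop]; trivial
    have ha' : ell 0 * f - ∑ b, aeval ell (X 0 * a b) * gen b ∈ P := by
      have := Ideal.mul_mem_left _ (ell 0) ha
      simpa only [map_mul, aeval_X, mul_sub, Finset.mul_sum, mul_assoc] using this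
    obtain ⟨u, hu⟩ := (hmem ha').1 hf
    have h2 : ∀ b, Forms.kill {0}ᶜ (a b) = Forms.kill {0}ᶜ u * τ b := fun b => by
      have := hu b
      rw [map_mul, hk0] at this
      exact mul_left_cancel₀ (X_ne_zero 0) (by rw [this]; ring)
    obtain ⟨u', hu'⟩ := hX0 (u - C (constantCoeff u)) (by simp)
    refine ⟨constantCoeff u, (hmem (a := fun b => a b - C (constantCoeff u) * τ b) ?_).2 ⟨u', fun b => ?_⟩⟩
    · convert ha using 1
      simp only [map_sub, map_mul, sub_mul, Finset.sum_sub_distrib, ht, Finset.mul_sum, mul_assoc, algHom_C,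
        algebraMap_eq]
      ring
    · have h3 := congrArg (Forms.kill {0}ᶜ) hu'
      simp only [Forms.kill_kill, map_mul, map_sub, hk0, algHom_C, algebraMap_eq] at h3
      rw [map_sub, map_mul, h2, hkτ, algHom_C, algebraMap_eq]
      linear_combination τ b * h3
  have hlin : ∀ z ∈ J, z.IsHomogeneous 1 → z * t ∈ Q := by
    intro z _ hz1
    obtain ⟨s, hs⟩ := htor (z * t) (by
      rw [mul_left_comm]
      exact Ideal.mul_mem_left _ _ hell0)
    have h3 : z ^ 3 * t - C (s ^ 3) * t ∈ Q := by
      have := Ideal.mul_mem_left _ (z ^ 2 + z * C s + C s ^ 2) hs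
      convert this using 1
      rw [C_pow]
      ring
    have h4 : z ^ 3 * t ∈ Q := by
      have h5 : z ^ 3 ∈ P ⊓ J ⊔ Ideal.span (ell '' Set.univ) :=
        mem_sup_span_univ F G (by simpa using hz1.pow 3)
      exact hell _ ((sup_le_sup_right inf_le_left _ :
        P ⊓ J ⊔ Ideal.span (ell '' Set.univ) ≤ P ⊔ Ideal.span (ell '' Set.univ)) h5)
    have h6 := sub_mem h4 h3
    rw [sub_sub_cancel] at h6
    by_cases h0 : s = 0
    · simpa [h0] using hs
    · refine absurd ?_ htQ
      have := Ideal.mul_mem_left _ (C (s ^ 3)⁻¹) h6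
      rwa [← mul_assoc, ← C_mul, inv_mul_cancel₀ (pow_ne_zero 3 h0), C_1, one_mul] at this
  refine ⟨t, fun a ha => Forms.mul_mem_of_mem_ker_constantCoeff (fun i => ?_) ha, htQ⟩
  have e : (X i : MvPolynomial ι k) * t = aeval ell (kap (X i)) * t + (X i - aeval ell (kap (X i))) * t := by ring
  rw [e]
  refine add_mem (hell _ (Submodule.mem_sup_right ?_)) (hlin _ (F.sub_mem_J _) ?_)
  · exact Forms.aeval_mem_span_image ell (Forms.mem_span_X_univ one_ne_zero (F.kap_homogeneous (isHomogeneous_X _ _)))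
  · exact IsHomogeneous.sub (isHomogeneous_X _ _)
      (F.aeval_homogeneous (F.kap_homogeneous (isHomogeneous_X _ _)))

end ModuleGens

end

namespace LinearPrimitive

open scoped IntermediateField

/-- Over an infinite base field, a generic linear combination of generators is a primitive
element. -/
lemma exists_adjoin_eq_top {k F E ι : Type} [Field k] [Infinite k] [Field F] [Field E] [Algebra k F]
    [Algebra F E] [Algebra k E] [IsScalarTower k F E] [FiniteDimensional F E] [Algebra.IsSeparable F E]
    [Fintype ι] [DecidableEq ι] (x : ι → E) (hx : ∀ φ ψ : E →ₐ[F] AlgebraicClosure F, (∀ i, φ (x i) = ψ (x i)) → φ = ψ) :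
    ∃ lam : ι → k, F⟮∑ i, lam i • x i⟯ = ⊤ := by
  let Ω := AlgebraicClosure F
  have hA : ∀ x : E, ((minpoly F x).map (algebraMap F Ω)).Splits := fun x => IsAlgClosed.splits _
  let φ : E →ₐ[F] Ω := IsAlgClosed.lift
  let T : (E →ₐ[F] Ω) → (ι → k) →ₗ[k] Ω := fun ψ =>
    ((φ.toLinearMap - ψ.toLinearMap).restrictScalars k).comp (Fintype.linearCombination k x)
  have hT : ∀ ψ, ψ ≠ φ → LinearMap.ker (T ψ) ≠ ⊤ := by
    intro ψ hψ h
    refine hψ (hx _ _ fun i => ?_)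
    have h1 : T ψ (Pi.single i 1) = 0 := LinearMap.mem_ker.1 (h ▸ Submodule.mem_top)
    change φ (Fintype.linearCombination k x (Pi.single i 1)) -
      ψ (Fintype.linearCombination k x (Pi.single i 1)) = 0 at h1
    rw [Fintype.linearCombination_apply_single, one_smul, sub_eq_zero] at h1
    exact h1.symm
  by_contra hcon
  push Not at hcon
  have hcov : ⋃ ψ : {ψ : E →ₐ[F] Ω // ψ ≠ φ}, (LinearMap.ker (T ψ) : Set (ι → k)) = Set.univ := by
    refine Set.eq_univ_of_forall fun lam => ?_
    have h1 := hcon lam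
    rw [Ne, Field.primitive_element_iff_algHom_eq_of_eval F Ω hA _ φ] at h1
    push Not at h1
    obtain ⟨ψ, h2, h3⟩ := h1
    refine Set.mem_iUnion.2 ⟨⟨ψ, h3.symm⟩, ?_⟩
    change T ψ lam = 0
    change φ (Fintype.linearCombination k x lam) - ψ (Fintype.linearCombination k x lam) = 0
    rw [Fintype.linearCombination_apply, h2, sub_self]
  obtain ⟨ψ, h⟩ := Subspace.exists_eq_top_of_iUnion_eq_univ hcov
  exact hT _ ψ.2 h

end LinearPrimitive

namespace LinearPrimitive

open scoped IntermediateField nonZeroDivisors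

section
variable {R A F E : Type} [CommRing R] [IsDomain R] [CommRing A] [IsDomain A] [Algebra R A]
  [FaithfulSMul R A] [Field F] [Field E] [Algebra R F] [IsFractionRing R F] [Algebra A E]
  [IsFractionRing A E] [Algebra F E] [Algebra R E] [IsScalarTower R A E] [IsScalarTower R F E]

/-- Clearing denominators in a polynomial. -/
lemma exists_map_eq_C_mul (p : Polynomial F) :
    ∃ s : R, s ≠ 0 ∧ ∃ q : Polynomial R, q.map (algebraMap R F) = Polynomial.C (algebraMap R F s) * p := by
  obtain ⟨s, hs, h⟩ := IsLocalization.integerNormalization_spec R⁰ p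
  refine ⟨s, nonZeroDivisors.ne_zero hs, _, h.trans ?_⟩
  rw [← Polynomial.smul_eq_C_mul, algebraMap_smul]

variable (F E) in
include F E in
lemma exists_bezout [IsIntegrallyClosed R] [CharZero R] {θ : A} (hθ : IsIntegral R θ) :
    ∃ a b : Polynomial R, ∃ s : R, s ≠ 0 ∧
      a * minpoly R θ + b * (minpoly R θ).derivative = Polynomial.C s := by
  have : CharZero F := charZero_of_injective_algebraMap (IsFractionRing.injective R F)
  have hirr : Irreducible ((minpoly R θ).map (algebraMap R F)) := by
    rw [← minpoly.isIntegrallyClosed_eq_field_fractions F E hθ]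
    exact minpoly.irreducible (hθ.algebraMap.tower_top)
  obtain ⟨a, b, hab⟩ := hirr.separable
  obtain ⟨s, hs, a', ha'⟩ := exists_map_eq_C_mul (R := R) a
  obtain ⟨t, ht, b', hb'⟩ := exists_map_eq_C_mul (R := R) b
  refine ⟨Polynomial.C t * a', Polynomial.C s * b', s * t, mul_ne_zero hs ht, ?_⟩
  apply Polynomial.map_injective _ (IsFractionRing.injective R F)
  simp only [Polynomial.map_add, Polynomial.map_mul, Polynomial.map_C, map_mul, ha', hb',
    ← Polynomial.derivative_map]
  linear_combination Polynomial.C (algebraMap R F s) * Polynomial.C (algebraMap R F t) * hab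

lemma exists_denominator [Module.Finite R A] {θ : A} (h : F⟮algebraMap A E θ⟯ = ⊤) :
    ∃ r : R, r ≠ 0 ∧ ∀ g : A, ∃ p : Polynomial R, r • g = Polynomial.aeval θ p := by
  classical
  have h1 : ∀ g : A, ∃ r : R, r ≠ 0 ∧ ∃ p : Polynomial R, r • g = Polynomial.aeval θ p := by
    intro g
    have hintegral : IsIntegral F (algebraMap A E θ) :=
      (Algebra.IsIntegral.isIntegral (R := R) θ).algebraMap.tower_top
    have h2 : algebraMap A E g ∈ F⟮algebraMap A E θ⟯.toSubalgebra := by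
      rw [h]; trivial
    rw [IntermediateField.adjoin_simple_toSubalgebra_of_isAlgebraic hintegral.isAlgebraic,
      Algebra.adjoin_singleton_eq_range_aeval] at h2
    obtain ⟨p, hp⟩ := h2
    obtain ⟨s, hs, q, hq⟩ := exists_map_eq_C_mul (R := R) p
    refine ⟨s, hs, q, IsFractionRing.injective A E ?_⟩
    have h3 := congrArg (Polynomial.aeval (algebraMap A E θ)) hq
    rw [map_mul, Polynomial.aeval_C, Polynomial.aeval_map_algebraMap, Polynomial.aeval_algebraMap_apply] at h3
    rw [h3, Algebra.smul_def, map_mul, ← IsScalarTower.algebraMap_apply, ← IsScalarTower.algebraMap_apply]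
    congr 1
    exact hp.symm
  obtain ⟨S, hS⟩ := (inferInstance : Module.Finite R A).fg_top
  choose r hr p hp using h1
  refine ⟨∏ g ∈ S, r g, Finset.prod_ne_zero_iff.2 fun g _ => hr g, fun g => ?_⟩
  have h2 : (⊤ : Submodule R A) ≤ (LinearMap.range (Polynomial.aeval (R := R) θ).toLinearMap).comap
      (LinearMap.lsmul R A (∏ g ∈ S, r g)) := by
    rw [← hS, Submodule.span_le]
    intro a ha
    refine ⟨Polynomial.C (∏ g ∈ S.erase a, r g) * p a, ?_⟩
    change Polynomial.aeval θ _ = (∏ g ∈ S, r g) • a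
    rw [map_mul, ← hp, Polynomial.aeval_C, ← Finset.prod_erase_mul _ _ ha, mul_smul, Algebra.smul_def (∏ g ∈ S.erase a, r g)]
  obtain ⟨q, hq⟩ := h2 (x := g) trivial
  exact ⟨q, hq.symm⟩

end

/-- A finite extension of an integrally closed domain is, up to a denominator, generated by
a generic linear form in given algebra generators. -/
lemma exists_linear {k R A ι : Type} [Field k] [Infinite k] [CommRing R] [IsDomain R]
    [IsIntegrallyClosed R] [CharZero R] [CommRing A] [IsDomain A] [Algebra k R] [Algebra R A]
    [Algebra k A] [IsScalarTower k R A] [FaithfulSMul R A] [Module.Finite R A] [Fintype ι]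
    [DecidableEq ι] (x : ι → A) (hx : Algebra.adjoin k (Set.range x) = ⊤) :
    ∃ lam : ι → k, ∃ Φ : Polynomial R, Φ.Monic ∧
      (∀ p, Polynomial.aeval (∑ i, lam i • x i) p = 0 ↔ Φ ∣ p) ∧
      (∃ a b : Polynomial R, ∃ s : R, s ≠ 0 ∧ a * Φ + b * Φ.derivative = Polynomial.C s) ∧
      ∃ r : R, r ≠ 0 ∧ ∀ g : A, ∃ p : Polynomial R, r • g = Polynomial.aeval (∑ i, lam i • x i) p := by
  let F := FractionRing R
  let E := FractionRing A
  let : Algebra F E := FractionRing.liftAlgebra R E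
  have : CharZero F := charZero_of_injective_algebraMap (IsFractionRing.injective R F)
  have : FiniteDimensional F E := inferInstance
  obtain ⟨lam, hlam⟩ := exists_adjoin_eq_top (k := k) (F := F) (fun i => algebraMap A E (x i)) fun φ ψ h => by
    have h1 : ((φ : E →+* AlgebraicClosure F).comp (algebraMap A E)) =
        ((ψ : E →+* AlgebraicClosure F).comp (algebraMap A E)) := by
      let Φ : (E →ₐ[F] AlgebraicClosure F) → A →ₐ[k] AlgebraicClosure F := fun φ =>
        (φ.restrictScalars k).comp (IsScalarTower.toAlgHom k A E)
      have : Φ φ = Φ ψ := AlgHom.ext_of_adjoin_eq_top hx (by rintro _ ⟨i, rfl⟩; exact h i)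
      exact congrArg AlgHom.toRingHom this
    exact AlgHom.coe_ringHom_injective (IsLocalization.ringHom_ext A⁰ h1)
  have hintegral : IsIntegral R (∑ i, lam i • x i) := Algebra.IsIntegral.isIntegral _
  refine ⟨lam, minpoly R _, minpoly.monic hintegral, minpoly.isIntegrallyClosed_dvd_iff hintegral, exists_bezout F E hintegral,
    exists_denominator (F := F) (E := E) ?_⟩
  convert hlam using 2
  simp only [Algebra.smul_def, map_sum, map_mul, ← IsScalarTower.algebraMap_apply]

end LinearPrimitive

namespace IntegralDimension

section
variable {R A : Type} [CommRing R] [CommRing A] [Algebra R A] [Algebra.IsIntegral R A]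

lemma ringKrullDim_le : ringKrullDim A ≤ ringKrullDim R :=
  Order.krullDim_le_of_strictMono (PrimeSpectrum.comap (algebraMap R A)) fun P Q h => by
    have := P.2
    exact Ideal.IsIntegral.comap_lt_comap (R := R) (I := P.asIdeal) (J := Q.asIdeal) h

lemma ringKrullDim_eq [FaithfulSMul R A] : ringKrullDim A = ringKrullDim R := by
  refine le_antisymm ringKrullDim_le (iSup_le fun l => ?_)
  have : Nonempty (Ideal.primesOver l.head.asIdeal A) := inferInstance
  obtain ⟨⟨Q, hQ, hQl⟩⟩ := this
  obtain ⟨L, hL, -⟩ := Ideal.exists_ltSeries_of_hasGoingUp (S := A) l Q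
  rw [← hL]
  exact Order.LTSeries.length_le_krullDim L

end

section
variable {k A σ : Type} [Field k] [CommRing A] [Algebra k A] [Fintype σ]
  {φ : MvPolynomial σ k →ₐ[k] A} {d : ℕ}

lemma card_eq_of_injective (hφ : φ.toRingHom.IsIntegral) (hd : ringKrullDim A = d)
    (hinj : Function.Injective φ) : Fintype.card σ = d := by
  algebraize [φ.toRingHom]
  have : FaithfulSMul (MvPolynomial σ k) A := (faithfulSMul_iff_algebraMap_injective _ _).2 hinj
  have h := ringKrullDim_eq (R := MvPolynomial σ k) (A := A)
  rw [hd, MvPolynomial.ringKrullDim_of_isNoetherianRing, ringKrullDim_eq_zero_of_field, zero_add,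
    Nat.card_eq_fintype_card] at h
  exact_mod_cast h.symm

lemma injective_of_card_eq (hφ : φ.toRingHom.IsIntegral) (hd : ringKrullDim A = d)
    (hcard : Fintype.card σ = d) : Function.Injective φ := by
  rw [injective_iff_map_eq_zero]
  intro f hf
  by_contra h0
  have hmem : ∀ a ∈ Ideal.span {f}, φ.toRingHom a = 0 := fun a ha => by
    obtain ⟨b, rfl⟩ := Ideal.mem_span_singleton'.1 ha
    rw [map_mul]
    exact mul_eq_zero_of_right _ hf
  have h1 : (Ideal.Quotient.lift _ φ.toRingHom hmem).IsIntegral :=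
    RingHom.IsIntegral.tower_top (Ideal.Quotient.mk (Ideal.span {f})) _ hφ
  algebraize [Ideal.Quotient.lift _ φ.toRingHom hmem]
  have h2 := ringKrullDim_le (R := MvPolynomial σ k ⧸ Ideal.span {f}) (A := A)
  have h3 := ringKrullDim_quotient_succ_le_of_nonZeroDivisor (mem_nonZeroDivisors_of_ne_zero h0)
  rw [MvPolynomial.ringKrullDim_of_isNoetherianRing, ringKrullDim_eq_zero_of_field, zero_add,
    Nat.card_eq_fintype_card, hcard] at h3
  have h4 := (add_le_add_left h2 1).trans h3
  rw [hd] at h4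
  norm_cast at h4
  omega

end

end IntegralDimension

namespace LinearNormalization

section
variable {k σ B : Type} [Field k] [Fintype σ] [CommRing B] [Algebra k B]

/-- Restriction of a form to the line through `y` in the direction `a`. -/
def alongLine (y : σ → B) (a : σ → k) : MvPolynomial σ k →ₐ[k] Polynomial B :=
  aeval fun j => Polynomial.C (y j) + Polynomial.C (algebraMap k B (a j)) * Polynomial.X

lemma natDegree_alongLine (y : σ → B) (a : σ → k) {G : MvPolynomial σ k} {d : ℕ}
    (hG : G.IsHomogeneous d) :
    (alongLine y a G).natDegree ≤ d ∧ (alongLine y a G).coeff d = algebraMap k B (eval a G) := by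
  have hlin : ∀ j, (Polynomial.C (y j) + Polynomial.C (algebraMap k B (a j)) * Polynomial.X).natDegree ≤ 1 ∧
      (Polynomial.C (y j) + Polynomial.C (algebraMap k B (a j)) * Polynomial.X).coeff 1 = algebraMap k B (a j) := by
    intro j
    refine ⟨by compute_degree, by simp [Polynomial.coeff_C]⟩
  have hprod : ∀ (m : σ →₀ ℕ) (s : Finset σ),
      (∏ j ∈ s, (Polynomial.C (y j) + Polynomial.C (algebraMap k B (a j)) * Polynomial.X) ^ m j).natDegree ≤
        ∑ j ∈ s, m j ∧
      (∏ j ∈ s, (Polynomial.C (y j) + Polynomial.C (algebraMap k B (a j)) * Polynomial.X) ^ m j).coeff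
        (∑ j ∈ s, m j) = algebraMap k B (∏ j ∈ s, a j ^ m j) := by
    classical
    intro m s
    induction s using Finset.induction_on with
    | empty => simp
    | insert j s hj ih =>
      rw [Finset.prod_insert hj, Finset.sum_insert hj, Finset.prod_insert hj]
      have h1 : ((Polynomial.C (y j) + Polynomial.C (algebraMap k B (a j)) * Polynomial.X) ^ m j).natDegree ≤ m j := by
        simpa using Polynomial.natDegree_pow_le_of_le (m j) (hlin j).1
      have h2 := Polynomial.coeff_pow_of_natDegree_le (m := m j) (hlin j).1
      rw [mul_one, (hlin j).2] at h2
      exact ⟨Polynomial.natDegree_mul_le_of_le h1 ih.1, by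
        rw [Polynomial.coeff_mul_add_eq_of_natDegree_le h1 ih.1, h2, ih.2, map_mul, map_pow]⟩
  have hmon : ∀ m ∈ G.support, ∑ j, m j = d := fun m hm => by
    have := hG (mem_support_iff.1 hm)
    simpa [Finsupp.weight_apply, Finsupp.sum_fintype] using this
  have hval : alongLine y a G = ∑ m ∈ G.support, Polynomial.C (algebraMap k B (coeff m G)) *
      ∏ j, (Polynomial.C (y j) + Polynomial.C (algebraMap k B (a j)) * Polynomial.X) ^ m j := by
    rw [alongLine, aeval_def, eval₂_eq']
    rfl
  rw [hval]
  constructor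
  · refine Polynomial.natDegree_sum_le_of_forall_le _ _ fun m hm => ?_
    have := (hprod m Finset.univ).1
    rw [hmon m hm] at this
    exact (Polynomial.natDegree_C_mul_le _ _).trans this
  · rw [Polynomial.finsetSum_coeff, eval_eq', map_sum]
    refine Finset.sum_congr rfl fun m hm => ?_
    have := (hprod m Finset.univ).2
    rw [hmon m hm] at this
    rw [Polynomial.coeff_C_mul, this, map_mul]

lemma isIntegralElem_of_aeval_eq_zero {A τ : Type} [CommRing A] [Algebra k A]
    (φ : MvPolynomial τ k →ₐ[k] A) (y : σ → MvPolynomial τ k) (a : σ → k) (x : A) {G : MvPolynomial σ k} {d : ℕ}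
    (hG : G.IsHomogeneous d) (ha : eval a G ≠ 0)
    (h : aeval (fun j => φ (y j) + algebraMap k A (a j) * x) G = 0) : φ.toRingHom.IsIntegralElem x := by
  obtain ⟨h1, h2⟩ := natDegree_alongLine y a hG
  refine ⟨Polynomial.C (C (eval a G)⁻¹) * alongLine y a G,
    Polynomial.monic_of_natDegree_le_of_coeff_eq_one d ((Polynomial.natDegree_C_mul_le _ _).trans h1) ?_, ?_⟩
  · rw [Polynomial.coeff_C_mul, h2, algebraMap_eq, ← C_mul, inv_mul_cancel₀ ha, C_1]
  · rw [Polynomial.eval₂_mul]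
    refine mul_eq_zero_of_right _ ?_
    let := φ.toRingHom.toAlgebra
    have : IsScalarTower k (MvPolynomial τ k) A := IsScalarTower.of_algebraMap_eq fun c => (φ.commutes c).symm
    have h3 := MvPolynomial.comp_aeval_apply (fun j => Polynomial.C (y j) +
      Polynomial.C (algebraMap k (MvPolynomial τ k) (a j)) * Polynomial.X) ((Polynomial.aeval x).restrictScalars k) G
    refine Eq.trans h3 ?_
    convert h using 3
    funext j
    change Polynomial.aeval (R := MvPolynomial τ k) x _ = _
    rw [map_add, map_mul, Polynomial.aeval_C, Polynomial.aeval_C, Polynomial.aeval_X,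
      ← IsScalarTower.algebraMap_apply]
    rfl

end

end LinearNormalization

/-- A linear Noether normalization of `P` which restricts to coordinates on the linear space with
ideal `J`. -/
structure Normalization {k ι : Type} [Field k] (n : ℕ)
    (P J : Ideal (MvPolynomial ι k)) (ell : Fin (n + 1) → MvPolynomial ι k)
    (kap : MvPolynomial ι k →ₐ[k] MvPolynomial (Fin (n + 1)) k) : Prop where
  ell_hom : ∀ i, (ell i).IsHomogeneous 1
  kap_ell : ∀ i, kap (ell i) = X i
  kap_hom : ∀ i, (kap (X i)).IsHomogeneous 1
  mem_J : ∀ f, f ∈ J ↔ kap f = 0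
  injective : ∀ f : MvPolynomial (Fin (n + 1)) k, aeval ell f ∈ P → f = 0
  integral : ((Ideal.Quotient.mkₐ k P).comp
    (aeval ell : MvPolynomial (Fin (n + 1)) k →ₐ[k] MvPolynomial ι k)).toRingHom.IsIntegral

namespace LinearNormalization

lemma isIntegral_of_generators {k σ τ A : Type} [Field k] [CommRing A] [Algebra k A]
    {φ : MvPolynomial σ k →ₐ[k] A} {ψ : MvPolynomial τ k →ₐ[k] A} (hφ : φ.toRingHom.IsIntegral)
    (h : ∀ j, ψ.toRingHom.IsIntegralElem (φ (X j))) : ψ.toRingHom.IsIntegral := by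
  let := ψ.toRingHom.toAlgebra
  have : IsScalarTower k (MvPolynomial τ k) A := IsScalarTower.of_algebraMap_eq fun c => (ψ.commutes c).symm
  let B := integralClosure (MvPolynomial τ k) A
  have hB : ∀ f, φ f ∈ B := by
    intro f
    have h1 : (⊤ : Subalgebra k (MvPolynomial σ k)) ≤ (B.restrictScalars k).comap φ := by
      rw [← MvPolynomial.adjoin_range_X, Algebra.adjoin_le_iff]
      rintro _ ⟨j, rfl⟩
      exact h j
    exact h1 trivial
  intro b
  obtain ⟨p, hp, hpb⟩ := hφ b
  have h2 : IsIntegral B b := by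
    refine ⟨p.map (φ.toRingHom.codRestrict B hB), hp.map _, ?_⟩
    rw [Polynomial.eval₂_map]
    exact hpb
  exact isIntegral_trans b h2

variable {k ι : Type} [Field k] {n : ℕ} {P : Ideal (MvPolynomial ι k)}
  {kap : MvPolynomial ι k →ₐ[k] MvPolynomial (Fin (n + 1)) k}

section
variable [Infinite k]

lemma eliminate (hhom : ∀ f ∈ P, ∀ m, homogeneousComponent m f ∈ P)
    (hdim : ringKrullDim (MvPolynomial ι k ⧸ P) = (n + 1 : ℕ)) {t : ℕ}
    {u : Fin (n + 1) → MvPolynomial ι k} {z : Fin (t + 1) → MvPolynomial ι k}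
    (hu : ∀ i, (u i).IsHomogeneous 1) (hz : ∀ j, (z j).IsHomogeneous 1)
    (hku : ∀ i, kap (u i) = X i) (hkz : ∀ j, kap (z j) = 0)
    (hintegral : ((Ideal.Quotient.mkₐ k P).comp (aeval (Sum.elim u z))).toRingHom.IsIntegral) :
    ∃ (u : Fin (n + 1) → MvPolynomial ι k) (z : Fin t → MvPolynomial ι k),
      (∀ i, (u i).IsHomogeneous 1) ∧ (∀ j, (z j).IsHomogeneous 1) ∧ (∀ i, kap (u i) = X i) ∧
      (∀ j, kap (z j) = 0) ∧
      ((Ideal.Quotient.mkₐ k P).comp (aeval (Sum.elim u z))).toRingHom.IsIntegral := by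
  have h1 : ∃ G : MvPolynomial (Fin (n + 1) ⊕ Fin (t + 1)) k, G ≠ 0 ∧ aeval (Sum.elim u z) G ∈ P := by
    by_contra hcon
    push Not at hcon
    have := IntegralDimension.card_eq_of_injective hintegral hdim ((injective_iff_map_eq_zero _).2 fun G hG => by
      by_contra h0
      exact hcon G h0 (Ideal.Quotient.eq_zero_iff_mem.1 hG))
    simp at this
  obtain ⟨G', hG'0, hG'P⟩ := h1
  have hlin : ∀ j, (aeval (Sum.elim u z) (X j : MvPolynomial _ k)).IsHomogeneous 1 := by
    rintro (j | j)
    · simpa using hu j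
    · simpa using hz j
  obtain ⟨d, hd⟩ : ∃ d, homogeneousComponent d G' ≠ 0 := by
    by_contra hcon
    push Not at hcon
    exact hG'0 (by rw [← sum_homogeneousComponent G', Finset.sum_eq_zero fun i _ => hcon i])
  set G := homogeneousComponent d G' with hGdef
  have hG : G.IsHomogeneous d := homogeneousComponent_isHomogeneous _ _
  have hGP : aeval (Sum.elim u z) G ∈ P := by
    rw [hGdef, ← Forms.homogeneousComponent_algHom _ hlin]
    exact hhom _ hG'P _
  obtain ⟨a, ha⟩ : ∃ a, eval a (G * X (Sum.inr (Fin.last t))) ≠ 0 := by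
    by_contra hcon
    push Not at hcon
    exact mul_ne_zero hd (X_ne_zero _) (MvPolynomial.funext fun a => by rw [hcon, map_zero])
  rw [map_mul, eval_X] at ha
  set w := a (Sum.inr (Fin.last t)) with hw
  have hw0 : w ≠ 0 := right_ne_zero_of_mul ha
  set x := C w⁻¹ * z (Fin.last t) with hx
  have hx1 : x.IsHomogeneous 1 := by simpa using (isHomogeneous_C ι w⁻¹).mul (hz (Fin.last t))
  have hkx : kap x = 0 := by rw [hx, map_mul, hkz, mul_zero]
  have hCx : ∀ b : k, (C b * x).IsHomogeneous 1 := fun b => by simpa using (isHomogeneous_C ι b).mul hx1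
  let u' : Fin (n + 1) → MvPolynomial ι k := fun i => u i - C (a (Sum.inl i)) * x
  let z' : Fin t → MvPolynomial ι k := fun j => z j.castSucc - C (a (Sum.inr j.castSucc)) * x
  refine ⟨u', z', fun i => (hu i).sub (hCx _), fun j => (hz _).sub (hCx _), fun i => ?_, fun j => ?_, ?_⟩
  · rw [map_sub, map_mul, hkx, mul_zero, sub_zero, hku]
  · rw [map_sub, map_mul, hkx, mul_zero, sub_zero, hkz]
  let ψ := (Ideal.Quotient.mkₐ k P).comp (aeval (Sum.elim u' z'))
  let y : Fin (n + 1) ⊕ Fin (t + 1) → MvPolynomial (Fin (n + 1) ⊕ Fin t) k :=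
    Sum.elim (fun i => X (Sum.inl i)) (Fin.lastCases 0 fun j => X (Sum.inr j))
  have hy : ∀ j, ψ (y j) + algebraMap k _ (a j) * Ideal.Quotient.mk P x =
      Ideal.Quotient.mk P (Sum.elim u z j) := by
    have e : ∀ f, ψ f = Ideal.Quotient.mk P (aeval (Sum.elim u' z') f) := fun f => rfl
    have e2 : ∀ b : k, algebraMap k (MvPolynomial ι k ⧸ P) b = Ideal.Quotient.mk P (C b) := fun b => rfl
    intro j
    rw [e, e2, ← map_mul, ← map_add]
    congr 1
    rcases j with i | j
    · simp [y, u']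
    · refine Fin.lastCases ?_ (fun j => ?_) j
      · simp only [y, Sum.elim_inr, Fin.lastCases_last, map_zero, zero_add]
        rw [hx, ← mul_assoc, ← C_mul, mul_inv_cancel₀ hw0, C_1, one_mul]
      · simp [y, z']
  have hxint : ψ.toRingHom.IsIntegralElem (Ideal.Quotient.mk P x) := by
    refine isIntegralElem_of_aeval_eq_zero ψ y a _ hG (left_ne_zero_of_mul ha) ?_
    simp only [hy]
    have := MvPolynomial.comp_aeval_apply (Sum.elim u z) (Ideal.Quotient.mkₐ k P) G
    exact this.symm.trans (Ideal.Quotient.eq_zero_iff_mem.2 hGP)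
  refine isIntegral_of_generators hintegral fun j => ?_
  have e3 : ((Ideal.Quotient.mkₐ k P).comp (aeval (Sum.elim u z))) (X j) = Ideal.Quotient.mk P (Sum.elim u z j) := by
    change Ideal.Quotient.mk P (aeval (Sum.elim u z) (X j)) = _
    rw [aeval_X]
  rw [e3, ← hy]
  have e4 : algebraMap k (MvPolynomial ι k ⧸ P) (a j) = ψ.toRingHom (C (a j)) := (ψ.commutes _).symm
  rw [e4]
  exact RingHom.IsIntegralElem.add _ (RingHom.isIntegralElem_map _)
    (RingHom.IsIntegralElem.mul _ (RingHom.isIntegralElem_map _) hxint)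

lemma exists_integral (hhom : ∀ f ∈ P, ∀ m, homogeneousComponent m f ∈ P)
    (hdim : ringKrullDim (MvPolynomial ι k ⧸ P) = (n + 1 : ℕ)) (t : ℕ) :
    ∀ {u : Fin (n + 1) → MvPolynomial ι k} {z : Fin t → MvPolynomial ι k},
    (∀ i, (u i).IsHomogeneous 1) → (∀ j, (z j).IsHomogeneous 1) → (∀ i, kap (u i) = X i) →
    (∀ j, kap (z j) = 0) →
    ((Ideal.Quotient.mkₐ k P).comp (aeval (Sum.elim u z))).toRingHom.IsIntegral →
    ∃ u : Fin (n + 1) → MvPolynomial ι k, (∀ i, (u i).IsHomogeneous 1) ∧ (∀ i, kap (u i) = X i) ∧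
      ((Ideal.Quotient.mkₐ k P).comp (aeval u)).toRingHom.IsIntegral := by
  induction t with
  | zero =>
    intro u z hu hz hku hkz hintegral
    refine ⟨u, hu, hku, isIntegral_of_generators hintegral fun j => ?_⟩
    rcases j with j | j
    · have : ((Ideal.Quotient.mkₐ k P).comp (aeval (Sum.elim u z))) (X (Sum.inl j)) =
          ((Ideal.Quotient.mkₐ k P).comp (aeval u)).toRingHom (X j) := by
        simp
      rw [this]
      exact RingHom.isIntegralElem_map _
    · exact j.elim0
  | succ t ih =>
    intro u z hu hz hku hkz hintegral
    obtain ⟨u', z', h1, h2, h3, h4, h5⟩ := eliminate hhom hdim hu hz hku hkz hintegral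
    exact ih h1 h2 h3 h4 h5

end

end LinearNormalization

/-- Existence of linear Noether normalizations. -/
lemma Normalization.exists {k ι : Type} [Field k] [Infinite k] [Fintype ι] {n : ℕ} {P J : Ideal (MvPolynomial ι k)}
    {kap : MvPolynomial ι k →ₐ[k] MvPolynomial (Fin (n + 1)) k}
    (hhom : ∀ f ∈ P, ∀ m, homogeneousComponent m f ∈ P)
    (hdim : ringKrullDim (MvPolynomial ι k ⧸ P) = (n + 1 : ℕ))
    (hkap : ∀ i, (kap (X i)).IsHomogeneous 1) (hJ : ∀ f, f ∈ J ↔ kap f = 0)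
    (u : Fin (n + 1) → MvPolynomial ι k) (hu : ∀ i, (u i).IsHomogeneous 1) (hku : ∀ i, kap (u i) = X i) :
    ∃ ell, Normalization n P J ell kap := by
  have hk : ∀ f, kap (aeval u f) = f := fun f => by
    have : kap.comp (aeval u) = AlgHom.id k _ := MvPolynomial.algHom_ext fun i => by simp [hku]
    exact AlgHom.congr_fun this f
  let e := Fintype.equivFin ι
  let z : Fin (Fintype.card ι) → MvPolynomial ι k := fun j => X (e.symm j) - aeval u (kap (X (e.symm j)))
  have hsurj : Function.Surjective ((Ideal.Quotient.mkₐ k P).comp (aeval (Sum.elim u z))) := by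
    refine (Ideal.Quotient.mkₐ_surjective k P).comp ?_
    change Function.Surjective (aeval (Sum.elim u z) : MvPolynomial _ k →ₐ[k] MvPolynomial ι k)
    rw [← AlgHom.range_eq_top, eq_top_iff, ← MvPolynomial.adjoin_range_X, Algebra.adjoin_le_iff]
    rintro _ ⟨i, rfl⟩
    refine ⟨X (Sum.inr (e i)) + rename Sum.inl (kap (X i)), ?_⟩
    change aeval (Sum.elim u z) _ = X i
    rw [map_add, aeval_X, aeval_rename, Sum.elim_comp_inl]
    simp [z]
  obtain ⟨ell, h1, h2, h3⟩ := LinearNormalization.exists_integral (kap := kap) hhom hdim _ hu (z := z)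
    (fun j => (isHomogeneous_X _ _).sub (Forms.isHomogeneous_aeval (hkap _) hu)) hku
    (fun j => by rw [map_sub, hk, sub_self]) (RingHom.isIntegral_of_surjective _ hsurj)
  have hinj := IntegralDimension.injective_of_card_eq h3 hdim (Fintype.card_fin _)
  exact ⟨ell, h1, h2, hkap, hJ, fun f hf => (injective_iff_map_eq_zero _).1 hinj f
    (Ideal.Quotient.eq_zero_iff_mem.2 hf), h3⟩

namespace ConeIdeal

section
variable {k ι : Type} [Field k] [Fintype ι] [DecidableEq ι]

lemma mem_vanIdeal {C : Set (ι → k)} {f : MvPolynomial ι k} :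
    f ∈ vanIdeal k ι C ↔ ∀ x ∈ C, eval x f = 0 := by
  simp [vanIdeal, RingHom.mem_ker]

lemma vanIdeal_union (C D : Set (ι → k)) : vanIdeal k ι (C ∪ D) = vanIdeal k ι C ⊓ vanIdeal k ι D := by
  ext f
  simp only [Ideal.mem_inf, mem_vanIdeal, Set.mem_union, or_imp, forall_and]

lemma vanIdeal_le_ker {C : Set (ι → k)} (h : 0 ∈ C) :
    vanIdeal k ι C ≤ RingHom.ker (constantCoeff (R := k) (σ := ι)) := fun f hf => by
  have := mem_vanIdeal.1 hf 0 h
  rwa [eval_zero] at this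

lemma eval_smul_of_isHomogeneous {f : MvPolynomial ι k} {m : ℕ} (hf : f.IsHomogeneous m) (t : k) (x : ι → k) :
    eval (t • x) f = t ^ m * eval x f := by
  rw [eval_eq, eval_eq, Finset.mul_sum]
  refine Finset.sum_congr rfl fun d hd => ?_
  have hm : ∑ i ∈ d.support, d i = m := by
    have := hf (mem_support_iff.1 hd)
    rw [Finsupp.weight_apply] at this
    simpa [Finsupp.sum] using this
  simp only [Pi.smul_apply, smul_eq_mul, mul_pow, Finset.prod_mul_distrib, Finset.prod_pow_eq_pow_sum, hm]
  ring

lemma vanIdeal_hom [Infinite k] {C : Set (ι → k)} (hC : ∀ x ∈ C, ∀ t : k, t • x ∈ C) :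
    ∀ f ∈ vanIdeal k ι C, ∀ m, homogeneousComponent m f ∈ vanIdeal k ι C := by
  intro f hf m
  rw [mem_vanIdeal] at hf ⊢
  intro x hx
  let p : Polynomial k := ∑ i ∈ Finset.range (f.totalDegree + 1),
    Polynomial.C (eval x (homogeneousComponent i f)) * Polynomial.X ^ i
  have hp : p = 0 := Polynomial.funext fun t => by
    have h1 := hf _ (hC x hx t)
    conv_lhs at h1 => rw [← sum_homogeneousComponent f, map_sum]
    rw [Polynomial.eval_finsetSum, Polynomial.eval_zero, ← h1]
    refine Finset.sum_congr rfl fun i _ => ?_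
    rw [eval_smul_of_isHomogeneous (homogeneousComponent_isHomogeneous i f), Polynomial.eval_mul,
      Polynomial.eval_C, Polynomial.eval_pow, Polynomial.eval_X, mul_comm]
  by_cases hm : f.totalDegree < m
  · rw [homogeneousComponent_eq_zero _ _ hm, map_zero]
  · have := congrArg (fun q => Polynomial.coeff q m) hp
    simpa [p, Polynomial.finsetSum_coeff, Polynomial.coeff_C_mul, Polynomial.coeff_X_pow,
      show m < f.totalDegree + 1 by omega] using this

lemma exists_parametrization [Infinite k] {n : ℕ} (L : Submodule k (ι → k)) (hL : Module.finrank k L = n + 1) :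
    ∃ (kap : MvPolynomial ι k →ₐ[k] MvPolynomial (Fin (n + 1)) k) (u : Fin (n + 1) → MvPolynomial ι k),
      (∀ i, (kap (X i)).IsHomogeneous 1) ∧ (∀ f, f ∈ vanIdeal k ι (L : Set (ι → k)) ↔ kap f = 0) ∧
      (∀ i, (u i).IsHomogeneous 1) ∧ ∀ i, kap (u i) = X i := by
  let b : Module.Basis (Fin (n + 1)) k L := Module.finBasisOfFinrankEq k L hL
  let kap : MvPolynomial ι k →ₐ[k] MvPolynomial (Fin (n + 1)) k :=
    aeval fun i => ∑ j, C ((b j : ι → k) i) * X j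
  have heval : ∀ (f : MvPolynomial ι k) (y : Fin (n + 1) → k),
      eval y (kap f) = eval ((∑ j, y j • b j : L) : ι → k) f := by
    intro f y
    have : (aeval (R := k) y).comp kap = aeval (R := k) ((∑ j, y j • b j : L) : ι → k) := by
      refine MvPolynomial.algHom_ext fun i => ?_
      simp [kap, mul_comm]
    have := DFunLike.congr_fun this f
    simpa [coe_aeval_eq_eval] using this
  obtain ⟨g, hg⟩ := L.subtype.exists_leftInverse_of_injective L.ker_subtype
  let e : (ι → k) →ₗ[k] Fin (n + 1) → k := b.equivFun.toLinearMap ∘ₗ g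
  have he : ∀ j, e (b j) = Pi.single j 1 := by
    intro j
    have : g (b j) = b j := LinearMap.congr_fun hg (b j)
    simp only [e, LinearMap.comp_apply, this]
    change b.equivFun (b j) = _
    ext i
    simp [Pi.single_apply, eq_comm]
  let u : Fin (n + 1) → MvPolynomial ι k := fun j => ∑ i, C (e (Pi.single i 1) j) * X i
  have hu : ∀ j x, eval x (u j) = e x j := by
    intro j x
    conv_rhs => rw [← Finset.univ_sum_single x, map_sum]
    simp only [u, map_sum, map_mul, eval_C, eval_X, Finset.sum_apply]
    refine Finset.sum_congr rfl fun i _ => ?_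
    rw [show (Pi.single i (x i) : ι → k) = x i • Pi.single i 1 by
      rw [← Pi.single_smul, smul_eq_mul, mul_one], map_smul, Pi.smul_apply, smul_eq_mul, mul_comm]
  have hlin : ∀ (a : k) {κ : Type} (i : κ), (C a * X i : MvPolynomial κ k).IsHomogeneous 1 := fun a κ i => by
    simpa using (isHomogeneous_C κ a).mul (isHomogeneous_X k i)
  refine ⟨kap, u, fun i => ?_, fun f => ?_, fun i => IsHomogeneous.sum _ _ _ fun j _ => hlin _ _, fun i => ?_⟩
  · simp only [kap, aeval_X]
    exact IsHomogeneous.sum _ _ _ fun j _ => hlin _ _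
  · rw [mem_vanIdeal]
    constructor
    · intro h
      exact MvPolynomial.funext fun y => by rw [heval, map_zero]; exact h _ (Subtype.coe_prop _)
    · intro h x hx
      have h1 := heval f (b.equivFun ⟨x, hx⟩)
      rw [h, map_zero, b.sum_equivFun] at h1
      exact h1.symm
  · refine MvPolynomial.funext fun y => ?_
    rw [heval, hu, eval_X, Submodule.coe_sum, map_sum, Finset.sum_apply]
    simp only [Submodule.coe_smul, map_smul, he, Pi.smul_apply, smul_eq_mul]
    simp [Pi.single_apply]

end

section
variable {k ι : Type} [Field k] [Fintype ι] [DecidableEq ι] {n : ℕ} {J : Ideal (MvPolynomial ι k)}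
  {kap : MvPolynomial ι k →ₐ[k] MvPolynomial (Fin (n + 1)) k} {ell : Fin (n + 1) → MvPolynomial ι k}
  (ell_hom : ∀ i, (ell i).IsHomogeneous 1) (kap_ell : ∀ i, kap (ell i) = X i)
  (kap_hom : ∀ i, (kap (X i)).IsHomogeneous 1) (mem_J : ∀ f, f ∈ J ↔ kap f = 0)
include ell_hom kap_ell kap_hom mem_J

lemma finrank_idealPiece_of_le {I : Ideal (MvPolynomial ι k)} (hI : J ≤ I) (m : ℕ) :
    Module.finrank k (idealPiece k ι I m) =
      Module.finrank k (idealPiece k (Fin (n + 1)) (I.comap (aeval ell)) m) +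
        Module.finrank k (idealPiece k ι J m) := by
  have hk : ∀ f, kap (aeval ell f) = f := fun f => by
    have : kap.comp (aeval ell) = AlgHom.id k _ := MvPolynomial.algHom_ext fun i => by simp [kap_ell]
    exact DFunLike.congr_fun this f
  let φ := kap.toLinearMap.domRestrict (idealPiece k ι I m)
  have h1 := φ.finrank_range_add_finrank_ker
  have h2 : LinearMap.range φ = idealPiece k (Fin (n + 1)) (I.comap (aeval ell)) m := by
    apply le_antisymm
    · rintro _ ⟨⟨f, hfI, hf⟩, rfl⟩
      refine ⟨?_, Forms.isHomogeneous_algHom hf kap kap_hom⟩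
      change aeval ell (kap f) ∈ I
      have h : f - aeval ell (kap f) ∈ J := by rw [mem_J, map_sub, hk, sub_self]
      have := I.sub_mem hfI (hI h)
      rwa [sub_sub_cancel] at this
    · rintro f ⟨hfI, hf⟩
      exact ⟨⟨aeval ell f, hfI, Forms.isHomogeneous_aeval hf ell_hom⟩, hk f⟩
  have h3 : (LinearMap.ker φ).map (idealPiece k ι I m).subtype = idealPiece k ι J m := by
    apply le_antisymm
    · rintro _ ⟨⟨f, hf⟩, h, rfl⟩
      exact ⟨(mem_J f).2 h, hf.2⟩
    · rintro f ⟨h, hf⟩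
      exact ⟨⟨f, hI h, hf⟩, (mem_J f).1 h, rfl⟩
  have h4 := LinearEquiv.finrank_eq
    (Submodule.equivMapOfInjective _ (Submodule.injective_subtype (idealPiece k ι I m)) (LinearMap.ker φ))
  rw [h3] at h4
  rw [← h1, h2, h4]

lemma finrank_comap_of_idealHilb {I : Ideal (MvPolynomial ι k)} (hI : J ≤ I) {m : ℕ}
    (h : idealHilb k ι I m = (m + n).choose n - (m - 4 + n).choose n) :
    Module.finrank k (idealPiece k (Fin (n + 1)) (I.comap (aeval ell)) m) = (m - 4 + n).choose n := by
  have htop : ∀ (κ : Type) [Fintype κ] [DecidableEq κ], idealPiece k κ ⊤ m = homogeneousSubmodule κ k m := by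
    intro κ _ _
    ext f
    simp [idealPiece]
  have h1 := finrank_idealPiece_of_le ell_hom kap_ell kap_hom mem_J hI m
  have h2 := finrank_idealPiece_of_le ell_hom kap_ell kap_hom mem_J (le_top : J ≤ ⊤) m
  rw [Ideal.comap_top, htop, htop, Forms.finrank_homogeneousSubmodule] at h2
  have h3 : Module.finrank k (idealPiece k (Fin (n + 1)) (I.comap (aeval ell)) m) ≤ (m + n).choose n := by
    rw [← Forms.finrank_homogeneousSubmodule (k := k)]
    exact Submodule.finrank_mono inf_le_right
  have h4 : (m - 4 + n).choose n ≤ (m + n).choose n := Nat.choose_le_choose n (by omega)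
  unfold idealHilb at h
  omega

end

end ConeIdeal

/-- A linear form `theta` generating the coordinate ring of `P` over a Noether normalization, up to
the denominator `r`; its minimal polynomial is `Φ`, of degree `D`. -/
structure PrimitiveForm {k ι : Type} [Field k] {n : ℕ} (D N : ℕ) (P : Ideal (MvPolynomial ι k))
    (ell : Fin (n + 1) → MvPolynomial ι k) (theta : MvPolynomial ι k)
    (r : MvPolynomial (Fin (n + 1)) k) (Φ : Polynomial (MvPolynomial (Fin (n + 1)) k)) : Prop where
  theta_hom : theta.IsHomogeneous 1
  monic : Φ.Monic
  natDegree_eq : Φ.natDegree = D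
  le_N : D ≤ N
  r_ne : r ≠ 0
  r_hom : r.IsHomogeneous N
  bezout : ∃ a b : Polynomial (MvPolynomial (Fin (n + 1)) k), ∃ s, s ≠ 0 ∧
    a * Φ + b * Φ.derivative = Polynomial.C s
  dvd : ∀ p : Polynomial (MvPolynomial (Fin (n + 1)) k),
    p.eval₂ (aeval ell : MvPolynomial (Fin (n + 1)) k →ₐ[k] MvPolynomial ι k).toRingHom theta ∈ P ↔ Φ ∣ p
  red : ∀ m G, G.IsHomogeneous m → ∃ lam : ℕ → MvPolynomial (Fin (n + 1)) k,
    (∀ i < D, (lam i).IsHomogeneous (N + m - i)) ∧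
      aeval ell r * G - ∑ i ∈ Finset.range D, aeval ell (lam i) * theta ^ i ∈ P

section
variable {k ι : Type} [Field k] {n D N : ℕ} {P J : Ideal (MvPolynomial ι k)}
  {ell : Fin (n + 1) → MvPolynomial ι k}
  {kap : MvPolynomial ι k →ₐ[k] MvPolynomial (Fin (n + 1)) k}
  {theta : MvPolynomial ι k} {r : MvPolynomial (Fin (n + 1)) k}
  {Φ : Polynomial (MvPolynomial (Fin (n + 1)) k)}

lemma PrimitiveForm.free (F : PrimitiveForm D N P ell theta r Φ) (lam : ℕ → MvPolynomial (Fin (n + 1)) k)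
    (h : ∑ i ∈ Finset.range D, aeval ell (lam i) * theta ^ i ∈ P) : ∀ i < D, lam i = 0 := by
  let p : Polynomial (MvPolynomial (Fin (n + 1)) k) :=
    ∑ i ∈ Finset.range D, Polynomial.C (lam i) * Polynomial.X ^ i
  have h1 : Φ ∣ p := by
    rw [← F.dvd]
    convert h
    simp only [p, Polynomial.eval₂_finsetSum, Polynomial.eval₂_mul, Polynomial.eval₂_C, Polynomial.eval₂_X_pow]
    rfl
  have h2 : p = 0 := by
    refine Polynomial.eq_zero_of_dvd_of_degree_lt h1 ?_
    rw [Polynomial.degree_eq_natDegree F.monic.ne_zero, F.natDegree_eq, Polynomial.degree_lt_iff_coeff_zero]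
    intro j hj
    simp only [p, Polynomial.finsetSum_coeff, Polynomial.coeff_C_mul, Polynomial.coeff_X_pow]
    refine Finset.sum_eq_zero fun i hi => ?_
    rw [if_neg (by have := Finset.mem_range.1 hi; omega), mul_zero]
  intro i hi
  have h3 := congrArg (fun q => Polynomial.coeff q i) h2
  simp only [p, Polynomial.finsetSum_coeff, Polynomial.coeff_C_mul, Polynomial.coeff_X_pow, mul_ite, mul_one,
    mul_zero, Finset.sum_ite_eq, Finset.mem_range, hi, if_true, Polynomial.coeff_zero] at h3
  exact h3

lemma PrimitiveForm.exists_of_surjective [Infinite k] [CharZero k] [Fintype ι] [DecidableEq ι] {A : Type} [CommRing A] [IsDomain A]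
    [Algebra k A] [Algebra (MvPolynomial (Fin (n + 1)) k) A] [IsScalarTower k (MvPolynomial (Fin (n + 1)) k) A]
    [FaithfulSMul (MvPolynomial (Fin (n + 1)) k) A] [Module.Finite (MvPolynomial (Fin (n + 1)) k) A]
    (π : MvPolynomial ι k →ₐ[k] A) (hπ : Function.Surjective π) (hmem : ∀ f, π f = 0 ↔ f ∈ P)
    (halg : ∀ f, algebraMap (MvPolynomial (Fin (n + 1)) k) A f = π (aeval ell f))
    (hell : ∀ i, (ell i).IsHomogeneous 1)
    (hhom : ∀ f ∈ P, ∀ m, homogeneousComponent m f ∈ P) :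
    ∃ (D N : ℕ) (theta : MvPolynomial ι k) (r : MvPolynomial (Fin (n + 1)) k)
      (Φ : Polynomial (MvPolynomial (Fin (n + 1)) k)), PrimitiveForm D N P ell theta r Φ := by
  obtain ⟨lam, Φ, hm, hdvd, hbez, r0, hr0, hred⟩ := LinearPrimitive.exists_linear (k := k)
    (R := MvPolynomial (Fin (n + 1)) k) (fun i => π (X i)) (by
      rw [← Function.comp_def, Set.range_comp]
      have := π.map_adjoin (Set.range (X : ι → MvPolynomial ι k))
      rw [← this, adjoin_range_X, Algebra.map_top, AlgHom.range_eq_top]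
      exact hπ)
  let theta : MvPolynomial ι k := ∑ i, C (lam i) * X i
  have htheta : (∑ i, lam i • π (X i)) = π theta := by
    simp only [theta, map_sum]
    refine Finset.sum_congr rfl fun i _ => ?_
    rw [C_mul', map_smul]
  rw [htheta] at hdvd hred
  have heval : ∀ p : Polynomial (MvPolynomial (Fin (n + 1)) k), Polynomial.aeval (π theta) p =
      π
        (p.eval₂ (aeval ell : MvPolynomial (Fin (n + 1)) k →ₐ[k] MvPolynomial ι k).toRingHom theta) := by
    intro p
    rw [Polynomial.aeval_def, ← AlgHom.coe_toRingHom, Polynomial.hom_eval₂]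
    congr 1
    exact RingHom.ext halg
  have hth : theta.IsHomogeneous 1 := IsHomogeneous.sum _ _ _ fun i _ => by
    simpa using (isHomogeneous_C ι (lam i)).mul (isHomogeneous_X k i)
  obtain ⟨N0, hN0⟩ : ∃ d, homogeneousComponent d r0 ≠ 0 := by
    by_contra hcon
    push Not at hcon
    exact hr0 (by rw [← sum_homogeneousComponent r0, Finset.sum_eq_zero fun i _ => hcon i])
  set D := Φ.natDegree with hD
  have hXD : (X 0 ^ D : MvPolynomial (Fin (n + 1)) k).IsHomogeneous D := by
    simpa using (isHomogeneous_X k (0 : Fin (n + 1))).pow D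
  refine ⟨D, N0 + D, theta, homogeneousComponent N0 r0 * X 0 ^ D, Φ, hth, hm, rfl, Nat.le_add_left _ _,
    mul_ne_zero hN0 (pow_ne_zero _ (X_ne_zero _)), (homogeneousComponent_isHomogeneous _ _).mul hXD, hbez, ?_, ?_⟩
  · intro p
    rw [← hdvd, heval, hmem]
  · intro m G hG
    obtain ⟨p, hp⟩ := hred (π G)
    let q := p %ₘ Φ
    have hq : Polynomial.aeval (π theta) p =
        Polynomial.aeval (π theta) q := by
      conv_lhs => rw [← Polynomial.modByMonic_add_div p Φ]
      rw [map_add, map_mul, (hdvd Φ).2 dvd_rfl, zero_mul, add_zero]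
    have hqd : ∀ j, D ≤ j → q.coeff j = 0 := by
      have := Polynomial.degree_modByMonic_lt p hm
      rw [Polynomial.degree_eq_natDegree hm.ne_zero, Polynomial.degree_lt_iff_coeff_zero] at this
      exact this
    have hqs : q.eval₂ (aeval ell : MvPolynomial (Fin (n + 1)) k →ₐ[k] MvPolynomial ι k).toRingHom theta =
        ∑ i ∈ Finset.range D, aeval ell (q.coeff i) * theta ^ i := by
      by_cases hD0 : D = 0
      · have : q = 0 := Polynomial.ext fun j => hqd j (by omega)
        rw [this, hD0, Polynomial.eval₂_zero, Finset.range_zero, Finset.sum_empty]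
      · refine Polynomial.eval₂_eq_sum_range' _ ?_ _
        by_contra hcon
        have h0 : q.leadingCoeff = 0 := hqd _ (not_lt.1 hcon)
        rw [Polynomial.leadingCoeff_eq_zero] at h0
        rw [h0, Polynomial.natDegree_zero] at hcon
        omega
    have h1 : aeval ell r0 * G - ∑ i ∈ Finset.range D, aeval ell (q.coeff i) * theta ^ i ∈ P := by
      rw [← hmem, map_sub, ← hqs, ← heval, ← hq, ← hp, map_mul, Algebra.smul_def, halg, sub_self]
    have hell' : ∀ i, (aeval ell (X i : MvPolynomial (Fin (n + 1)) k)).IsHomogeneous 1 := fun i => by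
      rw [aeval_X]; exact hell i
    have h2 := hhom _ h1 (N0 + m)
    have hth' : ∀ i, (theta ^ i).IsHomogeneous i := fun i => by simpa using hth.pow i
    simp only [map_sub, map_sum, Forms.homogeneousComponent_mul_of_isHomogeneous (hth' _),
      Forms.homogeneousComponent_mul_of_isHomogeneous hG, Forms.homogeneousComponent_algHom _ hell',
      if_pos (Nat.le_add_left m N0), Nat.add_sub_cancel] at h2
    refine ⟨fun i => if i ≤ N0 + m then homogeneousComponent (N0 + m - i) (q.coeff i) * X 0 ^ D else 0, ?_, ?_⟩
    · intro i hi
      dsimp only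
      split_ifs with h
      · rw [show N0 + D + m - i = N0 + m - i + D by omega]
        exact (homogeneousComponent_isHomogeneous _ _).mul hXD
      · exact isHomogeneous_zero _ _ _
    · convert P.mul_mem_left (aeval ell (X 0 ^ D : MvPolynomial (Fin (n + 1)) k)) h2 using 1
      rw [mul_sub, Finset.mul_sum, map_mul]
      congr 1
      · ring
      · refine Finset.sum_congr rfl fun i _ => ?_
        dsimp only
        split_ifs
        · rw [map_mul]; ring
        · rw [map_zero, zero_mul, mul_zero]

lemma PrimitiveForm.exists [Infinite k] [CharZero k] [Fintype ι] [DecidableEq ι] (H : Normalization n P J ell kap)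
    (hP : P.IsPrime) (hhom : ∀ f ∈ P, ∀ m, homogeneousComponent m f ∈ P) :
    ∃ (D N : ℕ) (theta : MvPolynomial ι k) (r : MvPolynomial (Fin (n + 1)) k)
      (Φ : Polynomial (MvPolynomial (Fin (n + 1)) k)), PrimitiveForm D N P ell theta r Φ := by
  have key : ∀ {A : Type} [CommRing A] [Algebra k A] (π : MvPolynomial ι k →ₐ[k] A), Function.Surjective π →
      IsDomain A → (∀ f, π f = 0 ↔ f ∈ P) →
      (π.comp (aeval ell : MvPolynomial (Fin (n + 1)) k →ₐ[k] MvPolynomial ι k)).toRingHom.IsIntegral →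
      ∃ (D N : ℕ) (theta : MvPolynomial ι k) (r : MvPolynomial (Fin (n + 1)) k)
        (Φ : Polynomial (MvPolynomial (Fin (n + 1)) k)), PrimitiveForm D N P ell theta r Φ := by
    intro A _ _ π hπ _ hmem hintegral
    have : Algebra.FiniteType k A := Algebra.FiniteType.of_surjective π hπ
    let φ : MvPolynomial (Fin (n + 1)) k →ₐ[k] A := π.comp (aeval ell)
    let : Algebra (MvPolynomial (Fin (n + 1)) k) A := φ.toRingHom.toAlgebra
    have : IsScalarTower k (MvPolynomial (Fin (n + 1)) k) A :=
      IsScalarTower.of_algebraMap_eq fun c => (φ.commutes c).symm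
    have : FaithfulSMul (MvPolynomial (Fin (n + 1)) k) A :=
      (faithfulSMul_iff_algebraMap_injective _ _).2 ((injective_iff_map_eq_zero φ).2 fun f hf =>
        H.injective f ((hmem _).1 hf))
    have : Algebra.FiniteType (MvPolynomial (Fin (n + 1)) k) A := .of_restrictScalars_finiteType k _ _
    have : Algebra.IsIntegral (MvPolynomial (Fin (n + 1)) k) A := ⟨hintegral⟩
    have : Module.Finite (MvPolynomial (Fin (n + 1)) k) A := Algebra.IsIntegral.finite
    exact PrimitiveForm.exists_of_surjective π hπ hmem (fun f => rfl) H.ell_hom hhom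
  exact key (Ideal.Quotient.mkₐ k P) (Ideal.Quotient.mkₐ_surjective k P) (Ideal.Quotient.isDomain P)
    (fun f => Ideal.Quotient.eq_zero_iff_mem) H.integral

end

namespace HilbertSqueeze

lemma eq_of_bounds {h : ℕ → ℕ} {n d D N : ℕ}
    (hd : Filter.Tendsto (fun m : ℕ => (h m : ℝ) * (Nat.factorial n : ℝ) / (m : ℝ) ^ n) Filter.atTop (nhds (d : ℝ)))
    (hl : ∀ m, D * (m + n).choose n ≤ h (m + D)) (hu : ∀ m, h m ≤ D * (m + (N + n)).choose n) : d = D := by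
  have hf : (n.factorial : ℝ) ≠ 0 := Nat.cast_ne_zero.2 n.factorial_ne_zero
  apply le_antisymm
  · have h1 := (Forms.tendsto_choose n (N + n)).const_mul ((D : ℝ) * n.factorial)
    rw [mul_assoc, mul_one_div_cancel hf, mul_one] at h1
    refine Nat.cast_le.1 (le_of_tendsto_of_tendsto' hd h1 fun m => ?_)
    rw [← mul_div_assoc, mul_right_comm]
    have := hu m
    gcongr
    exact_mod_cast this
  · have h1 := ((Forms.tendsto_choose n n).const_mul ((D : ℝ) * n.factorial)).mul
      ((tendsto_natCast_div_add_atTop (D : ℝ)).pow n)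
    rw [one_pow, mul_one, mul_assoc, mul_one_div_cancel hf, mul_one] at h1
    have h2 := hd.comp (Filter.tendsto_add_atTop_nat D)
    refine Nat.cast_le.1 (le_of_tendsto_of_tendsto h1 h2 ?_)
    filter_upwards [Filter.eventually_gt_atTop 0] with m hm
    have hm' : (m : ℝ) ≠ 0 := by positivity
    have e : (D : ℝ) * n.factorial * (((m + n).choose n : ℝ) / (m : ℝ) ^ n) * ((m : ℝ) / (m + D)) ^ n =
        ((D * (m + n).choose n : ℕ) : ℝ) * n.factorial / ((m + D : ℕ) : ℝ) ^ n := by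
      have hm'' : (m : ℝ) + D ≠ 0 := by positivity
      push_cast
      rw [div_pow]
      field_simp
    rw [e]
    have := hl m
    simp only [Function.comp_apply]
    gcongr

section
variable {k ι A : Type} [Field k] [Fintype ι] [DecidableEq ι] [CommRing A] [Algebra k A]
  {P : Ideal (MvPolynomial ι k)} (π : MvPolynomial ι k →ₐ[k] A) (hmem : ∀ f, π f = 0 ↔ f ∈ P)
include hmem

lemma idealHilb_eq (m : ℕ) : idealHilb k ι P m =
    Module.finrank k ((homogeneousSubmodule ι k m).map π.toLinearMap) := by
  let φ := π.toLinearMap.domRestrict (homogeneousSubmodule ι k m)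
  have h1 := φ.finrank_range_add_finrank_ker
  have h2 : LinearMap.range φ = (homogeneousSubmodule ι k m).map π.toLinearMap :=
    LinearMap.range_domRestrict _ _
  have h3 : (LinearMap.ker φ).map (homogeneousSubmodule ι k m).subtype = idealPiece k ι P m := by
    apply le_antisymm
    · rintro _ ⟨⟨f, hf⟩, h, rfl⟩
      exact ⟨(hmem f).1 h, hf⟩
    · rintro f ⟨h, hf⟩
      exact ⟨⟨f, hf⟩, (hmem f).2 h, rfl⟩
  have h4 := LinearEquiv.finrank_eq
    (Submodule.equivMapOfInjective _ (Submodule.injective_subtype (homogeneousSubmodule ι k m)) (LinearMap.ker φ))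
  rw [h3] at h4
  unfold idealHilb
  rw [← h1, h2, h4, Nat.add_sub_cancel]

variable {n D N : ℕ} {J : Ideal (MvPolynomial ι k)} {ell : Fin (n + 1) → MvPolynomial ι k}
  {kap : MvPolynomial ι k →ₐ[k] MvPolynomial (Fin (n + 1)) k}
  {theta : MvPolynomial ι k} {r : MvPolynomial (Fin (n + 1)) k}
  {Φ : Polynomial (MvPolynomial (Fin (n + 1)) k)}

omit [Fintype ι] [DecidableEq ι] hmem in
variable (ell theta) in
/-- Polynomial expressions in `theta` with homogeneous coefficients. -/
def expand (D M : ℕ) : ((i : Fin D) → homogeneousSubmodule (Fin (n + 1)) k (M - i)) →ₗ[k] A :=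
  ∑ i : Fin D, (LinearMap.mulRight k (π (theta ^ (i : ℕ)))) ∘ₗ π.toLinearMap ∘ₗ
    (aeval (R := k) ell : MvPolynomial (Fin (n + 1)) k →ₐ[k] MvPolynomial ι k).toLinearMap ∘ₗ
      (homogeneousSubmodule (Fin (n + 1)) k (M - i)).subtype ∘ₗ LinearMap.proj i

omit [Fintype ι] [DecidableEq ι] hmem in
lemma expand_apply (M : ℕ) (a : (i : Fin D) → homogeneousSubmodule (Fin (n + 1)) k (M - i)) :
    expand π ell theta D M a = π (∑ i : Fin D, aeval ell (a i : MvPolynomial (Fin (n + 1)) k) * theta ^ (i : ℕ)) := by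
  simp only [expand, LinearMap.sum_apply, map_sum, map_mul]
  rfl

omit hmem in
lemma finrank_coefficients (M : ℕ) :
    Module.finrank k ((i : Fin D) → homogeneousSubmodule (Fin (n + 1)) k (M - i)) =
      ∑ i : Fin D, (M - i + n).choose n := by
  rw [Module.finrank_pi_fintype]
  simp only [Forms.finrank_homogeneousSubmodule]

variable (H : Normalization n P J ell kap) (F : PrimitiveForm D N P ell theta r Φ)
include H F

lemma lower (m : ℕ) : D * (m + n).choose n ≤ idealHilb k ι P (m + D) := by
  rw [idealHilb_eq π hmem]
  have hinj : Function.Injective (expand π ell theta D (m + D)) := by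
    rw [← LinearMap.ker_eq_bot, LinearMap.ker_eq_bot']
    intro a ha
    rw [expand_apply, hmem] at ha
    let b : ℕ → MvPolynomial (Fin (n + 1)) k := fun i => if h : i < D then a ⟨i, h⟩ else 0
    have hb : ∀ i : Fin D, (a i : MvPolynomial (Fin (n + 1)) k) = b i := fun i => by simp [b]
    simp only [hb] at ha
    rw [Fin.sum_univ_eq_sum_range (fun i => aeval ell (b i) * theta ^ i)] at ha
    have := F.free b ha
    ext1 i
    exact Subtype.ext ((hb i).trans (this i i.2))
  have hrange : LinearMap.range (expand π ell theta D (m + D)) ≤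
      (homogeneousSubmodule ι k (m + D)).map π.toLinearMap := by
    rintro _ ⟨a, rfl⟩
    rw [expand_apply]
    refine ⟨_, Submodule.sum_mem _ fun i _ => ?_, rfl⟩
    have h1 := Forms.isHomogeneous_aeval (a i).2 H.ell_hom
    have h2 := h1.mul (by simpa using F.theta_hom.pow (i : ℕ))
    rwa [show m + D - (i : ℕ) + i = m + D by omega] at h2
  have := Submodule.finrank_mono hrange
  rw [LinearMap.finrank_range_of_inj hinj, finrank_coefficients] at this
  refine le_trans ?_ this
  have h := Finset.card_nsmul_le_sum (Finset.univ : Finset (Fin D)) (fun i => (m + D - (i : ℕ) + n).choose n)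
    ((m + n).choose n) fun i _ => Nat.choose_le_choose n (by omega)
  simpa using h

lemma upper [IsDomain A] (m : ℕ) : idealHilb k ι P m ≤ D * (m + (N + n)).choose n := by
  rw [idealHilb_eq π hmem]
  let s := π (aeval ell r)
  have hs : s ≠ 0 := fun h => F.r_ne (H.injective r ((hmem _).1 h))
  have hinj : Function.Injective (LinearMap.mulLeft k s) := fun x y h => mul_left_cancel₀ hs h
  rw [LinearEquiv.finrank_eq (Submodule.equivMapOfInjective _ hinj ((homogeneousSubmodule ι k m).map π.toLinearMap))]
  have hle : ((homogeneousSubmodule ι k m).map π.toLinearMap).map (LinearMap.mulLeft k s) ≤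
      LinearMap.range (expand π ell theta D (N + m)) := by
    rintro _ ⟨_, ⟨G, hG, rfl⟩, rfl⟩
    obtain ⟨lam, h1, h2⟩ := F.red m G hG
    refine ⟨fun i => ⟨lam i, h1 i i.2⟩, ?_⟩
    rw [expand_apply]
    change π _ = s * π G
    rw [Fin.sum_univ_eq_sum_range (fun i => aeval ell (lam i) * theta ^ i), ← map_mul, eq_comm, ← sub_eq_zero,
      ← map_sub, hmem]
    exact h2
  refine (Submodule.finrank_mono hle).trans ((LinearMap.finrank_range_le _).trans ?_)
  rw [finrank_coefficients]
  have h := Finset.sum_le_card_nsmul (Finset.univ : Finset (Fin D)) (fun i => (N + m - (i : ℕ) + n).choose n)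
    ((m + (N + n)).choose n) fun i _ => Nat.choose_le_choose n (by omega)
  simpa using h

end

lemma degree_eq {k ι : Type} [Field k] [Fintype ι] [DecidableEq ι] {P : Ideal (MvPolynomial ι k)}
    {n d D N : ℕ} {J : Ideal (MvPolynomial ι k)} {ell : Fin (n + 1) → MvPolynomial ι k}
    {kap : MvPolynomial ι k →ₐ[k] MvPolynomial (Fin (n + 1)) k}
    {theta : MvPolynomial ι k} {r : MvPolynomial (Fin (n + 1)) k}
    {Φ : Polynomial (MvPolynomial (Fin (n + 1)) k)} (hP : P.IsPrime)
    (H : Normalization n P J ell kap) (F : PrimitiveForm D N P ell theta r Φ)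
    (hd : Filter.Tendsto (fun m : ℕ => (idealHilb k ι P m : ℝ) * (Nat.factorial n : ℝ) / (m : ℝ) ^ n)
      Filter.atTop (nhds (d : ℝ))) : d = D :=
  have := Ideal.Quotient.isDomain P
  have hmem : ∀ f, Ideal.Quotient.mkₐ k P f = 0 ↔ f ∈ P := fun _ => Ideal.Quotient.eq_zero_iff_mem
  eq_of_bounds hd (lower (Ideal.Quotient.mkₐ k P) hmem H F) (upper (Ideal.Quotient.mkₐ k P) hmem H F)

end HilbertSqueeze

namespace Fiber

section
variable {k ι : Type} [Field k] [IsAlgClosed k] [Fintype ι] {n D N : ℕ} {P J : Ideal (MvPolynomial ι k)}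
  {ell : Fin (n + 1) → MvPolynomial ι k}
  {kap : MvPolynomial ι k →ₐ[k] MvPolynomial (Fin (n + 1)) k}
  {theta : MvPolynomial ι k} {r : MvPolynomial (Fin (n + 1)) k}
  {Φ : Polynomial (MvPolynomial (Fin (n + 1)) k)}

lemma exists_point_of_surjective {A : Type} [CommRing A] [Algebra k A] (π : MvPolynomial ι k →ₐ[k] A)
    (hmem : ∀ f, π f = 0 ↔ f ∈ P)
    (hintegral : (π.comp (aeval ell : MvPolynomial (Fin (n + 1)) k →ₐ[k] MvPolynomial ι k)).toRingHom.IsIntegral)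
    (F : PrimitiveForm D N P ell theta r Φ) (q : Fin (n + 1) → k) {ρ : k}
    (hρ : (Φ.map (eval q)).eval ρ = 0) :
    ∃ z : ι → k, (∀ f ∈ P, eval z f = 0) ∧ (∀ i, eval z (ell i) = q i) ∧ eval z theta = ρ := by
  let ψ : Polynomial (MvPolynomial (Fin (n + 1)) k) →+* A :=
    π.toRingHom.comp (Polynomial.eval₂RingHom
      (aeval ell : MvPolynomial (Fin (n + 1)) k →ₐ[k] MvPolynomial ι k).toRingHom theta)
  let : Algebra (Polynomial (MvPolynomial (Fin (n + 1)) k)) A := ψ.toAlgebra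
  have halg : ∀ p, algebraMap (Polynomial (MvPolynomial (Fin (n + 1)) k)) A p =
    π (p.eval₂ (aeval ell : MvPolynomial (Fin (n + 1)) k →ₐ[k] MvPolynomial ι k).toRingHom theta) := fun _ => rfl
  have : Algebra.IsIntegral (Polynomial (MvPolynomial (Fin (n + 1)) k)) A := by
    refine ⟨fun a => ?_⟩
    obtain ⟨p, hp, hpa⟩ := hintegral a
    refine ⟨p.map Polynomial.C, hp.map _, ?_⟩
    rw [Polynomial.eval₂_map, ← hpa]
    congr 1
    refine RingHom.ext fun x => ?_
    rw [RingHom.comp_apply, halg, Polynomial.eval₂_C]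
    rfl
  let ev : Polynomial (MvPolynomial (Fin (n + 1)) k) →+* k := Polynomial.eval₂RingHom (eval q) ρ
  have hev : ∀ p, p ∈ RingHom.ker ev ↔ p.eval₂ (eval q) ρ = 0 := fun _ => Iff.rfl
  have : (RingHom.ker ev).IsPrime := RingHom.ker_isPrime ev
  obtain ⟨Q, -, hQ, hQe⟩ := Ideal.exists_ideal_over_prime_of_isIntegral (S := A) (RingHom.ker ev) ⊥ (by
    intro p hp
    rw [Ideal.mem_comap, Ideal.mem_bot, halg, hmem, F.dvd] at hp
    obtain ⟨g, rfl⟩ := hp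
    rw [hev, Polynomial.eval₂_mul, Polynomial.eval₂_eq_eval_map, hρ, zero_mul])
  have hQm : ∀ p : Polynomial (MvPolynomial (Fin (n + 1)) k), p.eval₂ (eval q) ρ = 0 →
      π (p.eval₂ (aeval ell : MvPolynomial (Fin (n + 1)) k →ₐ[k] MvPolynomial ι k).toRingHom theta) ∈ Q := by
    intro p hp
    have : p ∈ Q.comap (algebraMap (Polynomial (MvPolynomial (Fin (n + 1)) k)) A) := by
      rw [hQe, hev]; exact hp
    exact this
  obtain ⟨M, hM, hQM⟩ := (Q.comap π).exists_le_maximal (Ideal.comap_ne_top _ hQ.ne_top)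
  obtain ⟨z, rfl⟩ := MvPolynomial.isMaximal_iff_eq_vanishingIdeal_singleton.1 hM
  have hz : ∀ f, π f ∈ Q → eval z f = 0 := fun f hf => by
    have h1 := hQM (show f ∈ Q.comap π from hf)
    rw [mem_vanishingIdeal_singleton_iff] at h1
    simpa [coe_aeval_eq_eval] using h1
  refine ⟨z, fun f hf => hz f ?_, fun i => ?_, ?_⟩
  · rw [(hmem f).2 hf]; exact Q.zero_mem
  · have h1 := hz _ (hQm (Polynomial.C (X i - C (q i))) (by simp))
    rw [Polynomial.eval₂_C] at h1
    change eval z (aeval ell (X i - C (q i))) = 0 at h1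
    rw [map_sub, aeval_X, map_sub, sub_eq_zero] at h1
    rw [h1]
    simp
  · have h1 := hz _ (hQm (Polynomial.X - Polynomial.C (C ρ)) (by simp))
    rw [Polynomial.eval₂_sub, Polynomial.eval₂_X, Polynomial.eval₂_C] at h1
    change eval z (theta - aeval ell (C ρ)) = 0 at h1
    rw [map_sub, sub_eq_zero] at h1
    rw [h1]
    simp

lemma exists_points (H : Normalization n P J ell kap) (F : PrimitiveForm D N P ell theta r Φ) :
    ∃ s : MvPolynomial (Fin (n + 1)) k, s ≠ 0 ∧ ∀ q, eval q s ≠ 0 → ∀ (α : Type) [Fintype α], Fintype.card α = D →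
      ∃ z : α → ι → k, (∀ σ, ∀ f ∈ P, eval (z σ) f = 0) ∧ (∀ σ i, eval (z σ) (ell i) = q i) ∧
        Function.Injective fun σ => eval (z σ) theta := by
  obtain ⟨a, b, s, hs, hab⟩ := F.bezout
  refine ⟨s, hs, fun q hq α _ hα => ?_⟩
  have hsep : (Φ.map (eval q)).Separable := by
    refine ⟨Polynomial.C (eval q s)⁻¹ * a.map (eval q), Polynomial.C (eval q s)⁻¹ * b.map (eval q), ?_⟩
    have h1 := congrArg (Polynomial.map (eval q)) hab
    rw [Polynomial.map_add, Polynomial.map_mul, Polynomial.map_mul, Polynomial.map_C, ← Polynomial.derivative_map] at h1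
    rw [mul_assoc, mul_assoc, ← mul_add, h1, ← Polynomial.C_mul, inv_mul_cancel₀ hq, Polynomial.C_1]
  have hcard := Polynomial.card_rootSet_eq_natDegree (K := k) hsep (IsAlgClosed.splits _)
  rw [F.monic.natDegree_map, F.natDegree_eq, ← hα] at hcard
  let e := (Fintype.equivOfCardEq hcard).symm
  have hpt : ∀ σ, ∃ z : ι → k, (∀ f ∈ P, eval z f = 0) ∧ (∀ i, eval z (ell i) = q i) ∧ eval z theta = (e σ : k) :=
    fun σ => exists_point_of_surjective (Ideal.Quotient.mkₐ k P)
      (fun f => Ideal.Quotient.eq_zero_iff_mem) H.integral F q (by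
        have := (Polynomial.mem_rootSet.1 (e σ).2).2
        simpa using this)
  choose z h1 h2 h3 using hpt
  refine ⟨z, h1, h2, fun σ τ h => ?_⟩
  simp only [h3] at h
  exact e.injective (Subtype.ext h)

end

end Fiber

lemma exists_coordinate_change {k : Type} [Field k] {n : ℕ} (q : Fin (n + 1) → k) (hq : q 0 ≠ 0) :
    ∃ α β : MvPolynomial (Fin (n + 1)) k →ₐ[k] MvPolynomial (Fin (n + 1)) k,
      (∀ f, α (β f) = f) ∧ (∀ f, β (α f) = f) ∧ (∀ f, eval (Pi.single 0 1) (α f) = eval q f) ∧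
      (∀ i, (α (X i)).IsHomogeneous 1) ∧ ∀ i, (β (X i)).IsHomogeneous 1 := by
  have hlin : ∀ (a : k) (i : Fin (n + 1)), (C a * X i : MvPolynomial (Fin (n + 1)) k).IsHomogeneous 1 :=
    fun a i => by simpa using (isHomogeneous_C _ a).mul (isHomogeneous_X k i)
  let α : MvPolynomial (Fin (n + 1)) k →ₐ[k] MvPolynomial (Fin (n + 1)) k :=
    aeval (Fin.cases (C (q 0) * X 0) fun i => X i.succ + C (q i.succ) * X 0)
  let β : MvPolynomial (Fin (n + 1)) k →ₐ[k] MvPolynomial (Fin (n + 1)) k :=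
    aeval (Fin.cases (C (q 0)⁻¹ * X 0) fun i => X i.succ - C (q i.succ * (q 0)⁻¹) * X 0)
  have hα0 : α (X 0) = C (q 0) * X 0 := by simp [α]
  have hαs : ∀ i : Fin n, α (X i.succ) = X i.succ + C (q i.succ) * X 0 := fun i => by simp [α]
  have hβ0 : β (X 0) = C (q 0)⁻¹ * X 0 := by simp [β]
  have hβs : ∀ i : Fin n, β (X i.succ) = X i.succ - C (q i.succ * (q 0)⁻¹) * X 0 := fun i => by simp [β]
  have hC : ∀ (φ : MvPolynomial (Fin (n + 1)) k →ₐ[k] MvPolynomial (Fin (n + 1)) k) a, φ (C a) = C a :=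
    fun φ a => φ.commutes a
  refine ⟨α, β, fun f => ?_, fun f => ?_, fun f => ?_, fun i => ?_, fun i => ?_⟩
  · have : α.comp β = AlgHom.id k _ := by
      refine MvPolynomial.algHom_ext fun i => ?_
      rw [AlgHom.comp_apply, AlgHom.id_apply]
      refine Fin.cases ?_ (fun i => ?_) i
      · rw [hβ0, map_mul, hC, hα0, ← mul_assoc, ← C_mul, inv_mul_cancel₀ hq, C_1, one_mul]
      · rw [hβs, map_sub, map_mul, hC, hα0, hαs, ← mul_assoc, ← C_mul, inv_mul_cancel_right₀ hq,
          add_sub_cancel_right]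
    exact DFunLike.congr_fun this f
  · have : β.comp α = AlgHom.id k _ := by
      refine MvPolynomial.algHom_ext fun i => ?_
      rw [AlgHom.comp_apply, AlgHom.id_apply]
      refine Fin.cases ?_ (fun i => ?_) i
      · rw [hα0, map_mul, hC, hβ0, ← mul_assoc, ← C_mul, mul_inv_cancel₀ hq, C_1, one_mul]
      · rw [hαs, map_add, map_mul, hC, hβ0, hβs, ← mul_assoc, ← C_mul, sub_add_cancel]
    exact DFunLike.congr_fun this f
  · have : (aeval (R := k) (Pi.single 0 1 : Fin (n + 1) → k)).comp α = aeval (R := k) q := by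
      refine MvPolynomial.algHom_ext fun i => ?_
      rw [AlgHom.comp_apply]
      refine Fin.cases ?_ (fun i => ?_) i
      · rw [hα0]; simp
      · rw [hαs]; simp
    have := DFunLike.congr_fun this f
    simpa [coe_aeval_eq_eval] using this
  · refine Fin.cases ?_ (fun i => ?_) i
    · rw [hα0]; exact hlin _ _
    · rw [hαs]; exact (isHomogeneous_X _ _).add (hlin _ _)
  · refine Fin.cases ?_ (fun i => ?_) i
    · rw [hβ0]; exact hlin _ _
    · rw [hβs]; exact (isHomogeneous_X _ _).sub (hlin _ _)

lemma Frame.exists {k ι : Type} [Field k] [IsAlgClosed k] [CharZero k] [Fintype ι] [DecidableEq ι] {n c : ℕ}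
    {P J : Ideal (MvPolynomial ι k)} {kap : MvPolynomial ι k →ₐ[k] MvPolynomial (Fin (n + 1)) k}
    (hP : P.IsPrime) (hhom : ∀ f ∈ P, ∀ m, homogeneousComponent m f ∈ P)
    (hone : ∀ f ∈ P, f.IsHomogeneous 1 → f = 0) (hcard : Fintype.card ι = n + c + 1)
    (hdim : ringKrullDim (MvPolynomial ι k ⧸ P) = (n + 1 : ℕ))
    (hdeg : Filter.Tendsto (fun m : ℕ => (idealHilb k ι P m : ℝ) * (Nat.factorial n : ℝ) / (m : ℝ) ^ n)
      Filter.atTop (nhds ((c + 3 : ℕ) : ℝ)))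
    (hkap : ∀ i, (kap (X i)).IsHomogeneous 1) (hJ : ∀ f, f ∈ J ↔ kap f = 0)
    (u : Fin (n + 1) → MvPolynomial ι k) (hu : ∀ i, (u i).IsHomogeneous 1) (hku : ∀ i, kap (u i) = X i)
    (hquartic : ∀ᶠ m in Filter.atTop, idealHilb k ι (P ⊔ J) m =
      Nat.choose (m + n) n - Nat.choose (m - 4 + n) n) :
    ∃ (N : ℕ) (ell : Fin (n + 1) → MvPolynomial ι k)
      (kap : MvPolynomial ι k →ₐ[k] MvPolynomial (Fin (n + 1)) k) (theta : MvPolynomial ι k)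
      (r : MvPolynomial (Fin (n + 1)) k) (zeta : Fin c ⊕ Fin 3 → ι → k),
      Frame n c N P J ell kap theta r zeta := by
  have : Infinite k := Infinite.of_injective _ (Nat.cast_injective (R := k))
  obtain ⟨ell, H⟩ := Normalization.exists hhom hdim hkap hJ u hu hku
  obtain ⟨D, N, theta, r, Φ, F⟩ := PrimitiveForm.exists H hP hhom
  have hD : c + 3 = D := HilbertSqueeze.degree_eq hP H F hdeg
  subst hD
  have hq : ∀ {ell : Fin (n + 1) → MvPolynomial ι k} {kap : MvPolynomial ι k →ₐ[k] MvPolynomial (Fin (n + 1)) k},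
      (∀ i, (ell i).IsHomogeneous 1) → (∀ i, kap (ell i) = X i) → (∀ i, (kap (X i)).IsHomogeneous 1) →
      (∀ f, f ∈ J ↔ kap f = 0) → ∀ᶠ m in Filter.atTop,
        Module.finrank k (idealPiece k (Fin (n + 1)) ((P ⊔ J).comap (aeval ell)) m) = Nat.choose (m - 4 + n) n :=
    fun h1 h2 h3 h4 => hquartic.mono fun m hm =>
      ConeIdeal.finrank_comap_of_idealHilb h1 h2 h3 h4 le_sup_right hm
  obtain ⟨m, hm⟩ := (hq H.ell_hom H.kap_ell hkap hJ).exists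
  obtain ⟨ψ, hψ, hψ0⟩ := Submodule.exists_mem_ne_zero_of_ne_bot
    (p := idealPiece k (Fin (n + 1)) ((P ⊔ J).comap (aeval ell)) m) fun h => by
      rw [h, finrank_bot] at hm
      exact (Nat.choose_pos (Nat.le_add_left n (m - 4))).ne hm
  obtain ⟨s, hs, hpts⟩ := Fiber.exists_points H F
  obtain ⟨q, hq0⟩ : ∃ q, eval q (X 0 * r * s * ψ) ≠ 0 := by
    by_contra hcon
    push Not at hcon
    exact mul_ne_zero (mul_ne_zero (mul_ne_zero (X_ne_zero _) F.r_ne) hs) hψ0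
      (MvPolynomial.funext fun q => by rw [hcon, map_zero])
  simp only [map_mul, eval_X, mul_ne_zero_iff] at hq0
  obtain ⟨⟨⟨hq0, hqr⟩, hqs⟩, hqψ⟩ := hq0
  obtain ⟨z, hz1, hz2, hz3⟩ := hpts q hqs (Fin c ⊕ Fin 3) (by simp)
  obtain ⟨α, β, hαβ, hβα, hαe, hα1, hβ1⟩ := exists_coordinate_change q hq0
  let ell' : Fin (n + 1) → MvPolynomial ι k := fun i => aeval ell (β (X i))
  have hell' : ∀ f : MvPolynomial (Fin (n + 1)) k, aeval ell' f = aeval ell (β f) := by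
    intro f
    have : (aeval ell' : MvPolynomial (Fin (n + 1)) k →ₐ[k] MvPolynomial ι k) = (aeval ell).comp β :=
      MvPolynomial.algHom_ext fun i => by rw [aeval_X]; rfl
    rw [this]; rfl
  have hka : ∀ f, kap (aeval ell f) = f := fun f => by
    have : kap.comp (aeval ell) = AlgHom.id k _ := MvPolynomial.algHom_ext fun i => by simp [H.kap_ell]
    exact DFunLike.congr_fun this f
  have hza : ∀ σ (f : MvPolynomial (Fin (n + 1)) k), eval (z σ) (aeval ell f) = eval q f := by
    intro σ f
    have : (aeval (R := k) (z σ)).comp (aeval ell) = aeval (R := k) q := by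
      refine MvPolynomial.algHom_ext fun i => ?_
      rw [AlgHom.comp_apply, aeval_X, aeval_X]
      exact hz2 σ i
    have := DFunLike.congr_fun this f
    simpa [coe_aeval_eq_eval] using this
  have e1 : ∀ i, (ell' i).IsHomogeneous 1 := fun i => Forms.isHomogeneous_aeval (hβ1 i) H.ell_hom
  have e2 : ∀ i, (α.comp kap) (ell' i) = X i := fun i => by
    rw [AlgHom.comp_apply, hka, hαβ]
  have e3 : ∀ i, ((α.comp kap) (X i)).IsHomogeneous 1 := fun i => Forms.isHomogeneous_algHom (hkap i) α hα1
  have e4 : ∀ f, f ∈ J ↔ (α.comp kap) f = 0 := fun f => by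
    rw [hJ, AlgHom.comp_apply]
    exact ⟨fun h => by rw [h, map_zero], fun h => by rw [← hβα (kap f), h, map_zero]⟩
  refine ⟨N, ell', α.comp kap, theta, α r, z, ?_⟩
  exact {
    ell_hom := e1
    prime := hP
    hom := hhom
    P_one := hone
    card_eq := hcard
    kap_ell := e2
    kap_hom := e3
    mem_J := e4
    zeta_P := hz1
    zeta_ell := fun σ i => by
      rw [hza, ← hαe, hαβ, eval_X, Pi.single_apply]
    zeta_theta := hz3
    theta_hom := F.theta_hom
    r_hom := Forms.isHomogeneous_algHom F.r_hom α hα1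
    r_ne := by rw [hαe]; exact hqr
    le_N := F.le_N
    red := fun m G hG => by
      obtain ⟨lam, h1, h2⟩ := F.red m G hG
      refine ⟨fun i => α (lam i), fun i hi => Forms.isHomogeneous_algHom (h1 i hi) α hα1, ?_⟩
      simp only [hell', hβα]
      exact h2
    free := fun lam h i hi => by
      simp only [hell'] at h
      rw [← hαβ (lam i), F.free (fun i => β (lam i)) h i hi, map_zero]
    psi := by
      refine ⟨m, α ψ, Forms.isHomogeneous_algHom hψ.2 α hα1, ?_, ?_⟩
      · rw [hαe]; exact hqψ
      · rw [hell', hβα]; exact hψ.1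
    quartic := hq e1 e2 e3 e4 }

lemma Forms.eq_zero_of_eval_single {k : Type} [Field k] [Infinite k] {m : ℕ} {f : MvPolynomial (Fin 1) k}
    (hf : f.IsHomogeneous m) (h : eval (Pi.single 0 1) f = 0) : f = 0 :=
  MvPolynomial.funext fun x => by
    have hx : x = x 0 • (Pi.single 0 1 : Fin 1 → k) := by
      ext i
      rw [Subsingleton.elim i 0]
      simp
    rw [hx, ConeIdeal.eval_smul_of_isHomogeneous hf, h, mul_zero, map_zero]

lemma Frame.pos {k ι : Type} [Field k] [Infinite k] [Fintype ι] [DecidableEq ι] {n c N : ℕ}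
    {P J : Ideal (MvPolynomial ι k)} {ell : Fin (n + 1) → MvPolynomial ι k}
    {kap : MvPolynomial ι k →ₐ[k] MvPolynomial (Fin (n + 1)) k}
    {theta : MvPolynomial ι k} {r : MvPolynomial (Fin (n + 1)) k} {zeta : Fin c ⊕ Fin 3 → ι → k}
    (F : Frame n c N P J ell kap theta r zeta) : 1 ≤ n := by
  by_contra hn
  obtain rfl : n = 0 := by omega
  have hz : ∀ σ f, eval (zeta σ) (aeval ell f) = eval (Pi.single 0 1) f := by
    intro σ f
    have : (aeval (R := k) (zeta σ)).comp (aeval ell) = aeval (R := k) (Pi.single 0 1 : Fin 1 → k) := by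
      refine MvPolynomial.algHom_ext fun i => ?_
      rw [AlgHom.comp_apply, aeval_X, aeval_X, Pi.single_apply, ← F.zeta_ell σ i, aeval_eq_eval]
    simpa [coe_aeval_eq_eval] using DFunLike.congr_fun this f
  let q : Fin c ⊕ Fin 3 → MvPolynomial ι k := fun σ => theta - C (eval (zeta σ) theta) * ell 0
  have hq : ∀ σ, (q σ).IsHomogeneous 1 := fun σ =>
    F.theta_hom.sub (by simpa using (isHomogeneous_C ι (eval (zeta σ) theta)).mul (F.ell_hom 0))
  have hqe : ∀ σ τ, eval (zeta τ) (q σ) = eval (zeta τ) theta - eval (zeta σ) theta := fun σ τ => by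
    simp [q, F.zeta_ell]
  have hprod : ∏ σ, q σ ∈ P := by
    obtain ⟨lam, hlam, hmem⟩ := F.red _ _ (IsHomogeneous.prod Finset.univ q _ fun σ _ => hq σ)
    let p : Polynomial k := ∑ i ∈ Finset.range (c + 3), Polynomial.monomial i (eval (Pi.single 0 1) (lam i))
    have hp : p = 0 := by
      refine Polynomial.eq_zero_of_degree_lt_of_eval_index_eq_zero (s := Finset.univ) (v := fun σ => eval (zeta σ) theta)
        F.zeta_theta.injOn ?_ fun σ _ => ?_
      · rw [Finset.card_univ, Fintype.card_sum, Fintype.card_fin, Fintype.card_fin]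
        refine (Polynomial.degree_lt_iff_coeff_zero _ _).2 fun i hi => ?_
        simp only [p, Polynomial.finsetSum_coeff, Polynomial.coeff_monomial]
        exact Finset.sum_eq_zero fun j hj => if_neg (by have := Finset.mem_range.1 hj; omega)
      · have h1 := F.zeta_P σ _ hmem
        rw [map_sub, map_mul, map_prod, Finset.prod_eq_zero (Finset.mem_univ σ) (by rw [hqe, sub_self]), mul_zero,
          zero_sub, neg_eq_zero, map_sum] at h1
        simpa only [p, Polynomial.eval_finsetSum, Polynomial.eval_monomial, map_mul, map_pow, hz] using h1
    have hl : ∀ i ∈ Finset.range (c + 3), lam i = 0 := fun i hi => by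
      refine Forms.eq_zero_of_eval_single (hlam i (Finset.mem_range.1 hi)) ?_
      have := congrArg (fun q => Polynomial.coeff q i) hp
      simpa [p, Polynomial.finsetSum_coeff, Polynomial.coeff_monomial, Finset.mem_range.1 hi] using this
    rw [Finset.sum_eq_zero fun i hi => by rw [hl i hi, map_zero, zero_mul], sub_zero] at hmem
    refine F.mem_of_aeval_mul_mem (fun h => F.r_ne ?_) hmem
    rw [h, map_zero]
  obtain ⟨σ, -, hσ⟩ := F.prime.prod_mem_iff.1 hprod
  have h0 := F.P_one _ hσ (hq σ)
  have : ∀ τ, τ = σ := fun τ => F.zeta_theta (by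
    have := hqe σ τ
    rw [h0, map_zero] at this
    exact (sub_eq_zero.1 this.symm))
  exact absurd ((this (Sum.inr 0)).trans (this (Sum.inr 1)).symm) (by simp)

/-- The zero locus of the vanishing ideal of a linear subspace is that subspace. -/
lemma ConeIdeal.mem_of_eval_eq_zero {k ι : Type} [Field k] [Fintype ι] [DecidableEq ι]
    (L : Submodule k (ι → k)) {x : ι → k}
    (h : ∀ f ∈ vanIdeal k ι (L : Set (ι → k)), eval x f = 0) : x ∈ L := by
  by_contra hx
  obtain ⟨φ, hφ, hφL⟩ := Submodule.exists_le_ker_of_notMem hx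
  have he : ∀ y, eval y (∑ i, C (φ (Pi.single i 1)) * X i : MvPolynomial ι k) = φ y := fun y => by
    conv_rhs => rw [← Finset.univ_sum_single y, map_sum]
    simp only [map_sum, map_mul, eval_C, eval_X]
    refine Finset.sum_congr rfl fun i _ => ?_
    rw [show (Pi.single i (y i) : ι → k) = y i • Pi.single i 1 by
      rw [← Pi.single_smul, smul_eq_mul, mul_one], map_smul, smul_eq_mul, mul_comm]
  refine hφ ?_
  rw [← he]
  exact h _ (ConeIdeal.mem_vanIdeal.2 fun y hy => by rw [he]; exact hφL hy)

/-- Proposition 2.3. Let `X ⊆ ℙ^{n+c}`, `c ≥ 4`, be an `n`-dimensional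
variety of maximal sectional regularity of degree `c + 3`, with extremal `n`-plane
`F(X) = ℙ(L)` (so `X ∩ F(X)` is a quartic hypersurface in `F(X)`). Then
`depth(X) = n`, `depth(X ∪ F(X)) = n + 1`, the ideal of `X ∪ F(X)` is generated by
quadrics, `I(X)₂ = I(X ∪ F(X))₂`, and hence `Q(X) = X ∪ F(X)`. -/
theorem stmt_11 {k : Type} [Field k] [IsAlgClosed k] [CharZero k]
    (n c : ℕ) (hc : 4 ≤ c)
    (C : Set (Fin (n + c + 1) → k))
    (hV : IsProjVariety k (Fin (n + c + 1)) C)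
    (hnd : Nondeg k (Fin (n + c + 1)) C)
    (hdim : HasDim k (Fin (n + c + 1)) C n)
    (hdeg : HasDegree k (Fin (n + c + 1)) C n (c + 3))
    (L : Submodule k (Fin (n + c + 1) → k)) (hL : Module.finrank k L = n + 1)
    (hquartic : ∀ᶠ m in Filter.atTop,
      idealHilb k (Fin (n + c + 1))
          (vanIdeal k (Fin (n + c + 1)) C ⊔
            vanIdeal k (Fin (n + c + 1)) (L : Set (Fin (n + c + 1) → k))) m =
        Nat.choose (m + n) n - Nat.choose (m - 4 + n) n) :
    arithDepth k (Fin (n + c + 1)) C = n ∧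
    arithDepth k (Fin (n + c + 1)) (C ∪ (L : Set (Fin (n + c + 1) → k))) = n + 1 ∧
    Ideal.span ((quadrics k (Fin (n + c + 1))
          (C ∪ (L : Set (Fin (n + c + 1) → k))) : Submodule k _) : Set _) =
      vanIdeal k (Fin (n + c + 1)) (C ∪ (L : Set (Fin (n + c + 1) → k))) ∧
    quadrics k (Fin (n + c + 1)) C =
      quadrics k (Fin (n + c + 1)) (C ∪ (L : Set (Fin (n + c + 1) → k))) ∧
    quadZero k (Fin (n + c + 1)) C = C ∪ (L : Set (Fin (n + c + 1) → k)) := by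
  have : Infinite k := Infinite.of_injective _ (Nat.cast_injective (R := k))
  obtain ⟨kap₀, u, hkap₀, hJ, hu, hku⟩ := ConeIdeal.exists_parametrization L hL
  obtain ⟨N, ell, kap, theta, r, zeta, F⟩ := Frame.exists (c := c) hV.prime (ConeIdeal.vanIdeal_hom hV.smul_mem)
    (fun f hf h1 => hnd f h1 (ConeIdeal.mem_vanIdeal.1 hf)) (by simp) hdim hdeg hkap₀ hJ u hu hku hquartic
  have hn := F.pos
  obtain ⟨Z, lam, om, D⟩ : ∃ Z lam om, ScrollData (vanIdeal k _ C) (vanIdeal k _ (L : Set (Fin (n + c + 1) → k)))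
      ell zeta Z lam om := by
    clear hdim hdeg hquartic hL hkap₀ hJ hku
    obtain ⟨p, rfl⟩ : ∃ p, n = p + 1 := ⟨n - 1, by omega⟩
    exact F.exists_scrollData hc
  obtain ⟨gen, deg, G⟩ := F.exists_moduleGens D hn hc
  obtain ⟨v, hvK, -, hv⟩ := ModuleGens.exists_primitive F G
  have hunion := ConeIdeal.vanIdeal_union (k := k) C (L : Set (Fin (n + c + 1) → k))
  have hquad : quadrics k (Fin (n + c + 1)) C = quadrics k (Fin (n + c + 1)) (C ∪ (L : Set (Fin (n + c + 1) → k))) := by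
    unfold quadrics
    rw [hunion]
    refine le_antisymm (fun f hf => ⟨⟨hf.1, F.mem_J_of_degree_le hn (by norm_num) hf.2 hf.1⟩, hf.2⟩)
      fun f hf => ⟨hf.1.1, hf.2⟩
  have hspan : Ideal.span (quadrics k (Fin (n + c + 1)) C : Set (MvPolynomial (Fin (n + c + 1)) k)) =
      vanIdeal k (Fin (n + c + 1)) (C ∪ (L : Set (Fin (n + c + 1) → k))) := by
    rw [hunion]
    exact F.span_eq_inf D hn hc
  refine ⟨?_, ?_, by rw [← hquad, hspan], hquad, ?_⟩
  · obtain ⟨t, ht, htn⟩ := ModuleGens.exists_socle_of_primitive F G hvK hv hn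
    have hset : {h | h ∈ (List.finRange n).map fun i => ell i.succ} = ell '' {0}ᶜ := by
      ext f
      simp only [Set.mem_ofPred_eq, List.mem_map, List.mem_finRange, true_and, Set.mem_image, Set.mem_compl_iff,
        Set.mem_singleton_iff]
      exact ⟨fun ⟨i, hi⟩ => ⟨i.succ, Fin.succ_ne_zero i, hi⟩, fun ⟨i, hi, h⟩ =>
        ⟨i.pred hi, by rw [Fin.succ_pred, h]⟩⟩
    rw [DepthBound.arithDepth_eq C _ (ConeIdeal.vanIdeal_le_ker hV.zero_mem)
      (ModuleGens.regIn_of_primitive F G hvK hv) ⟨t, by rw [hset]; exact ⟨ht, htn⟩⟩, List.length_map,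
      List.length_finRange]
  · have hreg := ModuleGens.regIn_inf F G
    have hsoc := ModuleGens.exists_socle_inf F G
    rw [← hunion] at hreg hsoc
    rw [DepthBound.arithDepth_eq _ _ (ConeIdeal.vanIdeal_le_ker (Or.inl hV.zero_mem)) hreg hsoc, List.length_map,
      List.length_finRange]
  · refine Set.Subset.antisymm (fun x hx => ?_) fun x hx f hf => ?_
    · have h0 : ∀ f ∈ vanIdeal k (Fin (n + c + 1)) (C ∪ (L : Set (Fin (n + c + 1) → k))), eval x f = 0 := by
        rw [← hspan]
        intro f hf
        have : Ideal.span (quadrics k (Fin (n + c + 1)) C : Set (MvPolynomial (Fin (n + c + 1)) k)) ≤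
            RingHom.ker (eval x) := Ideal.span_le.2 hx
        exact this hf
      by_contra hcon
      rw [Set.mem_union, not_or] at hcon
      obtain ⟨hxC, hxL⟩ := hcon
      refine hxL (ConeIdeal.mem_of_eval_eq_zero L fun g hg => ?_)
      by_contra hgx
      refine hxC ?_
      rw [hV.closed]
      intro f hf
      have := h0 (f * g) (by rw [hunion]; exact ⟨Ideal.mul_mem_right _ _ hf, Ideal.mul_mem_left _ _ hg⟩)
      rw [map_mul] at this
      exact (mul_eq_zero.1 this).resolve_right hgx
    · rw [hquad] at hf
      exact ConeIdeal.mem_vanIdeal.1 hf.1 x hx
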